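/- For every r, M ∈ ℕ there exists ρ = ρ(r, M, d) ∈ ℕ such that, whenever the coefficient fields (a,b,c) satisfy the parabolicity–regularity assumption with respect to ρ, the kernel Γ(z,z̄) = Σ_{k≥0} (Z*(−E)^{*k})(z,z̄) (each summand vanishes unless t > t̄, and the series converges pointwise, in fact in C^r locally away from {t = t̄}) admits two decompositions Γ(z,z̄) = K^{z}(z − z̄) + R(z,z̄) and Γ(z,z̄) = K̄^{z̄}(z − z̄) + R̄(z,z̄), in which the kernels K, K̄, R, R̄ can be chosen to depend only on r and on (a,b,c) (not on M), K and K̄ belong to C^M(K_M^2) ∩ χΛ_ρ, and R, R̄ belong to C_{loc,t}^r. Moreover the decompositions can be chosen so that the maps A_ρ ∋ (a,b,c) ↦ (K, R) ∈ C^M(K_M^2) ⊕ C_{loc,t}^r and A_ρ ∋ (a,b,c) ↦ (K̄, R̄) ∈ C^M(K_M^2) ⊕ C_{loc,t}^r are continuous. -/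

import Mathlib

open MeasureTheory Filter
open scoped BigOperators ENNReal

namespace VarBPHZ

/-! ## Basic parabolic setting on `ℝ^{1+d}` -/

/-- A space-time point in `ℝ^{1+d}`; coordinate `0` is time, coordinates `1, …, d` are space. -/
abbrev Pt (d : ℕ) := Fin (d + 1) → ℝ

variable {d : ℕ}

/-- Parabolic scaled degree `|k|_𝔰 = 2k₀ + k₁ + ⋯ + k_d` of a multi-index. -/
def pdeg (k : Fin (d + 1) → ℕ) : ℕ := k 0 + ∑ i, k i

/-- Parabolic norm `|z|_𝔰 = |t|^{1/2} + ∑ᵢ |xᵢ|`. -/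
noncomputable def pnorm (z : Pt d) : ℝ := Real.sqrt |z 0| + ∑ i : Fin d, |z i.succ|

/-- First-order partial derivative in the `i`-th coordinate. -/
noncomputable def pd (i : Fin (d + 1)) (f : Pt d → ℝ) : Pt d → ℝ :=
  fun z => fderiv ℝ f z (Pi.single i 1)

/-- Iterated partial derivative `∂^k` for a multi-index `k`. -/
noncomputable def mderiv (k : Fin (d + 1) → ℕ) (f : Pt d → ℝ) : Pt d → ℝ :=
  (List.finRange (d + 1)).foldr (fun i g => (pd i)^[k i] g) f

/-- Mixed partial derivative `∂₁^j ∂₂^m` of a two-argument kernel. -/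
noncomputable def mderiv2 (j m : Fin (d + 1) → ℕ) (F : Pt d → Pt d → ℝ) :
    Pt d → Pt d → ℝ :=
  fun z zb => mderiv j (fun z' => mderiv m (F z') zb) z

/-- Space-time convolution `u * v (z, z̄) = ∫ u(z, ζ) v(ζ, z̄) dζ`. -/
noncomputable def conv (u v : Pt d → Pt d → ℝ) : Pt d → Pt d → ℝ :=
  fun z zb => ∫ ζ : Pt d, u z ζ * v ζ zb

/-! ## The heat calculus spaces `Ψ_r^α` and `Φ_r^α` -/

/-- `Ft` is an `F̃`-representation of `F` for the space `Ψ_r^α`; the second argument of `Ft`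
packs `(u, v) ∈ ℝ × ℝ^d` as an element of `ℝ^{1+d}`. -/
def PsiRep (α : ℝ) (Ft : Pt d → Pt d → ℝ) (F : Pt d → Pt d → ℝ) : Prop :=
  ∀ z zb : Pt d, F z zb =
    if zb 0 < z 0 then
      (z 0 - zb 0) ^ ((α - d - 2) / 2) *
        Ft zb (Fin.cons (Real.sqrt (z 0 - zb 0))
          fun i : Fin d => (z i.succ - zb i.succ) / Real.sqrt (z 0 - zb 0))
    else 0

/-- Existence (and continuity) of the derivatives of `F̃` entering the `Ψ_r^α` seminorms:
derivatives are counted parabolically in the first slot and by total order in the second. -/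
def PsiSmooth (r : ℕ) (Ft : Pt d → Pt d → ℝ) : Prop :=
  (∀ j m : Fin (d + 1) → ℕ, pdeg j + ∑ i, m i < r →
    Differentiable ℝ fun p : Pt d × Pt d => mderiv2 j m Ft p.1 p.2) ∧
  ∀ j m : Fin (d + 1) → ℕ, pdeg j + ∑ i, m i ≤ r →
    Continuous fun p : Pt d × Pt d => mderiv2 j m Ft p.1 p.2

/-- The set of numbers of which the `Ψ_r^α` seminorm `‖·‖_{α,r;T,n}` of a representation
`Ft` is the supremum. -/
def psiSet (r : ℕ) (T : ℝ) (n : ℕ) (Ft : Pt d → Pt d → ℝ) : Set ℝ :=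
  {y | ∃ (j m : Fin (d + 1) → ℕ) (w uv : Pt d),
    pdeg j + ∑ i, m i ≤ r ∧ 0 ≤ uv 0 ∧ uv 0 ≤ Real.sqrt T ∧
    y = (1 + Real.sqrt (∑ i : Fin d, uv i.succ ^ 2)) ^ n * |mderiv2 j m Ft w uv|}

/-- Membership in the heat-calculus space `Ψ_r^α`. -/
def MemPsi (α : ℝ) (r : ℕ) (F : Pt d → Pt d → ℝ) : Prop :=
  ∃ Ft, PsiRep α Ft F ∧ PsiSmooth r Ft ∧
    ∀ T : ℝ, 0 < T → ∀ n : ℕ, BddAbove (psiSet r T n Ft)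

/-- The `Ψ_r^α` seminorm `‖F‖_{α,r;T,n}` of a kernel `F`. -/
noncomputable def psiNorm (α : ℝ) (r : ℕ) (T : ℝ) (n : ℕ) (F : Pt d → Pt d → ℝ) : ℝ :=
  sInf {y | ∃ Ft, PsiRep α Ft F ∧ PsiSmooth r Ft ∧ BddAbove (psiSet r T n Ft) ∧
    y = sSup (psiSet r T n Ft)}

/-- Translation invariance of a two-argument kernel. -/
def TransInv (F : Pt d → Pt d → ℝ) : Prop := ∀ z zb h : Pt d, F (z + h) (zb + h) = F z zb

/-- Membership in `Φ_r^α`, the translation-invariant part of `Ψ_r^α`. -/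
def MemPhi (α : ℝ) (r : ℕ) (F : Pt d → Pt d → ℝ) : Prop := MemPsi α r F ∧ TransInv F

/-- `∂_w^m` of a family of kernels depending on a parameter `w`. -/
noncomputable def famDeriv (m : Fin (d + 1) → ℕ) (F : Pt d → Pt d → Pt d → ℝ) :
    Pt d → Pt d → Pt d → ℝ :=
  fun w z zb => mderiv m (fun w' => F w' z zb) w

/-- Membership in `C^m(Ψ_r^α)` for a family of kernels. -/
def MemCPsi (m : ℕ) (α : ℝ) (r : ℕ) (F : Pt d → Pt d → Pt d → ℝ) : Prop :=
  (∀ m' : Fin (d + 1) → ℕ, pdeg m' < m → ∀ z zb : Pt d,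
    Differentiable ℝ fun w => famDeriv m' F w z zb) ∧
  (∀ m' : Fin (d + 1) → ℕ, pdeg m' ≤ m → ∀ w : Pt d, MemPsi α r (famDeriv m' F w)) ∧
  ∀ T : ℝ, 0 < T → ∀ n : ℕ,
    BddAbove {y | ∃ (m' : Fin (d + 1) → ℕ) (w : Pt d), pdeg m' ≤ m ∧
      y = psiNorm α r T n (famDeriv m' F w)}

/-- The `C^m(Ψ_r^α)` seminorm `sup_w max_{|m'|_𝔰 ≤ m} ‖∂_w^{m'} F_w‖_{α,r;T,n}`. -/
noncomputable def cpsiNorm (m : ℕ) (α : ℝ) (r : ℕ) (T : ℝ) (n : ℕ)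
    (F : Pt d → Pt d → Pt d → ℝ) : ℝ :=
  sSup {y | ∃ (m' : Fin (d + 1) → ℕ) (w : Pt d), pdeg m' ≤ m ∧
    y = psiNorm α r T n (famDeriv m' F w)}

/-- Membership in `C^m(Φ_r^α)`. -/
def MemCPhi (m : ℕ) (α : ℝ) (r : ℕ) (F : Pt d → Pt d → Pt d → ℝ) : Prop :=
  MemCPsi m α r F ∧ ∀ w, TransInv (F w)

/-- The Beta function `B(a,b) = ∫₀¹ (1−s)^{a−1} s^{b−1} ds`. -/
noncomputable def betaFn (a b : ℝ) : ℝ := ∫ s in (0 : ℝ)..1, (1 - s) ^ (a - 1) * s ^ (b - 1)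

/-! ## Coefficient fields, the parabolicity–regularity assumption, `Z`, `E` and `Γ` -/

/-- Membership in the parabolic space `C^ρ`: all parabolic derivatives of order `≤ ρ`
exist, are continuous and bounded. -/
def MemCpar (ρ : ℕ) (f : Pt d → ℝ) : Prop :=
  (∀ k : Fin (d + 1) → ℕ, pdeg k < ρ → Differentiable ℝ (mderiv k f)) ∧
  ∀ k : Fin (d + 1) → ℕ, pdeg k ≤ ρ →
    Continuous (mderiv k f) ∧ ∃ M : ℝ, ∀ z, |mderiv k f z| ≤ M

/-- The `C^ρ` norm `max_{|k|_𝔰 ≤ ρ} sup |∂^k f|`. -/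
noncomputable def cparNorm (ρ : ℕ) (f : Pt d → ℝ) : ℝ :=
  sSup {y | ∃ (k : Fin (d + 1) → ℕ) (z : Pt d), pdeg k ≤ ρ ∧ y = |mderiv k f z|}

/-- A triple of coefficient fields `(a, b, c)`. -/
structure Coeffs (d : ℕ) where
  a : Pt d → Matrix (Fin d) (Fin d) ℝ
  b : Pt d → Fin d → ℝ
  c : Pt d → ℝ

/-- The parabolicity–regularity assumption, with ellipticity constant `lam` and
regularity exponent `ρ`. -/
structure ParReg (lam : ℝ) (ρ : ℕ) (A : Coeffs d) : Prop where
  symm : ∀ z, (A.a z).IsSymm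
  lower : ∀ (z : Pt d) (ζ : Fin d → ℝ), lam * ∑ i, ζ i ^ 2 ≤ ∑ i, ∑ j, A.a z i j * ζ i * ζ j
  upper : ∀ (z : Pt d) (ζ : Fin d → ℝ), ∑ i, ∑ j, A.a z i j * ζ i * ζ j ≤ lam⁻¹ * ∑ i, ζ i ^ 2
  areg : ∀ i j, MemCpar ρ fun z => A.a z i j
  breg : ∀ i, MemCpar ρ fun z => A.b z i
  creg : MemCpar ρ A.c

/-- The norm `‖(a,b,c)‖_ρ` on coefficient triples. -/
noncomputable def coeffNorm (ρ : ℕ) (A : Coeffs d) : ℝ :=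
  sSup {y | ∃ i j, y = cparNorm ρ fun z => A.a z i j} +
    sSup {y | ∃ i, y = cparNorm ρ fun z => A.b z i} + cparNorm ρ A.c

/-- Difference of two coefficient triples. -/
def coeffSub (A B : Coeffs d) : Coeffs d where
  a := fun z => A.a z - B.a z
  b := fun z => A.b z - B.b z
  c := fun z => A.c z - B.c z

/-- The distance on the space `𝐀_ρ` of coefficient fields. -/
noncomputable def coeffDist (ρ : ℕ) (A B : Coeffs d) : ℝ := coeffNorm ρ (coeffSub A B)

/-- The constant-coefficient heat kernel `W^w` with coefficients frozen at `w`. -/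
noncomputable def Wker (A : Coeffs d) (w : Pt d) (z : Pt d) : ℝ :=
  if 0 < z 0 then
    (4 * Real.pi) ^ (-(d : ℝ) / 2) * (A.a w).det ^ (-(1 : ℝ) / 2) * z 0 ^ (-(d : ℝ) / 2) *
      Real.exp (-(∑ i, ∑ j, (A.a w)⁻¹ i j * z i.succ * z j.succ) / (4 * z 0))
  else 0

/-- `Z(z, z̄) = W^{z̄}(z − z̄)`. -/
noncomputable def Zker (A : Coeffs d) : Pt d → Pt d → ℝ := fun z zb => Wker A zb (z - zb)

/-- `∂ᵢ Z`, derivative in the `i`-th spatial coordinate of the first argument. -/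
noncomputable def ZkerD (A : Coeffs d) (i : Fin d) : Pt d → Pt d → ℝ :=
  fun z zb => pd i.succ (fun y => Zker A y zb) z

/-- `∂ᵢ ∂ⱼ Z`. -/
noncomputable def ZkerDD (A : Coeffs d) (i j : Fin d) : Pt d → Pt d → ℝ :=
  fun z zb => pd i.succ (fun y => pd j.succ (fun y' => Zker A y' zb) y) z

/-- The kernel `E = LZ` away from the diagonal. -/
noncomputable def Eker (A : Coeffs d) : Pt d → Pt d → ℝ := fun z zb =>
  (∑ i, ∑ j, (A.a zb i j - A.a z i j) * ZkerDD A i j z zb) -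
    (∑ i, A.b z i * ZkerD A i z zb) - A.c z * Zker A z zb

/-- The `k`-th term `Z * (−E)^{*k}` of the Volterra series. -/
noncomputable def volterra (A : Coeffs d) : ℕ → (Pt d → Pt d → ℝ)
  | 0 => Zker A
  | k + 1 => conv (volterra A k) fun z zb => -Eker A z zb

/-- The heat kernel `Γ`, defined as the sum of the Volterra series. -/
noncomputable def GammaKer (A : Coeffs d) : Pt d → Pt d → ℝ :=
  fun z zb => ∑' k, volterra A k z zb

/-! ## The space `C_{loc,t}^r` -/

/-- The set of which the `C_{loc,t}^r` seminorm with parameter `T` is the supremum. -/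
def clocSet (r : ℕ) (T : ℝ) (F : Pt d → Pt d → ℝ) : Set ℝ :=
  {y | ∃ (j1 j2 : Fin (d + 1) → ℕ) (z zb : Pt d), pdeg j1 + pdeg j2 ≤ r ∧
    |z 0 - zb 0| ≤ T ∧ y = |mderiv2 j1 j2 F z zb|}

/-- Membership in `C_{loc,t}^r`. -/
def MemCloc (r : ℕ) (F : Pt d → Pt d → ℝ) : Prop :=
  (∀ j1 j2 : Fin (d + 1) → ℕ, pdeg j1 + pdeg j2 < r →
    Differentiable ℝ fun p : Pt d × Pt d => mderiv2 j1 j2 F p.1 p.2) ∧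
  (∀ j1 j2 : Fin (d + 1) → ℕ, pdeg j1 + pdeg j2 ≤ r →
    Continuous fun p : Pt d × Pt d => mderiv2 j1 j2 F p.1 p.2) ∧
  ∀ T : ℝ, 0 < T → BddAbove (clocSet r T F)

/-- The `C_{loc,t}^r` seminorm with time-separation parameter `T`. -/
noncomputable def clocNorm (r : ℕ) (T : ℝ) (F : Pt d → Pt d → ℝ) : ℝ := sSup (clocSet r T F)

/-! ## The classes `Λ_r` of local families of translation-invariant kernels -/

/-- Names for the entries of the coefficient fields `a`, `a⁻¹`, `b`, `c`. -/
inductive CoeffVar (d : ℕ) where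
  | aa : Fin d → Fin d → CoeffVar d
  | ai : Fin d → Fin d → CoeffVar d
  | bb : Fin d → CoeffVar d
  | cc : CoeffVar d
deriving DecidableEq

/-- Evaluation of a formal variable `∂^l (entry)` of the coefficient field at `w`. -/
noncomputable def coeffEval (A : Coeffs d) (w : Pt d) :
    (Fin (d + 1) → ℕ) × CoeffVar d → ℝ
  | (l, CoeffVar.aa i j) => mderiv l (fun z => A.a z i j) w
  | (l, CoeffVar.ai i j) => mderiv l (fun z => (A.a z)⁻¹ i j) w
  | (l, CoeffVar.bb i) => mderiv l (fun z => A.b z i) w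
  | (l, CoeffVar.cc) => mderiv l A.c w

/-- The rational kernel `P(t,x) = t^{-1/2} Q(t^{1/2}, t^{-1/2} x)` attached to a
polynomial `Q`, extended by `0` to `t ≤ 0`. -/
noncomputable def ratKer (Q : MvPolynomial (Fin (d + 1)) ℝ) (z : Pt d) : ℝ :=
  if 0 < z 0 then
    (Real.sqrt (z 0))⁻¹ *
      MvPolynomial.eval
        (Fin.cons (Real.sqrt (z 0)) fun i : Fin d => z i.succ / Real.sqrt (z 0)) Q
  else 0

/-- The chain of differences `y_i − y_{i+1}` with `y_0 = ζ` and `y_{N+1} = 0`. -/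
noncomputable def chainDiff {N : ℕ} (ζ : Pt d) (y : Fin N → Pt d) (i : Fin (N + 1)) : Pt d :=
  (Fin.cons ζ (Fin.snoc y 0) : Fin (N + 2) → Pt d) i.castSucc -
    (Fin.cons ζ (Fin.snoc y 0) : Fin (N + 2) → Pt d) i.succ

/-- A single building block of the class `Λ_r`:
`K^w(ζ) = F(w) ∫ dy₁ ⋯ dy_N ∏ᵢ P^{[i]}(yᵢ − yᵢ₊₁) W^w(yᵢ − yᵢ₊₁)`. -/
noncomputable def lambdaAtom (A : Coeffs d)
    (p : MvPolynomial ((Fin (d + 1) → ℕ) × CoeffVar d) ℝ) (N : ℕ)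
    (Q : Fin (N + 1) → MvPolynomial (Fin (d + 1)) ℝ) (w ζ : Pt d) : ℝ :=
  MvPolynomial.eval (coeffEval A w) p *
    ∫ y : Fin N → Pt d, ∏ i : Fin (N + 1),
      (ratKer (Q i) (chainDiff ζ y i) * Wker A w (chainDiff ζ y i))

/-- Membership in `Λ_r`: finite linear combinations of the building blocks, where the
polynomial prefactor only involves derivatives `∂^l` of the coefficients with `|l|_𝔰 ≤ r`. -/
def MemLambda (A : Coeffs d) (r : ℕ) (K : Pt d → Pt d → ℝ) : Prop :=
  ∃ (M : ℕ) (p : Fin M → MvPolynomial ((Fin (d + 1) → ℕ) × CoeffVar d) ℝ)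
    (N : Fin M → ℕ) (Q : (m : Fin M) → Fin (N m + 1) → MvPolynomial (Fin (d + 1)) ℝ),
    (∀ m : Fin M, ∀ mo ∈ (p m).support, ∀ v ∈ mo.support, pdeg v.1 ≤ r) ∧
    ∀ w ζ : Pt d, K w ζ = ∑ m, lambdaAtom A (p m) (N m) (Q m) w ζ

/-! ## The spaces `𝒦_r^β` of regularising kernels and `C^M(𝒦_M^β)` -/

/-- Parabolic rescaling `z ↦ (c² t, c x)`. -/
noncomputable def pscale (c : ℝ) (z : Pt d) : Pt d :=
  Fin.cons (c ^ 2 * z 0) fun i : Fin d => c * z i.succ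

/-- `χ` is an admissible cutoff: smooth with `1_{B_𝔰(0,1/2)} ≤ χ ≤ 1_{B_𝔰(0,1)}`. -/
def IsCutoff (χ : Pt d → ℝ) : Prop :=
  ContDiff ℝ (⊤ : ℕ∞) χ ∧
    ∀ z : Pt d,
      ((if pnorm z ≤ 1 / 2 then (1 : ℝ) else 0) ≤ χ z) ∧
        χ z ≤ if pnorm z ≤ 1 then 1 else 0

/-- The `n`-th dyadic piece `φ_n = χ(2^{2n} t, 2^n x) − χ(2^{2n+2} t, 2^{n+1} x)`. -/
noncomputable def dyadicCut (χ : Pt d → ℝ) (n : ℕ) (z : Pt d) : ℝ :=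
  χ (pscale (2 ^ n) z) - χ (pscale (2 ^ (n + 1)) z)

/-- The set of which the `𝒦_{r,n}^β` norm is the supremum. -/
def kerPieceSet (β : ℝ) (r n : ℕ) (G : Pt d → ℝ) : Set ℝ :=
  {y | ∃ (k : Fin (d + 1) → ℕ) (z : Pt d), pdeg k ≤ 2 * r ∧
    y = |mderiv k G z| / 2 ^ (((d : ℝ) + 2 - β + pdeg k) * n)}

/-- Membership in the space `𝒦_{r,n}^β`: a `C^{2r}` function supported in
`B_𝔰(0, 2^{-n})` with finite norm. -/
def MemKerPiece (β : ℝ) (r n : ℕ) (G : Pt d → ℝ) : Prop :=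
  (∀ k : Fin (d + 1) → ℕ, pdeg k < 2 * r → Differentiable ℝ (mderiv k G)) ∧
  (∀ k : Fin (d + 1) → ℕ, pdeg k ≤ 2 * r → Continuous (mderiv k G)) ∧
  (∀ z : Pt d, ¬pnorm z ≤ (2 : ℝ) ^ (-(n : ℝ)) → G z = 0) ∧
  BddAbove (kerPieceSet β r n G)

/-- Derivative `∂_w^m` of a kernel family in the parameter ("upper slot"). -/
noncomputable def parDeriv (m : Fin (d + 1) → ℕ) (K : Pt d → Pt d → ℝ) :
    Pt d → Pt d → ℝ :=
  fun w ζ => mderiv m (fun w' => K w' ζ) w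

/-- The set of which the `C^M(𝒦_M^β)` norm is the supremum, using the dyadic
decomposition furnished by the cutoff `χ`. -/
def cKerSet (χ : Pt d → ℝ) (β : ℝ) (M : ℕ) (K : Pt d → Pt d → ℝ) : Set ℝ :=
  {y | ∃ (m : Fin (d + 1) → ℕ) (w : Pt d) (n : ℕ), pdeg m ≤ M ∧
    y ∈ kerPieceSet β M n fun ζ => dyadicCut χ n ζ * parDeriv m K w ζ}

/-- Membership in `C^M(𝒦_M^β)`, identifying `w ↦ K^w` with the family of dyadic
decompositions `(φ_n ∂_w^m K^w)_n`. -/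
def MemCKer (χ : Pt d → ℝ) (β : ℝ) (M : ℕ) (K : Pt d → Pt d → ℝ) : Prop :=
  (∀ m : Fin (d + 1) → ℕ, pdeg m < M → ∀ ζ : Pt d,
    Differentiable ℝ fun w => parDeriv m K w ζ) ∧
  (∀ m : Fin (d + 1) → ℕ, pdeg m ≤ M → ∀ (w : Pt d) (n : ℕ),
    MemKerPiece β M n fun ζ => dyadicCut χ n ζ * parDeriv m K w ζ) ∧
  BddAbove (cKerSet χ β M K)

/-- The `C^M(𝒦_M^β)` norm. -/
noncomputable def cKerNorm (χ : Pt d → ℝ) (β : ℝ) (M : ℕ) (K : Pt d → Pt d → ℝ) : ℝ :=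
  sSup (cKerSet χ β M K)

/-- Membership in `χΛ_r`: kernels of the form `χ · K̃^w` with `(K̃^w)_w ∈ Λ_r`. -/
def MemChiLambda (χ : Pt d → ℝ) (A : Coeffs d) (r : ℕ) (K : Pt d → Pt d → ℝ) : Prop :=
  ∃ Kt : Pt d → Pt d → ℝ, MemLambda A r Kt ∧ ∀ w ζ, K w ζ = χ ζ * Kt w ζ

section

/-! ## Iterated partial derivatives with bounds -/

/-- The space of pairs `(w, y)`. -/
abbrev EE (d : ℕ) := Pt d × Pt d

/-- Index set of the coordinate directions of `EE d`. -/
abbrev Ix (d : ℕ) := Fin (d + 1) ⊕ Fin (d + 1)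

/-- Coordinate directions of `EE d`. -/
noncomputable def dir : Ix d → EE d :=
  Sum.elim (fun i => (Pi.single i 1, 0)) (fun i => (0, Pi.single i 1))

/-- Coordinate functionals of `EE d`. -/
noncomputable def crd : Ix d → EE d →L[ℝ] ℝ :=
  Sum.elim (fun i => (ContinuousLinearMap.proj i).comp (ContinuousLinearMap.fst ℝ (Pt d) (Pt d)))
    (fun i => (ContinuousLinearMap.proj i).comp (ContinuousLinearMap.snd ℝ (Pt d) (Pt d)))

@[simp] lemma crd_inl (i : Fin (d + 1)) (e : EE d) : crd (Sum.inl i) e = e.1 i := rfl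
@[simp] lemma crd_inr (i : Fin (d + 1)) (e : EE d) : crd (Sum.inr i) e = e.2 i := rfl

lemma pt_eq_sum (w : Pt d) : w = ∑ i, w i • (Pi.single i 1 : Pt d) := by
  ext j
  simp [Finset.sum_apply, Pi.single_apply]

lemma eq_sum_dir (e : EE d) : e = ∑ i, crd i e • dir i := by
  rw [Fintype.sum_sum_type]
  simp only [crd_inl, crd_inr, dir, Sum.elim_inl, Sum.elim_inr]
  ext j
  · simp [Prod.fst_sum, Finset.sum_apply, Pi.single_apply]
  · simp [Prod.snd_sum, Finset.sum_apply, Pi.single_apply]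

lemma clm_eq_sum (T : EE d →L[ℝ] ℝ) : T = ∑ i, T (dir i) • crd i := by
  refine ContinuousLinearMap.ext fun e => ?_
  conv_lhs => rw [eq_sum_dir e]
  simp [map_sum, mul_comm]

/-- Partial derivative in direction `dir i`. -/
noncomputable def D (i : Ix d) (f : EE d → ℝ) : EE d → ℝ := fun e => fderiv ℝ f e (dir i)

/-- All iterated partial derivatives of `F x` of order at most `n` exist, are jointly continuous
and bounded by `B`. -/
def PB {X : Type} [TopologicalSpace X] :
    ℕ → (X → EE d → ℝ) → (X → EE d → ℝ) → Prop
  | 0, B, F => Continuous (fun p : X × EE d => F p.1 p.2) ∧ ∀ x e, |F x e| ≤ B x e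
  | n + 1, B, F => Continuous (fun p : X × EE d => F p.1 p.2) ∧ (∀ x e, |F x e| ≤ B x e) ∧
      (∀ x, Differentiable ℝ (F x)) ∧ ∀ i, PB n B (fun x => D i (F x))

/-- The version of `PB` without parameter. -/
def CB (n : ℕ) (B f : EE d → ℝ) : Prop := PB (X := Unit) n (fun _ => B) (fun _ => f)

section PB
variable {X : Type} [TopologicalSpace X] {n : ℕ} {B B' F G : X → EE d → ℝ}

lemma PB.cont (h : PB n B F) : Continuous (fun p : X × EE d => F p.1 p.2) := by
  cases n <;> exact h.1

lemma PB.bound (h : PB n B F) (x : X) (e : EE d) : |F x e| ≤ B x e := by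
  cases n
  · exact h.2 x e
  · exact h.2.1 x e

lemma PB.nonneg (h : PB n B F) (x : X) (e : EE d) : 0 ≤ B x e :=
  (abs_nonneg _).trans (h.bound x e)

lemma PB.diff (h : PB (n + 1) B F) (x : X) : Differentiable ℝ (F x) := h.2.2.1 x

lemma PB.deriv (h : PB (n + 1) B F) (i : Ix d) : PB n B (fun x => D i (F x)) := h.2.2.2 i

lemma PB.mono (h : PB n B F) (hB : ∀ x e, B x e ≤ B' x e) : PB n B' F := by
  induction n generalizing F with
  | zero => exact ⟨h.1, fun x e => (h.2 x e).trans (hB x e)⟩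
  | succ n ih => exact ⟨h.1, fun x e => (h.2.1 x e).trans (hB x e), h.2.2.1, fun i => ih (h.2.2.2 i)⟩

lemma PB.pred (h : PB (n + 1) B F) : PB n B F := by
  induction n generalizing F with
  | zero => exact ⟨h.1, h.2.1⟩
  | succ n ih => exact ⟨h.1, h.2.1, h.2.2.1, fun i => ih (h.2.2.2 i)⟩

lemma PB.le {m : ℕ} (h : PB n B F) (hm : m ≤ n) : PB m B F := by
  induction hm with
  | refl => exact h
  | step _ ih => exact ih h.pred

lemma PB.comap {Y : Type} [TopologicalSpace Y] (h : PB n B F) {g : Y → X} (hg : Continuous g) :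
    PB n (fun y => B (g y)) (fun y => F (g y)) := by
  induction n generalizing F with
  | zero => exact ⟨h.1.comp (by fun_prop : Continuous fun p : Y × EE d => (g p.1, p.2)),
      fun x e => h.2 (g x) e⟩
  | succ n ih => exact ⟨h.1.comp (by fun_prop : Continuous fun p : Y × EE d => (g p.1, p.2)),
      fun x e => h.2.1 (g x) e, fun x => h.2.2.1 (g x), fun i => ih (h.2.2.2 i)⟩

lemma PB.add (h : PB n B F) (h' : PB n B' G) :
    PB n (fun x e => B x e + B' x e) (fun x e => F x e + G x e) := by
  induction n generalizing F G with
  | zero =>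
    exact ⟨h.1.add h'.1, fun x e => (abs_add_le _ _).trans (add_le_add (h.2 x e) (h'.2 x e))⟩
  | succ n ih =>
    refine ⟨h.1.add h'.1, fun x e => (abs_add_le _ _).trans (add_le_add (h.2.1 x e) (h'.2.1 x e)),
      fun x => (h.diff x).add (h'.diff x), fun i => ?_⟩
    have := ih (h.deriv i) (h'.deriv i)
    convert this using 3 with x e
    simp only [D]
    rw [fderiv_fun_add (h.diff x _) (h'.diff x _)]; rfl

lemma D_zero (i : Ix d) : D i (fun _ => (0 : ℝ)) = fun _ => 0 := by
  funext e; simp [D]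

lemma PB.of_zero (hB : ∀ x e, 0 ≤ B x e) : PB n B (fun _ _ => (0 : ℝ)) := by
  induction n with
  | zero => exact ⟨continuous_const, fun x e => by simpa using hB x e⟩
  | succ n ih =>
    refine ⟨continuous_const, fun x e => by simpa using hB x e, fun x => differentiable_const 0, fun i => ?_⟩
    simp only [D_zero]; exact ih

/-- Functions of the parameter only. -/
lemma PB.of_param {τ : X → ℝ} (hτ : Continuous τ) : PB (d := d) n (fun x _ => |τ x|) (fun x _ => τ x) := by
  cases n with
  | zero => exact ⟨by fun_prop, fun x e => le_rfl⟩
  | succ n =>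
    refine ⟨by fun_prop, fun x e => le_rfl, fun x => differentiable_const _, fun i => ?_⟩
    have : (fun x => D (d := d) i (fun _ => τ x)) = fun _ _ => 0 := by
      funext x e; simp [D]
    rw [this]; exact PB.of_zero fun x e => abs_nonneg _

lemma PB.const (c : ℝ) : PB (X := X) (d := d) n (fun _ _ => |c|) (fun _ _ => c) :=
  PB.of_param continuous_const

lemma D_mul {f g : EE d → ℝ} (hf : Differentiable ℝ f) (hg : Differentiable ℝ g) (i : Ix d) :
    D i (fun e => f e * g e) = fun e => f e * D i g e + g e * D i f e := by
  funext e
  simp only [D]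
  rw [fderiv_fun_mul (hf e) (hg e)]
  simp

lemma PB.mul (h : PB n B F) (h' : PB n B' G) :
    PB n (fun x e => 2 ^ n * (B x e * B' x e)) (fun x e => F x e * G x e) := by
  induction n generalizing F G with
  | zero =>
    refine ⟨h.1.mul h'.1, fun x e => ?_⟩
    simp only [abs_mul, pow_zero, one_mul]
    exact mul_le_mul (h.2 x e) (h'.2 x e) (abs_nonneg _) (h.nonneg x e)
  | succ n ih =>
    refine ⟨h.cont.mul h'.cont, fun x e => ?_, fun x => (h.diff x).mul (h'.diff x), fun i => ?_⟩
    · rw [abs_mul]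
      have h1 : (1 : ℝ) ≤ 2 ^ (n + 1) := one_le_pow₀ (by norm_num)
      have h2 : 0 ≤ B x e * B' x e := mul_nonneg (h.nonneg x e) (h'.nonneg x e)
      have h3 := mul_le_mul (h.bound x e) (h'.bound x e) (abs_nonneg _) (h.nonneg x e)
      nlinarith
    · have h1 := (ih h.pred (h'.deriv i)).add (ih (h.deriv i) h'.pred)
      convert h1 using 1
      · funext x e; ring
      · funext x e
        rw [D_mul (h.diff x) (h'.diff x)]; ring

lemma PB.param_mul {τ : X → ℝ} (hτ : Continuous τ) (h : PB n B F) :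
    PB n (fun x e => |τ x| * B x e) (fun x e => τ x * F x e) := by
  induction n generalizing F with
  | zero =>
    refine ⟨by have := h.1; fun_prop, fun x e => ?_⟩
    rw [abs_mul]; exact mul_le_mul_of_nonneg_left (h.2 x e) (abs_nonneg _)
  | succ n ih =>
    refine ⟨by have := h.1; fun_prop, fun x e => ?_, fun x => (h.diff x).const_mul _, fun i => ?_⟩
    · rw [abs_mul]; exact mul_le_mul_of_nonneg_left (h.bound x e) (abs_nonneg _)
    · convert ih (h.deriv i) using 3 with x e
      simp only [D]
      rw [fderiv_const_mul (h.diff x e)]; simp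

lemma PB.const_mul (c : ℝ) (h : PB n B F) :
    PB n (fun x e => |c| * B x e) (fun x e => c * F x e) := h.param_mul continuous_const

lemma PB.neg (h : PB n B F) : PB n B (fun x e => - F x e) := by
  have := h.const_mul (-1)
  simpa using this

lemma PB.sub (h : PB n B F) (h' : PB n B' G) :
    PB n (fun x e => B x e + B' x e) (fun x e => F x e - G x e) := by
  simpa [sub_eq_add_neg] using h.add h'.neg

lemma PB.sum {κ : Type*} (s : Finset κ) {B F : κ → X → EE d → ℝ} (h : ∀ k ∈ s, PB n (B k) (F k)) :
    PB n (fun x e => ∑ k ∈ s, B k x e) (fun x e => ∑ k ∈ s, F k x e) := by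
  classical
  induction s using Finset.induction_on with
  | empty => simpa using PB.of_zero (fun _ _ => le_rfl)
  | insert a s ha ih =>
    simp only [Finset.sum_insert ha]
    exact (h a (by simp)).add (ih fun k hk => h k (by simp [hk]))

end PB

/-! ### Composition with the affine-quadratic changes of variables -/

/-- The map `(u,v) ↦ (u², u v)`. -/
def sh (y : Pt d) : Pt d := fun i => y 0 * y i

/-- Data of a change of variables `(w,y) ↦ (w + α sh(P y + q), P' y + q')`. -/
structure Aff (X : Type) [TopologicalSpace X] (d : ℕ) where
  α : X → ℝ
  P : X → Pt d
  q : X → Pt d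
  P' : X → Pt d
  q' : X → Pt d
  cα : Continuous α
  cP : Continuous P
  cq : Continuous q
  cP' : Continuous P'
  cq' : Continuous q'
  bα : ∀ x, |α x| ≤ 1
  bP : ∀ x i, |P x i| ≤ 1
  bP' : ∀ x i, |P' x i| ≤ 1

section Aff
variable {X : Type} [TopologicalSpace X] (T : Aff X d)

/-- The inner variable `P y + q`. -/
def Aff.Y (x : X) (e : EE d) : Pt d := fun i => T.P x i * e.2 i + T.q x i
/-- The change of variables. -/
def Aff.Φ (x : X) (e : EE d) : EE d :=
  (fun i => e.1 i + T.α x * (T.Y x e 0 * T.Y x e i), fun i => T.P' x i * e.2 i + T.q' x i)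
def Aff.wt (x : X) (e : EE d) : ℝ := 1 + ∑ j, |T.Y x e j|

lemma Aff.one_le_wt (x : X) (e : EE d) : 1 ≤ T.wt x e := by
  unfold Aff.wt
  have : 0 ≤ ∑ j, |T.Y x e j| := Finset.sum_nonneg fun j _ => abs_nonneg _
  linarith

lemma Aff.Y_le_wt (x : X) (e : EE d) (j) : |T.Y x e j| ≤ T.wt x e := by
  unfold Aff.wt
  have := Finset.single_le_sum (f := fun j => |T.Y x e j|) (fun j _ => abs_nonneg _) (Finset.mem_univ j)
  linarith

lemma Aff.cont_Y : Continuous (fun p : X × EE d => T.Y p.1 p.2) := by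
  have h1 := T.cP
  have h2 := T.cq
  unfold Aff.Y
  fun_prop

lemma Aff.cont_Φ : Continuous (fun p : X × EE d => T.Φ p.1 p.2) := by
  have h1 := T.cα
  have h2 := T.cP'
  have h3 := T.cq'
  have h4 := T.cont_Y
  have h5 : ∀ i, Continuous (fun p : X × EE d => T.Y p.1 p.2 i) := fun i => (continuous_apply i).comp h4
  unfold Aff.Φ
  refine Continuous.prodMk ?_ ?_
  · refine continuous_pi fun i => ?_
    have := h5 0
    have := h5 i
    fun_prop
  · fun_prop

lemma D_eq_deriv {f : EE d → ℝ} (hf : Differentiable ℝ f) (i : Ix d) (e : EE d) :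
    D i f e = deriv (fun t : ℝ => f (e + t • dir i)) 0 := by
  have : HasDerivAt (fun t : ℝ => e + t • dir i) (dir i) 0 := by
    have := ((hasDerivAt_id (0:ℝ)).smul_const (dir i)).const_add e
    simpa using this
  have h2 : HasFDerivAt f (fderiv ℝ f e) (e + (0:ℝ) • dir i) := by simpa using (hf e).hasFDerivAt
  exact (h2.comp_hasDerivAt 0 this).deriv.symm

/-- Each coordinate of the inner variable has a constant derivative. -/
lemma D_of_line {f : EE d → ℝ} (hf : Differentiable ℝ f) (i : Ix d) (e : EE d) {c : ℝ}
    (h : HasDerivAt (fun t : ℝ => f (e + t • dir i)) c 0) : D i f e = c := by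
  rw [D_eq_deriv hf, h.deriv]

lemma fderiv_apply_eq (f : EE d → ℝ) (e h : EE d) : fderiv ℝ f e h = ∑ i, crd i h * D i f e := by
  conv_lhs => rw [eq_sum_dir h]
  simp [map_sum, D]

lemma Aff.diff_Φ (x : X) : Differentiable ℝ (T.Φ x) := by
  unfold Aff.Φ Aff.Y
  refine Differentiable.prodMk ?_ ?_
  · fun_prop
  · fun_prop

lemma Aff.line (x : X) (e : EE d) (k : Ix d) :
    HasDerivAt (fun t : ℝ => T.Φ x (e + t • dir k))
      (fderiv ℝ (T.Φ x) e (dir k)) 0 := by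
  have : HasDerivAt (fun t : ℝ => e + t • dir k) (dir k) 0 := by
    have := ((hasDerivAt_id (0:ℝ)).smul_const (dir k)).const_add e
    simpa using this
  have h2 : HasFDerivAt (T.Φ x) (fderiv ℝ (T.Φ x) e) (e + (0:ℝ) • dir k) := by
    simpa using (T.diff_Φ x e).hasFDerivAt
  exact h2.comp_hasDerivAt 0 this

lemma Aff.fderiv_Φ_inl (x : X) (e : EE d) (i : Fin (d + 1)) :
    fderiv ℝ (T.Φ x) e (dir (Sum.inl i)) = dir (Sum.inl i) := by
  refine (T.line x e (Sum.inl i)).unique ?_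
  have : (fun t : ℝ => T.Φ x (e + t • dir (Sum.inl i))) = fun t : ℝ => T.Φ x e + t • dir (Sum.inl i) := by
    funext t
    ext j
    · simp [Aff.Φ, Aff.Y, dir]; ring
    · simp [Aff.Φ, dir]
  rw [this]
  have := ((hasDerivAt_id (0:ℝ)).smul_const (dir (Sum.inl i) : EE d)).const_add (T.Φ x e)
  simpa using this

lemma Aff.fderiv_Φ_inr (x : X) (e : EE d) (i : Fin (d + 1)) :
    fderiv ℝ (T.Φ x) e (dir (Sum.inr i)) =
      (fun j => T.α x * (T.P x i * ((if i = 0 then 1 else 0) * T.Y x e j + (if j = i then T.Y x e 0 else 0))),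
        fun j => if j = i then T.P' x i else 0) := by
  refine (T.line x e (Sum.inr i)).unique ?_
  refine HasDerivAt.prodMk (hasDerivAt_pi.2 fun j => ?_) (hasDerivAt_pi.2 fun j => ?_)
  · have hY : ∀ k, HasDerivAt (fun t : ℝ => T.Y x (e + t • dir (Sum.inr i)) k)
        (T.P x k * (Pi.single i 1 : Pt d) k) 0 := by
      intro k
      have : (fun t : ℝ => T.Y x (e + t • dir (Sum.inr i)) k) =
          fun t : ℝ => T.P x k * (e.2 k + t * (Pi.single i 1 : Pt d) k) + T.q x k := by
        funext t; simp [Aff.Y, dir]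
      rw [this]
      have := ((((hasDerivAt_id (0:ℝ)).mul_const ((Pi.single i 1 : Pt d) k)).const_add
        (e.2 k)).const_mul (T.P x k)).add_const (T.q x k)
      simpa using this
    have h1 := (((hY 0).mul (hY j)).const_mul (T.α x)).const_add (e.1 j)
    convert h1 using 1
    · funext t; simp [dir]
    · simp only [zero_smul, add_zero, Pi.single_apply]
      by_cases h0 : i = 0
      · subst h0
        by_cases hj : j = 0
        · subst hj; simp only [if_true]; ring
        · simp only [hj, if_true, if_false]; ring
      · by_cases hj : j = i
        · subst hj; simp only [h0, Ne.symm h0, if_true, if_false]; ring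
        · simp only [h0, Ne.symm h0, hj, if_false]; ring
  · have h1 := ((((hasDerivAt_id (0:ℝ)).mul_const ((Pi.single i 1 : Pt d) j)).const_add
        (e.2 j)).const_mul (T.P' x j)).add_const (T.q' x j)
    convert h1 using 1
    · funext t; simp [dir]
    · simp only [Pi.single_apply, one_mul]
      by_cases hj : j = i
      · subst hj; simp
      · simp [hj]

variable {F : EE d → ℝ}

lemma Aff.D_comp_inl (hF : Differentiable ℝ F) (x : X) (i : Fin (d + 1)) :
    D (Sum.inl i) (fun e => F (T.Φ x e)) = fun e => D (Sum.inl i) F (T.Φ x e) := by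
  funext e
  simp only [D]
  rw [show (fun e => F (T.Φ x e)) = F ∘ T.Φ x from rfl, fderiv_comp e (hF _) (T.diff_Φ x e),
    ContinuousLinearMap.comp_apply, T.fderiv_Φ_inl]

lemma Aff.D_comp_inr (hF : Differentiable ℝ F) (x : X) (i : Fin (d + 1)) :
    D (Sum.inr i) (fun e => F (T.Φ x e)) = fun e =>
      (T.α x * T.P x i * (if i = 0 then 1 else 0)) * (∑ j, T.Y x e j * D (Sum.inl j) F (T.Φ x e)) +
      ((T.α x * T.P x i) * (T.Y x e 0 * D (Sum.inl i) F (T.Φ x e)) +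
      T.P' x i * D (Sum.inr i) F (T.Φ x e)) := by
  funext e
  have : D (Sum.inr i) (fun e => F (T.Φ x e)) e = fderiv ℝ F (T.Φ x e) (fderiv ℝ (T.Φ x) e (dir (Sum.inr i))) := by
    simp only [D]
    rw [show (fun e => F (T.Φ x e)) = F ∘ T.Φ x from rfl, fderiv_comp e (hF _) (T.diff_Φ x e),
      ContinuousLinearMap.comp_apply]
  rw [this, fderiv_apply_eq, T.fderiv_Φ_inr, Fintype.sum_sum_type]
  simp only [crd_inl, crd_inr, ite_mul, zero_mul, Finset.sum_ite_eq', Finset.mem_univ, if_true]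
  rw [Finset.mul_sum, ← add_assoc]
  congr 1
  have : ∀ j, T.α x * (T.P x i * ((if i = 0 then 1 * T.Y x e j else 0) + if j = i then T.Y x e 0 else 0)) *
      D (Sum.inl j) F (T.Φ x e) =
      T.α x * T.P x i * (if i = 0 then 1 else 0) * (T.Y x e j * D (Sum.inl j) F (T.Φ x e)) +
      (if j = i then (T.α x * T.P x i) * (T.Y x e 0 * D (Sum.inl i) F (T.Φ x e)) else 0) := by
    intro j
    by_cases hj : j = i
    · subst hj; simp only [if_true]; split_ifs <;> ring
    · simp only [hj, if_false]; split_ifs <;> ring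
  rw [Finset.sum_congr rfl fun j _ => this j, Finset.sum_add_distrib]
  simp

lemma Aff.PB_Y {n : ℕ} (j : Fin (d + 1)) : PB n T.wt (fun x e => T.Y x e j) := by
  have hc : Continuous (fun p : X × EE d => T.Y p.1 p.2 j) := (continuous_apply j).comp T.cont_Y
  cases n with
  | zero => exact ⟨hc, fun x e => T.Y_le_wt x e j⟩
  | succ n =>
    have hd : ∀ x, Differentiable ℝ (fun e => T.Y x e j) := fun x => by
      unfold Aff.Y; fun_prop
    refine ⟨hc, fun x e => T.Y_le_wt x e j, hd, fun i => ?_⟩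
    have : (fun x => D i (fun e => T.Y x e j)) = fun x _ => T.P x j * (dir i : EE d).2 j := by
      funext x e
      refine D_of_line (hd x) i e ?_
      have : (fun t : ℝ => T.Y x (e + t • dir i) j) =
          fun t : ℝ => T.P x j * (e.2 j + t * (dir i : EE d).2 j) + T.q x j := by
        funext t; simp [Aff.Y]
      rw [this]
      have := ((((hasDerivAt_id (0:ℝ)).mul_const ((dir i : EE d).2 j)).const_add
        (e.2 j)).const_mul (T.P x j)).add_const (T.q x j)
      simpa using this
    rw [this]
    have hP : Continuous (fun x => T.P x j * (dir i : EE d).2 j) :=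
      ((continuous_apply j).comp T.cP).mul continuous_const
    refine (PB.of_param hP).mono fun x e => ?_
    refine le_trans ?_ (T.one_le_wt x e)
    rw [abs_mul]
    have h1 : |(dir i : EE d).2 j| ≤ 1 := by
      rcases i with i | i
      · simp [dir]
      · simp only [dir, Sum.elim_inr, Pi.single_apply]; split_ifs <;> simp
    calc _ ≤ 1 * 1 := mul_le_mul (T.bP x j) h1 (abs_nonneg _) zero_le_one
      _ = 1 := one_mul 1

end Aff

/-- Constants in the composition estimate. -/
noncomputable def compC (d : ℕ) : ℕ → ℝ
  | 0 => 1
  | n + 1 => 2 ^ n * compC d n * (d + 3)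

lemma one_le_compC (d n : ℕ) : 1 ≤ compC d n := by
  induction n with
  | zero => simp [compC]
  | succ n ih =>
    have h2 : (1 : ℝ) ≤ 2 ^ n := one_le_pow₀ (by norm_num)
    have h3 : (1 : ℝ) ≤ (d : ℝ) + 3 := by have : (0:ℝ) ≤ d := Nat.cast_nonneg d; linarith
    unfold compC
    nlinarith [mul_le_mul h2 ih zero_le_one (by linarith), mul_nonneg (by linarith : (0:ℝ) ≤ 2^n) (by linarith : (0:ℝ) ≤ compC d n)]

lemma PB.compΦ {X : Type} [TopologicalSpace X] (T : Aff X d) {n : ℕ} {B F : X → EE d → ℝ}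
    (h : PB n B F) :
    PB n (fun x e => compC d n * T.wt x e ^ n * B x (T.Φ x e)) (fun x e => F x (T.Φ x e)) := by
  induction n generalizing F with
  | zero =>
    refine ⟨h.1.comp (continuous_fst.prodMk T.cont_Φ), fun x e => ?_⟩
    simpa [compC] using h.2 x _
  | succ n ih =>
    have hw := T.one_le_wt
    have hC := one_le_compC d
    have hB : ∀ x e, 0 ≤ B x (T.Φ x e) := fun x e => h.nonneg x _
    refine ⟨h.1.comp (continuous_fst.prodMk T.cont_Φ), fun x e => ?_,
      fun x => (h.diff x).comp (T.diff_Φ x), fun i => ?_⟩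
    · refine (h.bound x _).trans ?_
      have h1 : 1 ≤ T.wt x e ^ (n + 1) := one_le_pow₀ (hw x e)
      have h2 := hC (n + 1)
      have h3 : 1 ≤ compC d (n + 1) * T.wt x e ^ (n + 1) := by nlinarith
      nlinarith [hB x e]
    · have key : ∀ x e, 2 ^ n * (T.wt x e * (compC d n * T.wt x e ^ n * B x (T.Φ x e))) =
          2 ^ n * compC d n * T.wt x e ^ (n + 1) * B x (T.Φ x e) := fun x e => by ring
      have hbig : ∀ x e, compC d n * T.wt x e ^ n * B x (T.Φ x e) ≤
          2 ^ n * compC d n * T.wt x e ^ (n + 1) * B x (T.Φ x e) := by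
        intro x e
        refine mul_le_mul_of_nonneg_right ?_ (hB x e)
        have h1 : (1 : ℝ) ≤ 2 ^ n := one_le_pow₀ (by norm_num)
        have h2 : T.wt x e ^ n ≤ T.wt x e ^ (n + 1) := pow_le_pow_right₀ (hw x e) (Nat.le_succ n)
        have h3 : 0 ≤ T.wt x e ^ n := by have := hw x e; positivity
        have := hC n
        exact mul_le_mul (by nlinarith) h2 h3 (by positivity)
      have hK : ∀ x e, 0 ≤ 2 ^ n * compC d n * T.wt x e ^ (n + 1) * B x (T.Φ x e) := fun x e =>
        le_trans (mul_nonneg (mul_nonneg (by linarith [hC n]) (by have := hw x e; positivity)) (hB x e)) (hbig x e)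
      have hα := T.cα
      have hP : ∀ i, Continuous fun x => T.P x i := fun i => (continuous_apply i).comp T.cP
      have hP' : ∀ i, Continuous fun x => T.P' x i := fun i => (continuous_apply i).comp T.cP'
      rcases i with i | i
      · have h1 := ih (h.deriv (Sum.inl i))
        simp only [T.D_comp_inl (h.diff _)]
        refine h1.mono fun x e => (hbig x e).trans ?_
        simp only [compC]
        have : (1 : ℝ) ≤ d + 3 := by have : (0:ℝ) ≤ d := Nat.cast_nonneg d; linarith
        nlinarith [hK x e]
      · have h1 : ∀ j, PB n _ _ := fun j => (T.PB_Y (n := n) j).mul (ih (h.deriv (Sum.inl j)))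
        have h2 := PB.sum Finset.univ (fun j _ => h1 j)
        have hc1 : Continuous fun x => T.α x * T.P x i * (if i = 0 then 1 else 0) := by
          have := hP i; fun_prop
        have hc2 : Continuous fun x => T.α x * T.P x i := by
          have := hP i; fun_prop
        have hc2b : ∀ x, |T.α x * T.P x i| ≤ 1 := fun x => by
          rw [abs_mul]
          calc _ ≤ 1 * 1 := mul_le_mul (T.bα x) (T.bP x i) (abs_nonneg _) zero_le_one
            _ = 1 := one_mul 1
        have hc1b : ∀ x, |T.α x * T.P x i * (if i = 0 then 1 else 0)| ≤ 1 := fun x => by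
          split_ifs
          · simpa using hc2b x
          · simp
        have h3 := (h2.param_mul hc1).add (((T.PB_Y (n := n) 0).mul (ih (h.deriv (Sum.inl i)))).param_mul hc2 |>.add
          ((ih (h.deriv (Sum.inr i))).param_mul (hP' i)))
        simp only [T.D_comp_inr (h.diff _)]
        refine h3.mono fun x e => ?_
        simp only [key, Finset.sum_const, Finset.card_univ, Fintype.card_fin, nsmul_eq_mul]
        set K := 2 ^ n * compC d n * T.wt x e ^ (n + 1) * B x (T.Φ x e) with hKdef
        have hK' : 0 ≤ K := hK x e
        have e1 : |T.α x * T.P x i * (if i = 0 then 1 else 0)| * (((d + 1 : ℕ) : ℝ) * K) ≤ (d + 1) * K := by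
          push_cast
          have : 0 ≤ ((d:ℝ) + 1) * K := by positivity
          nlinarith [hc1b x]
        have e2 : |T.α x * T.P x i| * K ≤ K := by nlinarith [hc2b x]
        have e3 : |T.P' x i| * (compC d n * T.wt x e ^ n * B x (T.Φ x e)) ≤ K := by
          refine le_trans ?_ (hbig x e)
          have : 0 ≤ compC d n * T.wt x e ^ n * B x (T.Φ x e) :=
            mul_nonneg (mul_nonneg (by linarith [hC n]) (by have := hw x e; positivity)) (hB x e)
          nlinarith [T.bP' x i]
        have e4 : compC d (n + 1) * T.wt x e ^ (n + 1) * B x (T.Φ x e) = (d + 3) * K := by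
          simp only [compC, hKdef]; ring
        rw [e4]
        linarith

end

section

set_option linter.unusedSectionVars false
set_option linter.unusedVariables false

/-! ## Parametric integrals -/

section Integral
variable {X : Type} [TopologicalSpace X] [SecondCountableTopology X] [MeasurableSpace X]
  [OpensMeasurableSpace X] {μ : Measure X} {n : ℕ} {F : X → EE d → ℝ} {g : X → ℝ} {b : EE d → ℝ}

lemma PB.cont_x {X : Type} [TopologicalSpace X] {n : ℕ} {B F : X → EE d → ℝ} (h : PB n B F) (e : EE d) :
    Continuous fun x => F x e :=
  h.cont.comp (by fun_prop : Continuous fun x : X => (x, e))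

lemma PB.cont_e {X : Type} [TopologicalSpace X] {n : ℕ} {B F : X → EE d → ℝ} (h : PB n B F) (x : X) :
    Continuous (F x) :=
  h.cont.comp (by fun_prop : Continuous fun e : EE d => (x, e))

lemma PB.integrable (h : PB n (fun x e => g x * b e) F) (hg : Integrable g μ) (e : EE d) :
    Integrable (fun x => F x e) μ :=
  (hg.mul_const (b e)).mono' (h.cont_x e).aestronglyMeasurable
    (Eventually.of_forall fun x => h.bound x e)

lemma fderiv_eq_sum (f : EE d → ℝ) (e : EE d) : fderiv ℝ f e = ∑ i, D i f e • crd i :=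
  clm_eq_sum _

lemma PB.aesm_fderiv (h : PB (n + 1) (fun x e => g x * b e) F) (e : EE d) :
    AEStronglyMeasurable (fun x => fderiv ℝ (F x) e) μ := by
  have : (fun x => fderiv ℝ (F x) e) = fun x => ∑ i, D i (F x) e • (crd i : EE d →L[ℝ] ℝ) := by
    funext x; exact fderiv_eq_sum _ _
  rw [this]
  have h1 : ∀ i, Continuous fun x => D i (F x) e := fun i => (h.deriv i).cont_x e
  have : Continuous fun x => ∑ i, D i (F x) e • (crd i : EE d →L[ℝ] ℝ) := by fun_prop
  exact this.aestronglyMeasurable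

/-- A constant. -/
noncomputable def crdC (d : ℕ) : ℝ := ∑ i : Ix d, ‖(crd i : EE d →L[ℝ] ℝ)‖

lemma PB.norm_fderiv_le (h : PB (n + 1) (fun x e => g x * b e) F) (x : X) (e : EE d) :
    ‖fderiv ℝ (F x) e‖ ≤ crdC d * (|g x| * |b e|) := by
  rw [fderiv_eq_sum]
  refine (norm_sum_le _ _).trans ?_
  rw [crdC, Finset.sum_mul]
  refine Finset.sum_le_sum fun i _ => ?_
  rw [norm_smul, mul_comm]
  refine mul_le_mul_of_nonneg_left ?_ (norm_nonneg _)
  have h1 := (h.deriv i).bound x e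
  rw [Real.norm_eq_abs, ← abs_mul]
  exact h1.trans (le_abs_self _)

lemma PB.hasFDerivAt_integral (h : PB (n + 1) (fun x e => g x * b e) F) (hg : Integrable g μ)
    (hb : Continuous b) (e : EE d) :
    HasFDerivAt (fun e => ∫ x, F x e ∂μ) (∫ x, fderiv ℝ (F x) e ∂μ) e := by
  have hC0 : 0 ≤ crdC d := Finset.sum_nonneg fun i _ => norm_nonneg _
  have hU : {e' | |b e'| < |b e| + 1} ∈ nhds e :=
    (isOpen_lt hb.abs continuous_const).mem_nhds (by
      show |b e| < |b e| + 1
      linarith)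
  refine hasFDerivAt_integral_of_dominated_of_fderiv_le (𝕜 := ℝ) (F' := fun e x => fderiv ℝ (F x) e)
    (bound := fun x => crdC d * (|g x| * (|b e| + 1))) hU
    (Eventually.of_forall fun e' => (h.cont_x e').aestronglyMeasurable) (h.integrable hg e)
    (h.aesm_fderiv e) ?_ ?_ ?_
  · refine Eventually.of_forall fun x e' he' => (h.norm_fderiv_le x e').trans ?_
    have h3 : |b e'| < |b e| + 1 := he'
    exact mul_le_mul_of_nonneg_left (mul_le_mul_of_nonneg_left h3.le (abs_nonneg _)) hC0
  · exact (hg.abs.mul_const _).const_mul _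
  · exact Eventually.of_forall fun x e' _ => (h.diff x e').hasFDerivAt

lemma PB.D_integral (h : PB (n + 1) (fun x e => g x * b e) F) (hg : Integrable g μ)
    (hb : Continuous b) (i : Ix d) :
    D i (fun e => ∫ x, F x e ∂μ) = fun e => ∫ x, D i (F x) e ∂μ := by
  funext e
  simp only [D]
  rw [(h.hasFDerivAt_integral hg hb e).fderiv]
  have hintg : Integrable (fun x => fderiv ℝ (F x) e) μ :=
    ((hg.abs.mul_const |b e|).const_mul (crdC d)).mono' (h.aesm_fderiv e)
      (Eventually.of_forall fun x => h.norm_fderiv_le x e)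
  exact ContinuousLinearMap.integral_apply hintg (dir i)

lemma PB.continuous_integral (h : PB n (fun x e => g x * b e) F) (hg : Integrable g μ)
    (hb : Continuous b) : Continuous (fun e => ∫ x, F x e ∂μ) := by
  refine continuous_iff_continuousAt.2 fun e => ?_
  have hU : {e' | |b e'| < |b e| + 1} ∈ nhds e :=
    (isOpen_lt hb.abs continuous_const).mem_nhds (by
      show |b e| < |b e| + 1
      linarith)
  refine continuousAt_of_dominated (bound := fun x => |g x| * (|b e| + 1))
    (Eventually.of_forall fun e' => (h.cont_x e').aestronglyMeasurable) ?_ (hg.abs.mul_const _)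
    (Eventually.of_forall fun x => (h.cont_e x).continuousAt)
  filter_upwards [hU] with e' he'
  refine Eventually.of_forall fun x => ?_
  have h3 : |b e'| < |b e| + 1 := he'
  calc |F x e'| ≤ g x * b e' := h.bound x e'
    _ ≤ |g x * b e'| := le_abs_self _
    _ = |g x| * |b e'| := abs_mul _ _
    _ ≤ _ := mul_le_mul_of_nonneg_left h3.le (abs_nonneg _)

lemma CB.of_unit {n : ℕ} {Y : Type} [TopologicalSpace Y] {B f : EE d → ℝ} (h : CB n B f) :
    PB (X := Y) n (fun _ => B) (fun _ => f) :=
  PB.comap (g := fun _ : Y => ()) h continuous_const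

lemma PB.toCB {n : ℕ} {B F : X → EE d → ℝ} (h : PB n B F) (x : X) : CB n (B x) (F x) :=
  PB.comap (g := fun _ : Unit => x) h continuous_const

lemma PB.integral (h : PB n (fun x e => g x * b e) F) (hg : Integrable g μ)
    (hb : Continuous b) : CB n (fun e => (∫ x, g x ∂μ) * b e) (fun e => ∫ x, F x e ∂μ) := by
  induction n generalizing F with
  | zero =>
    refine ⟨(h.continuous_integral hg hb).comp continuous_snd, fun _ e => ?_⟩
    show |∫ x, F x e ∂μ| ≤ (∫ x, g x ∂μ) * b e
    rw [← integral_mul_const]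
    exact (abs_integral_le_integral_abs).trans
      (integral_mono (h.integrable hg e).abs (hg.mul_const _) fun x => h.bound x e)
  | succ n ih =>
    refine ⟨(h.continuous_integral hg hb).comp continuous_snd, fun _ e => ?_,
      fun _ e => (h.hasFDerivAt_integral hg hb e).differentiableAt, fun i => ?_⟩
    · show |∫ x, F x e ∂μ| ≤ (∫ x, g x ∂μ) * b e
      rw [← integral_mul_const]
      exact (abs_integral_le_integral_abs).trans
        (integral_mono (h.integrable hg e).abs (hg.mul_const _) fun x => h.bound x e)
    · show PB n _ (fun _ => D i (fun e => ∫ x, F x e ∂μ))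
      rw [h.D_integral hg hb i]
      exact ih (h.deriv i)

end Integral

/-! ## Pairs -/

section Pairs
variable {X : Type} [TopologicalSpace X] {n : ℕ} {ε : ℝ} {B B' F F' G G' : X → EE d → ℝ}

/-- Two functions with bounds, together with a bound on the difference. -/
structure PD (n : ℕ) (ε : ℝ) (B F F' : X → EE d → ℝ) : Prop where
  l : PB n B F
  r : PB n B F'
  s : PB n (fun x e => ε * B x e) (fun x e => F x e - F' x e)

lemma D_sub {f g : EE d → ℝ} (hf : Differentiable ℝ f) (hg : Differentiable ℝ g) (i : Ix d) :
    D i (fun e => f e - g e) = fun e => D i f e - D i g e := by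
  funext e
  simp only [D]
  rw [fderiv_fun_sub (hf e) (hg e)]; rfl

lemma D_add {f g : EE d → ℝ} (hf : Differentiable ℝ f) (hg : Differentiable ℝ g) (i : Ix d) :
    D i (fun e => f e + g e) = fun e => D i f e + D i g e := by
  funext e
  simp only [D]
  rw [fderiv_fun_add (hf e) (hg e)]; rfl

lemma PD.mono (hε : 0 ≤ ε) (h : PD n ε B F F') (hB : ∀ x e, B x e ≤ B' x e) : PD n ε B' F F' :=
  ⟨h.l.mono hB, h.r.mono hB, h.s.mono fun x e => mul_le_mul_of_nonneg_left (hB x e) hε⟩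

lemma PD.le {m : ℕ} (h : PD n ε B F F') (hm : m ≤ n) : PD m ε B F F' :=
  ⟨h.l.le hm, h.r.le hm, h.s.le hm⟩

lemma PD.comap {Y : Type} [TopologicalSpace Y] (h : PD n ε B F F') {g : Y → X} (hg : Continuous g) :
    PD n ε (fun y => B (g y)) (fun y => F (g y)) (fun y => F' (g y)) :=
  ⟨h.l.comap hg, h.r.comap hg, h.s.comap hg⟩

lemma PD.deriv (h : PD (n + 1) ε B F F') (i : Ix d) :
    PD n ε B (fun x => D i (F x)) (fun x => D i (F' x)) := by
  refine ⟨h.l.deriv i, h.r.deriv i, ?_⟩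
  have := h.s.deriv i
  simp only [D_sub (h.l.diff _) (h.r.diff _)] at this
  exact this

lemma PD.add (h : PD n ε B F F') (h' : PD n ε B' G G') :
    PD n ε (fun x e => B x e + B' x e) (fun x e => F x e + G x e) (fun x e => F' x e + G' x e) := by
  refine ⟨h.l.add h'.l, h.r.add h'.r, ?_⟩
  convert h.s.add h'.s using 3 <;> ring

lemma PD.of_same (hε : 0 ≤ ε) (h : PB n B F) : PD n ε B F F :=
  ⟨h, h, by simpa using PB.of_zero fun x e => mul_nonneg hε (h.nonneg x e)⟩

lemma PD.of_param (hε : 0 ≤ ε) {τ : X → ℝ} (hτ : Continuous τ) :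
    PD (d := d) n ε (fun x _ => |τ x|) (fun x _ => τ x) (fun x _ => τ x) :=
  PD.of_same hε (PB.of_param hτ)

lemma PD.param_mul {τ : X → ℝ} (hτ : Continuous τ) (h : PD n ε B F F') :
    PD n ε (fun x e => |τ x| * B x e) (fun x e => τ x * F x e) (fun x e => τ x * F' x e) := by
  refine ⟨h.l.param_mul hτ, h.r.param_mul hτ, ?_⟩
  convert h.s.param_mul hτ using 3 <;> ring

lemma PD.const_mul (c : ℝ) (h : PD n ε B F F') :
    PD n ε (fun x e => |c| * B x e) (fun x e => c * F x e) (fun x e => c * F' x e) :=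
  h.param_mul continuous_const

lemma PD.neg (h : PD n ε B F F') : PD n ε B (fun x e => - F x e) (fun x e => - F' x e) := by
  simpa using h.const_mul (-1)

lemma PD.mul (hε : 0 ≤ ε) (h : PD n ε B F F') (h' : PD n ε B' G G') :
    PD n ε (fun x e => 2 ^ (n + 1) * (B x e * B' x e)) (fun x e => F x e * G x e)
      (fun x e => F' x e * G' x e) := by
  have hle : ∀ x e, 2 ^ n * (B x e * B' x e) ≤ 2 ^ (n + 1) * (B x e * B' x e) := fun x e => by
    have := mul_nonneg (h.l.nonneg x e) (h'.l.nonneg x e)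
    have h2 : (2:ℝ) ^ n ≤ 2 ^ (n + 1) := pow_le_pow_right₀ (by norm_num) (Nat.le_succ n)
    exact mul_le_mul_of_nonneg_right h2 this
  refine ⟨(h.l.mul h'.l).mono hle, (h.r.mul h'.r).mono hle, ?_⟩
  convert (h.s.mul h'.l).add (h.r.mul h'.s) using 3 <;> ring

lemma PD.sum {κ : Type*} (s : Finset κ) {B F F' : κ → X → EE d → ℝ}
    (h : ∀ k ∈ s, PD n ε (B k) (F k) (F' k)) :
    PD n ε (fun x e => ∑ k ∈ s, B k x e) (fun x e => ∑ k ∈ s, F k x e) (fun x e => ∑ k ∈ s, F' k x e) := by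
  refine ⟨PB.sum s fun k hk => (h k hk).l, PB.sum s fun k hk => (h k hk).r, ?_⟩
  convert PB.sum s fun k hk => (h k hk).s using 3
  · rw [Finset.mul_sum]
  · rw [Finset.sum_sub_distrib]

lemma PD.compΦ (T : Aff X d) (h : PD n ε B F F') :
    PD n ε (fun x e => compC d n * T.wt x e ^ n * B x (T.Φ x e)) (fun x e => F x (T.Φ x e))
      (fun x e => F' x (T.Φ x e)) := by
  refine ⟨h.l.compΦ T, h.r.compΦ T, ?_⟩
  convert h.s.compΦ T using 3
  ring

/-- Pairs without parameter. -/
def CD (n : ℕ) (ε : ℝ) (B f f' : EE d → ℝ) : Prop :=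
  PD (X := Unit) n ε (fun _ => B) (fun _ => f) (fun _ => f')

lemma CD.of_unit {B f f' : EE d → ℝ} (h : CD n ε B f f') :
    PD (X := X) n ε (fun _ => B) (fun _ => f) (fun _ => f') :=
  PD.comap (g := fun _ : X => ()) h continuous_const

lemma PD.integral [SecondCountableTopology X] [MeasurableSpace X]
    [OpensMeasurableSpace X] {μ : Measure X} {g : X → ℝ} {b : EE d → ℝ}
    (h : PD n ε (fun x e => g x * b e) F F') (hg : Integrable g μ)
    (hb : Continuous b) :
    CD n ε (fun e => (∫ x, g x ∂μ) * b e) (fun e => ∫ x, F x e ∂μ) (fun e => ∫ x, F' x e ∂μ) := by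
  refine ⟨h.l.integral hg hb, h.r.integral hg hb, ?_⟩
  have h1 : PB n (fun x e => g x * (ε * b e)) (fun x e => F x e - F' x e) := by
    convert h.s using 3; ring
  have := h1.integral hg (continuous_const.mul hb)
  simp only [integral_sub (h.l.integrable hg _) (h.r.integrable hg _)] at this
  unfold CB at this
  convert this using 3
  ring

end Pairs

end

section

set_option linter.unusedSectionVars false
set_option linter.unusedVariables false

/-! ## The averaging operator -/

/-- Clamp to the unit interval. -/
noncomputable def cl (θ : ℝ) : ℝ := max 0 (min 1 θ)

lemma cl_nonneg (θ : ℝ) : 0 ≤ cl θ := le_max_left _ _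
lemma cl_le_one (θ : ℝ) : cl θ ≤ 1 := max_le zero_le_one (min_le_left _ _)
lemma cl_abs (θ : ℝ) : |cl θ| ≤ 1 := by rw [abs_of_nonneg (cl_nonneg θ)]; exact cl_le_one θ
lemma cl_cont : Continuous cl := by unfold cl; fun_prop
lemma cl_eq {θ : ℝ} (h : θ ∈ Set.Icc (0:ℝ) 1) : cl θ = θ := by
  unfold cl; rw [min_eq_right h.2, max_eq_right h.1]

/-- The scaling of the zeroth variable. -/
noncomputable def avT (d : ℕ) : Aff ℝ d where
  α := fun _ => 0
  P := fun _ _ => 0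
  q := fun _ _ => 0
  P' := fun θ i => if i = 0 then cl θ else 1
  q' := fun _ _ => 0
  cα := continuous_const
  cP := continuous_const
  cq := continuous_const
  cP' := continuous_pi fun i => by split_ifs; exacts [cl_cont, continuous_const]
  cq' := continuous_const
  bα := fun _ => by simp
  bP := fun _ _ => by simp
  bP' := fun θ i => by split_ifs; exacts [cl_abs θ, by simp]

lemma avT_wt (θ : ℝ) (e : EE d) : (avT d).wt θ e = 1 := by
  simp [Aff.wt, Aff.Y, avT]

lemma avT_Φ (θ : ℝ) (e : EE d) : (avT d).Φ θ e = (e.1, fun i => if i = 0 then cl θ * e.2 0 else e.2 i) := by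
  ext i
  · simp [Aff.Φ, Aff.Y, avT]
  · simp only [Aff.Φ, avT, add_zero]
    by_cases h : i = 0
    · subst h; simp
    · simp [h]

/-- The averaging operator. -/
noncomputable def Av (j : ℕ) (F : EE d → ℝ) (e : EE d) : ℝ :=
  ∫ θ in Set.Ioc (0:ℝ) 1, cl θ ^ j * F ((avT d).Φ θ e)

/-- Restriction to `u = 0`. -/
def ev (e : EE d) : EE d := (e.1, fun i => if i = 0 then 0 else e.2 i)

/-- The difference quotient operator. -/
noncomputable def Iop (F : EE d → ℝ) : EE d → ℝ := Av 0 (D (Sum.inr 0) F)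

lemma av_integrand {n : ℕ} {ε : ℝ} (hε : 0 ≤ ε) {b f f' : EE d → ℝ} (h : CD n ε b f f')
    (hb : ∀ θ e, b ((avT d).Φ θ e) ≤ b e) (j : ℕ) :
    PD n ε (fun _ e => compC d n * b e) (fun θ e => cl θ ^ j * f ((avT d).Φ θ e))
      (fun θ e => cl θ ^ j * f' ((avT d).Φ θ e)) := by
  have h1 := ((CD.of_unit (X := ℝ) h).compΦ (avT d)).param_mul (cl_cont.pow j)
  refine h1.mono hε fun θ e => ?_
  have h2 : |cl θ ^ j| ≤ 1 := by rw [abs_pow]; exact pow_le_one₀ (abs_nonneg _) (cl_abs θ)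
  have h3 : 0 ≤ b ((avT d).Φ θ e) := h.l.nonneg () _
  rw [avT_wt, one_pow, mul_one]
  have h4 := one_le_compC d n
  have h5 : compC d n * b ((avT d).Φ θ e) ≤ compC d n * b e :=
    mul_le_mul_of_nonneg_left (hb θ e) (by linarith)
  have h6 : 0 ≤ compC d n * b ((avT d).Φ θ e) := mul_nonneg (by linarith) h3
  calc _ ≤ 1 * (compC d n * b ((avT d).Φ θ e)) := mul_le_mul_of_nonneg_right h2 h6
    _ ≤ _ := by linarith

lemma Av_CD {n : ℕ} {ε : ℝ} (hε : 0 ≤ ε) {b f f' : EE d → ℝ} (h : CD n ε b f f') (hbc : Continuous b)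
    (hb : ∀ θ e, b ((avT d).Φ θ e) ≤ b e) (j : ℕ) :
    CD n ε (fun e => compC d n * b e) (Av j f) (Av j f') := by
  have h1 := (av_integrand hε h hb j).integral (μ := volume.restrict (Set.Ioc (0:ℝ) 1))
    (g := fun _ => compC d n) (b := b) (integrable_const _) hbc
  simp only [integral_const, MeasurableSet.univ, measureReal_restrict_apply, Set.univ_inter, Real.volume_real_Ioc, smul_eq_mul] at h1
  norm_num at h1
  exact h1

lemma CB.toCD {n : ℕ} {ε : ℝ} (hε : 0 ≤ ε) {b f : EE d → ℝ} (h : CB n b f) : CD n ε b f f := PD.of_same hε h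

lemma CB.diff {n : ℕ} {b f : EE d → ℝ} (h : CB (n + 1) b f) : Differentiable ℝ f := PB.diff h ()
lemma CB.cont {n : ℕ} {b f : EE d → ℝ} (h : CB n b f) : Continuous f := PB.cont_e h ()
lemma CB.deriv {n : ℕ} {b f : EE d → ℝ} (h : CB (n + 1) b f) (i : Ix d) : CB n b (D i f) := PB.deriv h i
lemma CB.bound {n : ℕ} {b f : EE d → ℝ} (h : CB n b f) (e : EE d) : |f e| ≤ b e := PB.bound h () e
lemma CD.deriv {n : ℕ} {ε : ℝ} {b f f' : EE d → ℝ} (h : CD (n + 1) ε b f f') (i : Ix d) :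
    CD n ε b (D i f) (D i f') := PD.deriv h i
lemma CD.cl {n : ℕ} {ε : ℝ} {b f f' : EE d → ℝ} (h : CD n ε b f f') : CB n b f := h.l
lemma CD.cr {n : ℕ} {ε : ℝ} {b f f' : EE d → ℝ} (h : CD n ε b f f') : CB n b f' := h.r

lemma D_Av {n : ℕ} {b f : EE d → ℝ} (h : CB (n + 1) b f) (hbc : Continuous b)
    (hb : ∀ θ e, b ((avT d).Φ θ e) ≤ b e) (j : ℕ) (i : Ix d) :
    D i (Av j f) = Av (if i = Sum.inr 0 then j + 1 else j) (D i f) := by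
  have h1 := PB.D_integral (μ := volume.restrict (Set.Ioc (0:ℝ) 1))
    (g := fun _ => compC d (n + 1)) (b := b) (av_integrand le_rfl (h.toCD le_rfl) hb j).l
    (integrable_const _) hbc i
  show D i (fun e => ∫ θ in Set.Ioc (0:ℝ) 1, cl θ ^ j * f ((avT d).Φ θ e)) = _
  rw [h1]
  funext e
  unfold Av
  congr 1
  funext θ
  have hdf : Differentiable ℝ f := h.diff
  have h2 : D i (fun e => cl θ ^ j * f ((avT d).Φ θ e)) e =
      cl θ ^ j * D i (fun e => f ((avT d).Φ θ e)) e := by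
    simp only [D]
    have := fderiv_const_mul ((hdf.comp ((avT d).diff_Φ θ)) e) (cl θ ^ j)
    simp only [Function.comp_def] at this
    rw [this]; rfl
  rw [h2]
  rcases i with i | i
  · rw [(avT d).D_comp_inl hdf]; simp
  · rw [(avT d).D_comp_inr hdf]
    by_cases hi : i = 0
    · subst hi
      simp [avT, pow_succ, mul_assoc]
    · simp [avT, hi]

lemma Av_ev (f : EE d → ℝ) (j : ℕ) (e : EE d) : Av j f (ev e) = (1 / ((j : ℝ) + 1)) * f (ev e) := by
  unfold Av
  have : ∀ θ, (avT d).Φ θ (ev e) = ev e := by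
    intro θ
    rw [avT_Φ]; ext i
    · rfl
    · simp [ev]
      intro h; simp [h]
  simp only [this]
  rw [integral_mul_const]
  congr 1
  rw [setIntegral_congr_fun (g := fun θ => θ ^ j) measurableSet_Ioc
    (fun θ hθ => by simp [cl_eq ⟨hθ.1.le, hθ.2⟩]), ← intervalIntegral.integral_of_le zero_le_one]
  simp

lemma taylor_one {b f : EE d → ℝ} (h : CB 1 b f) (e : EE d) :
    f e = f (ev e) + e.2 0 * Iop f e := by
  set γ : ℝ → EE d := fun θ => (e.1, fun i => if i = 0 then θ * e.2 0 else e.2 i) with hγ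
  have hγd : ∀ θ, HasDerivAt γ (e.2 0 • dir (Sum.inr 0)) θ := by
    intro θ
    have : γ = fun θ => ev e + θ • (e.2 0 • dir (Sum.inr 0) : EE d) := by
      funext θ
      ext i
      · simp [hγ, ev, dir]
      · by_cases hi : i = 0
        · subst hi; simp [hγ, ev, dir]
        · simp [hγ, ev, dir, hi]
    rw [this]
    have := ((hasDerivAt_id θ).smul_const (e.2 0 • dir (Sum.inr 0) : EE d)).const_add (ev e)
    simpa using this
  have hd : ∀ θ ∈ Set.uIcc (0:ℝ) 1, HasDerivAt (fun θ => f (γ θ)) (e.2 0 * D (Sum.inr 0) f (γ θ)) θ := by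
    intro θ _
    have := (h.diff (γ θ)).hasFDerivAt.comp_hasDerivAt θ (hγd θ)
    simp only [map_smul, smul_eq_mul] at this
    exact this
  have hγc : Continuous γ := by rw [continuous_iff_continuousAt]; exact fun θ => (hγd θ).continuousAt
  have hc : Continuous (fun θ => e.2 0 * D (Sum.inr 0) f (γ θ)) :=
    continuous_const.mul ((h.deriv _).cont.comp hγc)
  have := intervalIntegral.integral_eq_sub_of_hasDerivAt hd (hc.intervalIntegrable 0 1)
  rw [intervalIntegral.integral_const_mul] at this
  have h1 : γ 1 = e := by
    ext i
    · rfl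
    · by_cases hi : i = 0
      · subst hi; simp [hγ]
      · simp [hγ, hi]
  have h0 : γ 0 = ev e := by simp [hγ, ev]
  rw [h1, h0] at this
  have h3 : Iop f e = ∫ θ in (0:ℝ)..1, D (Sum.inr 0) f (γ θ) := by
    unfold Iop Av
    rw [intervalIntegral.integral_of_le zero_le_one]
    refine setIntegral_congr_fun measurableSet_Ioc fun θ hθ => ?_
    simp only [pow_zero, one_mul, avT_Φ, cl_eq ⟨hθ.1.le, hθ.2⟩, hγ]
  rw [h3, this]; ring

lemma ev_ev (e : EE d) : ev (ev e) = ev e := by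
  ext i <;> simp [ev]
  intro h1 h2; exact absurd h1 h2

/-! ## Weights -/

/-- Square of the norm of the spatial part. -/
def gs (y : Pt d) : ℝ := ∑ i : Fin d, y i.succ ^ 2

/-- Standard weight. -/
noncomputable def wb (N : ℕ) (β : ℝ) (e : EE d) : ℝ := (1 + |e.2 0|) ^ N * Real.exp (-(β * gs e.2))

lemma gs_nonneg (y : Pt d) : 0 ≤ gs y := Finset.sum_nonneg fun i _ => sq_nonneg _
lemma gs_cont : Continuous (gs : Pt d → ℝ) := by unfold gs; fun_prop
lemma wb_cont (N : ℕ) (β : ℝ) : Continuous (wb N β : EE d → ℝ) := by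
  unfold wb
  have := gs_cont (d := d)
  fun_prop
lemma wb_nonneg (N : ℕ) (β : ℝ) (e : EE d) : 0 ≤ wb N β e := by unfold wb; positivity
lemma wb_le {N N' : ℕ} {β β' : ℝ} (hN : N ≤ N') (hβ : β' ≤ β) (e : EE d) : wb N β e ≤ wb N' β' e := by
  unfold wb
  have h1 : (1:ℝ) ≤ 1 + |e.2 0| := by linarith [abs_nonneg (e.2 0)]
  have := gs_nonneg e.2
  exact mul_le_mul (pow_le_pow_right₀ h1 hN) (Real.exp_le_exp.2 (by nlinarith)) (Real.exp_nonneg _) (by positivity)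
lemma wb_av (N : ℕ) (β : ℝ) (θ : ℝ) (e : EE d) : wb N β ((avT d).Φ θ e) ≤ wb N β e := by
  rw [avT_Φ]
  unfold wb
  have : gs (fun i => if i = 0 then cl θ * e.2 0 else e.2 i) = gs e.2 := by
    unfold gs
    simp [Fin.succ_ne_zero]
  simp only [this, if_true]
  refine mul_le_mul_of_nonneg_right ?_ (Real.exp_nonneg _)
  refine pow_le_pow_left₀ (by positivity) ?_ N
  rw [abs_mul]
  have := cl_abs θ
  nlinarith [abs_nonneg (e.2 0), abs_nonneg (cl θ)]

/-- Bounded by a multiple of the standard weight. -/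
def WD (n : ℕ) (ε : ℝ) (C : ℝ) (N : ℕ) (β : ℝ) (f f' : EE d → ℝ) : Prop :=
  CD n ε (fun e => C * wb N β e) f f'

lemma CD.mono {n : ℕ} {ε : ℝ} {b b' f f' : EE d → ℝ} (h : CD n ε b f f') (hε : 0 ≤ ε)
    (hb : ∀ e, b e ≤ b' e) : CD n ε b' f f' := PD.mono hε h fun _ e => hb e

lemma CD.wd {n : ℕ} {ε : ℝ} (hε : 0 ≤ ε) {b f f' : EE d → ℝ} {C : ℝ} {N : ℕ} {β : ℝ} (h : CD n ε b f f')
    (hb : ∀ e, b e ≤ C * wb N β e) : WD n ε C N β f f' := h.mono hε hb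

lemma WD.weaken {n : ℕ} {ε : ℝ} (hε : 0 ≤ ε) {f f' : EE d → ℝ} {C C' : ℝ} {N N' : ℕ} {β β' : ℝ}
    (h : WD n ε C N β f f') (hC' : 0 ≤ C') (hC : C ≤ C') (hN : N ≤ N') (hβ : β' ≤ β) : WD n ε C' N' β' f f' :=
  CD.mono h hε fun e => mul_le_mul hC (wb_le hN hβ e) (wb_nonneg _ _ _) hC'

lemma WD.Av {n : ℕ} {ε : ℝ} (hε : 0 ≤ ε) {f f' : EE d → ℝ} {C : ℝ} {N : ℕ} {β : ℝ} (hC : 0 ≤ C)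
    (h : WD n ε C N β f f') (j : ℕ) : WD n ε (compC d n * C) N β (Av j f) (Av j f') := by
  have := Av_CD hε h (continuous_const.mul (wb_cont N β))
    (fun θ e => mul_le_mul_of_nonneg_left (wb_av N β θ e) hC) j
  simpa [WD, mul_assoc] using this

lemma WD.Iop {n : ℕ} {ε : ℝ} (hε : 0 ≤ ε) {f f' : EE d → ℝ} {C : ℝ} {N : ℕ} {β : ℝ} (hC : 0 ≤ C)
    (h : WD (n + 1) ε C N β f f') : WD n ε (compC d n * C) N β (Iop f) (Iop f') :=
  WD.Av hε hC (CD.deriv h _) 0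

lemma WD.add {n : ℕ} {ε : ℝ} {f f' g g' : EE d → ℝ} {C C' : ℝ} {N : ℕ} {β : ℝ}
    (h : WD n ε C N β f f') (h' : WD n ε C' N β g g') :
    WD n ε (C + C') N β (fun e => f e + g e) (fun e => f' e + g' e) := by
  have := PD.add h h'
  simpa [WD, CD, add_mul] using this

lemma WD.neg {n : ℕ} {ε : ℝ} {f f' : EE d → ℝ} {C : ℝ} {N : ℕ} {β : ℝ}
    (h : WD n ε C N β f f') : WD n ε C N β (fun e => - f e) (fun e => - f' e) := PD.neg h

lemma WD.sum {κ : Type*} (s : Finset κ) {n : ℕ} {ε : ℝ} {f f' : κ → EE d → ℝ} {C : κ → ℝ} {N : ℕ} {β : ℝ}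
    (h : ∀ k ∈ s, WD n ε (C k) N β (f k) (f' k)) :
    WD n ε (∑ k ∈ s, C k) N β (fun e => ∑ k ∈ s, f k e) (fun e => ∑ k ∈ s, f' k e) := by
  have := PD.sum s h
  simpa [WD, CD, Finset.sum_mul] using this

lemma wb_mul (N N' : ℕ) (β β' : ℝ) (e : EE d) : wb N β e * wb N' β' e = wb (N + N') (β + β') e := by
  unfold wb
  rw [show -((β + β') * gs e.2) = -(β * gs e.2) + -(β' * gs e.2) by ring, Real.exp_add]; ring

lemma WD.mul {n : ℕ} {ε : ℝ} (hε : 0 ≤ ε) {f f' g g' : EE d → ℝ} {C C' : ℝ} {N N' : ℕ} {β β' : ℝ}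
    (h : WD n ε C N β f f') (h' : WD n ε C' N' β' g g') :
    WD n ε (2 ^ (n + 1) * (C * C')) (N + N') (β + β') (fun e => f e * g e) (fun e => f' e * g' e) := by
  have := PD.mul hε h h'
  unfold WD CD
  convert this using 3
  rw [← wb_mul]; ring

lemma WD.deriv {n : ℕ} {ε : ℝ} {f f' : EE d → ℝ} {C : ℝ} {N : ℕ} {β : ℝ}
    (h : WD (n + 1) ε C N β f f') (i : Ix d) : WD n ε C N β (D i f) (D i f') := CD.deriv h i

lemma WD.const_mul {n : ℕ} {ε : ℝ} {f f' : EE d → ℝ} {C : ℝ} {N : ℕ} {β : ℝ} (c : ℝ)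
    (h : WD n ε C N β f f') : WD n ε (|c| * C) N β (fun e => c * f e) (fun e => c * f' e) := by
  have := PD.const_mul c h
  simpa [WD, CD, mul_assoc] using this

lemma WD.le {n m : ℕ} {ε : ℝ} {f f' : EE d → ℝ} {C : ℝ} {N : ℕ} {β : ℝ}
    (h : WD n ε C N β f f') (hm : m ≤ n) : WD m ε C N β f f' := PD.le h hm

lemma WD.cl {n : ℕ} {ε : ℝ} {f f' : EE d → ℝ} {C : ℝ} {N : ℕ} {β : ℝ}
    (h : WD n ε C N β f f') : CB n (fun e => C * wb N β e) f := h.l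

/-- Iterates of the difference quotient operator. -/
lemma WD.Iop_iter {n : ℕ} {ε : ℝ} (hε : 0 ≤ ε) {C : ℝ} {N : ℕ} {β : ℝ} (m : ℕ) (hC : 0 ≤ C) :
    ∃ C' : ℝ, 0 ≤ C' ∧ ∀ f f' : EE d → ℝ, WD (n + m) ε C N β f f' →
      WD n ε C' N β (VarBPHZ.Iop^[m] f) (VarBPHZ.Iop^[m] f') := by
  induction m generalizing C with
  | zero => exact ⟨C, hC, fun f f' h => h⟩
  | succ m ih =>
    obtain ⟨C', hC', h'⟩ := ih (C := compC d (n + m) * C)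
      (mul_nonneg (by linarith [one_le_compC d (n + m)]) hC)
    exact ⟨C', hC', fun f f' h => h' _ _ (WD.Iop hε hC h)⟩

lemma taylor {n : ℕ} {f : EE d → ℝ} {C : ℝ} {N : ℕ} {β : ℝ} (hC : 0 ≤ C)
    (h : CB n (fun e => C * wb N β e) f) (e : EE d) :
    f e = ∑ m ∈ Finset.range n, e.2 0 ^ m * (Iop^[m] f) (ev e) + e.2 0 ^ n * (Iop^[n] f) e := by
  induction n generalizing C f with
  | zero => simp
  | succ n ih =>
    have h1 : CB n (fun e => (compC d n * C) * wb N β e) (Iop f) := (WD.Iop le_rfl hC (h.toCD le_rfl)).l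
    have h2 := ih (mul_nonneg (by linarith [one_le_compC d n]) hC) h1
    have h3 := taylor_one (PB.le h (by omega) : CB 1 _ f) e
    rw [Finset.sum_range_succ', h3, h2]
    simp only [Function.iterate_succ, Function.comp_apply, pow_zero, one_mul, Function.iterate_zero, id]
    rw [mul_add, Finset.mul_sum]
    simp only [pow_succ]
    rw [add_comm, Finset.sum_congr rfl fun m _ => by
      rw [show e.2 0 * (e.2 0 ^ m * Iop^[m] (Iop f) (ev e)) = e.2 0 ^ m * e.2 0 * Iop^[m] (Iop f) (ev e) by ring]]
    ring

end

section

set_option linter.unusedSectionVars false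
set_option linter.unusedVariables false

/-! ## Multi-index derivatives -/

lemma foldr_congr_k {α : Type*} {β : Type*} (op : α → β → β) (l : List α) (k k' : α → ℕ) (f : β)
    (h : ∀ a ∈ l, k a = k' a) :
    l.foldr (fun i g => (op i)^[k i] g) f = l.foldr (fun i g => (op i)^[k' i] g) f := by
  induction l with
  | nil => rfl
  | cons a l ih =>
    simp only [List.foldr_cons]
    rw [ih fun b hb => h b (by simp [hb]), h a (by simp)]

lemma foldr_head {β : Type*} (op : Fin (d + 1) → β → β) (l : List (Fin (d + 1))) (hl : l.Pairwise (· < ·))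
    (k : Fin (d + 1) → ℕ) (j : Fin (d + 1)) (hj : j ∈ l) (hk : ∀ a ∈ l, a < j → k a = 0) (f : β) :
    l.foldr (fun i g => (op i)^[(k + Pi.single j 1 : Fin (d + 1) → ℕ) i] g) f =
      op j (l.foldr (fun i g => (op i)^[k i] g) f) := by
  induction l with
  | nil => simp at hj
  | cons a l ih =>
    simp only [List.foldr_cons]
    rw [List.pairwise_cons] at hl
    rcases List.mem_cons.1 hj with rfl | hj'
    · rw [foldr_congr_k op l (k + Pi.single j 1) k f fun b hb => by
        have := (hl.1 b hb).ne'
        simp [this]]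
      simp only [Pi.add_apply, Pi.single_eq_same]
      rw [Function.iterate_succ_apply']
    · have hlt := hl.1 j hj'
      have h0 := hk a (by simp) hlt
      rw [ih hl.2 hj' fun b hb => hk b (by simp [hb])]
      simp [h0, hlt.ne]

lemma finRange_pairwise : (List.finRange (d + 1)).Pairwise (· < ·) := List.pairwise_lt_finRange _

lemma mderiv_head (k : Fin (d + 1) → ℕ) (j : Fin (d + 1)) (hk : ∀ a, a < j → k a = 0) (f : Pt d → ℝ) :
    mderiv (k + Pi.single j 1) f = pd j (mderiv k f) :=
  foldr_head pd _ finRange_pairwise k j (List.mem_finRange j) (fun a _ => hk a) f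

lemma mderiv_zero (f : Pt d → ℝ) : mderiv 0 f = f := by
  unfold mderiv
  have : ∀ l : List (Fin (d + 1)), l.foldr (fun i g => (pd i)^[(0 : Fin (d + 1) → ℕ) i] g) f = f := by
    intro l
    induction l with
    | nil => rfl
    | cons a l ih => simpa using ih
  exact this _

lemma pdeg_add_single (k : Fin (d + 1) → ℕ) (i : Fin (d + 1)) :
    pdeg k + 1 ≤ pdeg (k + Pi.single i 1) ∧ pdeg (k + Pi.single i 1) ≤ pdeg k + 2 := by
  unfold pdeg
  simp only [Pi.add_apply, Finset.sum_add_distrib, Finset.sum_pi_single', Finset.mem_univ, if_true]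
  by_cases h : i = 0
  · subst h; simp; omega
  · simp [Pi.single_apply, Ne.symm h]; omega

lemma sum_add_single (k : Fin (d + 1) → ℕ) (i : Fin (d + 1)) :
    ∑ a, (k + Pi.single i 1 : Fin (d + 1) → ℕ) a = ∑ a, k a + 1 := by
  simp [Finset.sum_add_distrib]

lemma sum_le_pdeg (k : Fin (d + 1) → ℕ) : ∑ a, k a ≤ pdeg k := by unfold pdeg; omega

lemma exists_min_index {k : Fin (d + 1) → ℕ} (hk : k ≠ 0) :
    ∃ (j : Fin (d + 1)) (k' : Fin (d + 1) → ℕ), k = k' + Pi.single j 1 ∧ ∀ a, a < j → k' a = 0 := by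
  obtain ⟨j0, hj0⟩ := Function.ne_iff.1 hk
  obtain ⟨j, hj, hmin⟩ := WellFounded.has_min (wellFounded_lt : WellFounded ((· < ·) : Fin (d + 1) → _ → Prop))
    {j | k j ≠ 0} ⟨j0, hj0⟩
  refine ⟨j, k - Pi.single j 1, ?_, fun a ha => ?_⟩
  · funext b
    by_cases hb : b = j
    · subst hb
      have : k b ≠ 0 := hj
      simp; omega
    · simp [hb]
  · have : k a = 0 := by
      by_contra h
      exact hmin a h ha
    simp [this]

/-- Induction principle for multi-indices. -/
lemma midx_induction {P : (Fin (d + 1) → ℕ) → Prop} (h0 : P 0)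
    (hs : ∀ (k : Fin (d + 1) → ℕ) (j : Fin (d + 1)), (∀ a, a < j → k a = 0) →
      (∀ k' : Fin (d + 1) → ℕ, ∑ a, k' a ≤ ∑ a, k a → P k') → P (k + Pi.single j 1)) (k : Fin (d + 1) → ℕ) : P k := by
  have : ∀ n, ∀ k : Fin (d + 1) → ℕ, ∑ a, k a ≤ n → P k := by
    intro n
    induction n with
    | zero =>
      intro k hk
      have : k = 0 := by
        funext a
        have := Finset.single_le_sum (f := k) (fun _ _ => Nat.zero_le _) (Finset.mem_univ a)
        simp only [Pi.zero_apply]; omega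
      rw [this]; exact h0
    | succ n ih =>
      intro k hk
      by_cases hk0 : k = 0
      · rw [hk0]; exact h0
      · obtain ⟨j, k', rfl, hj⟩ := exists_min_index hk0
        rw [sum_add_single] at hk
        exact hs k' j hj fun k'' hk'' => ih k'' (by omega)
  exact this _ k le_rfl

lemma pt_clm_eq_sum (T : Pt d →L[ℝ] ℝ) : T = ∑ i, T (Pi.single i 1) • ContinuousLinearMap.proj (R := ℝ) (φ := fun _ : Fin (d+1) => ℝ) i := by
  refine ContinuousLinearMap.ext fun e => ?_
  conv_lhs => rw [pt_eq_sum e]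
  simp [map_sum, mul_comm]

lemma pd_comm {g : Pt d → ℝ} (hg : Differentiable ℝ g) (hp : ∀ a, Differentiable ℝ (pd a g)) (i j : Fin (d + 1)) :
    pd i (pd j g) = pd j (pd i g) := by
  have hf : fderiv ℝ g = fun z => ∑ i, pd i g z • ContinuousLinearMap.proj (R := ℝ) (φ := fun _ : Fin (d+1) => ℝ) i := by
    funext z; exact pt_clm_eq_sum _
  have hdiff : Differentiable ℝ (fderiv ℝ g) := by
    rw [hf]; fun_prop
  funext z
  have hs := second_derivative_symmetric (fun y => (hg y).hasFDerivAt) (hdiff z).hasFDerivAt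
    (Pi.single i 1) (Pi.single j 1)
  have key : ∀ a b : Fin (d + 1), pd a (pd b g) z = fderiv ℝ (fderiv ℝ g) z (Pi.single a 1) (Pi.single b 1) := by
    intro a b
    unfold pd
    have h1 : HasFDerivAt (fun z => fderiv ℝ g z (Pi.single b 1))
        ((ContinuousLinearMap.apply ℝ ℝ (Pi.single b 1 : Pt d)).comp (fderiv ℝ (fderiv ℝ g) z)) z :=
      (ContinuousLinearMap.apply ℝ ℝ (Pi.single b 1 : Pt d)).hasFDerivAt.comp z (hdiff z).hasFDerivAt
    rw [h1.fderiv]; rfl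
  rw [key, key, hs]

lemma pd_mderiv {ρ : ℕ} {f : Pt d → ℝ} (hf : ∀ k : Fin (d + 1) → ℕ, pdeg k < ρ → Differentiable ℝ (mderiv k f))
    (k : Fin (d + 1) → ℕ) : pdeg k + 2 ≤ ρ → ∀ i, pd i (mderiv k f) = mderiv (k + Pi.single i 1) f := by
  induction k using midx_induction with
  | h0 => intro _ i; rw [mderiv_head 0 i (by simp)]
  | hs k j hj ih =>
    intro hk i
    have hk' := pdeg_add_single k j
    rw [mderiv_head k j hj]
    have ihk := ih k le_rfl (by omega)
    rcases le_or_gt i j with hij | hij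
    · rw [← mderiv_head k j hj, ← mderiv_head _ i]
      intro a ha
      have haj := lt_of_lt_of_le ha hij
      simp [hj a haj, haj.ne]
    · rw [pd_comm (hf k (by omega)) (fun a => by
        rw [ihk]; exact hf _ (by have := pdeg_add_single k a; omega)), ihk, ← mderiv_head]
      · congr 1; abel
      · intro a ha
        simp [hj a ha, (ha.trans hij).ne]

lemma pd_sub {f g : Pt d → ℝ} (hf : Differentiable ℝ f) (hg : Differentiable ℝ g) (i : Fin (d + 1)) :
    pd i (fun z => f z - g z) = fun z => pd i f z - pd i g z := by
  funext z
  simp only [pd]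
  rw [fderiv_fun_sub (hf z) (hg z)]; rfl

lemma mderiv_sub {ρ : ℕ} {f g : Pt d → ℝ}
    (hf : ∀ k : Fin (d + 1) → ℕ, pdeg k < ρ → Differentiable ℝ (mderiv k f))
    (hg : ∀ k : Fin (d + 1) → ℕ, pdeg k < ρ → Differentiable ℝ (mderiv k g))
    (k : Fin (d + 1) → ℕ) : pdeg k ≤ ρ → mderiv k (fun z => f z - g z) = fun z => mderiv k f z - mderiv k g z := by
  induction k using midx_induction with
  | h0 => intro _; simp only [mderiv_zero]
  | hs k j hj ih =>
    intro hk
    have hk' := pdeg_add_single k j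
    simp only [mderiv_head k j hj]
    rw [ih k le_rfl (by omega), pd_sub (hf k (by omega)) (hg k (by omega))]

lemma finite_pdeg (ρ : ℕ) : {k : Fin (d + 1) → ℕ | pdeg k ≤ ρ}.Finite := by
  refine (Set.finite_Iic (fun _ : Fin (d + 1) => ρ)).subset fun k hk a => ?_
  have := Finset.single_le_sum (f := k) (fun _ _ => Nat.zero_le _) (Finset.mem_univ a)
  have h2 : pdeg k ≤ ρ := hk
  have := sum_le_pdeg k
  show k a ≤ ρ
  omega

lemma MemCpar.exists_bound {ρ : ℕ} {f : Pt d → ℝ} (h : MemCpar ρ f) :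
    ∃ Q : ℝ, ∀ k : Fin (d + 1) → ℕ, pdeg k ≤ ρ → ∀ z, |mderiv k f z| ≤ Q := by
  choose! M hM using fun k hk => (h.2 k hk).2
  obtain ⟨Q, hQ⟩ := ((finite_pdeg (d := d) ρ).image M).bddAbove
  exact ⟨Q, fun k hk z => (hM k hk z).trans (hQ ⟨k, hk, rfl⟩)⟩

lemma MemCpar.le_cparNorm {ρ : ℕ} {f : Pt d → ℝ} (h : MemCpar ρ f) {k : Fin (d + 1) → ℕ} (hk : pdeg k ≤ ρ) (z) :
    |mderiv k f z| ≤ cparNorm ρ f := by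
  obtain ⟨Q, hQ⟩ := h.exists_bound
  refine le_csSup ⟨Q, ?_⟩ ⟨k, z, hk, rfl⟩
  rintro y ⟨k, z, hk, rfl⟩
  exact hQ k hk z

lemma cparNorm_nonneg (ρ : ℕ) (f : Pt d → ℝ) : 0 ≤ cparNorm ρ f := by
  refine Real.sSup_nonneg ?_
  rintro y ⟨k, z, hk, rfl⟩
  exact abs_nonneg _

lemma MemCpar.sub {ρ : ℕ} {f g : Pt d → ℝ} (hf : MemCpar ρ f) (hg : MemCpar ρ g) :
    MemCpar ρ (fun z => f z - g z) := by
  refine ⟨fun k hk => ?_, fun k hk => ?_⟩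
  · rw [mderiv_sub hf.1 hg.1 k hk.le]
    exact (hf.1 k hk).sub (hg.1 k hk)
  · rw [mderiv_sub hf.1 hg.1 k hk]
    refine ⟨(hf.2 k hk).1.sub (hg.2 k hk).1, ?_⟩
    obtain ⟨Q, hQ⟩ := (hf.2 k hk).2
    obtain ⟨Q', hQ'⟩ := (hg.2 k hk).2
    exact ⟨Q + Q', fun z => (abs_sub _ _).trans (add_le_add (hQ z) (hQ' z))⟩

/-- Functions of the first variable. -/
def lift (f : Pt d → ℝ) (e : EE d) : ℝ := f e.1

lemma D_lift_inl {f : Pt d → ℝ} (hf : Differentiable ℝ f) (i : Fin (d + 1)) :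
    D (Sum.inl i) (lift f) = lift (pd i f) := by
  funext e
  have : HasFDerivAt (lift f) ((fderiv ℝ f e.1).comp (ContinuousLinearMap.fst ℝ (Pt d) (Pt d))) e :=
    (hf e.1).hasFDerivAt.comp e hasFDerivAt_fst
  simp only [D, this.fderiv, lift, pd]
  rfl

lemma D_lift_inr {f : Pt d → ℝ} (hf : Differentiable ℝ f) (i : Fin (d + 1)) :
    D (Sum.inr i) (lift f) = fun _ => 0 := by
  funext e
  have : HasFDerivAt (lift f) ((fderiv ℝ f e.1).comp (ContinuousLinearMap.fst ℝ (Pt d) (Pt d))) e :=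
    (hf e.1).hasFDerivAt.comp e hasFDerivAt_fst
  simp only [D, this.fderiv]
  simp [dir]

lemma CB_lift {ρ : ℕ} {f : Pt d → ℝ} (h : MemCpar ρ f) {Q : ℝ}
    (hQ : ∀ k : Fin (d + 1) → ℕ, pdeg k ≤ ρ → ∀ z, |mderiv k f z| ≤ Q) (n : ℕ) (k : Fin (d + 1) → ℕ) :
    pdeg k + 2 * n ≤ ρ → CB n (fun _ => Q) (lift (mderiv k f)) := by
  induction n generalizing k with
  | zero =>
    intro hk
    exact ⟨(h.2 k hk).1.comp (by fun_prop), fun _ e => hQ k hk _⟩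
  | succ n ih =>
    intro hk
    have hd := h.1 k (by omega)
    refine ⟨(h.2 k (by omega)).1.comp (by fun_prop), fun _ e => hQ k (by omega) _, fun _ => hd.comp differentiable_fst, fun i => ?_⟩
    rcases i with i | i
    · show CB n _ (D _ (lift (mderiv k f)))
      rw [D_lift_inl hd, pd_mderiv h.1 k (by omega)]
      exact ih _ (by have := pdeg_add_single k i; omega)
    · show CB n _ (D _ (lift (mderiv k f)))
      rw [D_lift_inr hd]
      exact PB.of_zero fun _ _ => (abs_nonneg _).trans (hQ k (by omega) 0)

lemma CD_lift {ρ : ℕ} {f f' : Pt d → ℝ} (h : MemCpar ρ f) (h' : MemCpar ρ f') {Q ε : ℝ} (hε : 0 ≤ ε) (hQ1 : 1 ≤ Q)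
    (hQ : ∀ k : Fin (d + 1) → ℕ, pdeg k ≤ ρ → ∀ z, |mderiv k f z| ≤ Q)
    (hQ' : ∀ k : Fin (d + 1) → ℕ, pdeg k ≤ ρ → ∀ z, |mderiv k f' z| ≤ Q)
    (hs : ∀ k : Fin (d + 1) → ℕ, pdeg k ≤ ρ → ∀ z, |mderiv k (fun z => f z - f' z) z| ≤ ε)
    {n : ℕ} (hn : 2 * n ≤ ρ) : CD n ε (fun _ => Q) (lift f) (lift f') := by
  have h0 : pdeg (0 : Fin (d + 1) → ℕ) = 0 := by simp [pdeg]
  have e1 := CB_lift h hQ n 0 (by rw [h0]; omega)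
  have e2 := CB_lift h' hQ' n 0 (by rw [h0]; omega)
  have e3 := CB_lift (h.sub h') hs n 0 (by rw [h0]; omega)
  rw [mderiv_zero] at e1 e2 e3
  exact ⟨e1, e2, PB.mono e3 fun _ _ => by nlinarith⟩

/-! ## Iterated derivatives of functions with bounds -/

/-- Iterated partial derivative in the directions selected by `s`. -/
noncomputable def Dk (s : Fin (d + 1) → Ix d) (k : Fin (d + 1) → ℕ) (f : EE d → ℝ) : EE d → ℝ :=
  (List.finRange (d + 1)).foldr (fun i g => (D (s i))^[k i] g) f

lemma Dk_zero (s : Fin (d + 1) → Ix d) (f : EE d → ℝ) : Dk s 0 f = f := by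
  unfold Dk
  have : ∀ l : List (Fin (d + 1)), l.foldr (fun i g => (D (s i))^[(0 : Fin (d + 1) → ℕ) i] g) f = f := by
    intro l
    induction l with
    | nil => rfl
    | cons a l ih => simpa using ih
  exact this _

lemma Dk_head (s : Fin (d + 1) → Ix d) (k : Fin (d + 1) → ℕ) (j : Fin (d + 1)) (hk : ∀ a, a < j → k a = 0)
    (f : EE d → ℝ) : Dk s (k + Pi.single j 1) f = D (s j) (Dk s k f) :=
  foldr_head (fun i => D (s i)) _ finRange_pairwise k j (List.mem_finRange j) (fun a _ => hk a) f

lemma CB_Dk {b f : EE d → ℝ} (s : Fin (d + 1) → Ix d) (k : Fin (d + 1) → ℕ) :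
    ∀ n : ℕ, CB (n + ∑ a, k a) b f → CB n b (Dk s k f) := by
  induction k using midx_induction with
  | h0 => intro n h; rw [Dk_zero]; simpa using h
  | hs k j hj ih =>
    intro n h
    rw [Dk_head s k j hj]
    refine CB.deriv (ih k le_rfl (n + 1) ?_) _
    rw [sum_add_single] at h
    rwa [show n + 1 + ∑ a, k a = n + (∑ a, k a + 1) by ring]

lemma Dk_sub {b b' f g : EE d → ℝ} (s : Fin (d + 1) → Ix d) (k : Fin (d + 1) → ℕ) :
    CB (∑ a, k a) b f → CB (∑ a, k a) b' g →
    Dk s k (fun e => f e - g e) = fun e => Dk s k f e - Dk s k g e := by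
  induction k using midx_induction with
  | h0 => intro _ _; simp only [Dk_zero]
  | hs k j hj ih =>
    intro hf hg
    simp only [Dk_head s k j hj]
    rw [sum_add_single] at hf hg
    rw [ih k le_rfl (PB.pred hf) (PB.pred hg), D_sub]
    · exact (CB_Dk s k 1 (by rwa [add_comm])).diff
    · exact (CB_Dk s k 1 (by rwa [add_comm])).diff

lemma pd_slice_inr {f : EE d → ℝ} (hf : Differentiable ℝ f) (w : Pt d) (i : Fin (d + 1)) :
    pd i (fun y => f (w, y)) = fun y => D (Sum.inr i) f (w, y) := by
  funext y
  have h1 : HasFDerivAt (fun y : Pt d => ((w, y) : EE d)) (ContinuousLinearMap.inr ℝ (Pt d) (Pt d)) y :=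
    hasFDerivAt_prodMk_right w y
  have := (hf (w, y)).hasFDerivAt.comp y h1
  simp only [pd, D]
  rw [show (fun y => f (w, y)) = f ∘ fun y => (w, y) from rfl, this.fderiv]
  simp [dir]

lemma pd_slice_inl {f : EE d → ℝ} (hf : Differentiable ℝ f) (y : Pt d) (i : Fin (d + 1)) :
    pd i (fun w => f (w, y)) = fun w => D (Sum.inl i) f (w, y) := by
  funext w
  have h1 : HasFDerivAt (fun w : Pt d => ((w, y) : EE d)) (ContinuousLinearMap.inl ℝ (Pt d) (Pt d)) w :=
    hasFDerivAt_prodMk_left w y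
  have := (hf (w, y)).hasFDerivAt.comp w h1
  simp only [pd, D]
  rw [show (fun w => f (w, y)) = f ∘ fun w => (w, y) from rfl, this.fderiv]
  simp [dir]

lemma mderiv_slice_inr {b f : EE d → ℝ} (w : Pt d) (k : Fin (d + 1) → ℕ) :
    CB (∑ a, k a) b f → mderiv k (fun y => f (w, y)) = fun y => Dk Sum.inr k f (w, y) := by
  induction k using midx_induction with
  | h0 => intro _; simp only [Dk_zero, mderiv_zero]
  | hs k j hj ih =>
    intro hf
    rw [sum_add_single] at hf
    rw [mderiv_head k j hj, Dk_head _ k j hj, ih k le_rfl (PB.pred hf), pd_slice_inr]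
    exact (CB_Dk _ k 1 (by rwa [add_comm])).diff

lemma mderiv_slice_inl {b f : EE d → ℝ} (y : Pt d) (k : Fin (d + 1) → ℕ) :
    CB (∑ a, k a) b f → mderiv k (fun w => f (w, y)) = fun w => Dk Sum.inl k f (w, y) := by
  induction k using midx_induction with
  | h0 => intro _; simp only [Dk_zero, mderiv_zero]
  | hs k j hj ih =>
    intro hf
    rw [sum_add_single] at hf
    rw [mderiv_head k j hj, Dk_head _ k j hj, ih k le_rfl (PB.pred hf), pd_slice_inl]
    exact (CB_Dk _ k 1 (by rwa [add_comm])).diff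

lemma mderiv2_eq {b f : EE d → ℝ} (j m : Fin (d + 1) → ℕ) (h : CB (∑ a, j a + ∑ a, m a) b f) (z zb : Pt d) :
    mderiv2 j m (fun z zb => f (z, zb)) z zb = Dk Sum.inl j (Dk Sum.inr m f) (z, zb) := by
  unfold mderiv2
  have h1 : (fun z' => mderiv m (fun y => f (z', y)) zb) = fun z' => Dk Sum.inr m f (z', zb) := by
    funext z'
    rw [mderiv_slice_inr z' m (PB.le h (by omega))]
  rw [h1, mderiv_slice_inl zb j (CB_Dk _ m _ h)]

lemma MemCloc.of_CB {r : ℕ} {b f : EE d → ℝ} (h : CB r b f)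
    (hb : ∀ T : ℝ, 0 < T → ∃ Q, ∀ e : EE d, |e.1 0 - e.2 0| ≤ T → b e ≤ Q) :
    MemCloc r (fun z zb => f (z, zb)) := by
  have key : ∀ j m : Fin (d + 1) → ℕ, pdeg j + pdeg m ≤ r → ∀ n, n + (∑ a, j a + ∑ a, m a) ≤ r →
      CB n b (Dk Sum.inl j (Dk Sum.inr m f)) := by
    intro j m hjm n hn
    have := sum_le_pdeg j
    have := sum_le_pdeg m
    refine CB_Dk _ j n (CB_Dk _ m _ (PB.le h ?_)); omega
  have keq : ∀ j m : Fin (d + 1) → ℕ, pdeg j + pdeg m ≤ r → ∀ z zb,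
      mderiv2 j m (fun z zb => f (z, zb)) z zb = Dk Sum.inl j (Dk Sum.inr m f) (z, zb) := by
    intro j m hjm z zb
    have := sum_le_pdeg j
    have := sum_le_pdeg m
    exact mderiv2_eq j m (PB.le h (by omega)) z zb
  refine ⟨fun j m hjm => ?_, fun j m hjm => ?_, fun T hT => ?_⟩
  · simp only [keq j m hjm.le]
    have := sum_le_pdeg j
    have := sum_le_pdeg m
    exact (key j m hjm.le 1 (by omega)).diff
  · simp only [keq j m hjm]
    have := sum_le_pdeg j
    have := sum_le_pdeg m
    exact (key j m hjm 0 (by omega)).cont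
  · obtain ⟨Q, hQ⟩ := hb T hT
    refine ⟨Q, ?_⟩
    rintro y ⟨j, m, z, zb, hjm, hT', rfl⟩
    rw [keq j m hjm]
    have := sum_le_pdeg j
    have := sum_le_pdeg m
    exact ((key j m hjm 0 (by omega)).bound _).trans (hQ _ hT')

lemma clocNorm_le_of_CB {r : ℕ} {b f : EE d → ℝ} (h : CB r b f) {T Q : ℝ} (hQ0 : 0 ≤ Q)
    (hb : ∀ e : EE d, |e.1 0 - e.2 0| ≤ T → b e ≤ Q) :
    clocNorm r T (fun z zb => f (z, zb)) ≤ Q := by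
  refine Real.sSup_le ?_ hQ0
  rintro y ⟨j, m, z, zb, hjm, hT', rfl⟩
  have := sum_le_pdeg j
  have := sum_le_pdeg m
  rw [mderiv2_eq j m (PB.le h (by omega)) z zb]
  refine ((CB_Dk _ j 0 (CB_Dk _ m _ (PB.le h ?_)) : CB 0 b _).bound _).trans (hb _ hT')
  omega

end

section

set_option linter.unusedSectionVars false
set_option linter.unusedVariables false

/-! ## Uniform families -/

lemma CD.succ {n : ℕ} {ε : ℝ} {b f f' : EE d → ℝ} (hd : Differentiable ℝ f) (hd' : Differentiable ℝ f')
    (h0 : ∀ e, |f e| ≤ b e) (h0' : ∀ e, |f' e| ≤ b e) (hs : ∀ e, |f e - f' e| ≤ ε * b e)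
    (h : ∀ i, CD n ε b (D i f) (D i f')) : CD (n + 1) ε b f f' := by
  refine ⟨⟨hd.continuous.comp continuous_snd, fun _ e => h0 e, fun _ => hd, fun i => (h i).l⟩,
    ⟨hd'.continuous.comp continuous_snd, fun _ e => h0' e, fun _ => hd', fun i => (h i).r⟩,
    ⟨(hd.continuous.sub hd'.continuous).comp continuous_snd, fun _ e => hs e, fun _ => hd.sub hd', fun i => ?_⟩⟩
  have := (h i).s
  have e1 : (fun (_ : Unit) => D i (fun e => f e - f' e)) = fun _ e => D i f e - D i f' e := by
    funext _; rw [D_sub hd hd']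
  show PB n _ (fun (_ : Unit) => D i (fun e => f e - f' e))
  rw [e1]; exact this

lemma CD.zero {ε : ℝ} {b f f' : EE d → ℝ} (hd : Continuous f) (hd' : Continuous f')
    (h0 : ∀ e, |f e| ≤ b e) (h0' : ∀ e, |f' e| ≤ b e) (hs : ∀ e, |f e - f' e| ≤ ε * b e) : CD 0 ε b f f' :=
  ⟨⟨hd.comp continuous_snd, fun _ e => h0 e⟩, ⟨hd'.comp continuous_snd, fun _ e => h0' e⟩,
    ⟨(hd.sub hd').comp continuous_snd, fun _ e => hs e⟩⟩

lemma CD.bound_sub {n : ℕ} {ε : ℝ} {b f f' : EE d → ℝ} (h : CD n ε b f f') (e : EE d) :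
    |f e - f' e| ≤ ε * b e := h.s.bound () e

/-- Uniform families of pairs of functions. -/
def UW {I : Type} (ε : I → ℝ) (n N : ℕ) (β : ℝ) (f f' : I → EE d → ℝ) : Prop :=
  ∃ C : ℝ, 0 ≤ C ∧ ∀ i, WD n (ε i) C N β (f i) (f' i)

section UW
variable {I : Type} {ε : I → ℝ} {n N : ℕ} {β : ℝ} {f f' g g' : I → EE d → ℝ}

lemma UW.weaken (hε : ∀ i, 0 ≤ ε i) {N' : ℕ} {β' : ℝ} (h : UW ε n N β f f') (hN : N ≤ N') (hβ : β' ≤ β) :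
    UW ε n N' β' f f' := by
  obtain ⟨C, hC, h⟩ := h
  exact ⟨C, hC, fun i => (h i).weaken (hε i) hC le_rfl hN hβ⟩

lemma UW.le {m : ℕ} (h : UW ε n N β f f') (hm : m ≤ n) : UW ε m N β f f' := by
  obtain ⟨C, hC, h⟩ := h
  exact ⟨C, hC, fun i => (h i).le hm⟩

lemma UW.add (h : UW ε n N β f f') (h' : UW ε n N β g g') :
    UW ε n N β (fun i e => f i e + g i e) (fun i e => f' i e + g' i e) := by
  obtain ⟨C, hC, h⟩ := h
  obtain ⟨C', hC', h'⟩ := h'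
  exact ⟨C + C', add_nonneg hC hC', fun i => (h i).add (h' i)⟩

lemma UW.neg (h : UW ε n N β f f') : UW ε n N β (fun i e => - f i e) (fun i e => - f' i e) := by
  obtain ⟨C, hC, h⟩ := h
  exact ⟨C, hC, fun i => (h i).neg⟩

lemma UW.sub (h : UW ε n N β f f') (h' : UW ε n N β g g') :
    UW ε n N β (fun i e => f i e - g i e) (fun i e => f' i e - g' i e) := by
  simpa only [sub_eq_add_neg] using h.add h'.neg

lemma UW.sum {κ : Type*} (s : Finset κ) {f f' : κ → I → EE d → ℝ} (h : ∀ k ∈ s, UW ε n N β (f k) (f' k)) :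
    UW ε n N β (fun i e => ∑ k ∈ s, f k i e) (fun i e => ∑ k ∈ s, f' k i e) := by
  choose! C hC h using h
  exact ⟨∑ k ∈ s, C k, Finset.sum_nonneg hC, fun i => WD.sum s fun k hk => h k hk i⟩

lemma UW.mul (hε : ∀ i, 0 ≤ ε i) {N' : ℕ} {β' : ℝ} (h : UW ε n N β f f') (h' : UW ε n N' β' g g') :
    UW ε n (N + N') (β + β') (fun i e => f i e * g i e) (fun i e => f' i e * g' i e) := by
  obtain ⟨C, hC, h⟩ := h
  obtain ⟨C', hC', h'⟩ := h'
  exact ⟨_, by positivity, fun i => (h i).mul (hε i) (h' i)⟩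

lemma UW.mul0 (hε : ∀ i, 0 ≤ ε i) (h : UW ε n 0 0 f f') (h' : UW ε n N β g g') :
    UW ε n N β (fun i e => f i e * g i e) (fun i e => f' i e * g' i e) := by
  have := h.mul hε h'
  rwa [zero_add, zero_add] at this

lemma UW.const_mul (c : ℝ) (h : UW ε n N β f f') : UW ε n N β (fun i e => c * f i e) (fun i e => c * f' i e) := by
  obtain ⟨C, hC, h⟩ := h
  exact ⟨|c| * C, by positivity, fun i => (h i).const_mul c⟩

lemma UW.of_CB (hε : ∀ i, 0 ≤ ε i) {F : EE d → ℝ} {C : ℝ} (hC : 0 ≤ C) (h : CB n (fun e => C * wb N β e) F) :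
    UW ε n N β (fun _ => F) (fun _ => F) := ⟨C, hC, fun i => h.toCD (hε i)⟩

lemma wb_zero (e : EE d) : wb 0 0 e = 1 := by simp [wb]

lemma UW.const (hε : ∀ i, 0 ≤ ε i) (c : ℝ) : UW (d := d) ε n 0 0 (fun _ _ => c) (fun _ _ => c) := by
  refine UW.of_CB hε (abs_nonneg c) ?_
  simp only [wb_zero, mul_one]
  exact PB.const c

lemma UW.prod (hε : ∀ i, 0 ≤ ε i) {κ : Type*} (s : Finset κ) {f f' : κ → I → EE d → ℝ}
    (h : ∀ k ∈ s, UW ε n 0 0 (f k) (f' k)) :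
    UW ε n 0 0 (fun i e => ∏ k ∈ s, f k i e) (fun i e => ∏ k ∈ s, f' k i e) := by
  classical
  induction s using Finset.induction_on with
  | empty => simpa using UW.const hε 1
  | insert a s ha ih =>
    simp only [Finset.prod_insert ha]
    exact (h a (by simp)).mul0 hε (ih fun k hk => h k (by simp [hk]))

lemma UW.deriv (h : UW ε (n + 1) N β f f') (k : Ix d) : UW ε n N β (fun i => D k (f i)) (fun i => D k (f' i)) := by
  obtain ⟨C, hC, h⟩ := h
  exact ⟨C, hC, fun i => (h i).deriv k⟩

lemma UW.iop (hε : ∀ i, 0 ≤ ε i) (h : UW ε (n + 1) N β f f') :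
    UW ε n N β (fun i => Iop (f i)) (fun i => Iop (f' i)) := by
  obtain ⟨C, hC, h⟩ := h
  exact ⟨_, mul_nonneg (zero_le_one.trans (one_le_compC d n)) hC, fun i => (h i).Iop (hε i) hC⟩

lemma UW.iop_iter (hε : ∀ i, 0 ≤ ε i) (m : ℕ) (h : UW ε (n + m) N β f f') :
    UW ε n N β (fun i => Iop^[m] (f i)) (fun i => Iop^[m] (f' i)) := by
  induction m generalizing f f' with
  | zero => exact h
  | succ m ih =>
    simp only [Function.iterate_succ_apply]
    exact ih (UW.iop hε h)

lemma UW.dl (h : UW ε (n + 1) N β f f') (i : I) : Differentiable ℝ (f i) := by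
  obtain ⟨C, hC, h⟩ := h
  exact (h i).cl.diff
lemma UW.dr (h : UW ε (n + 1) N β f f') (i : I) : Differentiable ℝ (f' i) := by
  obtain ⟨C, hC, h⟩ := h
  exact CB.diff (CD.cr (h i))

lemma UW.succ (hε : ∀ i, 0 ≤ ε i) (hd : ∀ i, Differentiable ℝ (f i)) (hd' : ∀ i, Differentiable ℝ (f' i))
    (h0 : UW ε 0 N β f f') (h : ∀ k, UW ε n N β (fun i => D k (f i)) (fun i => D k (f' i))) :
    UW ε (n + 1) N β f f' := by
  obtain ⟨C, hC, h0⟩ := h0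
  choose C' hC' h using h
  have hS : ∀ k, C' k ≤ C + ∑ k, C' k := fun k => by
    have := Finset.single_le_sum (f := C') (fun k _ => hC' k) (Finset.mem_univ k)
    linarith
  have hS0 : 0 ≤ ∑ k, C' k := Finset.sum_nonneg fun k _ => hC' k
  have hmono : ∀ e : EE d, C * wb N β e ≤ (C + ∑ k, C' k) * wb N β e := fun e =>
    mul_le_mul_of_nonneg_right (by linarith) (wb_nonneg _ _ _)
  refine ⟨C + ∑ k, C' k, by positivity, fun i => CD.succ (hd i) (hd' i) (fun e => ?_) (fun e => ?_) (fun e => ?_) fun k => ?_⟩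
  · exact ((h0 i).cl.bound e).trans (hmono e)
  · exact (CB.bound (CD.cr (h0 i)) e).trans (hmono e)
  · exact (CD.bound_sub (h0 i) e).trans (mul_le_mul_of_nonneg_left (hmono e) (hε i))
  · exact (h k i).weaken (hε i) (by positivity) (hS k) le_rfl le_rfl

lemma UW.congr (h : UW ε n N β f f') (h1 : ∀ i e, f i e = g i e) (h2 : ∀ i e, f' i e = g' i e) : UW ε n N β g g' := by
  have e1 : f = g := by funext i e; exact h1 i e
  have e2 : f' = g' := by funext i e; exact h2 i e
  rwa [← e1, ← e2]

end UW

/-! ## Absorbing polynomials -/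

lemma absorb_poly (η : ℝ) (hη : 0 < η) (m : ℕ) :
    ∃ C : ℝ, 0 ≤ C ∧ ∀ y : Pt d, (1 + ∑ i : Fin d, |y i.succ|) ^ m ≤ C * Real.exp (η * gs y) := by
  refine ⟨(2 * (d + 1)) ^ m * (m.factorial * η⁻¹ ^ m * Real.exp η), by positivity, fun y => ?_⟩
  have hg := gs_nonneg y
  have hS : 0 ≤ ∑ i : Fin d, |y i.succ| := Finset.sum_nonneg fun _ _ => abs_nonneg _
  have hcs : (∑ i : Fin d, |y i.succ|) ^ 2 ≤ d * gs y := by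
    have := sq_sum_le_card_mul_sum_sq (s := Finset.univ) (f := fun i : Fin d => |y i.succ|)
    simpa [gs] using this
  have hd0 : (0:ℝ) ≤ d := Nat.cast_nonneg d
  have h1 : 1 + ∑ i : Fin d, |y i.succ| ≤ (2 * (d + 1)) * (1 + gs y) := by
    nlinarith [sq_nonneg (1 - ∑ i : Fin d, |y i.succ|)]
  have h2 : (1 + gs y) ^ m ≤ m.factorial * η⁻¹ ^ m * Real.exp η * Real.exp (η * gs y) := by
    have := Real.pow_div_factorial_le_exp (η * (1 + gs y)) (by positivity) m
    rw [div_le_iff₀ (by positivity), mul_pow] at this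
    calc (1 + gs y) ^ m = η⁻¹ ^ m * (η ^ m * (1 + gs y) ^ m) := by
          rw [← mul_assoc, ← mul_pow, inv_mul_cancel₀ hη.ne', one_pow, one_mul]
      _ ≤ η⁻¹ ^ m * (Real.exp (η * (1 + gs y)) * m.factorial) := by gcongr
      _ = _ := by rw [show η * (1 + gs y) = η + η * gs y by ring, Real.exp_add]; ring
  calc _ ≤ ((2 * (d + 1)) * (1 + gs y)) ^ m := by gcongr
    _ = (2 * (d + 1)) ^ m * (1 + gs y) ^ m := mul_pow _ _ _
    _ ≤ (2 * (d + 1)) ^ m * (m.factorial * η⁻¹ ^ m * Real.exp η * Real.exp (η * gs y)) := by gcongr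
    _ = _ := by ring

lemma CB_snd (n : ℕ) (j : Fin (d + 1)) : CB n (fun e : EE d => 1 + |e.2 j|) (fun e => e.2 j) := by
  cases n with
  | zero => exact ⟨by fun_prop, fun _ e => by simp⟩
  | succ n =>
    have hc : Continuous (fun p : Unit × EE d => p.2.2 j) := by fun_prop
    have hdf : Differentiable ℝ (fun e : EE d => e.2 j) := by fun_prop
    refine ⟨hc, fun _ e => by simp, fun _ => hdf, fun i => ?_⟩
    have : D i (fun e : EE d => e.2 j) = fun _ => (dir i).2 j := by
      funext e
      exact D_of_line hdf i e (by
        simp only [Prod.snd_add, Prod.smul_snd, Pi.add_apply, Pi.smul_apply, smul_eq_mul]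
        simpa using ((hasDerivAt_id (0:ℝ)).mul_const ((dir i).2 j)).const_add (e.2 j))
    show PB n _ (fun _ : Unit => D i (fun e : EE d => e.2 j))
    rw [this]
    refine (PB.const _).mono fun _ e => ?_
    have : |(dir i : EE d).2 j| ≤ 1 := by
      rcases i with i | i
      · simp [dir]
      · simp only [dir, Sum.elim_inr, Pi.single_apply]; split_ifs <;> simp
    have := abs_nonneg (e.2 j)
    linarith

section UW2
variable {I : Type} {ε : I → ℝ} {n N : ℕ} {β : ℝ} {f f' g g' : I → EE d → ℝ}

lemma UW.v (hε : ∀ i, 0 ≤ ε i) {η : ℝ} (hη : 0 < η) (j : Fin d) :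
    UW (d := d) ε n 0 (-η) (fun _ e => e.2 j.succ) (fun _ e => e.2 j.succ) := by
  obtain ⟨C, hC, h⟩ := absorb_poly (d := d) η hη 1
  refine UW.of_CB hε hC ((CB_snd n j.succ).mono fun _ e => ?_)
  have := h e.2
  have h2 := Finset.single_le_sum (f := fun i : Fin d => |e.2 i.succ|) (fun _ _ => abs_nonneg _) (Finset.mem_univ j)
  simp only [wb, pow_zero, one_mul, neg_mul, neg_neg]
  simp only [pow_one] at this
  linarith

lemma UW.u (hε : ∀ i, 0 ≤ ε i) : UW (d := d) ε n 1 0 (fun _ e => e.2 0) (fun _ e => e.2 0) := by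
  refine UW.of_CB hε zero_le_one ((CB_snd n 0).mono fun _ e => ?_)
  simp [wb]

lemma UW.upow (hε : ∀ i, 0 ≤ ε i) (m : ℕ) : UW (d := d) ε n m 0 (fun _ e => e.2 0 ^ m) (fun _ e => e.2 0 ^ m) := by
  induction m with
  | zero => simpa using UW.const hε 1
  | succ m ih => simpa [pow_succ] using ih.mul hε (UW.u hε)

/-- The shear `(w, y) ↦ (w + σ sh y, y)`. -/
noncomputable def shT (d : ℕ) (σ : ℝ) (hσ : |σ| ≤ 1) : Aff Unit d where
  α := fun _ => σ
  P := fun _ _ => 1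
  q := fun _ _ => 0
  P' := fun _ _ => 1
  q' := fun _ _ => 0
  cα := continuous_const
  cP := continuous_const
  cq := continuous_const
  cP' := continuous_const
  cq' := continuous_const
  bα := fun _ => hσ
  bP := fun _ _ => by simp
  bP' := fun _ _ => by simp

/-- The shear `(w, y) ↦ (w + σ sh y, y)`. -/
def shear (σ : ℝ) (e : EE d) : EE d := (fun i => e.1 i + σ * (e.2 0 * e.2 i), e.2)

lemma shT_Φ (σ : ℝ) (hσ : |σ| ≤ 1) (x : Unit) (e : EE d) : (shT d σ hσ).Φ x e = shear σ e := by
  simp [Aff.Φ, Aff.Y, shT, shear]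

lemma wb_shear (σ : ℝ) (e : EE d) : wb N β (shear σ e) = wb N β e := rfl

lemma UW.shear (hε : ∀ i, 0 ≤ ε i) {σ : ℝ} (hσ : |σ| ≤ 1) {η : ℝ} (hη : 0 < η) (h : UW ε n N β f f') :
    UW ε n (N + n) (β - η) (fun i e => f i (VarBPHZ.shear σ e)) (fun i e => f' i (VarBPHZ.shear σ e)) := by
  obtain ⟨C, hC, h⟩ := h
  obtain ⟨C', hC', h'⟩ := absorb_poly (d := d) η hη n
  refine ⟨compC d n * C' * C, mul_nonneg (mul_nonneg (zero_le_one.trans (one_le_compC d n)) hC') hC, fun i => ?_⟩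
  have := PD.compΦ (shT d σ hσ) (h i)
  simp only [shT_Φ, wb_shear] at this
  refine CD.mono (b := fun e => compC d n * (shT d σ hσ).wt () e ^ n * (C * wb N β e)) this (hε i) fun e => ?_
  show compC d n * (shT d σ hσ).wt () e ^ n * (C * wb N β e) ≤ _
  have hw : (shT d σ hσ).wt () e ≤ (1 + |e.2 0|) * (1 + ∑ j : Fin d, |e.2 j.succ|) := by
    have hS : 0 ≤ ∑ i : Fin d, |e.2 i.succ| := Finset.sum_nonneg fun _ _ => abs_nonneg _
    simp only [Aff.wt, Aff.Y, shT, one_mul, add_zero, Fin.sum_univ_succ]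
    nlinarith [abs_nonneg (e.2 0)]
  have hc0 := zero_le_one.trans (one_le_compC d n)
  have hw0 := zero_le_one.trans ((shT d σ hσ).one_le_wt () e)
  calc compC d n * (shT d σ hσ).wt () e ^ n * (C * wb N β e)
      ≤ compC d n * ((1 + |e.2 0|) * (1 + ∑ j : Fin d, |e.2 j.succ|)) ^ n * (C * wb N β e) := by
        have := wb_nonneg N β e
        gcongr
    _ = compC d n * ((1 + |e.2 0|) ^ n * (1 + ∑ j : Fin d, |e.2 j.succ|) ^ n) * (C * wb N β e) := by rw [mul_pow]
    _ ≤ compC d n * ((1 + |e.2 0|) ^ n * (C' * Real.exp (η * gs e.2))) * (C * wb N β e) := by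
        have := wb_nonneg N β e
        have := h' e.2
        gcongr
    _ = _ := by
        simp only [wb]
        rw [pow_add, show -((β - η) * gs e.2) = η * gs e.2 + -(β * gs e.2) by ring, Real.exp_add]
        ring

end UW2

/-! ## Real powers -/

lemma rpow_lip (c Q s : ℝ) (hc : 0 < c) (hcQ : c ≤ Q) : ∃ C : ℝ, 0 ≤ C ∧
    (∀ x, c ≤ x → x ≤ Q → |x ^ s| ≤ C) ∧
    ∀ x y, c ≤ x → x ≤ Q → c ≤ y → y ≤ Q → |x ^ s - y ^ s| ≤ C * |x - y| := by
  have hcont : ∀ s : ℝ, ContinuousOn (fun x : ℝ => x ^ s) (Set.Icc c Q) := fun s x hx =>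
    (Real.continuousAt_rpow_const x s (Or.inl (hc.trans_le hx.1).ne')).continuousWithinAt
  obtain ⟨C1, h1⟩ := isCompact_Icc.exists_bound_of_continuousOn (hcont s)
  obtain ⟨C2, h2⟩ := isCompact_Icc.exists_bound_of_continuousOn ((hcont (s - 1)).const_smul s)
  have hC1 : 0 ≤ C1 := (norm_nonneg _).trans (h1 c ⟨le_rfl, hcQ⟩)
  have hC2 : 0 ≤ C2 := (norm_nonneg _).trans (h2 c ⟨le_rfl, hcQ⟩)
  refine ⟨C1 + C2, by positivity, fun x hx hx' => ?_, fun x y hx hx' hy hy' => ?_⟩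
  · exact (h1 x ⟨hx, hx'⟩).trans (by linarith)
  · have := (convex_Icc c Q).norm_image_sub_le_of_norm_hasDerivWithin_le (f := fun x => x ^ s)
      (f' := fun x => s * x ^ (s - 1)) (C := C2) (x := y) (y := x) (fun z hz =>
        (Real.hasDerivAt_rpow_const (Or.inl (hc.trans_le hz.1).ne')).hasDerivWithinAt)
      (fun z hz => h2 z hz) ⟨hy, hy'⟩ ⟨hx, hx'⟩
    simp only [Real.norm_eq_abs] at this
    exact this.trans (mul_le_mul_of_nonneg_right (by linarith) (abs_nonneg _))

section UW3
variable {I : Type} {ε : I → ℝ} {n N : ℕ} {β : ℝ} {f f' g g' : I → EE d → ℝ}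

lemma UW.bounds (h : UW ε n 0 0 f f') : ∃ C, 0 ≤ C ∧ (∀ i e, |f i e| ≤ C) ∧ (∀ i e, |f' i e| ≤ C) ∧
    ∀ i e, |f i e - f' i e| ≤ ε i * C := by
  obtain ⟨C, hC, h⟩ := h
  refine ⟨C, hC, fun i e => ?_, fun i e => ?_, fun i e => ?_⟩
  · simpa [wb_zero] using (h i).cl.bound e
  · simpa [wb_zero] using CB.bound (CD.cr (h i)) e
  · simpa [wb_zero] using CD.bound_sub (h i) e

lemma D_rpow {h : EE d → ℝ} (hd : Differentiable ℝ h) (h0 : ∀ e, 0 < h e) (s : ℝ) (k : Ix d) :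
    Differentiable ℝ (fun e => h e ^ s) ∧
    D k (fun e => h e ^ s) = fun e => s * (h e ^ (s - 1) * D k h e) := by
  have := fun e => ((hd e).hasFDerivAt.rpow_const (p := s) (Or.inl (h0 e).ne'))
  refine ⟨fun e => (this e).differentiableAt, ?_⟩
  funext e
  simp only [D]
  rw [(this e).fderiv]
  simp [mul_assoc]

lemma UW.rpow (hε : ∀ i, 0 ≤ ε i) {c : ℝ} (hc : 0 < c) (h : UW ε n 0 0 f f') (h1 : ∀ i e, c ≤ f i e)
    (h2 : ∀ i e, c ≤ f' i e) (s : ℝ) :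
    UW ε n 0 0 (fun i e => f i e ^ s) (fun i e => f' i e ^ s) := by
  have base : ∀ (m : ℕ) (h : UW ε m 0 0 f f') (s : ℝ), (∀ i, Continuous (f i)) → (∀ i, Continuous (f' i)) →
      UW ε 0 0 0 (fun i e => f i e ^ s) (fun i e => f' i e ^ s) := by
    intro m h s hcf hcf'
    obtain ⟨Q, hQ, a1, a2, a3⟩ := h.bounds
    obtain ⟨C, hC, b1, b2⟩ := rpow_lip c (Q + c) s hc (by linarith)
    have le1 : ∀ i e, f i e ≤ Q + c := fun i e => (le_abs_self _).trans ((a1 i e).trans (by linarith))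
    have le2 : ∀ i e, f' i e ≤ Q + c := fun i e => (le_abs_self _).trans ((a2 i e).trans (by linarith))
    refine ⟨C + C * Q, by positivity, fun i => CD.zero ?_ ?_ (fun e => ?_) (fun e => ?_) fun e => ?_⟩
    · exact (hcf i).rpow_const fun e => Or.inl (hc.trans_le (h1 i e)).ne'
    · exact (hcf' i).rpow_const fun e => Or.inl (hc.trans_le (h2 i e)).ne'
    · rw [wb_zero, mul_one]
      exact (b1 _ (h1 i e) (le1 i e)).trans (by nlinarith)
    · rw [wb_zero, mul_one]
      exact (b1 _ (h2 i e) (le2 i e)).trans (by nlinarith)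
    · rw [wb_zero, mul_one]
      refine (b2 _ _ (h1 i e) (le1 i e) (h2 i e) (le2 i e)).trans ?_
      calc C * |f i e - f' i e| ≤ C * (ε i * Q) := by gcongr; exact a3 i e
        _ ≤ ε i * (C + C * Q) := by nlinarith [mul_nonneg (hε i) hC]
  have hcl : ∀ i, Continuous (f i) := by
    obtain ⟨C, hC, h⟩ := h
    exact fun i => (h i).cl.cont
  have hcr : ∀ i, Continuous (f' i) := by
    obtain ⟨C, hC, h⟩ := h
    exact fun i => CB.cont (CD.cr (h i))
  induction n generalizing s with
  | zero => exact base 0 h s hcl hcr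
  | succ n ih =>
    refine UW.succ hε (fun i => (D_rpow (h.dl i) (fun e => hc.trans_le (h1 i e)) s (Sum.inl 0)).1)
      (fun i => (D_rpow (h.dr i) (fun e => hc.trans_le (h2 i e)) s (Sum.inl 0)).1) (base _ h s hcl hcr) fun k => ?_
    refine UW.congr (((ih (h.le (Nat.le_succ n)) (s - 1)).mul0 hε (h.deriv k)).const_mul s) ?_ ?_
    · intro i e; rw [(D_rpow (h.dl i) (fun e => hc.trans_le (h1 i e)) s k).2]
    · intro i e; rw [(D_rpow (h.dr i) (fun e => hc.trans_le (h2 i e)) s k).2]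

end UW3

end

section

set_option linter.unusedSectionVars false
set_option linter.unusedVariables false

/-! ## Matrix facts -/

/-- Ellipticity without regularity. -/
structure Ell (lam : ℝ) (A : Coeffs d) : Prop where
  symm : ∀ z, (A.a z).IsSymm
  lower : ∀ (z : Pt d) (ζ : Fin d → ℝ), lam * ∑ i, ζ i ^ 2 ≤ ∑ i, ∑ j, A.a z i j * ζ i * ζ j
  upper : ∀ (z : Pt d) (ζ : Fin d → ℝ), ∑ i, ∑ j, A.a z i j * ζ i * ζ j ≤ lam⁻¹ * ∑ i, ζ i ^ 2

lemma ParReg.ell {lam : ℝ} {ρ : ℕ} {A : Coeffs d} (h : ParReg lam ρ A) : Ell lam A := ⟨h.symm, h.lower, h.upper⟩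

lemma quad_eq (m : Matrix (Fin d) (Fin d) ℝ) (ζ : Fin d → ℝ) :
    ∑ i, ∑ j, m i j * ζ i * ζ j = dotProduct ζ (m.mulVec ζ) := by
  simp only [dotProduct, Matrix.mulVec, Finset.mul_sum]
  refine Finset.sum_congr rfl fun i _ => Finset.sum_congr rfl fun j _ => by ring

lemma sq_eq_dot (ζ : Fin d → ℝ) : ∑ i, ζ i ^ 2 = dotProduct ζ ζ := by
  simp only [dotProduct, sq]

lemma Ell.det_lower {lam : ℝ} (hlam : 0 < lam) {A : Coeffs d} (h : Ell lam A) (z : Pt d) :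
    lam ^ d ≤ (A.a z).det := by
  have hH : (A.a z).IsHermitian := by
    have := h.symm z
    rw [Matrix.IsHermitian, Matrix.conjTranspose_eq_transpose_of_trivial]; exact this
  rw [hH.det_eq_prod_eigenvalues]
  have hev : ∀ i, lam ≤ hH.eigenvalues i := by
    intro i
    set v : Fin d → ℝ := (hH.eigenvectorBasis i).ofLp with hv
    have h1 := hH.mulVec_eigenvectorBasis i
    have h2 := h.lower z v
    rw [quad_eq, sq_eq_dot, h1, dotProduct_smul, smul_eq_mul] at h2
    have h3 : dotProduct v v = 1 := by
      have := (hH.eigenvectorBasis.orthonormal).1 i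
      rw [EuclideanSpace.norm_eq, Real.sqrt_eq_one] at this
      rw [← sq_eq_dot, ← this]
      simp [hv]
    rw [h3] at h2
    linarith
  calc lam ^ d = ∏ i : Fin d, lam := by simp
    _ ≤ ∏ i : Fin d, hH.eigenvalues i := Finset.prod_le_prod (fun _ _ => hlam.le) fun i _ => hev i
    _ = _ := by simp

lemma Ell.det_pos {lam : ℝ} (hlam : 0 < lam) {A : Coeffs d} (h : Ell lam A) (z : Pt d) : 0 < (A.a z).det :=
  (pow_pos hlam d).trans_le (h.det_lower hlam z)

lemma Ell.isUnit {lam : ℝ} (hlam : 0 < lam) {A : Coeffs d} (h : Ell lam A) (z : Pt d) : IsUnit (A.a z).det :=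
  (h.det_pos hlam z).ne'.isUnit

lemma Ell.inv_symm {lam : ℝ} {A : Coeffs d} (h : Ell lam A) (z : Pt d) : ((A.a z)⁻¹).IsSymm := by
  have := h.symm z
  rw [Matrix.IsSymm, Matrix.transpose_nonsing_inv, this]

lemma Ell.inv_lower {lam : ℝ} (hlam : 0 < lam) {A : Coeffs d} (h : Ell lam A) (z : Pt d) (v : Fin d → ℝ) :
    lam * ∑ i, v i ^ 2 ≤ ∑ i, ∑ j, (A.a z)⁻¹ i j * v i * v j := by
  set a := A.a z with ha
  set ζ := a⁻¹.mulVec v with hζ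
  have hv : a.mulVec ζ = v := by
    rw [hζ, Matrix.mulVec_mulVec, Matrix.mul_nonsing_inv _ (h.isUnit hlam z), Matrix.one_mulVec]
  rw [quad_eq, ← hζ, sq_eq_dot]
  have h1 := h.lower z (ζ - lam • v)
  have h2 := h.upper z v
  rw [quad_eq, sq_eq_dot] at h1 h2
  have h0 : 0 ≤ dotProduct (ζ - lam • v) (ζ - lam • v) := by
    rw [← sq_eq_dot]; exact Finset.sum_nonneg fun _ _ => sq_nonneg _
  have hsym : dotProduct ζ (a.mulVec v) = dotProduct v v := by
    rw [Matrix.dotProduct_mulVec, ← Matrix.mulVec_transpose, h.symm z, hv]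
  rw [← ha] at h1 h2
  simp only [Matrix.mulVec_sub, Matrix.mulVec_smul, hv, dotProduct_sub, sub_dotProduct, dotProduct_smul, smul_dotProduct,
    smul_eq_mul, hsym] at h1
  rw [dotProduct_comm v ζ]
  have h3 : lam * (lam * dotProduct v (a.mulVec v)) ≤ lam * dotProduct v v := by
    refine mul_le_mul_of_nonneg_left ?_ hlam.le
    calc lam * dotProduct v (a.mulVec v) ≤ lam * (lam⁻¹ * dotProduct v v) := by gcongr
      _ = _ := by rw [← mul_assoc, mul_inv_cancel₀ hlam.ne', one_mul]
  have h4 : 0 ≤ lam * dotProduct (ζ - lam • v) (ζ - lam • v) := mul_nonneg hlam.le h0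
  simp only [dotProduct_sub, sub_dotProduct, dotProduct_smul, smul_dotProduct,
    smul_eq_mul] at h4
  nlinarith

/-! ## Good families of coefficients -/

/-- Families of pairs of coefficient fields with uniform bounds. -/
structure Good {I : Type} (lam : ℝ) (ε : I → ℝ) (n : ℕ) (A A' : I → Coeffs d) : Prop where
  pos : 0 < lam
  hε : ∀ i, 0 ≤ ε i
  el : ∀ i, Ell lam (A i)
  er : ∀ i, Ell lam (A' i)
  ha : ∀ j k, UW ε n 0 0 (fun i => lift fun z => (A i).a z j k) (fun i => lift fun z => (A' i).a z j k)
  hb : ∀ j, UW ε n 0 0 (fun i => lift fun z => (A i).b z j) (fun i => lift fun z => (A' i).b z j)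
  hc : UW ε n 0 0 (fun i => lift (A i).c) (fun i => lift (A' i).c)

lemma UW.det {I : Type} {ε : I → ℝ} (hε : ∀ i, 0 ≤ ε i) {n : ℕ} {m m' : I → EE d → Matrix (Fin d) (Fin d) ℝ}
    (h : ∀ j k, UW ε n 0 0 (fun i e => m i e j k) (fun i e => m' i e j k)) :
    UW ε n 0 0 (fun i e => (m i e).det) (fun i e => (m' i e).det) := by
  simp only [Matrix.det_apply']
  exact UW.sum _ fun σ _ => (UW.prod hε _ fun k _ => h _ _).const_mul _

section Good
variable {I : Type} {lam : ℝ} {ε : I → ℝ} {n : ℕ} {A A' : I → Coeffs d}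

lemma Good.det (h : Good lam ε n A A') :
    UW ε n 0 0 (fun i e => ((A i).a e.1).det) (fun i e => ((A' i).a e.1).det) := UW.det h.hε h.ha

lemma Good.detpow (h : Good lam ε n A A') (s : ℝ) :
    UW ε n 0 0 (fun i e => ((A i).a e.1).det ^ s) (fun i e => ((A' i).a e.1).det ^ s) :=
  h.det.rpow h.hε (pow_pos h.pos d) (fun i e => (h.el i).det_lower h.pos _) (fun i e => (h.er i).det_lower h.pos _) s

lemma inv_entry (m : Matrix (Fin d) (Fin d) ℝ) (j k : Fin d) :
    m⁻¹ j k = m.det ^ (-1 : ℝ) * (m.updateRow k (Pi.single j 1)).det := by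
  rw [Matrix.inv_def, Matrix.smul_apply, Matrix.adjugate_apply, Ring.inverse_eq_inv', smul_eq_mul, Real.rpow_neg_one]

lemma Good.inv (h : Good lam ε n A A') (j k : Fin d) :
    UW ε n 0 0 (fun i e => ((A i).a e.1)⁻¹ j k) (fun i e => ((A' i).a e.1)⁻¹ j k) := by
  simp only [inv_entry]
  refine (h.detpow (-1)).mul0 h.hε (UW.det h.hε fun j' k' => ?_)
  by_cases hj : j' = k
  · subst hj
    simp only [Matrix.updateRow_self]
    exact UW.const h.hε _
  · simp only [Matrix.updateRow_ne hj]
    exact h.ha j' k'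

noncomputable def qf (A : Coeffs d) (e : EE d) : ℝ := ∑ i, ∑ j, (A.a e.1)⁻¹ i j * e.2 i.succ * e.2 j.succ

/-- The profile of the frozen heat kernel. -/
noncomputable def Zt (A : Coeffs d) (e : EE d) : ℝ :=
  (4 * Real.pi) ^ (-(d : ℝ) / 2) * ((A.a e.1).det ^ (-(1 : ℝ) / 2) * Real.exp (-(1 / 4) * qf A e))

lemma Good.qf (h : Good lam ε n A A') {η : ℝ} (hη : 0 < η) :
    UW ε n 0 (-η) (fun i => qf (A i)) (fun i => qf (A' i)) := by
  refine UW.sum _ fun j _ => UW.sum _ fun k _ => ?_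
  have := ((h.inv j k).mul0 h.hε (UW.v (η := η / 2) h.hε (by positivity) j)).mul h.hε (UW.v (η := η / 2) h.hε (by positivity) k)
  rwa [show -(η / 2) + -(η / 2) = -η by ring, add_zero] at this

lemma exp_sub_le {x y c : ℝ} (hx : x ≤ c) (hy : y ≤ c) : |Real.exp x - Real.exp y| ≤ |x - y| * Real.exp c := by
  wlog hxy : y ≤ x generalizing x y
  · rw [abs_sub_comm, abs_sub_comm x]; exact this hy hx (le_of_not_ge hxy)
  rw [abs_of_nonneg (sub_nonneg.2 (Real.exp_le_exp.2 hxy)), abs_of_nonneg (sub_nonneg.2 hxy)]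
  have h1 := Real.add_one_le_exp (y - x)
  have h2 : Real.exp y = Real.exp (y - x) * Real.exp x := by rw [← Real.exp_add]; ring_nf
  calc Real.exp x - Real.exp y = (1 - Real.exp (y - x)) * Real.exp x := by rw [h2]; ring
    _ ≤ (x - y) * Real.exp x := mul_le_mul_of_nonneg_right (by linarith) (Real.exp_pos _).le
    _ ≤ _ := mul_le_mul_of_nonneg_left (Real.exp_le_exp.2 hx) (sub_nonneg.2 hxy)

lemma UW.exp_neg (hε : ∀ i, 0 ≤ ε i) {q q' : I → EE d → ℝ} (n : ℕ) (hq : ∀ η : ℝ, 0 < η → UW ε n 0 (-η) q q')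
    (h1 : ∀ i e, lam * gs e.2 ≤ q i e) (h2 : ∀ i e, lam * gs e.2 ≤ q' i e) {β : ℝ} (hβ : β < lam / 4) :
    UW ε n 0 β (fun i e => Real.exp (-(1 / 4) * q i e)) (fun i e => Real.exp (-(1 / 4) * q' i e)) := by
  have hcl : ∀ i, Continuous (q i) := by
    obtain ⟨C, hC, h⟩ := hq 1 one_pos
    exact fun i => (h i).cl.cont
  have hcr : ∀ i, Continuous (q' i) := by
    obtain ⟨C, hC, h⟩ := hq 1 one_pos
    exact fun i => CB.cont (CD.cr (h i))
  have base : ∀ {β : ℝ}, β < lam / 4 → UW ε 0 0 β (fun i e => Real.exp (-(1 / 4) * q i e)) (fun i e => Real.exp (-(1 / 4) * q' i e)) := by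
    intro β hβ
    obtain ⟨C, hC, h⟩ := (hq (lam / 4 - β) (by linarith)).le (Nat.zero_le n)
    have e1 : ∀ {x : ℝ} (e : EE d), lam * gs e.2 ≤ x → -(1/4) * x ≤ -(β * gs e.2) := by
      intro x e hx
      nlinarith [gs_nonneg e.2]
    refine ⟨1 + C, by positivity, fun i => CD.zero (by have := hcl i; fun_prop) (by have := hcr i; fun_prop)
      (fun e => ?_) (fun e => ?_) fun e => ?_⟩
    · rw [abs_of_pos (Real.exp_pos _)]
      simp only [wb, pow_zero, one_mul]
      have := Real.exp_le_exp.2 (e1 e (h1 i e))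
      nlinarith [Real.exp_pos (-(β * gs e.2))]
    · rw [abs_of_pos (Real.exp_pos _)]
      simp only [wb, pow_zero, one_mul]
      have := Real.exp_le_exp.2 (e1 e (h2 i e))
      nlinarith [Real.exp_pos (-(β * gs e.2))]
    · have hc1 : -(1/4) * q i e ≤ -(lam / 4 * gs e.2) := by linarith [h1 i e]
      have hc2 : -(1/4) * q' i e ≤ -(lam / 4 * gs e.2) := by linarith [h2 i e]
      refine (exp_sub_le hc1 hc2).trans ?_
      have h3 := CD.bound_sub (h i) e
      have h4 : |-(1/4) * q i e - -(1/4) * q' i e| ≤ |q i e - q' i e| := by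
        rw [← mul_sub, abs_mul]
        have := abs_nonneg (q i e - q' i e)
        norm_num; linarith
      calc _ ≤ (ε i * (C * wb 0 (-(lam / 4 - β)) e)) * Real.exp (-(lam / 4 * gs e.2)) := by
            gcongr; exact h4.trans h3
        _ = ε i * (C * wb 0 β e) := by
            simp only [wb, pow_zero, one_mul]
            rw [show -(β * gs e.2) = -(-(lam / 4 - β) * gs e.2) + -(lam / 4 * gs e.2) by ring, Real.exp_add]
            ring
        _ ≤ _ := mul_le_mul_of_nonneg_left (mul_le_mul_of_nonneg_right (by linarith) (wb_nonneg _ _ _)) (hε i)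
  induction n generalizing β with
  | zero => exact base hβ
  | succ n ih =>
    have hD : ∀ {f : EE d → ℝ} (hf : Differentiable ℝ f) (k : Ix d) (e : EE d), D k (fun e => Real.exp (-(1 / 4) * f e)) e =
        -(1/4) * (D k f e * Real.exp (-(1 / 4) * f e)) := by
      intro f hf k e
      have := ((hf e).hasFDerivAt.const_mul (-(1/4))).exp
      simp only [D]
      rw [this.fderiv]
      simp; ring
    have hdl := (hq 1 one_pos).dl
    have hdr := (hq 1 one_pos).dr
    refine UW.succ hε (fun i => by have := hdl i; fun_prop) (fun i => by have := hdr i; fun_prop) (base hβ) fun k => ?_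
    have h3 := (hq ((lam / 4 - β) / 2) (by linarith)).deriv k
    have h4 := ih (fun η hη => (hq η hη).le (Nat.le_succ n)) (β := (lam / 4 + β) / 2) (by linarith)
    have h5 := (h3.mul hε h4).const_mul (-(1/4))
    rw [show -((lam / 4 - β) / 2) + (lam / 4 + β) / 2 = β by ring] at h5
    refine h5.congr ?_ ?_
    · intro i e; exact (hD (hdl i) k e).symm
    · intro i e; exact (hD (hdr i) k e).symm

lemma Good.Zt (h : Good lam ε n A A') {β : ℝ} (hβ : β < lam / 4) :
    UW ε n 0 β (fun i => Zt (A i)) (fun i => Zt (A' i)) :=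
  ((h.detpow _).mul0 h.hε (UW.exp_neg h.hε n (fun η hη => h.qf hη)
    (fun i e => (h.el i).inv_lower h.pos _ _) (fun i e => (h.er i).inv_lower h.pos _ _) hβ)).const_mul _

/-- The coefficient `a` evaluated at the shifted point. -/
noncomputable def shf (f : Pt d → ℝ) (e : EE d) : ℝ := f (shear 1 e).1

/-- The profile of `E`. -/
noncomputable def Et (A : Coeffs d) (e : EE d) : ℝ :=
  -(∑ i : Fin d, ∑ j : Fin d, Iop (shf fun z => A.a z i j) e * D (Sum.inr i.succ) (D (Sum.inr j.succ) (Zt A)) e) -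
    (∑ i : Fin d, shf (fun z => A.b z i) e * D (Sum.inr i.succ) (Zt A) e) - shf A.c e * (e.2 0 * Zt A e)

lemma Good.Et (h : Good lam ε (n + 2) A A') {β : ℝ} (hβ : β < lam / 4) :
    UW ε n (n + 2) β (fun i => Et (A i)) (fun i => Et (A' i)) := by
  set η := (lam / 4 - β) / 2 with hη
  have hη0 : 0 < η := by linarith
  have hZ := h.Zt (β := (lam / 4 + β) / 2) (by linarith)
  have hsum : 0 - η + (lam / 4 + β) / 2 = β := by rw [hη]; ring
  have s1 : |(1:ℝ)| ≤ 1 := by simp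
  refine UW.sub (UW.sub (UW.neg (UW.sum _ fun i _ => UW.sum _ fun j _ => ?_)) (UW.sum _ fun i _ => ?_)) ?_
  · have e1 := (UW.shear h.hε s1 hη0 ((h.ha i j).le (Nat.le_succ (n + 1)))).iop h.hε
    have e2 := e1.mul h.hε ((hZ.deriv (Sum.inr j.succ)).deriv (Sum.inr i.succ))
    rw [hsum] at e2
    exact e2.weaken h.hε (by omega) le_rfl
  · have e1 := UW.shear h.hε s1 hη0 ((h.hb i).le (Nat.le_succ (n + 1)))
    have e2 := e1.mul h.hε (hZ.deriv (Sum.inr i.succ))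
    rw [hsum] at e2
    exact (e2.le (Nat.le_succ n)).weaken h.hε (by omega) le_rfl
  · have e1 := UW.shear h.hε s1 hη0 (h.hc.le (Nat.le_succ (n + 1)))
    have e2 := e1.mul h.hε ((UW.u h.hε).mul h.hε (hZ.le (Nat.le_succ (n + 1))))
    rw [zero_add (((lam / 4 + β) / 2)), hsum] at e2
    exact (e2.le (Nat.le_succ n)).weaken h.hε (by omega) le_rfl

end Good

end

section

set_option linter.unusedSectionVars false
set_option linter.unusedVariables false

/-! ## The profiles of the Volterra series -/

/-- Parameter space for the Volterra integrals. -/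
abbrev XX (d : ℕ) := ℝ × (Fin d → ℝ)

/-- `(0, ξ)`. -/
def Xi (x : XX d) : Pt d := Fin.cons 0 x.2

@[simp] lemma Xi_zero (x : XX d) : Xi x 0 = 0 := rfl
@[simp] lemma Xi_succ (x : XX d) (i : Fin d) : Xi x i.succ = x.2 i := rfl

lemma Xi_cont (i : Fin (d + 1)) : Continuous fun x : XX d => Xi x i := by
  refine Fin.cases ?_ (fun i => ?_) i
  · simpa using continuous_const
  · simp only [Xi_succ]; fun_prop

/-- The change of variables for the first factor. -/
noncomputable def vT1 (d : ℕ) : Aff (XX d) d where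
  α := fun _ => 1
  P := fun x _ => Real.sin x.1
  q := fun x i => Real.cos x.1 * Xi x i
  P' := fun x _ => Real.cos x.1
  q' := fun x i => -(Real.sin x.1 * Xi x i)
  cα := continuous_const
  cP := by fun_prop
  cq := continuous_pi fun i => by have := Xi_cont i; fun_prop
  cP' := by fun_prop
  cq' := continuous_pi fun i => by have := Xi_cont i; fun_prop
  bα := fun _ => by simp
  bP := fun x _ => Real.abs_sin_le_one _
  bP' := fun x _ => Real.abs_cos_le_one _

/-- The change of variables for the second factor. -/
noncomputable def vT2 (d : ℕ) : Aff (XX d) d where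
  α := fun _ => 0
  P := fun x _ => 0
  q := fun x i => 0
  P' := fun x _ => Real.sin x.1
  q' := fun x i => Real.cos x.1 * Xi x i
  cα := continuous_const
  cP := by fun_prop
  cq := by fun_prop
  cP' := by fun_prop
  cq' := continuous_pi fun i => by have := Xi_cont i; fun_prop
  bα := fun _ => by simp
  bP := fun x _ => by simp
  bP' := fun x _ => Real.abs_sin_le_one _

/-- The variable `y''`. -/
noncomputable def yb (x : XX d) (y : Pt d) : Pt d := fun i => Real.sin x.1 * y i + Real.cos x.1 * Xi x i
/-- The variable `y'`. -/
noncomputable def ya (x : XX d) (y : Pt d) : Pt d := fun i => Real.cos x.1 * y i + -(Real.sin x.1 * Xi x i)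

lemma vT1_Φ (x : XX d) (e : EE d) : (vT1 d).Φ x e = (fun i => e.1 i + sh (yb x e.2) i, ya x e.2) := by
  simp [Aff.Φ, Aff.Y, vT1, sh, yb]; rfl
lemma vT2_Φ (x : XX d) (e : EE d) : (vT2 d).Φ x e = (e.1, yb x e.2) := by
  simp [Aff.Φ, Aff.Y, vT2]; rfl
lemma vT1_wt (x : XX d) (e : EE d) : (vT1 d).wt x e = 1 + ∑ j, |yb x e.2 j| := rfl
lemma vT2_wt (x : XX d) (e : EE d) : (vT2 d).wt x e = 1 := by
  simp [Aff.wt, Aff.Y, vT2]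

lemma gs_ya_yb (x : XX d) (y : Pt d) : gs (ya x y) + gs (yb x y) = gs y + ∑ i, x.2 i ^ 2 := by
  simp only [gs, ya, yb, Xi_succ]
  rw [← Finset.sum_add_distrib, ← Finset.sum_add_distrib]
  refine Finset.sum_congr rfl fun i _ => ?_
  have := Real.sin_sq_add_cos_sq x.1
  linear_combination (y i.succ ^ 2 + x.2 i ^ 2) * this

/-- The measure of the Volterra integrals. -/
noncomputable def vmu (d : ℕ) : Measure (XX d) :=
  (volume.restrict (Set.Ioo (0:ℝ) (Real.pi / 2))).prod volume

/-- The integrand of a Volterra step. -/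
noncomputable def stepF (k : ℕ) (V Eh : EE d → ℝ) (x : XX d) (e : EE d) : ℝ :=
  (2 * Real.cos x.1 ^ (k + 1)) * (V ((vT1 d).Φ x e) * -Eh ((vT2 d).Φ x e))

/-- A Volterra step. -/
noncomputable def stepV (k : ℕ) (V Eh : EE d → ℝ) (e : EE d) : ℝ := ∫ x, stepF k V Eh x e ∂vmu d

/-- The profiles of the Volterra series. -/
noncomputable def Vt (A : Coeffs d) : ℕ → EE d → ℝ
  | 0 => Zt A
  | k + 1 => stepV k (Vt A k) (Et A)

/-- Gaussian in the variable `ξ`. -/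
noncomputable def gau (μ : ℝ) (ξ : Fin d → ℝ) : ℝ := Real.exp (-(μ * ∑ i, ξ i ^ 2))

lemma gau_eq (μ : ℝ) (ξ : Fin d → ℝ) : gau μ ξ = ∏ i, Real.exp (-μ * ξ i ^ 2) := by
  rw [gau, ← Real.exp_sum, ← Finset.mul_sum]; ring_nf

lemma gau_integrable {μ : ℝ} (hμ : 0 < μ) : Integrable (gau (d := d) μ) := by
  have : gau (d := d) μ = fun ξ => ∏ i, Real.exp (-μ * ξ i ^ 2) := funext fun ξ => gau_eq μ ξ
  rw [this]
  exact Integrable.fintype_prod (f := fun _ x => Real.exp (-μ * x ^ 2)) fun _ => integrable_exp_neg_mul_sq hμ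

/-- The dominating function. -/
noncomputable def vg (μ : ℝ) (k : ℕ) (x : XX d) : ℝ := |Real.cos x.1 ^ (k + 1)| * gau μ x.2

lemma cosInt (k : ℕ) : Integrable (fun θ : ℝ => |Real.cos θ ^ (k + 1)|) (volume.restrict (Set.Ioo (0:ℝ) (Real.pi / 2))) := by
  refine Integrable.mono' (g := fun _ => (1:ℝ)) (by simp) (by fun_prop) (ae_of_all _ fun θ => ?_)
  rw [Real.norm_eq_abs, abs_abs, abs_pow]
  exact pow_le_one₀ (abs_nonneg _) (Real.abs_cos_le_one _)

lemma vg_integrable {μ : ℝ} (hμ : 0 < μ) (k : ℕ) : Integrable (vg (d := d) μ k) (vmu d) :=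
  Integrable.mul_prod (cosInt k) (gau_integrable hμ)

/-- The decaying constants. -/
noncomputable def Jc (k : ℕ) : ℝ := ∫ θ in Set.Ioo (0:ℝ) (Real.pi / 2), |Real.cos θ ^ (k + 1)|

lemma Jc_nonneg (k : ℕ) : 0 ≤ Jc k := integral_nonneg fun _ => abs_nonneg _

lemma vg_integral (μ : ℝ) (k : ℕ) : ∫ x, vg (d := d) μ k x ∂vmu d = Jc k * ∫ ξ, gau (d := d) μ ξ :=
  integral_prod_mul (fun θ => |Real.cos θ ^ (k + 1)|) (gau (d := d) μ)

lemma Jc_tendsto : Tendsto Jc atTop (nhds 0) := by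
  have : Tendsto Jc atTop (nhds (∫ θ in Set.Ioo (0:ℝ) (Real.pi / 2), (0:ℝ))) := by
    refine tendsto_integral_of_dominated_convergence (fun _ => (1:ℝ)) (fun n => by fun_prop) (by simp)
      (fun n => ae_of_all _ fun θ => ?_) ?_
    · rw [Real.norm_eq_abs, abs_abs, abs_pow]
      exact pow_le_one₀ (abs_nonneg _) (Real.abs_cos_le_one _)
    · filter_upwards [ae_restrict_mem measurableSet_Ioo] with θ hθ
      have h1 : |Real.cos θ| < 1 := by
        have hs := Real.sin_pos_of_pos_of_lt_pi hθ.1 (by linarith [hθ.2, Real.pi_pos])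
        refine abs_lt.2 ⟨?_, ?_⟩ <;> nlinarith [Real.sin_sq_add_cos_sq θ]
      have := (tendsto_pow_atTop_nhds_zero_of_lt_one (abs_nonneg _) h1).comp (tendsto_add_atTop_nat 1)
      refine this.congr fun n => ?_
      simp [abs_pow]
  simpa using this

section Step
variable {n : ℕ} {μ : ℝ}

lemma step_bound (hμ : 0 < μ) (NE : ℕ) {CE : ℝ} (hCE : 0 ≤ CE) : ∃ C : ℝ, 0 ≤ C ∧
    ∀ (ε : ℝ) (hε : 0 ≤ ε) (Eh Eh' : EE d → ℝ), WD n ε CE NE (2 * μ) Eh Eh' →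
    ∀ (k N : ℕ) (κ : ℝ) (hκ : 0 ≤ κ) (V V' : EE d → ℝ), WD n ε κ N μ V V' →
      PD n ε (fun x e => vg μ k x * (C * κ * wb (N + (NE + n)) μ e)) (stepF k V Eh) (stepF k V' Eh') := by
  obtain ⟨C', hC', habs⟩ := absorb_poly (d := d) μ hμ n
  have hc0 := zero_le_one.trans (one_le_compC d n)
  refine ⟨2 * (2 ^ (n + 1) * (compC d n * compC d n * CE * C')), by positivity, ?_⟩
  intro ε hε Eh Eh' hE k N κ hκ V V' hV
  have h1 := PD.compΦ (vT1 d) (CD.of_unit (X := XX d) hV)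
  have h2 := (PD.compΦ (vT2 d) (CD.of_unit (X := XX d) hE)).neg
  have h3 := (PD.mul hε h1 h2).param_mul (τ := fun x : XX d => 2 * Real.cos x.1 ^ (k + 1)) (by fun_prop)
  refine PD.mono hε h3 fun x e => ?_
  show |2 * Real.cos x.1 ^ (k + 1)| * (2 ^ (n + 1) * (compC d n * (vT1 d).wt x e ^ n * (κ * wb N μ ((vT1 d).Φ x e)) *
    (compC d n * (vT2 d).wt x e ^ n * (CE * wb NE (2 * μ) ((vT2 d).Φ x e))))) ≤ _
  rw [vT2_wt, one_pow, vT1_wt, vT1_Φ, vT2_Φ, abs_mul, abs_two]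
  have hu1 : |ya x e.2 0| ≤ |e.2 0| := by
    simp only [ya, Xi_zero, mul_zero, neg_zero, add_zero, abs_mul]
    exact mul_le_of_le_one_left (abs_nonneg _) (Real.abs_cos_le_one _)
  have hu2 : |yb x e.2 0| ≤ |e.2 0| := by
    simp only [yb, Xi_zero, mul_zero, add_zero, abs_mul]
    exact mul_le_of_le_one_left (abs_nonneg _) (Real.abs_sin_le_one _)
  have hw : 1 + ∑ j, |yb x e.2 j| ≤ (1 + |e.2 0|) * (1 + ∑ j : Fin d, |yb x e.2 j.succ|) := by
    have hS : 0 ≤ ∑ i : Fin d, |yb x e.2 i.succ| := Finset.sum_nonneg fun _ _ => abs_nonneg _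
    rw [Fin.sum_univ_succ]
    nlinarith [abs_nonneg (e.2 0)]
  have hw' : (1 + ∑ j, |yb x e.2 j|) ^ n ≤ (1 + |e.2 0|) ^ n * (C' * Real.exp (μ * gs (yb x e.2))) := by
    have h0 : 0 ≤ 1 + ∑ j, |yb x e.2 j| := by positivity
    calc _ ≤ ((1 + |e.2 0|) * (1 + ∑ j : Fin d, |yb x e.2 j.succ|)) ^ n := by gcongr
      _ = (1 + |e.2 0|) ^ n * (1 + ∑ j : Fin d, |yb x e.2 j.succ|) ^ n := mul_pow _ _ _
      _ ≤ _ := by gcongr; exact habs _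
  have hwb1 : wb N μ ((fun i => e.1 i + sh (yb x e.2) i, ya x e.2) : EE d) ≤ (1 + |e.2 0|) ^ N * Real.exp (-(μ * gs (ya x e.2))) := by
    simp only [wb]; gcongr
  have hwb2 : wb NE (2 * μ) ((e.1, yb x e.2) : EE d) ≤ (1 + |e.2 0|) ^ NE * Real.exp (-(2 * μ * gs (yb x e.2))) := by
    simp only [wb]; gcongr
  have hp1 := wb_nonneg N μ ((fun i => e.1 i + sh (yb x e.2) i, ya x e.2) : EE d)
  have hp2 := wb_nonneg NE (2 * μ) ((e.1, yb x e.2) : EE d)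
  calc _ ≤ 2 * |Real.cos x.1 ^ (k + 1)| * (2 ^ (n + 1) * (compC d n * ((1 + |e.2 0|) ^ n * (C' * Real.exp (μ * gs (yb x e.2)))) *
        (κ * ((1 + |e.2 0|) ^ N * Real.exp (-(μ * gs (ya x e.2))))) *
        (compC d n * 1 * (CE * ((1 + |e.2 0|) ^ NE * Real.exp (-(2 * μ * gs (yb x e.2)))))))) := by
        gcongr
    _ = _ := by
        have hexp : Real.exp (μ * gs (yb x e.2)) * Real.exp (-(μ * gs (ya x e.2))) * Real.exp (-(2 * μ * gs (yb x e.2)))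
            = gau μ x.2 * Real.exp (-(μ * gs e.2)) := by
          rw [gau, ← Real.exp_add, ← Real.exp_add, ← Real.exp_add]
          congr 1
          linear_combination -μ * gs_ya_yb x e.2
        simp only [vg, wb]
        rw [pow_add (1 + |e.2 0|), pow_add (1 + |e.2 0|)]
        linear_combination (2 * |Real.cos x.1 ^ (k + 1)| * (2 ^ (n + 1) * compC d n * (1 + |e.2 0|) ^ n * C' * κ * (1 + |e.2 0|) ^ N *
          compC d n * CE * (1 + |e.2 0|) ^ NE)) * hexp

end Step

section Vk
variable {I : Type} {lam : ℝ} {ε : I → ℝ} {n : ℕ} {A A' : I → Coeffs d}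

/-- The decay rate of the profiles. -/
noncomputable def mu (lam : ℝ) : ℝ := lam / 16

/-- Bounds on all the profiles. -/
lemma Good.Vt (h : Good lam ε (n + 2) A A') : ∃ C κ : ℝ, 0 ≤ C ∧ 0 ≤ κ ∧
    ∀ i k, WD n (ε i) (κ * ∏ j ∈ Finset.range k, (C * Jc j)) (k * (2 * n + 2)) (mu lam) (Vt (A i) k) (Vt (A' i) k) := by
  have hμ : 0 < mu lam := by have := h.pos; unfold mu; linarith
  obtain ⟨κ, hκ, hZ⟩ := h.Zt (β := mu lam) (by unfold mu; linarith [h.pos])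
  obtain ⟨CE, hCE, hE⟩ := h.Et (β := 2 * mu lam) (by unfold mu; linarith [h.pos])
  obtain ⟨C, hC, hS⟩ := step_bound (d := d) (n := n) hμ (n + 2) hCE
  have hG : 0 ≤ ∫ ξ, gau (d := d) (mu lam) ξ := integral_nonneg fun ξ => (Real.exp_pos _).le
  refine ⟨C * ∫ ξ, gau (d := d) (mu lam) ξ, κ, by positivity, hκ, fun i k => ?_⟩
  have hC' : ∀ k, 0 ≤ κ * ∏ j ∈ Finset.range k, ((C * ∫ ξ, gau (d := d) (mu lam) ξ) * Jc j) := fun k =>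
    mul_nonneg hκ (Finset.prod_nonneg fun j _ => by have := Jc_nonneg j; positivity)
  induction k with
  | zero =>
    have := (hZ i).le (show n ≤ n + 2 by omega)
    simpa [VarBPHZ.Vt] using this
  | succ k ih =>
    have h1 := hS (ε i) (h.hε i) _ _ (hE i) k _ _ (hC' k) _ _ ih
    have h2 := PD.integral h1 (vg_integrable hμ k) (by have := wb_cont (d := d) (k * (2 * n + 2) + (n + 2 + n)) (mu lam); fun_prop)
    refine CD.wd (h.hε i) h2 fun e => le_of_eq ?_
    show (∫ x, vg (mu lam) k x ∂vmu d) * _ = _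
    rw [vg_integral, Finset.prod_range_succ, show k * (2 * n + 2) + (n + 2 + n) = (k + 1) * (2 * n + 2) by ring]
    ring

end Vk

lemma summable_kappa (C s : ℝ) (hC : 0 ≤ C) (hs : 0 ≤ s) (κ : ℝ) :
    Summable fun k => (κ * ∏ j ∈ Finset.range k, (C * Jc j)) * s ^ k := by
  have key : Summable fun k => (∏ j ∈ Finset.range k, ((C * s) * Jc j + 0)) := by
    refine summable_of_ratio_norm_eventually_le (r := 1 / 2) (by norm_num) ?_
    have := (Jc_tendsto.const_mul (C * s))
    rw [mul_zero] at this
    filter_upwards [this.eventually_le_const (show (0:ℝ) < 1 / 2 by norm_num)] with k hk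
    rw [Finset.prod_range_succ, norm_mul, mul_comm]
    refine mul_le_mul_of_nonneg_right ?_ (norm_nonneg _)
    rw [add_zero, Real.norm_of_nonneg (by have := Jc_nonneg k; positivity)]
    exact hk
  refine (key.mul_left κ).congr fun k => ?_
  rw [mul_assoc]
  congr 1
  simp only [add_zero, Finset.prod_mul_distrib, Finset.prod_const, Finset.card_range, mul_pow]
  ring

end

section

set_option linter.unusedSectionVars false
set_option linter.unusedVariables false

/-! ## Good families from the regularity assumption -/

/-- Index set of quantified neighbourhoods. -/
abbrev Nbd (lam : ℝ) (ρ : ℕ) (A : Coeffs d) : Type :=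
  {p : Coeffs d × ℝ // ParReg lam ρ p.1 ∧ 0 ≤ p.2 ∧ p.2 ≤ 1 ∧ coeffDist ρ A p.1 ≤ p.2}

lemma cpar_UW {lam : ℝ} {ρ n : ℕ} (hn : 2 * n ≤ ρ) {A : Coeffs d} {f : Pt d → ℝ} (hf : MemCpar ρ f)
    {f' : Nbd lam ρ A → Pt d → ℝ} (hf' : ∀ p, MemCpar ρ (f' p))
    (hd : ∀ p, cparNorm ρ (fun z => f z - f' p z) ≤ p.1.2) :
    UW (fun p : Nbd lam ρ A => p.1.2) n 0 0 (fun _ => lift f) (fun p => lift (f' p)) := by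
  obtain ⟨Q, hQ⟩ := hf.exists_bound
  refine ⟨|Q| + 2, by positivity, fun p => ?_⟩
  have hs : ∀ k : Fin (d + 1) → ℕ, pdeg k ≤ ρ → ∀ z, |mderiv k (fun z => f z - f' p z) z| ≤ p.1.2 := fun k hk z =>
    ((hf.sub (hf' p)).le_cparNorm hk z).trans (hd p)
  have := CD_lift (Q := |Q| + 2) hf (hf' p) p.2.2.1 (by linarith [abs_nonneg Q])
    (fun k hk z => (hQ k hk z).trans (by linarith [le_abs_self Q])) (fun k hk z => ?_) hs hn
  · refine CD.wd p.2.2.1 this fun e => ?_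
    simp [wb]
  · have h1 := hs k hk z
    rw [mderiv_sub hf.1 (hf' p).1 k hk] at h1
    have h2 := hQ k hk z
    have h3 := p.2.2.2.1
    have h4 := le_abs_self Q
    rw [abs_le] at *
    constructor <;> linarith [h1.1, h1.2, h2.1, h2.2]

lemma coeffDist_a (ρ : ℕ) (A B : Coeffs d) (i j : Fin d) :
    cparNorm ρ (fun z => A.a z i j - B.a z i j) ≤ coeffDist ρ A B := by
  have h1 : cparNorm ρ (fun z => A.a z i j - B.a z i j) ≤ sSup {y | ∃ i j, y = cparNorm ρ fun z => (coeffSub A B).a z i j} := by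
    refine le_csSup ?_ ⟨i, j, rfl⟩
    refine Set.Finite.bddAbove (Set.Finite.subset (Set.finite_range fun ij : Fin d × Fin d => cparNorm ρ fun z => (coeffSub A B).a z ij.1 ij.2) ?_)
    rintro y ⟨i, j, rfl⟩; exact ⟨(i, j), rfl⟩
  have h2 : 0 ≤ sSup {y | ∃ i, y = cparNorm ρ fun z => (coeffSub A B).b z i} :=
    Real.sSup_nonneg (by rintro y ⟨i, rfl⟩; exact cparNorm_nonneg _ _)
  have h3 := cparNorm_nonneg ρ (coeffSub A B).c
  unfold coeffDist coeffNorm; linarith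

lemma coeffDist_b (ρ : ℕ) (A B : Coeffs d) (i : Fin d) :
    cparNorm ρ (fun z => A.b z i - B.b z i) ≤ coeffDist ρ A B := by
  have h1 : cparNorm ρ (fun z => A.b z i - B.b z i) ≤ sSup {y | ∃ i, y = cparNorm ρ fun z => (coeffSub A B).b z i} := by
    refine le_csSup ?_ ⟨i, rfl⟩
    refine Set.Finite.bddAbove (Set.Finite.subset (Set.finite_range fun i : Fin d => cparNorm ρ fun z => (coeffSub A B).b z i) ?_)
    rintro y ⟨i, rfl⟩; exact ⟨i, rfl⟩
  have h2 : 0 ≤ sSup {y | ∃ i j, y = cparNorm ρ fun z => (coeffSub A B).a z i j} :=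
    Real.sSup_nonneg (by rintro y ⟨i, j, rfl⟩; exact cparNorm_nonneg _ _)
  have h3 := cparNorm_nonneg ρ (coeffSub A B).c
  unfold coeffDist coeffNorm; linarith

lemma coeffDist_c (ρ : ℕ) (A B : Coeffs d) :
    cparNorm ρ (fun z => A.c z - B.c z) ≤ coeffDist ρ A B := by
  have h1 : 0 ≤ sSup {y | ∃ i, y = cparNorm ρ fun z => (coeffSub A B).b z i} :=
    Real.sSup_nonneg (by rintro y ⟨i, rfl⟩; exact cparNorm_nonneg _ _)
  have h2 : 0 ≤ sSup {y | ∃ i j, y = cparNorm ρ fun z => (coeffSub A B).a z i j} :=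
    Real.sSup_nonneg (by rintro y ⟨i, j, rfl⟩; exact cparNorm_nonneg _ _)
  have h3 : cparNorm ρ (fun z => A.c z - B.c z) = cparNorm ρ (coeffSub A B).c := rfl
  unfold coeffDist coeffNorm; linarith

lemma good_of {lam : ℝ} (hlam : 0 < lam) {ρ n : ℕ} (hn : 2 * n ≤ ρ) {A : Coeffs d} (hA : ParReg lam ρ A) :
    Good lam (fun p : Nbd lam ρ A => p.1.2) n (fun _ => A) (fun p => p.1.1) where
  pos := hlam
  hε := fun p => p.2.2.1
  el := fun _ => hA.ell
  er := fun p => p.2.1.ell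
  ha := fun i j => cpar_UW hn (hA.areg i j) (fun p => p.2.1.areg i j) fun p => (coeffDist_a ρ A p.1.1 i j).trans p.2.2.2.2
  hb := fun i => cpar_UW hn (hA.breg i) (fun p => p.2.1.breg i) fun p => (coeffDist_b ρ A p.1.1 i).trans p.2.2.2.2
  hc := cpar_UW hn hA.creg (fun p => p.2.1.creg) fun p => (coeffDist_c ρ A p.1.1).trans p.2.2.2.2

lemma mderiv_const_zero (k : Fin (d + 1) → ℕ) : mderiv k (fun _ : Pt d => (0:ℝ)) = fun _ => 0 := by
  induction k using midx_induction with
  | h0 => rw [mderiv_zero]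
  | hs k j hk ih =>
    rw [mderiv_head k j hk, ih k le_rfl]
    funext z; simp [pd]

lemma coeffDist_self (ρ : ℕ) (A : Coeffs d) : coeffDist ρ A A ≤ 0 := by
  have h0 : cparNorm ρ (fun _ : Pt d => (0:ℝ)) = 0 := by
    refine le_antisymm (Real.sSup_le ?_ le_rfl) (cparNorm_nonneg _ _)
    rintro y ⟨k, z, hk, rfl⟩
    simp [mderiv_const_zero]
  unfold coeffDist coeffNorm coeffSub
  simp only [sub_self, Matrix.zero_apply, Pi.zero_apply, h0]
  have h1 : sSup {y : ℝ | ∃ i j : Fin d, y = 0} ≤ 0 := Real.sSup_le (by rintro y ⟨i, j, rfl⟩; rfl) le_rfl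
  have h2 : sSup {y : ℝ | ∃ i : Fin d, y = 0} ≤ 0 := Real.sSup_le (by rintro y ⟨i, rfl⟩; rfl) le_rfl
  linarith

/-- The base point of the neighbourhood. -/
def nbd0 {lam : ℝ} {ρ : ℕ} {A : Coeffs d} (hA : ParReg lam ρ A) : Nbd lam ρ A :=
  ⟨(A, 0), hA, le_rfl, zero_le_one, coeffDist_self ρ A⟩

/-! ## Kernels from profiles -/

/-- The self-similar variables. -/
noncomputable def vv (ζ : Pt d) : Pt d := Fin.cons (Real.sqrt (ζ 0)) fun i : Fin d => ζ i.succ / Real.sqrt (ζ 0)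

@[simp] lemma vv_zero (ζ : Pt d) : vv ζ 0 = Real.sqrt (ζ 0) := rfl
@[simp] lemma vv_succ (ζ : Pt d) (i : Fin d) : vv ζ i.succ = ζ i.succ / Real.sqrt (ζ 0) := rfl

lemma vv_sh {y : Pt d} (hy : 0 < y 0) : vv (sh y) = y := by
  funext i
  refine Fin.cases ?_ (fun i => ?_) i
  · simp [sh, Real.sqrt_mul_self hy.le]
  · simp only [vv_succ, sh]
    rw [Real.sqrt_mul_self hy.le]; field_simp

lemma sh_vv {ζ : Pt d} (hζ : 0 < ζ 0) : sh (vv ζ) = ζ := by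
  have := Real.sqrt_pos.2 hζ
  funext i
  refine Fin.cases ?_ (fun i => ?_) i
  · simp [sh, Real.mul_self_sqrt hζ.le]
  · simp only [vv_succ, sh, vv_zero]
    field_simp

/-- The kernel of homogeneity `p` with profile `G`. -/
noncomputable def KK (p : ℤ) (G : EE d → ℝ) (e : EE d) : ℝ :=
  if 0 < e.2 0 then Real.sqrt (e.2 0) ^ p * G (e.1, vv e.2) else 0

lemma KK_pos {p : ℤ} {G : EE d → ℝ} {e : EE d} (h : 0 < e.2 0) : KK p G e = Real.sqrt (e.2 0) ^ p * G (e.1, vv e.2) := if_pos h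
lemma KK_neg {p : ℤ} {G : EE d → ℝ} {e : EE d} (h : ¬ 0 < e.2 0) : KK p G e = 0 := if_neg h

lemma isOpen_pos : IsOpen {e : EE d | 0 < e.2 0} := isOpen_lt continuous_const (by fun_prop)
lemma isOpen_neg : IsOpen {e : EE d | e.2 0 < 0} := isOpen_lt (by fun_prop) continuous_const

lemma KK_ev_pos {p : ℤ} {G : EE d → ℝ} {e : EE d} (h : 0 < e.2 0) :
    KK p G =ᶠ[nhds e] fun e => Real.sqrt (e.2 0) ^ p * G (e.1, vv e.2) := by
  filter_upwards [isOpen_pos.mem_nhds h] with e he using KK_pos he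

lemma KK_ev_neg {p : ℤ} {G : EE d → ℝ} {e : EE d} (h : e.2 0 < 0) : KK p G =ᶠ[nhds e] fun _ => 0 := by
  filter_upwards [isOpen_neg.mem_nhds h] with e he using KK_neg (not_lt.2 (le_of_lt he))

lemma vv_diff {e : EE d} (h : 0 < e.2 0) : DifferentiableAt ℝ (fun e : EE d => vv e.2) e := by
  have hs : DifferentiableAt ℝ (fun e : EE d => Real.sqrt (e.2 0)) e :=
    DifferentiableAt.sqrt (f := fun e : EE d => e.2 0) (by fun_prop) h.ne'
  refine differentiableAt_pi.2 fun i => ?_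
  refine Fin.cases ?_ (fun i => ?_) i
  · exact hs
  · have h1 : DifferentiableAt ℝ (fun e : EE d => e.2 i.succ) e := by fun_prop
    simp only [vv_succ, div_eq_mul_inv]
    exact h1.mul (hs.inv (Real.sqrt_pos.2 h).ne')

lemma vvp_diff {e : EE d} (h : 0 < e.2 0) : DifferentiableAt ℝ (fun e : EE d => ((e.1, vv e.2) : EE d)) e :=
  DifferentiableAt.prodMk (by fun_prop) (vv_diff h)

lemma KK_diff {p : ℤ} {G : EE d → ℝ} (hG : Differentiable ℝ G) {e : EE d} (h : e.2 0 ≠ 0) :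
    DifferentiableAt ℝ (KK p G) e := by
  rcases lt_or_gt_of_ne h with h | h
  · exact (KK_ev_neg h).differentiableAt_iff.2 (by fun_prop)
  · refine (KK_ev_pos h).differentiableAt_iff.2 ?_
    have hs : DifferentiableAt ℝ (fun e : EE d => Real.sqrt (e.2 0)) e :=
      DifferentiableAt.sqrt (f := fun e : EE d => e.2 0) (by fun_prop) h.ne'
    refine DifferentiableAt.mul ?_ ?_
    · exact (differentiableAt_zpow.2 (Or.inl (Real.sqrt_pos.2 h).ne')).comp e hs
    · exact (hG (e.1, vv e.2)).comp (f := fun e : EE d => ((e.1, vv e.2) : EE d)) e (vvp_diff h)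

lemma D_line_at {f : EE d → ℝ} {e : EE d} (hf : DifferentiableAt ℝ f e) (i : Ix d) {c : ℝ}
    (h : HasDerivAt (fun t : ℝ => f (e + t • dir i)) c 0) : D i f e = c := by
  have h1 : HasDerivAt (fun t : ℝ => e + t • dir i) (dir i) 0 := by
    have := ((hasDerivAt_id (0:ℝ)).smul_const (dir i)).const_add e
    simpa using this
  have h2 : HasFDerivAt f (fderiv ℝ f e) (e + (0:ℝ) • dir i) := by simpa using hf.hasFDerivAt
  exact (h2.comp_hasDerivAt (0:ℝ) h1).unique h

lemma D_neg_side {f : EE d → ℝ} {e : EE d} (hf : f =ᶠ[nhds e] fun _ => 0) (i : Ix d) : D i f e = 0 := by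
  unfold D; rw [hf.fderiv_eq]; simp

lemma line_G {G : EE d → ℝ} (hG : Differentiable ℝ G) {γ : ℝ → EE d} {γ' : EE d} {t : ℝ} (h : HasDerivAt γ γ' t) :
    HasDerivAt (fun t => G (γ t)) (∑ i, crd i γ' * D i G (γ t)) t := by
  have := (hG (γ t)).hasFDerivAt.comp_hasDerivAt t h
  rwa [fderiv_apply_eq] at this

lemma D_KK_inl {p : ℤ} {G : EE d → ℝ} (hG : Differentiable ℝ G) {e : EE d} (h : e.2 0 ≠ 0) (i : Fin (d + 1)) :
    D (Sum.inl i) (KK p G) e = KK p (D (Sum.inl i) G) e := by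
  rcases lt_or_gt_of_ne h with h0 | h0
  · rw [D_neg_side (KK_ev_neg h0), KK_neg (not_lt.2 h0.le)]
  · refine D_line_at (KK_diff hG h) _ ?_
    have hγ : HasDerivAt (fun t : ℝ => ((e.1 + t • Pi.single i 1, vv e.2) : EE d)) (Pi.single i 1, 0) 0 := by
      refine HasDerivAt.prodMk ?_ (hasDerivAt_const _ _)
      simpa using ((hasDerivAt_id (0:ℝ)).smul_const (Pi.single i (1:ℝ) : Pt d)).const_add e.1
    have h1 := (line_G hG hγ).const_mul (Real.sqrt (e.2 0) ^ p)
    refine (h1.congr_deriv ?_).congr_of_eventuallyEq (Eventually.of_forall fun t => ?_)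
    · rw [KK_pos h0]
      simp [Pi.single_apply]
    · simp only [dir, Sum.elim_inl]
      rw [KK_pos (by simpa using h0)]
      simp

lemma D_KK_succ {p : ℤ} {G : EE d → ℝ} (hG : Differentiable ℝ G) {e : EE d} (h : e.2 0 ≠ 0) (i : Fin d) :
    D (Sum.inr i.succ) (KK p G) e = KK (p - 1) (D (Sum.inr i.succ) G) e := by
  rcases lt_or_gt_of_ne h with h0 | h0
  · rw [D_neg_side (KK_ev_neg h0), KK_neg (not_lt.2 h0.le)]
  · refine D_line_at (KK_diff hG h) _ ?_
    have hs := Real.sqrt_pos.2 h0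
    have hγ : HasDerivAt (fun t : ℝ => ((e.1, vv e.2 + t • ((Real.sqrt (e.2 0))⁻¹ • Pi.single i.succ 1)) : EE d))
        (0, (Real.sqrt (e.2 0))⁻¹ • Pi.single i.succ 1) 0 := by
      refine HasDerivAt.prodMk (hasDerivAt_const _ _) ?_
      have := ((hasDerivAt_id (0:ℝ)).smul_const ((Real.sqrt (e.2 0))⁻¹ • Pi.single i.succ (1:ℝ) : Pt d)).const_add (vv e.2)
      simpa using this
    have h1 := (line_G hG hγ).const_mul (Real.sqrt (e.2 0) ^ p)
    refine (h1.congr_deriv ?_).congr_of_eventuallyEq (Eventually.of_forall fun t => ?_)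
    · rw [KK_pos h0, zpow_sub_one₀ hs.ne']
      simp [Pi.single_apply, mul_assoc]
    · simp only [dir, Sum.elim_inr]
      rw [KK_pos (by simpa using h0)]
      have : vv (e + t • ((0, Pi.single i.succ 1) : EE d)).2 = vv e.2 + t • ((Real.sqrt (e.2 0))⁻¹ • Pi.single i.succ 1) := by
        funext j
        refine Fin.cases ?_ (fun j => ?_) j
        · simp
        · simp [Pi.single_apply, add_div]
          split_ifs
          · field_simp
          · simp
      rw [this]
      simp

/-- The radial derivative of a profile. -/
noncomputable def rad (p : ℤ) (G : EE d → ℝ) (e : EE d) : ℝ :=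
  (1 / 2) * ((p : ℝ) * G e + e.2 0 * D (Sum.inr 0) G e - ∑ i : Fin d, e.2 i.succ * D (Sum.inr i.succ) G e)

lemma D_KK_zero {p : ℤ} {G : EE d → ℝ} (hG : Differentiable ℝ G) {e : EE d} (h : e.2 0 ≠ 0) :
    D (Sum.inr 0) (KK p G) e = KK (p - 2) (rad p G) e := by
  rcases lt_or_gt_of_ne h with h0 | h0
  · rw [D_neg_side (KK_ev_neg h0), KK_neg (not_lt.2 h0.le)]
  · refine D_line_at (KK_diff hG h) _ ?_
    have hs := Real.sqrt_pos.2 h0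
    have hsq := Real.mul_self_sqrt h0.le
    set u := Real.sqrt (e.2 0) with hu
    have hr : HasDerivAt (fun t : ℝ => Real.sqrt (e.2 0 + t)) (1 / (2 * u)) 0 := by
      have := ((hasDerivAt_id (0:ℝ)).const_add (e.2 0)).sqrt (by simpa using h0.ne')
      simpa using this
    have hγ : HasDerivAt (fun t : ℝ => ((e.1, Fin.cons (Real.sqrt (e.2 0 + t)) fun i : Fin d => e.2 i.succ / Real.sqrt (e.2 0 + t)) : EE d))
        (0, Fin.cons (1 / (2 * u)) fun i : Fin d => -(e.2 i.succ * (1 / (2 * u))) / u ^ 2) 0 := by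
      refine HasDerivAt.prodMk (hasDerivAt_const _ _) (hasDerivAt_pi.2 fun j => ?_)
      refine Fin.cases ?_ (fun j => ?_) j
      · simpa using hr
      · have := (hasDerivAt_const (0:ℝ) (e.2 j.succ)).div hr (by simpa using hs.ne')
        refine this.congr_deriv ?_
        simp [← hu]
    have hz : HasDerivAt (fun t : ℝ => Real.sqrt (e.2 0 + t) ^ p) (p * u ^ (p - 1) * (1 / (2 * u))) 0 := by
      have := (hasDerivAt_zpow p (Real.sqrt (e.2 0 + 0)) (by left; simpa using hs.ne')).comp (0:ℝ) hr
      refine this.congr_deriv ?_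
      simp [← hu]
    have h1 := hz.mul (line_G hG hγ)
    refine (h1.congr_deriv ?_).congr_of_eventuallyEq ?_
    · rw [KK_pos h0, ← hu, show p - 2 = p - 1 - 1 by ring, zpow_sub_one₀ hs.ne', zpow_sub_one₀ hs.ne']
      simp only [add_zero, ← hu, Fintype.sum_sum_type, crd_inl, crd_inr, Pi.zero_apply, zero_mul, Finset.sum_const_zero, zero_add,
        Fin.sum_univ_succ, Fin.cons_zero, Fin.cons_succ]
      simp only [rad, vv_zero, vv_succ, ← hu]
      have hvv : (Fin.cons u fun i : Fin d => e.2 i.succ / u) = vv e.2 := rfl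
      have hsum : ∑ x : Fin d, -(e.2 x.succ * (1 / (2 * u))) / u ^ 2 * D (Sum.inr x.succ) G (e.1, vv e.2)
          = -(1 / (2 * u ^ 2)) * ∑ x : Fin d, e.2 x.succ / u * D (Sum.inr x.succ) G (e.1, vv e.2) := by
        rw [Finset.mul_sum]
        refine Finset.sum_congr rfl fun i _ => ?_
        field_simp
      rw [hvv, hsum]
      generalize ∑ x : Fin d, e.2 x.succ / u * D (Sum.inr x.succ) G (e.1, vv e.2) = S
      have hup : u ^ p = u ^ (p - 1) * u := by rw [zpow_sub_one₀ hs.ne']; field_simp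
      rw [hup]
      field_simp
      ring
    · have : ∀ᶠ t : ℝ in nhds 0, 0 < e.2 0 + t :=
        (continuous_const.add continuous_id).continuousAt.eventually (lt_mem_nhds (by simpa using h0))
      filter_upwards [this] with t ht
      simp only [dir, Sum.elim_inr]
      rw [KK_pos (by simpa using ht)]
      have h2 : vv (e + t • ((0, Pi.single 0 1) : EE d)).2 = Fin.cons (Real.sqrt (e.2 0 + t)) fun i : Fin d => e.2 i.succ / Real.sqrt (e.2 0 + t) := by
        funext j
        refine Fin.cases ?_ (fun j => ?_) j <;> simp
      rw [h2]
      simp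

end

section

set_option linter.unusedSectionVars false
set_option linter.unusedVariables false

/-! ## Identification of the Volterra series -/

lemma pd_slice_sub {F : EE d → ℝ} {zb z : Pt d} (hF : DifferentiableAt ℝ F (zb, z - zb)) (i : Fin (d + 1)) :
    pd i (fun y => F (zb, y - zb)) z = D (Sum.inr i) F (zb, z - zb) := by
  unfold pd D
  have h1 : HasFDerivAt (fun y : Pt d => ((zb, y - zb) : EE d)) (ContinuousLinearMap.prod (0 : Pt d →L[ℝ] Pt d) (ContinuousLinearMap.id ℝ (Pt d))) z := by
    have := (hasFDerivAt_const zb z).prodMk ((hasFDerivAt_id (𝕜 := ℝ) z).sub_const zb)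
    exact this
  have h2 := hF.hasFDerivAt.comp z h1
  have h3 : (fun y => F (zb, y - zb)) = F ∘ fun y => (zb, y - zb) := rfl
  rw [h3, h2.fderiv]
  simp [dir]

lemma Wker_eq (A : Coeffs d) (w ζ : Pt d) : Wker A w ζ = KK (-(d:ℤ)) (Zt A) (w, ζ) := by
  unfold Wker KK
  split_ifs with h
  · have hs := Real.sqrt_pos.2 h
    have h1 : ζ 0 ^ (-(d : ℝ) / 2) = Real.sqrt (ζ 0) ^ (-(d:ℤ)) := by
      rw [← Real.rpow_intCast, Real.sqrt_eq_rpow, ← Real.rpow_mul h.le]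
      congr 1
      push_cast; ring
    have h2 : -(∑ i, ∑ j, (A.a w)⁻¹ i j * ζ i.succ * ζ j.succ) / (4 * ζ 0) = -(1 / 4) * qf A (w, vv ζ) := by
      simp only [qf, vv_succ]
      have : ∀ i j : Fin d, (A.a w)⁻¹ i j * (ζ i.succ / Real.sqrt (ζ 0)) * (ζ j.succ / Real.sqrt (ζ 0))
          = ((A.a w)⁻¹ i j * ζ i.succ * ζ j.succ) / ζ 0 := by
        intro i j
        rw [← mul_div_assoc, mul_div_assoc, mul_assoc, div_mul_div_comm, Real.mul_self_sqrt h.le]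
        ring
      simp only [this, ← Finset.sum_div]
      field_simp
    rw [h1, h2, Zt]
    ring
  · rfl

lemma Zker_eq (A : Coeffs d) (z zb : Pt d) : Zker A z zb = KK (-(d:ℤ)) (Zt A) (zb, z - zb) := Wker_eq A zb (z - zb)

section E
variable {A : Coeffs d} {b : EE d → ℝ}

lemma ZkerD_eq (hZ : CB 2 b (Zt A)) (i : Fin d) {z zb : Pt d} (h : z 0 ≠ zb 0) :
    ZkerD A i z zb = KK (-(d:ℤ) - 1) (D (Sum.inr i.succ) (Zt A)) (zb, z - zb) := by
  unfold ZkerD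
  have h0 : (z - zb) 0 ≠ 0 := by simpa [sub_ne_zero] using h
  have : (fun y => Zker A y zb) = fun y => KK (-(d:ℤ)) (Zt A) (zb, y - zb) := funext fun y => Zker_eq A y zb
  rw [this, pd_slice_sub (KK_diff (hZ.diff) h0), D_KK_succ hZ.diff h0]

lemma ZkerDD_eq (hZ : CB 2 b (Zt A)) (i j : Fin d) {z zb : Pt d} (h : z 0 ≠ zb 0) :
    ZkerDD A i j z zb = KK (-(d:ℤ) - 2) (D (Sum.inr i.succ) (D (Sum.inr j.succ) (Zt A))) (zb, z - zb) := by
  have h0 : (z - zb) 0 ≠ 0 := by simpa [sub_ne_zero] using h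
  have hD : Differentiable ℝ (D (Sum.inr j.succ) (Zt A)) := (hZ.deriv _).diff
  have hev : (fun y => pd j.succ (fun y' => Zker A y' zb) y) =ᶠ[nhds z]
      fun y => KK (-(d:ℤ) - 1) (D (Sum.inr j.succ) (Zt A)) (zb, y - zb) := by
    have : {y : Pt d | y 0 ≠ zb 0} ∈ nhds z := (isOpen_ne_fun (by fun_prop) continuous_const).mem_nhds h
    filter_upwards [this] with y hy using ZkerD_eq hZ j hy
  unfold ZkerDD
  have : pd i.succ (fun y => pd j.succ (fun y' => Zker A y' zb) y) z
      = pd i.succ (fun y => KK (-(d:ℤ) - 1) (D (Sum.inr j.succ) (Zt A)) (zb, y - zb)) z := by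
    unfold pd at hev ⊢; rw [hev.fderiv_eq]
  rw [this, pd_slice_sub (KK_diff hD h0), D_KK_succ hD h0]
  congr 1; ring

lemma shf_point (f : Pt d → ℝ) {z zb : Pt d} (h : 0 < (z - zb) 0) : shf f (zb, vv (z - zb)) = f z := by
  unfold shf shear
  congr 1
  funext i
  have := congrFun (sh_vv h) i
  simp only [sh] at this
  simp only [one_mul, this]
  simp

lemma shf_ev (f : Pt d → ℝ) (e : EE d) : shf f (ev e) = f e.1 := by
  unfold shf shear ev
  simp

lemma Eker_eq (hZ : CB 2 b (Zt A)) {b' : EE d → ℝ} (ha : ∀ i j, CB 1 b' (shf fun z => A.a z i j)) {z zb : Pt d} (h : z 0 ≠ zb 0) :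
    Eker A z zb = KK (-(d:ℤ) - 1) (Et A) (zb, z - zb) := by
  have h0 : (z - zb) 0 ≠ 0 := by simpa [sub_ne_zero] using h
  unfold Eker
  simp only [ZkerDD_eq hZ _ _ h, ZkerD_eq hZ _ h, Zker_eq]
  by_cases hp : 0 < (z - zb) 0
  · have hs := Real.sqrt_pos.2 hp
    have hp' : 0 < ((zb, z - zb) : EE d).2 0 := hp
    simp only [KK_pos hp', Et]
    set u := Real.sqrt ((z - zb) 0) with hu
    set e : EE d := (zb, vv (z - zb)) with he
    have he0 : e.2 0 = u := rfl
    have hta : ∀ i j, A.a zb i j - A.a z i j = -(u * Iop (shf fun z => A.a z i j) e) := by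
      intro i j
      have := taylor_one (ha i j) e
      rw [shf_ev, shf_point _ hp, he0] at this
      simp only [he] at this ⊢
      linarith
    have hz1 : u ^ (-(d:ℤ) - 2) * u = u ^ (-(d:ℤ) - 1) := by
      rw [← zpow_add_one₀ hs.ne']; congr 1; ring
    have hz2 : u ^ (-(d:ℤ) - 1) * u = u ^ (-(d:ℤ)) := by
      rw [← zpow_add_one₀ hs.ne']; congr 1; ring
    simp only [hta, he0, shf_point _ hp, he]
    rw [← hz2, ← hz1]
    simp only [mul_sub, mul_neg, Finset.mul_sum, neg_mul, Finset.sum_neg_distrib]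
    congr 1
    · congr 1
      · congr 1
        refine Finset.sum_congr rfl fun i _ => Finset.sum_congr rfl fun j _ => ?_
        ring
      · refine Finset.sum_congr rfl fun i _ => ?_
        ring
    · rw [show vv (z - zb) 0 = u from rfl]; ring
  · have hp' : ¬ 0 < ((zb, z - zb) : EE d).2 0 := hp
    simp only [KK_neg hp']
    simp

end E

/-! ### The change of variables -/

/-- Splitting space and time. -/
lemma integral_split (f : Pt d → ℝ) : ∫ ζ, f ζ = ∫ p : ℝ × (Fin d → ℝ), f (Fin.cons p.1 p.2) := by
  have hem := (volume_preserving_piFinSuccAbove (fun _ : Fin (d + 1) => ℝ) 0).symm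
  rw [← hem.integral_comp' ]
  refine integral_congr_ae (Eventually.of_forall fun p => ?_)
  show f _ = f _
  congr 1
  funext i
  refine Fin.cases ?_ (fun i => ?_) i <;> simp [MeasurableEquiv.piFinSuccAbove]

/-- The change of variables map. -/
noncomputable def Psi (zb y : Pt d) (x : XX d) : XX d :=
  (zb 0 + sh (yb x y) 0, fun i => zb i.succ + sh (yb x y) i.succ)

/-- Its derivative. -/
noncomputable def Psi' (y : Pt d) (x : XX d) : XX d →L[ℝ] XX d :=
  ((2 * (y 0 * y 0) * Real.sin x.1 * Real.cos x.1) • ContinuousLinearMap.fst ℝ ℝ (Fin d → ℝ)).prod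
    ((ContinuousLinearMap.fst ℝ ℝ (Fin d → ℝ)).smulRight
      (fun i : Fin d => y 0 * (2 * Real.sin x.1 * Real.cos x.1 * y i.succ + (Real.cos x.1 ^ 2 - Real.sin x.1 ^ 2) * x.2 i)) +
      (y 0 * Real.sin x.1 * Real.cos x.1) • ContinuousLinearMap.snd ℝ ℝ (Fin d → ℝ))

lemma Psi_hasFDeriv (zb y : Pt d) (x : XX d) : HasFDerivAt (Psi zb y) (Psi' y x) x := by
  have hθ : HasFDerivAt (fun x : XX d => x.1) (ContinuousLinearMap.fst ℝ ℝ (Fin d → ℝ)) x := hasFDerivAt_fst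
  have hsin := hθ.sin
  have hcos := hθ.cos
  refine HasFDerivAt.prodMk ?_ (hasFDerivAt_pi'.2 fun i => ?_)
  · have h1 : HasFDerivAt (fun x : XX d => zb 0 + (Real.sin x.1 * y 0) * (Real.sin x.1 * y 0)) _ x :=
      ((hsin.mul_const (y 0)).mul (hsin.mul_const (y 0))).const_add (zb 0)
    have h2 : (fun x : XX d => zb 0 + sh (yb x y) 0) = fun x => zb 0 + (Real.sin x.1 * y 0) * (Real.sin x.1 * y 0) := by
      funext x; simp [sh, yb]
    rw [h2]
    refine h1.congr_fderiv ?_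
    ext p <;> simp
    ring
  · have hξ : HasFDerivAt (fun x : XX d => x.2 i) ((ContinuousLinearMap.proj i).comp (ContinuousLinearMap.snd ℝ ℝ (Fin d → ℝ))) x :=
      ((ContinuousLinearMap.proj (R := ℝ) (φ := fun _ : Fin d => ℝ) i).comp (ContinuousLinearMap.snd ℝ ℝ (Fin d → ℝ))).hasFDerivAt
    have h1 : HasFDerivAt (fun x : XX d => zb i.succ + (Real.sin x.1 * y 0) * (Real.sin x.1 * y i.succ + Real.cos x.1 * x.2 i)) _ x :=
      ((hsin.mul_const (y 0)).mul ((hsin.mul_const (y i.succ)).add (hcos.mul hξ))).const_add (zb i.succ)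
    have h2 : (fun x : XX d => zb i.succ + sh (yb x y) i.succ) = fun x : XX d => zb i.succ + (Real.sin x.1 * y 0) * (Real.sin x.1 * y i.succ + Real.cos x.1 * x.2 i) := by
      funext x; simp [sh, yb]
    show HasFDerivAt (fun x : XX d => zb i.succ + sh (yb x y) i.succ) _ x
    rw [h2]
    refine h1.congr_fderiv ?_
    ext p
    · simp
      ring
    · simp
      ring

lemma Psi_det (y : Pt d) (x : XX d) (hm : y 0 * Real.sin x.1 * Real.cos x.1 ≠ 0) :
    (Psi' y x).det = (2 * (y 0 * y 0) * Real.sin x.1 * Real.cos x.1) * (y 0 * Real.sin x.1 * Real.cos x.1) ^ d := by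
  set m := y 0 * Real.sin x.1 * Real.cos x.1 with hmd
  set a := 2 * (y 0 * y 0) * Real.sin x.1 * Real.cos x.1 with ha
  set ℓ : Fin d → ℝ := fun i : Fin d => y 0 * (2 * Real.sin x.1 * Real.cos x.1 * y i.succ + (Real.cos x.1 ^ 2 - Real.sin x.1 ^ 2) * x.2 i) with hℓ
  have h1 : ((Psi' y x : XX d →L[ℝ] XX d) : XX d →ₗ[ℝ] XX d) =
      (LinearMap.prodMap (a • LinearMap.id) (m • LinearMap.id)) ∘ₗ
        (LinearMap.transvection (LinearMap.fst ℝ ℝ (Fin d → ℝ)) ((0, m⁻¹ • ℓ) : XX d)) := by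
    refine LinearMap.ext fun p => ?_
    refine Prod.ext ?_ ?_
    · simp [Psi', LinearMap.transvection, ← ha]
    · funext i
      simp [Psi', LinearMap.transvection, ← hmd, ← hℓ]
      field_simp
      ring
  rw [ContinuousLinearMap.det, h1, LinearMap.det_comp, LinearMap.transvection.det, LinearMap.det_prodMap]
  simp

lemma Psi_inj (zb y : Pt d) (hy : 0 < y 0) : Set.InjOn (Psi zb y) (Set.Ioo (0:ℝ) (Real.pi / 2) ×ˢ Set.univ) := by
  rintro ⟨θ, ξ⟩ hθ ⟨θ', ξ'⟩ hθ' h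
  have hθ1 : 0 < θ ∧ θ < Real.pi / 2 := by simpa using hθ
  have hθ1' : 0 < θ' ∧ θ' < Real.pi / 2 := by simpa using hθ'
  have hs := Real.sin_pos_of_pos_of_lt_pi hθ1.1 (by linarith [Real.pi_pos])
  have hs' := Real.sin_pos_of_pos_of_lt_pi hθ1'.1 (by linarith [Real.pi_pos])
  have hc := Real.cos_pos_of_mem_Ioo ⟨by linarith [Real.pi_pos, hθ1.1], hθ1.2⟩
  have h1 : Real.sin θ * y 0 * (Real.sin θ * y 0) = Real.sin θ' * y 0 * (Real.sin θ' * y 0) := by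
    have := congrArg Prod.fst h
    simpa [Psi, sh, yb] using this
  have h2 : Real.sin θ = Real.sin θ' := by
    have := mul_self_inj (by positivity) (by positivity) |>.1 h1
    exact mul_right_cancel₀ hy.ne' this
  have h3 : θ = θ' := Real.injOn_sin ⟨by linarith [hθ1.1, Real.pi_pos], hθ1.2.le⟩ ⟨by linarith [hθ1'.1, Real.pi_pos], hθ1'.2.le⟩ h2
  subst h3
  refine Prod.ext rfl (funext fun i => ?_)
  have := congrFun (congrArg Prod.snd h) i
  simp only [Psi, sh, yb, Xi_zero, Xi_succ, mul_zero, add_zero, add_right_inj] at this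
  have h4 := mul_left_cancel₀ (by positivity) this
  rw [add_right_inj] at h4
  exact mul_left_cancel₀ hc.ne' h4

lemma Psi_image (zb y : Pt d) (hy : 0 < y 0) :
    Psi zb y '' (Set.Ioo (0:ℝ) (Real.pi / 2) ×ˢ Set.univ) = Set.Ioo (zb 0) (zb 0 + y 0 * y 0) ×ˢ Set.univ := by
  ext ⟨s, q⟩
  simp only [Set.mem_image, Set.mem_prod, Set.mem_univ, and_true, Set.mem_Ioo]
  constructor
  · rintro ⟨⟨θ, ξ⟩, ⟨h1, h2⟩, h⟩
    have hs := Real.sin_pos_of_pos_of_lt_pi h1 (by dsimp at h2; linarith [Real.pi_pos])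
    have hc := Real.cos_pos_of_mem_Ioo ⟨by dsimp at h1; linarith [Real.pi_pos], h2⟩
    have h3 : zb 0 + Real.sin θ * y 0 * (Real.sin θ * y 0) = s := by
      simpa [Psi, sh, yb] using congrArg Prod.fst h
    have h4 := Real.sin_sq_add_cos_sq θ
    dsimp at hs hc
    constructor
    · have : 0 < Real.sin θ * y 0 * (Real.sin θ * y 0) := by positivity
      linarith
    · have : 0 < Real.cos θ ^ 2 * (y 0 * y 0) := by positivity
      nlinarith
  · rintro ⟨h1, h2⟩
    set ω := Real.sqrt (s - zb 0) / y 0 with hω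
    have hs0 : 0 < s - zb 0 := by linarith
    have hω0 : 0 < ω := div_pos (Real.sqrt_pos.2 hs0) hy
    have hω1 : ω < 1 := by
      rw [hω, div_lt_one hy, Real.sqrt_lt' hy]; nlinarith
    have hωs : ω * y 0 * (ω * y 0) = s - zb 0 := by
      rw [hω, div_mul_cancel₀ _ hy.ne', Real.mul_self_sqrt hs0.le]
    set θ := Real.arcsin ω with hθ
    have hsin : Real.sin θ = ω := Real.sin_arcsin (by linarith) hω1.le
    have hθ0 : 0 < θ := Real.arcsin_pos.2 hω0
    have hθ1 : θ < Real.pi / 2 := Real.arcsin_lt_pi_div_two.2 hω1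
    have hc := Real.cos_pos_of_mem_Ioo ⟨by linarith [Real.pi_pos], hθ1⟩
    refine ⟨(θ, fun i => ((q i - zb i.succ) / (ω * y 0) - ω * y i.succ) / Real.cos θ), ⟨hθ0, hθ1⟩, ?_⟩
    refine Prod.ext ?_ (funext fun i => ?_)
    · simp only [Psi, sh, yb, Xi_zero, mul_zero, add_zero, hsin, hωs]; ring
    · simp only [Psi, sh, yb, Xi_zero, Xi_succ, mul_zero, add_zero, hsin]
      field_simp
      ring

lemma cov (zb y : Pt d) (hy : 0 < y 0) (f : Pt d → ℝ) (hf : ∀ ζ, ¬ (zb 0 < ζ 0 ∧ ζ 0 < zb 0 + y 0 * y 0) → f ζ = 0) :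
    ∫ ζ, f ζ = ∫ x, ((2 * (y 0 * y 0) * Real.sin x.1 * Real.cos x.1) * (y 0 * Real.sin x.1 * Real.cos x.1) ^ d) *
      f (fun i => zb i + sh (yb x y) i) ∂vmu d := by
  rw [integral_split]
  set S : Set (XX d) := Set.Ioo (0:ℝ) (Real.pi / 2) ×ˢ Set.univ with hS
  have hSm : MeasurableSet S := measurableSet_Ioo.prod MeasurableSet.univ
  have h1 : ∫ p : XX d, f (Fin.cons p.1 p.2) = ∫ p in Psi zb y '' S, f (Fin.cons p.1 p.2) := by
    symm
    refine setIntegral_eq_integral_of_forall_compl_eq_zero fun p hp => hf _ fun hc => hp ?_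
    rw [Psi_image zb y hy]
    exact ⟨hc, trivial⟩
  have hH : (volume : Measure (XX d)).IsAddHaarMeasure := by
    rw [Measure.volume_eq_prod]; infer_instance
  rw [h1, integral_image_eq_integral_abs_det_fderiv_smul volume hSm
    (fun x _ => (Psi_hasFDeriv zb y x).hasFDerivWithinAt) (Psi_inj zb y hy)]
  have hμ : vmu d = (volume : Measure (XX d)).restrict S := by
    rw [vmu, hS, Measure.volume_eq_prod, ← Measure.prod_restrict, Measure.restrict_univ]
  rw [hμ]
  refine setIntegral_congr_fun hSm fun x hx => ?_
  have hθ1 : 0 < x.1 ∧ x.1 < Real.pi / 2 := by simpa [hS] using hx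
  have hs := Real.sin_pos_of_pos_of_lt_pi hθ1.1 (by linarith [Real.pi_pos])
  have hc := Real.cos_pos_of_mem_Ioo ⟨by linarith [Real.pi_pos, hθ1.1], hθ1.2⟩
  show |(Psi' y x).det| • f _ = _
  rw [Psi_det y x (by positivity), abs_of_pos (by positivity), smul_eq_mul]
  congr 2
  funext i
  refine Fin.cases ?_ (fun i => ?_) i <;> simp [Psi]

lemma volterra_eq {A : Coeffs d} {b : EE d → ℝ} (hZ : CB 2 b (Zt A)) {b' : EE d → ℝ}
    (ha : ∀ i j, CB 1 b' (shf fun z => A.a z i j)) (k : ℕ) (z zb : Pt d) :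
    volterra A k z zb = KK ((k:ℤ) - d) (Vt A k) (zb, z - zb) := by
  induction k generalizing z zb with
  | zero => rw [volterra, Zker_eq]; simp [Vt]
  | succ k ih =>
    rw [volterra, conv]
    have hae : ∀ᵐ ζ : Pt d, ζ 0 ≠ zb 0 := by
      have : volume {ζ : Pt d | ζ 0 = zb 0} = 0 := by
        have := Measure.pi_hyperplane (fun _ : Fin (d + 1) => (volume : Measure ℝ)) 0 (zb 0)
        exact this
      exact measure_eq_zero_iff_ae_notMem.1 this
    have h1 : ∫ ζ, volterra A k z ζ * -Eker A ζ zb =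
        ∫ ζ, KK ((k:ℤ) - d) (Vt A k) (ζ, z - ζ) * -KK (-(d:ℤ) - 1) (Et A) (zb, ζ - zb) := by
      refine integral_congr_ae ?_
      filter_upwards [hae] with ζ hζ
      rw [ih, Eker_eq hZ ha hζ]
    rw [h1]
    by_cases hp : 0 < (z - zb) 0
    · have hp' : 0 < ((zb, z - zb) : EE d).2 0 := hp
      rw [KK_pos hp']
      set y := vv (z - zb) with hy
      have hy0 : 0 < y 0 := Real.sqrt_pos.2 hp
      have hsh : sh y = z - zb := sh_vv hp
      have hyy : y 0 * y 0 = z 0 - zb 0 := congrFun hsh 0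
      rw [cov zb y hy0 _ (fun ζ hζ => ?_)]
      · show _ = _ * stepV k (Vt A k) (Et A) (zb, y)
        rw [stepV, ← integral_const_mul]
        have hμ : vmu d = (volume : Measure (XX d)).restrict (Set.Ioo (0:ℝ) (Real.pi / 2) ×ˢ Set.univ) := by
          rw [vmu, Measure.volume_eq_prod, ← Measure.prod_restrict, Measure.restrict_univ]
        rw [hμ]
        refine setIntegral_congr_fun (measurableSet_Ioo.prod MeasurableSet.univ) fun x hx => ?_
        have hθ1 : 0 < x.1 ∧ x.1 < Real.pi / 2 := by simpa using hx
        have hs := Real.sin_pos_of_pos_of_lt_pi hθ1.1 (by linarith [Real.pi_pos])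
        have hc := Real.cos_pos_of_mem_Ioo ⟨by linarith [Real.pi_pos, hθ1.1], hθ1.2⟩
        have hya0 : ya x y 0 = Real.cos x.1 * y 0 := by simp [ya]
        have hyb0 : yb x y 0 = Real.sin x.1 * y 0 := by simp [yb]
        have e1 : z - (fun i => zb i + sh (yb x y) i) = sh (ya x y) := by
          funext i
          have h2 := congrFun hsh i
          simp only [sh, Pi.sub_apply] at h2
          simp only [Pi.sub_apply, sh, hya0, hyb0]
          have h3 : z i = zb i + y 0 * y i := by linarith
          rw [h3]
          simp only [ya, yb]
          linear_combination (-y 0 * y i) * (Real.sin_sq_add_cos_sq x.1)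
        have e2 : (fun i => zb i + sh (yb x y) i) - zb = sh (yb x y) := by
          funext i; simp
        beta_reduce
        rw [e1, e2]
        have p1 : 0 < (((fun i => zb i + sh (yb x y) i), sh (ya x y)) : EE d).2 0 := by
          simp only [sh, hya0]; positivity
        have p2 : 0 < ((zb, sh (yb x y)) : EE d).2 0 := by
          simp only [sh, hyb0]; positivity
        rw [KK_pos p1, KK_pos p2]
        have q1 : Real.sqrt (sh (ya x y) 0) = Real.cos x.1 * y 0 := by
          rw [sh, hya0, Real.sqrt_mul_self (by positivity)]
        have q2 : Real.sqrt (sh (yb x y) 0) = Real.sin x.1 * y 0 := by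
          rw [sh, hyb0, Real.sqrt_mul_self (by positivity)]
        dsimp only
        rw [q1, q2, vv_sh (by rw [hya0]; positivity), vv_sh (by rw [hyb0]; positivity), stepF, vT1_Φ, vT2_Φ]
        rw [show Real.sqrt ((z - zb) 0) = y 0 from rfl]
        have hz1 : (Real.cos x.1 * y 0) ^ ((k:ℤ) - d) = Real.cos x.1 ^ k * y 0 ^ k / (Real.cos x.1 ^ d * y 0 ^ d) := by
          rw [zpow_sub₀ (by positivity), zpow_natCast, zpow_natCast, mul_pow, mul_pow]
        have hz2 : (Real.sin x.1 * y 0) ^ (-(d:ℤ) - 1) = 1 / (Real.sin x.1 ^ (d + 1) * y 0 ^ (d + 1)) := by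
          rw [show -(d:ℤ) - 1 = -((d + 1 : ℕ) : ℤ) by push_cast; ring, zpow_neg, zpow_natCast, mul_pow, one_div]
        have hz3 : y 0 ^ (((k + 1 : ℕ) : ℤ) - d) = y 0 ^ (k + 1) / y 0 ^ d := by
          rw [zpow_sub₀ (by positivity), zpow_natCast, zpow_natCast]
        rw [hz1, hz2, hz3]
        generalize Vt A k _ = V
        generalize Et A _ = E
        rw [mul_pow, mul_pow]
        field_simp
        ring
      · by_cases h2 : zb 0 < ζ 0
        · have h3 : ¬ 0 < ((ζ, z - ζ) : EE d).2 0 := by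
            intro h4; apply hζ; refine ⟨h2, ?_⟩
            simp only [Pi.sub_apply] at h4
            linarith
          rw [KK_neg h3, zero_mul]
        · have h3 : ¬ 0 < ((zb, ζ - zb) : EE d).2 0 := by
            simp only [Pi.sub_apply]; linarith
          rw [KK_neg h3]; simp
    · have hp' : ¬ 0 < ((zb, z - zb) : EE d).2 0 := hp
      rw [KK_neg hp']
      refine (integral_congr_ae (Eventually.of_forall fun ζ => ?_)).trans (integral_zero _ _)
      show KK ((k:ℤ) - d) (Vt A k) (ζ, z - ζ) * -KK (-(d:ℤ) - 1) (Et A) (zb, ζ - zb) = 0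
      simp only [Pi.sub_apply] at hp
      by_cases h2 : zb 0 < ζ 0
      · have h3 : ¬ 0 < ((ζ, z - ζ) : EE d).2 0 := by
          simp only [Pi.sub_apply]; linarith
        rw [KK_neg h3, zero_mul]
      · have h3 : ¬ 0 < ((zb, ζ - zb) : EE d).2 0 := by
          simp only [Pi.sub_apply]; linarith
        rw [KK_neg h3]; simp

end

section

set_option linter.unusedSectionVars false
set_option linter.unusedVariables false

/-! ## The kernel lemma -/

/-- Gaussian weight with a general profile in the time variable. -/
noncomputable def gw (b : ℝ → ℝ) (β : ℝ) (e : EE d) : ℝ := b (|e.2 0|) * Real.exp (-(β * gs e.2))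

/-- Time weight. -/
noncomputable def kw (b : ℝ → ℝ) (C : ℝ) (N : ℕ) (e : EE d) : ℝ :=
  C * (b (Real.sqrt |e.2 0|) * (1 + Real.sqrt |e.2 0|) ^ N)

lemma gw_cont {b : ℝ → ℝ} (hb : Continuous b) (β : ℝ) : Continuous (gw b β : EE d → ℝ) := by
  have := gs_cont (d := d)
  unfold gw; fun_prop

lemma kw_cont {b : ℝ → ℝ} (hb : Continuous b) (C : ℝ) (N : ℕ) : Continuous (kw b C N : EE d → ℝ) := by
  unfold kw; fun_prop

lemma kw_mono {b : ℝ → ℝ} (hb : ∀ s, 0 ≤ b s) {C C' : ℝ} {N N' : ℕ} (hC : 0 ≤ C) (h : C ≤ C') (hN : N ≤ N')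
    (e : EE d) : kw b C N e ≤ kw b C' N' e := by
  unfold kw
  have h1 : (1:ℝ) ≤ 1 + Real.sqrt |e.2 0| := by have := Real.sqrt_nonneg |e.2 0|; linarith
  have h0 := hb (Real.sqrt |e.2 0|)
  have hC2 := hC.trans h
  have := pow_le_pow_right₀ h1 hN
  gcongr

lemma kw_nonneg {b : ℝ → ℝ} (hb : ∀ s, 0 ≤ b s) {C : ℝ} {N : ℕ} (hC : 0 ≤ C) (e : EE d) : 0 ≤ kw b C N e := by
  unfold kw
  have h0 := hb (Real.sqrt |e.2 0|)
  positivity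

lemma ker_bound (p : ℤ) {β δ : ℝ} (hβ : 0 < β) (hδ : 0 < δ) (q : ℕ) : ∃ (C : ℝ) (N : ℕ), 0 ≤ C ∧
    ∀ (b : ℝ → ℝ) (G : EE d → ℝ) (ψ : Pt d → ℝ) (Cψ : ℝ), (∀ s, 0 ≤ b s) → (∀ e, |G e| ≤ gw b β e) →
      (∀ ζ, |ψ ζ| ≤ Cψ) → ((q:ℤ) ≤ p ∨ ∀ ζ, pnorm ζ < δ → ψ ζ = 0) →
      ∀ e : EE d, |ψ e.2 * KK p G e| ≤ kw b (C * Cψ) N e * Real.sqrt |e.2 0| ^ q := by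
  obtain ⟨C1, hC1, h1⟩ := absorb_poly (d := d) β hβ ((q:ℤ) - p).toNat
  refine ⟨1 + C1 * δ⁻¹ ^ ((q:ℤ) - p).toNat, (p - q).toNat, by positivity, fun b G ψ Cψ hb hG hψ hc e => ?_⟩
  have hCψ : 0 ≤ Cψ := (abs_nonneg _).trans (hψ 0)
  have hrhs : 0 ≤ kw b ((1 + C1 * δ⁻¹ ^ ((q:ℤ) - p).toNat) * Cψ) (p - q).toNat e * Real.sqrt |e.2 0| ^ q :=
    mul_nonneg (kw_nonneg hb (by positivity) e) (by positivity)
  by_cases ht : 0 < e.2 0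
  swap
  · rw [KK_neg ht]; simpa using hrhs
  by_cases hz : ψ e.2 = 0
  · rw [hz]; simpa using hrhs
  rw [KK_pos ht, abs_of_pos ht]
  rw [kw, abs_of_pos ht]
  rw [abs_of_pos ht] at hrhs
  have hu : 0 < Real.sqrt (e.2 0) := Real.sqrt_pos.2 ht
  have hG1 := hG (e.1, vv e.2)
  simp only [gw, vv_zero, abs_of_pos hu] at hG1
  set u := Real.sqrt (e.2 0) with hudef
  have hkey : u ^ p * Real.exp (-(β * gs (vv e.2))) ≤ (1 + C1 * δ⁻¹ ^ ((q:ℤ) - p).toNat) * (1 + u) ^ (p - q).toNat * u ^ q := by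
    have hexp1 : Real.exp (-(β * gs (vv e.2))) ≤ 1 := by
      rw [Real.exp_le_one_iff]; have := gs_nonneg (vv e.2); nlinarith
    rcases le_or_gt (q:ℤ) p with hqp | hqp
    · have e1 : u ^ p = u ^ (p - q).toNat * u ^ q := by
        rw [← zpow_natCast u (p - q).toNat, ← zpow_natCast u q, ← zpow_add₀ hu.ne']
        congr 1; omega
      have e2 : u ^ (p - q).toNat ≤ (1 + u) ^ (p - q).toNat := by gcongr; linarith
      have e3 : u ^ p ≤ (1 + u) ^ (p - q).toNat * u ^ q := by rw [e1]; gcongr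
      calc u ^ p * Real.exp (-(β * gs (vv e.2))) ≤ u ^ p * 1 := by gcongr
        _ ≤ 1 * ((1 + u) ^ (p - q).toNat * u ^ q) := by linarith
        _ ≤ (1 + C1 * δ⁻¹ ^ ((q:ℤ) - p).toNat) * ((1 + u) ^ (p - q).toNat * u ^ q) := by
            gcongr
            have : 0 ≤ C1 * δ⁻¹ ^ ((q:ℤ) - p).toNat := by positivity
            linarith
        _ = _ := by ring
    · have hc' : ∀ ζ, pnorm ζ < δ → ψ ζ = 0 := by
        rcases hc with hc | hc
        · omega
        · exact hc
      have hpn : δ ≤ pnorm e.2 := by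
        by_contra hlt
        exact hz (hc' _ (not_le.1 hlt))
      set m := ((q:ℤ) - p).toNat with hm
      have hS : pnorm e.2 = u * (1 + ∑ i : Fin d, |vv e.2 i.succ|) := by
        rw [pnorm, abs_of_pos ht, ← hudef, mul_add, mul_one, Finset.mul_sum]
        congr 1
        refine Finset.sum_congr rfl fun i _ => ?_
        rw [vv_succ, ← hudef, abs_div, abs_of_pos hu]
        field_simp
      set S := 1 + ∑ i : Fin d, |vv e.2 i.succ| with hSd
      have hS0 : 0 ≤ S := by
        have : 0 ≤ ∑ i : Fin d, |vv e.2 i.succ| := Finset.sum_nonneg fun _ _ => abs_nonneg _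
        linarith
      have h2 : (1:ℝ) ≤ (δ⁻¹ * (u * S)) ^ m := by
        apply one_le_pow₀
        rw [inv_mul_eq_div, le_div_iff₀ hδ, one_mul, ← hS]; exact hpn
      have e1 : u ^ p * u ^ m = u ^ q := by
        rw [← zpow_natCast u m, ← zpow_natCast u q, ← zpow_add₀ hu.ne']
        congr 1; omega
      have h3 := h1 (vv e.2)
      have hone : (1:ℝ) ≤ (1 + u) ^ (p - q).toNat := one_le_pow₀ (by linarith)
      calc u ^ p * Real.exp (-(β * gs (vv e.2))) ≤ u ^ p * Real.exp (-(β * gs (vv e.2))) * (δ⁻¹ * (u * S)) ^ m :=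
            le_mul_of_one_le_right (by positivity) h2
        _ = (u ^ p * u ^ m) * δ⁻¹ ^ m * (S ^ m * Real.exp (-(β * gs (vv e.2)))) := by rw [mul_pow, mul_pow]; ring
        _ ≤ u ^ q * δ⁻¹ ^ m * (C1 * Real.exp (β * gs (vv e.2)) * Real.exp (-(β * gs (vv e.2)))) := by
            rw [e1]; gcongr
        _ = (C1 * δ⁻¹ ^ m) * u ^ q := by
            rw [mul_assoc C1, ← Real.exp_add, add_neg_cancel, Real.exp_zero]; ring
        _ ≤ (1 + C1 * δ⁻¹ ^ m) * 1 * u ^ q := by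
            have : 0 < u ^ q := by positivity
            nlinarith
        _ ≤ (1 + C1 * δ⁻¹ ^ m) * (1 + u) ^ (p - q).toNat * u ^ q := by gcongr
  have hbu := hb u
  calc |ψ e.2 * (u ^ p * G (e.1, vv e.2))| = |ψ e.2| * (u ^ p * |G (e.1, vv e.2)|) := by
        rw [abs_mul, abs_mul, abs_of_pos (by positivity : 0 < u ^ p)]
    _ ≤ Cψ * (u ^ p * (b u * Real.exp (-(β * gs (vv e.2))))) := by
        have := hψ e.2
        gcongr
    _ = Cψ * b u * (u ^ p * Real.exp (-(β * gs (vv e.2)))) := by ring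
    _ ≤ Cψ * b u * ((1 + C1 * δ⁻¹ ^ ((q:ℤ) - p).toNat) * (1 + u) ^ (p - q).toNat * u ^ q) := by gcongr
    _ = _ := by ring

lemma small_diff {f c : EE d → ℝ} (hc : Continuous c) (h : ∀ e, |f e| ≤ c e * Real.sqrt |e.2 0| ^ 4) {e₀ : EE d}
    (h0 : e₀.2 0 = 0) : HasFDerivAt f (0 : EE d →L[ℝ] ℝ) e₀ := by
  refine Asymptotics.IsBigO.hasFDerivAt (n := 2) ?_ (by norm_num)
  refine Asymptotics.IsBigO.of_bound (|c e₀| + 1) ?_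
  have h1 : ∀ᶠ e in nhds e₀, |c e| < |c e₀| + 1 :=
    (hc.abs.continuousAt (x := e₀)).eventually (gt_mem_nhds (by simp))
  filter_upwards [h1] with e he
  have h2 : |e.2 0| ≤ ‖e - e₀‖ := by
    have : e.2 0 = (e - e₀).2 0 := by simp [h0]
    rw [this]
    exact (norm_le_pi_norm (e - e₀).2 0).trans (norm_snd_le _)
  have h3 : Real.sqrt |e.2 0| ^ 4 = |e.2 0| ^ 2 := by
    rw [show (4:ℕ) = 2 * 2 from rfl, pow_mul, Real.sq_sqrt (abs_nonneg _)]
  rw [Real.norm_eq_abs, Real.norm_eq_abs, abs_of_nonneg (by positivity : 0 ≤ ‖e - e₀‖ ^ 2)]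
  calc |f e| ≤ c e * |e.2 0| ^ 2 := h3 ▸ h e
    _ ≤ |c e| * |e.2 0| ^ 2 := by gcongr; exact le_abs_self _
    _ ≤ (|c e₀| + 1) * ‖e - e₀‖ ^ 2 := by gcongr

lemma small_cont {f c : EE d → ℝ} (hc : Continuous c) (h : ∀ e, |f e| ≤ c e * Real.sqrt |e.2 0| ^ 1) {e₀ : EE d}
    (h0 : e₀.2 0 = 0) : ContinuousAt f e₀ := by
  have hf0 : f e₀ = 0 := by
    have := h e₀; rw [h0] at this; simpa using this
  rw [ContinuousAt, hf0]
  refine squeeze_zero_norm (fun e => h e) ?_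
  have : Continuous fun e : EE d => c e * Real.sqrt |e.2 0| ^ 1 := by fun_prop
  have h2 := this.tendsto e₀
  simpa [h0] using h2

lemma KK_contAt {p : ℤ} {G : EE d → ℝ} (hG : Continuous G) {e : EE d} (h : e.2 0 ≠ 0) :
    ContinuousAt (KK p G) e := by
  rcases lt_or_gt_of_ne h with h | h
  · exact (continuousAt_congr (KK_ev_neg h)).2 continuousAt_const
  · refine (continuousAt_congr (KK_ev_pos h)).2 ?_
    have h1 : ContinuousAt (fun e : EE d => Real.sqrt (e.2 0)) e := by fun_prop
    have h2 := h1.zpow₀ p (Or.inl (Real.sqrt_pos.2 h).ne')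
    exact h2.mul (hG.continuousAt.comp (vvp_diff h).continuousAt)

lemma pnorm_cont : Continuous (pnorm : Pt d → ℝ) := by unfold pnorm; fun_prop

lemma diff_of_snd {ψ : Pt d → ℝ} (h : Differentiable ℝ fun e : EE d => ψ e.2) : Differentiable ℝ ψ := by
  have : ψ = (fun e : EE d => ψ e.2) ∘ fun ζ => (0, ζ) := rfl
  rw [this]
  exact h.comp (by fun_prop)

lemma D_snd_inr {ψ : Pt d → ℝ} (h : Differentiable ℝ ψ) (j : Fin (d + 1)) (e : EE d) :
    D (Sum.inr j) (fun e : EE d => ψ e.2) e = pd j ψ e.2 := by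
  unfold D pd
  have := (h e.2).hasFDerivAt.comp e hasFDerivAt_snd
  have h2 : (fun e : EE d => ψ e.2) = ψ ∘ Prod.snd := rfl
  rw [h2, this.fderiv]
  simp [dir]

lemma D_snd_inl {ψ : Pt d → ℝ} (h : Differentiable ℝ ψ) (j : Fin (d + 1)) (e : EE d) :
    D (Sum.inl j) (fun e : EE d => ψ e.2) e = 0 := by
  unfold D
  have := (h e.2).hasFDerivAt.comp e hasFDerivAt_snd
  have h2 : (fun e : EE d => ψ e.2) = ψ ∘ Prod.snd := rfl
  rw [h2, this.fderiv]
  simp [dir]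

lemma rad_CB (n : ℕ) (p : ℤ) {β : ℝ} (hβ : 0 < β) : ∃ C : ℝ, 0 ≤ C ∧ ∀ (b : ℝ → ℝ) (G : EE d → ℝ), (∀ s, 0 ≤ b s) →
    CB (n + 1) (gw b β) G → CB n (gw (fun s => C * ((1 + |s|) * b s)) (β / 2)) (rad p G) := by
  obtain ⟨C1, hC1, h1⟩ := absorb_poly (d := d) (β / 2) (by positivity) 1
  refine ⟨(|(p:ℝ)| + 2 ^ n + d * 2 ^ n) * C1, by positivity, fun b G hb hG => ?_⟩
  have t1 : CB n (fun e => |(p:ℝ)| * gw b β e) (fun e => (p:ℝ) * G e) := PB.const_mul _ (hG.pred)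
  have t2 : CB n (fun e => 2 ^ n * ((1 + |e.2 0|) * gw b β e)) (fun e => e.2 0 * D (Sum.inr 0) G e) :=
    PB.mul (CB_snd n 0) (hG.deriv (Sum.inr 0))
  have t3 : ∀ i : Fin d, CB n (fun e => 2 ^ n * ((1 + |e.2 i.succ|) * gw b β e)) (fun e => e.2 i.succ * D (Sum.inr i.succ) G e) :=
    fun i => PB.mul (CB_snd n i.succ) (hG.deriv (Sum.inr i.succ))
  have t4 := PB.sum Finset.univ (fun i (_ : i ∈ Finset.univ) => t3 i)
  have t5 := PB.const_mul (1/2 : ℝ) ((PB.add t1 t2).sub t4)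
  refine t5.mono fun _ e => ?_
  have hS0 : 0 ≤ ∑ i : Fin d, |e.2 i.succ| := Finset.sum_nonneg fun _ _ => abs_nonneg _
  have hg : 0 ≤ gw b β e := mul_nonneg (hb _) (Real.exp_pos _).le
  have hi : ∀ i : Fin d, |e.2 i.succ| ≤ ∑ i : Fin d, |e.2 i.succ| := fun i =>
    Finset.single_le_sum (f := fun i : Fin d => |e.2 i.succ|) (fun _ _ => abs_nonneg _) (Finset.mem_univ i)
  set S := ∑ i : Fin d, |e.2 i.succ| with hS
  have h2 := h1 e.2
  rw [pow_one, ← hS] at h2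
  have hsum : ∑ i : Fin d, 2 ^ n * ((1 + |e.2 i.succ|) * gw b β e) ≤ d * (2 ^ n * ((1 + S) * gw b β e)) := by
    calc _ ≤ ∑ i : Fin d, 2 ^ n * ((1 + S) * gw b β e) := Finset.sum_le_sum fun i _ => by
          have := hi i; gcongr
      _ = _ := by simp
  have hu := abs_nonneg (e.2 0)
  have hp := abs_nonneg (p:ℝ)
  have h2n : (0:ℝ) < 2 ^ n := by positivity
  have hd0 : (0:ℝ) ≤ d := Nat.cast_nonneg d
  show |(1/2:ℝ)| * ((|(p:ℝ)| * gw b β e + 2 ^ n * ((1 + |e.2 0|) * gw b β e)) + ∑ i : Fin d, 2 ^ n * ((1 + |e.2 i.succ|) * gw b β e)) ≤ _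
  have hhalf : |(1/2:ℝ)| ≤ 1 := by norm_num [abs_of_pos]
  have hU : 1 ≤ 1 + |e.2 0| := by linarith
  have hSS : 1 ≤ 1 + S := by linarith
  have a1 : |(p:ℝ)| * gw b β e ≤ |(p:ℝ)| * ((1 + |e.2 0|) * (1 + S) * gw b β e) := by
    gcongr
    exact le_mul_of_one_le_left hg (one_le_mul_of_one_le_of_one_le hU hSS)
  have a2 : 2 ^ n * ((1 + |e.2 0|) * gw b β e) ≤ 2 ^ n * ((1 + |e.2 0|) * (1 + S) * gw b β e) := by
    gcongr
    exact le_mul_of_one_le_right (by linarith) hSS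
  have a3 : d * (2 ^ n * ((1 + S) * gw b β e)) ≤ d * (2 ^ n * ((1 + |e.2 0|) * (1 + S) * gw b β e)) := by
    gcongr
    exact le_mul_of_one_le_left (by linarith) hU
  calc _ ≤ 1 * ((|(p:ℝ)| * gw b β e + 2 ^ n * ((1 + |e.2 0|) * gw b β e)) + d * (2 ^ n * ((1 + S) * gw b β e))) := by
        have : 0 ≤ ∑ i : Fin d, 2 ^ n * ((1 + |e.2 i.succ|) * gw b β e) :=
          Finset.sum_nonneg fun i _ => by positivity
        gcongr
    _ ≤ (|(p:ℝ)| + 2 ^ n + d * 2 ^ n) * ((1 + |e.2 0|) * (1 + S) * gw b β e) := by linarith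
    _ ≤ (|(p:ℝ)| + 2 ^ n + d * 2 ^ n) * ((1 + |e.2 0|) * (C1 * Real.exp (β / 2 * gs e.2)) * gw b β e) := by gcongr
    _ = _ := by
        have : Real.exp (-(β / 2 * gs e.2)) = Real.exp (β / 2 * gs e.2) * Real.exp (-(β * gs e.2)) := by
          rw [← Real.exp_add]; congr 1; ring
        simp only [gw, this, abs_abs]; ring

lemma KK_b {p : ℤ} {G : EE d → ℝ} {e : EE d} (h : e.2 0 = 0) : KK p G e = 0 := KK_neg (by rw [h]; simp)

lemma ker (n : ℕ) : ∀ (p : ℤ) {β δ Cψ : ℝ} (hβ : 0 < β) (hδ : 0 < δ) (hCψ : 0 ≤ Cψ), ∃ (C : ℝ) (N : ℕ), 0 ≤ C ∧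
    ∀ (b : ℝ → ℝ) (G : EE d → ℝ) (ψ : Pt d → ℝ), Continuous b → (∀ s, 0 ≤ b s) → CB n (gw b β) G →
      CB n (fun _ => Cψ) (fun e : EE d => ψ e.2) → ((2 * n + 4 : ℤ) ≤ p ∨ ∀ ζ, pnorm ζ < δ → ψ ζ = 0) →
      CB n (kw b C N) (fun e => ψ e.2 * KK p G e) := by
  induction n with
  | zero =>
    intro p β δ Cψ hβ hδ hCψ
    obtain ⟨C0, N0, hC0, h0⟩ := ker_bound (d := d) p hβ hδ 0
    obtain ⟨C1, N1, hC1, h1⟩ := ker_bound (d := d) p hβ hδ 1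
    refine ⟨C0 * Cψ, N0, by positivity, fun b G ψ hbc hb hG hψ hp => ?_⟩
    have hψb : ∀ ζ, |ψ ζ| ≤ Cψ := fun ζ => hψ.bound (0, ζ)
    have hcont : Continuous fun e : EE d => ψ e.2 * KK p G e := by
      refine continuous_iff_continuousAt.2 fun e => ?_
      by_cases he : e.2 0 = 0
      · exact small_cont (kw_cont hbc _ _) (h1 b G ψ Cψ hb hG.bound hψb (hp.imp (fun h => by push_cast at h ⊢; omega) id)) he
      · exact hψ.cont.continuousAt.mul (KK_contAt hG.cont he)
    refine ⟨hcont.comp continuous_snd, fun _ e => ?_⟩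
    have := h0 b G ψ Cψ hb hG.bound hψb (hp.imp (fun h => by push_cast at h ⊢; omega) id) e
    simpa using this
  | succ n ih =>
    intro p β δ Cψ hβ hδ hCψ
    obtain ⟨C0, N0, hC0, h0⟩ := ker_bound (d := d) p hβ hδ 0
    obtain ⟨C4, N4, hC4, h4⟩ := ker_bound (d := d) p hβ hδ 4
    obtain ⟨C1, N1, hC1, h1⟩ := ih p hβ hδ hCψ
    obtain ⟨C2, N2, hC2, h2⟩ := ih (p - 1) hβ hδ hCψ
    obtain ⟨C3, N3, hC3, h3⟩ := ih (p - 2) (half_pos hβ) hδ hCψ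
    obtain ⟨Cr, hCr, hr⟩ := rad_CB (d := d) n p hβ
    refine ⟨C0 * Cψ + C1 + C2 + C3 * Cr, N0 + N1 + N2 + N3 + 1, by positivity, fun b G ψ hbc hb hG hψ hp => ?_⟩
    have hψb : ∀ ζ, |ψ ζ| ≤ Cψ := fun ζ => hψ.bound (0, ζ)
    have hψd := diff_of_snd hψ.diff
    have hfd : ∀ e : EE d, e.2 0 = 0 → HasFDerivAt (fun e : EE d => ψ e.2 * KK p G e) (0 : EE d →L[ℝ] ℝ) e := fun e he =>
      small_diff (kw_cont hbc _ _) (h4 b G ψ Cψ hb hG.bound hψb (hp.imp (fun h => by push_cast at h ⊢; omega) id)) he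
    have hdiff : Differentiable ℝ fun e : EE d => ψ e.2 * KK p G e := by
      intro e
      by_cases he : e.2 0 = 0
      · exact (hfd e he).differentiableAt
      · exact (hψ.diff e).mul (KK_diff hG.diff he)
    have hD0 : ∀ (e : EE d) i, e.2 0 = 0 → D i (fun e : EE d => ψ e.2 * KK p G e) e = 0 := by
      intro e i he
      unfold D; rw [(hfd e he).fderiv]; rfl
    have hDm : ∀ (e : EE d) i, e.2 0 ≠ 0 → D i (fun e : EE d => ψ e.2 * KK p G e) e
        = D i (fun e : EE d => ψ e.2) e * KK p G e + ψ e.2 * D i (KK p G) e := by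
      intro e i he
      unfold D
      rw [fderiv_fun_mul (hψ.diff e) (KK_diff hG.diff he)]
      simp only [add_apply, smul_apply, smul_eq_mul]
      ring
    have hv : ∀ j : Fin (d + 1), (∀ ζ, pnorm ζ < δ → ψ ζ = 0) → ∀ ζ, pnorm ζ < δ → pd j ψ ζ = 0 := by
      intro j hz ζ hζ
      have : ψ =ᶠ[nhds ζ] fun _ => 0 := by
        filter_upwards [(isOpen_lt pnorm_cont continuous_const).mem_nhds hζ] with x hx using hz x hx
      unfold pd; rw [this.fderiv_eq]; simp
    have hψ' : ∀ j : Fin (d + 1), CB n (fun _ => Cψ) (fun e : EE d => pd j ψ e.2) := by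
      intro j
      have := hψ.deriv (Sum.inr j)
      rwa [show D (Sum.inr j) (fun e : EE d => ψ e.2) = fun e => pd j ψ e.2 from funext fun e => D_snd_inr hψd j e] at this
    refine ⟨hdiff.continuous.comp continuous_snd, fun _ e => ?_, fun _ => hdiff, fun i => ?_⟩
    · have := h0 b G ψ Cψ hb hG.bound hψb (hp.imp (fun h => by push_cast at h ⊢; omega) id) e
      rw [pow_zero, mul_one] at this
      refine this.trans (kw_mono hb (by positivity) ?_ (by omega) e)
      have : 0 ≤ C3 * Cr := by positivity
      linarith
    show CB n _ (D i (fun e : EE d => ψ e.2 * KK p G e))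
    have hC3r : 0 ≤ C3 * Cr := by positivity
    have hC0p : 0 ≤ C0 * Cψ := by positivity
    rcases i with i | i
    · have hE : D (Sum.inl i) (fun e : EE d => ψ e.2 * KK p G e) = fun e => ψ e.2 * KK p (D (Sum.inl i) G) e := by
        funext e
        by_cases he : e.2 0 = 0
        · rw [hD0 e _ he, KK_b he, mul_zero]
        · rw [hDm e _ he, D_snd_inl hψd, D_KK_inl hG.diff he]; ring
      rw [hE]
      refine PB.mono (h1 b _ ψ hbc hb (hG.deriv _) hψ.pred (hp.imp (fun h => by push_cast at h ⊢; omega) id)) fun _ e =>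
        kw_mono hb hC1 (by linarith) (by omega) e
    · have a1 : CB n (kw b C1 N1) (fun e : EE d => pd i ψ e.2 * KK p G e) :=
        h1 b G _ hbc hb hG.pred (hψ' i) (hp.imp (fun h => by push_cast at h ⊢; omega) (hv i))
      revert a1
      refine Fin.cases ?_ (fun i => ?_) i
      · intro a1
        have hE : D (Sum.inr 0) (fun e : EE d => ψ e.2 * KK p G e) = fun e =>
            pd 0 ψ e.2 * KK p G e + ψ e.2 * KK (p - 2) (rad p G) e := by
          funext e
          by_cases he : e.2 0 = 0
          · rw [hD0 e _ he, KK_b he, KK_b he, mul_zero, mul_zero, add_zero]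
          · rw [hDm e _ he, D_snd_inr hψd, D_KK_zero hG.diff he]
        rw [hE]
        have a2 := h3 (fun s => Cr * ((1 + |s|) * b s)) (rad p G) ψ (by fun_prop)
          (fun s => by have := hb s; positivity) (hr b G hb hG) hψ.pred (hp.imp (fun h => by push_cast at h ⊢; omega) id)
        refine PB.mono (PB.add a1 a2) fun _ e => ?_
        have e1 : kw (fun s => Cr * ((1 + |s|) * b s)) C3 N3 e = kw b (C3 * Cr) (N3 + 1) e := by
          simp only [kw, abs_of_nonneg (Real.sqrt_nonneg _)]; ring
        rw [e1]
        have e2 := kw_mono (N' := N0 + N1 + N2 + N3 + 1) hb hC1 le_rfl (by omega : N1 ≤ N0 + N1 + N2 + N3 + 1) e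
        have e3 := kw_mono (N' := N0 + N1 + N2 + N3 + 1) hb hC3r le_rfl (by omega : N3 + 1 ≤ N0 + N1 + N2 + N3 + 1) e
        have e4 : kw b C1 (N0 + N1 + N2 + N3 + 1) e + kw b (C3 * Cr) (N0 + N1 + N2 + N3 + 1) e
            = kw b (C1 + C3 * Cr) (N0 + N1 + N2 + N3 + 1) e := by simp only [kw]; ring
        have e5 := kw_mono (C' := C0 * Cψ + C1 + C2 + C3 * Cr) (N := N0 + N1 + N2 + N3 + 1) hb (by positivity : 0 ≤ C1 + C3 * Cr) (by linarith) le_rfl e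
        linarith
      · intro a1
        have hE : D (Sum.inr i.succ) (fun e : EE d => ψ e.2 * KK p G e) = fun e =>
            pd i.succ ψ e.2 * KK p G e + ψ e.2 * KK (p - 1) (D (Sum.inr i.succ) G) e := by
          funext e
          by_cases he : e.2 0 = 0
          · rw [hD0 e _ he, KK_b he, KK_b he, mul_zero, mul_zero, add_zero]
          · rw [hDm e _ he, D_snd_inr hψd, D_KK_succ hG.diff he]
        rw [hE]
        have a2 := h2 b _ ψ hbc hb (hG.deriv (Sum.inr i.succ)) hψ.pred (hp.imp (fun h => by push_cast at h ⊢; omega) id)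
        refine PB.mono (PB.add a1 a2) fun _ e => ?_
        have e2 := kw_mono (N' := N0 + N1 + N2 + N3 + 1) hb hC1 le_rfl (by omega : N1 ≤ N0 + N1 + N2 + N3 + 1) e
        have e3 := kw_mono (N' := N0 + N1 + N2 + N3 + 1) hb hC2 le_rfl (by omega : N2 ≤ N0 + N1 + N2 + N3 + 1) e
        have e4 : kw b C1 (N0 + N1 + N2 + N3 + 1) e + kw b C2 (N0 + N1 + N2 + N3 + 1) e
            = kw b (C1 + C2) (N0 + N1 + N2 + N3 + 1) e := by simp only [kw]; ring
        have e5 := kw_mono (C' := C0 * Cψ + C1 + C2 + C3 * Cr) (N := N0 + N1 + N2 + N3 + 1) hb (by positivity : 0 ≤ C1 + C2) (by linarith) le_rfl e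
        linarith

end

section

set_option linter.unusedSectionVars false
set_option linter.unusedVariables false

/-! ## Families with Gaussian profiles -/

/-- Uniform families of profiles. -/
def GF {I : Type} (ε : I → ℝ) (n : ℕ) (f f' : I → EE d → ℝ) : Prop :=
  ∃ (b : ℝ → ℝ) (β : ℝ), Continuous b ∧ (∀ s, 0 ≤ b s) ∧ 0 < β ∧ ∀ i, CD n (ε i) (gw b β) (f i) (f' i)

def KF {I : Type} (ε : I → ℝ) (n : ℕ) (f f' : I → EE d → ℝ) : Prop :=
  ∃ c : ℝ → ℝ, Continuous c ∧ (∀ s, 0 ≤ c s) ∧ ∀ i, CD n (ε i) (fun e => c (e.2 0)) (f i) (f' i)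

section GF
variable {I : Type} {ε : I → ℝ} {n N : ℕ} {β : ℝ} {f f' g g' : I → EE d → ℝ}

lemma CD.add {n : ℕ} {ε : ℝ} {b b' f f' g g' : EE d → ℝ} (h : CD n ε b f f') (h' : CD n ε b' g g') :
    CD n ε (fun e => b e + b' e) (fun e => f e + g e) (fun e => f' e + g' e) := PD.add h h'

lemma CD.le {n m : ℕ} {ε : ℝ} {b f f' : EE d → ℝ} (h : CD n ε b f f') (hm : m ≤ n) : CD m ε b f f' := PD.le h hm

lemma UW.gf (hε : ∀ i, 0 ≤ ε i) (hβ : 0 < β) (h : UW ε n N β f f') : GF ε n f f' := by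
  obtain ⟨C, hC, h⟩ := h
  refine ⟨fun s => C * (1 + |s|) ^ N, β, by fun_prop, fun s => by positivity, hβ, fun i => ?_⟩
  refine CD.mono (b := fun e => C * wb N β e) (h i) (hε i) fun e => le_of_eq ?_
  simp only [wb, gw, abs_abs]; ring

lemma GF.le {m : ℕ} (h : GF ε n f f') (hm : m ≤ n) : GF ε m f f' := by
  obtain ⟨b, β, h1, h2, h3, h4⟩ := h
  exact ⟨b, β, h1, h2, h3, fun i => (h4 i).le hm⟩

lemma GF.add (hε : ∀ i, 0 ≤ ε i) (h : GF ε n f f') (h' : GF ε n g g') :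
    GF ε n (fun i e => f i e + g i e) (fun i e => f' i e + g' i e) := by
  obtain ⟨b, β, h1, h2, h3, h4⟩ := h
  obtain ⟨b', β', h1', h2', h3', h4'⟩ := h'
  refine ⟨fun s => b s + b' s, min β β', by fun_prop, fun s => add_nonneg (h2 s) (h2' s), lt_min h3 h3', fun i => ?_⟩
  refine CD.mono ((h4 i).add (h4' i)) (hε i) fun e => ?_
  have hg := gs_nonneg e.2
  have e1 : Real.exp (-(β * gs e.2)) ≤ Real.exp (-(min β β' * gs e.2)) := by
    apply Real.exp_le_exp.2; have := min_le_left β β'; nlinarith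
  have e2 : Real.exp (-(β' * gs e.2)) ≤ Real.exp (-(min β β' * gs e.2)) := by
    apply Real.exp_le_exp.2; have := min_le_right β β'; nlinarith
  have := h2 |e.2 0|
  have := h2' |e.2 0|
  simp only [gw, add_mul]
  gcongr

lemma GF.shear (hε : ∀ i, 0 ≤ ε i) {σ : ℝ} (hσ : |σ| ≤ 1) (h : GF ε n f f') :
    GF ε n (fun i e => f i (VarBPHZ.shear σ e)) (fun i e => f' i (VarBPHZ.shear σ e)) := by
  obtain ⟨b, β, h1, h2, h3, h4⟩ := h
  obtain ⟨C', hC', h'⟩ := absorb_poly (d := d) (β / 2) (by positivity) n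
  have hc0 := zero_le_one.trans (one_le_compC d n)
  refine ⟨fun s => compC d n * C' * ((1 + |s|) ^ n * b s), β / 2, by fun_prop, fun s => by have := h2 s; positivity,
    by positivity, fun i => ?_⟩
  have := PD.compΦ (shT d σ hσ) (h4 i)
  simp only [shT_Φ] at this
  refine CD.mono (b := fun e => compC d n * (shT d σ hσ).wt () e ^ n * gw b β e) this (hε i) fun e => ?_
  show compC d n * (shT d σ hσ).wt () e ^ n * gw b β e ≤ _
  have hw : (shT d σ hσ).wt () e ≤ (1 + |e.2 0|) * (1 + ∑ j : Fin d, |e.2 j.succ|) := by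
    have hS : 0 ≤ ∑ i : Fin d, |e.2 i.succ| := Finset.sum_nonneg fun _ _ => abs_nonneg _
    simp only [Aff.wt, Aff.Y, shT, one_mul, add_zero, Fin.sum_univ_succ]
    nlinarith [abs_nonneg (e.2 0)]
  have hw0 := zero_le_one.trans ((shT d σ hσ).one_le_wt () e)
  have hg0 : 0 ≤ gw b β e := mul_nonneg (h2 _) (Real.exp_pos _).le
  calc compC d n * (shT d σ hσ).wt () e ^ n * gw b β e
      ≤ compC d n * ((1 + |e.2 0|) * (1 + ∑ j : Fin d, |e.2 j.succ|)) ^ n * gw b β e := by gcongr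
    _ = compC d n * ((1 + |e.2 0|) ^ n * (1 + ∑ j : Fin d, |e.2 j.succ|) ^ n) * gw b β e := by rw [mul_pow]
    _ ≤ compC d n * ((1 + |e.2 0|) ^ n * (C' * Real.exp (β / 2 * gs e.2))) * gw b β e := by
        have := h' e.2
        gcongr
    _ = _ := by
        have : Real.exp (-(β / 2 * gs e.2)) = Real.exp (β / 2 * gs e.2) * Real.exp (-(β * gs e.2)) := by
          rw [← Real.exp_add]; congr 1; ring
        simp only [gw, this, abs_abs]; ring

lemma KK_sub (p : ℤ) (G G' : EE d → ℝ) (e : EE d) : KK p (fun e => G e - G' e) e = KK p G e - KK p G' e := by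
  unfold KK; split_ifs <;> ring

lemma GF.ker (hε : ∀ i, 0 ≤ ε i) (h : GF ε n f f') (p : ℤ) {ψ : Pt d → ℝ} {Cψ δ : ℝ} (hδ : 0 < δ)
    (hψ : CB n (fun _ => Cψ) (fun e : EE d => ψ e.2)) (hc : (2 * n + 4 : ℤ) ≤ p ∨ ∀ ζ, pnorm ζ < δ → ψ ζ = 0) :
    KF ε n (fun i e => ψ e.2 * KK p (f i) e) (fun i e => ψ e.2 * KK p (f' i) e) := by
  obtain ⟨b, β, h1, h2, h3, h4⟩ := h
  have hCψ : 0 ≤ Cψ := (abs_nonneg _).trans (hψ.bound 0)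
  obtain ⟨C, N, hC, hk⟩ := VarBPHZ.ker (d := d) n p h3 hδ hCψ
  refine ⟨fun s => C * (b (Real.sqrt |s|) * (1 + Real.sqrt |s|) ^ N), by fun_prop, fun s => by have := h2 (Real.sqrt |s|); positivity,
    fun i => ⟨hk b _ ψ h1 h2 (h4 i).cl hψ hc, hk b _ ψ h1 h2 (h4 i).cr hψ hc, ?_⟩⟩
  have hs : CB n (gw (fun s => ε i * b s) β) (fun e => f i e - f' i e) := by
    refine PB.mono (h4 i).s fun _ e => le_of_eq ?_
    simp only [gw]; ring
  have := hk (fun s => ε i * b s) _ ψ (by fun_prop) (fun s => mul_nonneg (hε i) (h2 s)) hs hψ hc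
  have e1 : (fun e : EE d => ψ e.2 * KK p (fun e => f i e - f' i e) e) = fun e => ψ e.2 * KK p (f i) e - ψ e.2 * KK p (f' i) e := by
    funext e; rw [KK_sub]; ring
  rw [e1] at this
  refine PB.mono this fun _ e => le_of_eq ?_
  simp only [kw]; ring

lemma KF.add (h : KF ε n f f') (h' : KF ε n g g') :
    KF ε n (fun i e => f i e + g i e) (fun i e => f' i e + g' i e) := by
  obtain ⟨c, h1, h2, h3⟩ := h
  obtain ⟨c', h1', h2', h3'⟩ := h'
  exact ⟨fun s => c s + c' s, by fun_prop, fun s => add_nonneg (h2 s) (h2' s), fun i => (h3 i).add (h3' i)⟩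

end GF

/-- Composition with a linear map. -/
lemma CB.comp_lin (T : EE d →L[ℝ] EE d) {K : ℝ} (hK : ∀ j, ∑ i, |crd i (T (dir j))| ≤ K) (hK1 : 1 ≤ K) {n : ℕ} {b f : EE d → ℝ}
    (h : CB n b f) : CB n (fun e => K ^ n * b (T e)) (fun e => f (T e)) := by
  have hb0 : ∀ e, 0 ≤ b e := fun e => (abs_nonneg _).trans (h.bound e)
  have hb : ∀ n e, |f (T e)| ≤ K ^ n * b (T e) := fun n e =>
    (h.bound (T e)).trans (le_mul_of_one_le_left (hb0 _) (one_le_pow₀ hK1))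
  induction n generalizing f with
  | zero => exact ⟨(h.cont.comp T.continuous).comp continuous_snd, fun _ e => hb 0 e⟩
  | succ n ih =>
    have hdf : Differentiable ℝ fun e => f (T e) := h.diff.comp T.differentiable
    refine ⟨hdf.continuous.comp continuous_snd, fun _ e => hb _ e, fun _ => hdf, fun j => ?_⟩
    show CB n _ (D j fun e => f (T e))
    have hD : D j (fun e => f (T e)) = fun e => ∑ i, crd i (T (dir j)) * D i f (T e) := by
      funext e
      have := (h.diff (T e)).hasFDerivAt.comp e T.hasFDerivAt
      rw [← fderiv_apply_eq]
      unfold D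
      rw [show (fun e => f (T e)) = f ∘ T from rfl, this.fderiv]
      rfl
    rw [hD]
    have hi : ∀ i, CB n (fun e => K ^ n * b (T e)) (fun e => D i f (T e)) := fun i =>
      ih (h.deriv i) fun n e => ((h.deriv i).bound (T e)).trans (le_mul_of_one_le_left (hb0 _) (one_le_pow₀ hK1))
    have := PB.sum Finset.univ (fun i (_ : i ∈ Finset.univ) => PB.const_mul (crd i (T (dir j))) (hi i))
    refine PB.mono this fun _ e => ?_
    rw [← Finset.sum_mul, pow_succ]
    have := hK j
    have := hb0 (T e)
    have hKn : 0 ≤ K ^ n * b (T e) := by positivity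
    calc _ ≤ K * (K ^ n * b (T e)) := by gcongr
      _ = _ := by ring

/-- `(z, zb) ↦ (zb, z - zb)`. -/
noncomputable def ell1 (d : ℕ) : EE d →L[ℝ] EE d :=
  (ContinuousLinearMap.snd ℝ (Pt d) (Pt d)).prod (ContinuousLinearMap.fst ℝ (Pt d) (Pt d) - ContinuousLinearMap.snd ℝ (Pt d) (Pt d))
/-- `(z, zb) ↦ (z, z - zb)`. -/
noncomputable def ell2 (d : ℕ) : EE d →L[ℝ] EE d :=
  (ContinuousLinearMap.fst ℝ (Pt d) (Pt d)).prod (ContinuousLinearMap.fst ℝ (Pt d) (Pt d) - ContinuousLinearMap.snd ℝ (Pt d) (Pt d))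

lemma ell1_apply (z zb : Pt d) : ell1 d (z, zb) = (zb, z - zb) := rfl
lemma ell2_apply (z zb : Pt d) : ell2 d (z, zb) = (z, z - zb) := rfl

lemma exists_K (T : EE d →L[ℝ] EE d) : ∃ K : ℝ, 1 ≤ K ∧ ∀ j, ∑ i, |crd i (T (dir j))| ≤ K := by
  have hn : ∀ j, 0 ≤ ∑ i, |crd i (T (dir j))| := fun j => Finset.sum_nonneg fun _ _ => abs_nonneg _
  refine ⟨1 + ∑ j, ∑ i, |crd i (T (dir j))|, ?_, fun j => ?_⟩
  · have := Finset.sum_nonneg fun j (_ : j ∈ Finset.univ) => hn j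
    linarith
  · have := Finset.single_le_sum (f := fun j => ∑ i, |crd i (T (dir j))|) (fun j _ => hn j) (Finset.mem_univ j)
    linarith

lemma KF.cloc {I : Type} {ε : I → ℝ} {r : ℕ} {f f' : I → EE d → ℝ} (hε : ∀ i, 0 ≤ ε i) (h : KF ε r f f') (T : EE d →L[ℝ] EE d)
    (hT : ∀ e, (T e).2 0 = e.1 0 - e.2 0) :
    (∀ i, MemCloc r (fun z zb => f i (T (z, zb)))) ∧
    (∀ i, MemCloc r (fun z zb => f i (T (z, zb)) - f' i (T (z, zb)))) ∧
    ∀ t : ℝ, ∃ Q : ℝ, 0 ≤ Q ∧ ∀ i, clocNorm r t (fun z zb => f i (T (z, zb)) - f' i (T (z, zb))) ≤ ε i * Q := by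
  obtain ⟨c, h1, h2, h3⟩ := h
  obtain ⟨K, hK1, hK⟩ := exists_K T
  have hQ : ∀ t : ℝ, ∃ Q, 0 ≤ Q ∧ ∀ s, |s| ≤ t → c s ≤ Q := by
    intro t
    obtain ⟨Q, hQ⟩ := (isCompact_Icc (a := -t) (b := t)).bddAbove_image h1.continuousOn
    refine ⟨max Q 0, le_max_right _ _, fun s hs => le_max_of_le_left ?_⟩
    exact hQ ⟨s, abs_le.1 hs, rfl⟩
  have hK0 : 0 ≤ K := zero_le_one.trans hK1
  have hs : ∀ i, CB r (fun e => K ^ r * (ε i * c ((T e).2 0))) (fun e => f i (T e) - f' i (T e)) := fun i =>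
    CB.comp_lin T hK hK1 (b := fun e => ε i * c (e.2 0)) (f := fun e => f i e - f' i e) (h3 i).s
  refine ⟨fun i => ?_, fun i => ?_, fun t => ?_⟩
  · refine MemCloc.of_CB (CB.comp_lin T hK hK1 (h3 i).cl) fun t ht => ?_
    obtain ⟨Q, hQ0, hQ⟩ := hQ t
    refine ⟨K ^ r * Q, fun e he => ?_⟩
    rw [hT]
    have := hQ _ he
    gcongr
  · refine MemCloc.of_CB (hs i) fun t ht => ?_
    obtain ⟨Q, hQ0, hQ⟩ := hQ t
    refine ⟨K ^ r * (ε i * Q), fun e he => ?_⟩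
    rw [hT]
    have := hQ _ he
    have := hε i
    gcongr
  · obtain ⟨Q, hQ0, hQ⟩ := hQ t
    refine ⟨K ^ r * Q, by positivity, fun i => ?_⟩
    refine clocNorm_le_of_CB (hs i) (mul_nonneg (hε i) (by positivity)) fun e he => ?_
    rw [hT]
    have := hQ _ he
    have := hε i
    calc K ^ r * (ε i * c (e.1 0 - e.2 0)) ≤ K ^ r * (ε i * Q) := by gcongr
      _ = _ := by ring

/-! ## The series -/

lemma CB_upow (n j : ℕ) : CB n (fun e : EE d => (2 ^ n * (1 + |e.2 0|)) ^ j) (fun e => e.2 0 ^ j) := by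
  induction j with
  | zero => simpa [CB] using (PB.const (X := Unit) (d := d) (n := n) 1)
  | succ j ih =>
    have := PB.mul ih (CB_snd n 0)
    simp only [pow_succ]
    refine PB.mono this fun _ e => le_of_eq ?_
    ring

lemma continuous_series {X : Type*} [TopologicalSpace X] {κ : ℕ → ℝ} (hκ : ∀ k, 0 ≤ κ k)
    (hs : ∀ s : ℝ, 0 ≤ s → Summable fun k => κ k * s ^ k) {g : X → ℝ} (hg : Continuous g) (hg0 : ∀ x, 0 ≤ g x) :
    Continuous fun x => ∑' k, κ k * g x ^ k := by
  refine continuous_iff_continuousAt.2 fun x => ?_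
  have hU : IsOpen {y | g y < g x + 1} := isOpen_lt hg continuous_const
  have : ContinuousOn (fun x => ∑' k, κ k * g x ^ k) {y | g y < g x + 1} := by
    refine continuousOn_tsum (u := fun k => κ k * (g x + 1) ^ k) (fun k => by fun_prop) (hs _ (by have := hg0 x; linarith)) ?_
    intro k y hy
    rw [Real.norm_eq_abs, abs_of_nonneg (mul_nonneg (hκ k) (pow_nonneg (hg0 y) k))]
    have h1 := hg0 y
    have h2 := hκ k
    have h3 : g y ≤ g x + 1 := le_of_lt hy
    gcongr
  exact this.continuousAt (hU.mem_nhds (by simp))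

/-- The remainder of the Volterra series. -/
noncomputable def Gr (A : Coeffs d) (L : ℕ) (e : EE d) : ℝ := ∑' j, e.2 0 ^ j * Vt A (L + 1 + j) e

section series
variable {I : Type} {lam : ℝ} {ε : I → ℝ} {n : ℕ} {A A' : I → Coeffs d}

lemma Good.Vu (h : Good lam ε (n + 2) A A') : ∃ b : ℝ → ℝ, Continuous b ∧ (∀ s, 0 ≤ b s) ∧
    ∀ i j k, j ≤ k → CD n (ε i) (fun e => (1 / 2 : ℝ) ^ k * gw b (mu lam) e) (fun e => e.2 0 ^ j * VarBPHZ.Vt (A i) k e)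
      (fun e => e.2 0 ^ j * VarBPHZ.Vt (A' i) k e) := by
  obtain ⟨C, κ, hC, hκ, hV⟩ := h.Vt
  set K : ℕ → ℝ := fun k => 2 ^ (n + 1) * (κ * ∏ j ∈ Finset.range k, (C * Jc j)) with hK
  have hκ0 : ∀ k, 0 ≤ κ * ∏ j ∈ Finset.range k, (C * Jc j) := fun k =>
    mul_nonneg hκ (Finset.prod_nonneg fun j _ => mul_nonneg hC (Jc_nonneg j))
  have hK0 : ∀ k, 0 ≤ K k := fun k => mul_nonneg (by positivity) (hκ0 k)
  have hsum : ∀ s : ℝ, 0 ≤ s → Summable fun k => K k * s ^ k := by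
    intro s hs
    have := (summable_kappa C s hC hs κ).mul_left (2 ^ (n + 1))
    refine this.congr fun k => by simp only [hK]; ring
  set g : ℝ → ℝ := fun s => 2 * (2 ^ n * (1 + |s|) ^ (2 * n + 3)) with hg
  have hg0 : ∀ s, 0 ≤ g s := fun s => by simp only [hg]; positivity
  refine ⟨fun s => ∑' k, K k * g s ^ k, continuous_series hK0 hsum (by fun_prop) hg0,
    fun s => tsum_nonneg fun k => mul_nonneg (hK0 k) (pow_nonneg (hg0 s) k), fun i j k hjk => ?_⟩
  have h1 := PD.mul (h.hε i) (CB.toCD (h.hε i) (CB_upow (d := d) n j)) (hV i k)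
  refine CD.mono (b := fun e => 2 ^ (n + 1) * ((2 ^ n * (1 + |e.2 0|)) ^ j * ((κ * ∏ j ∈ Finset.range k, (C * Jc j)) *
    wb (k * (2 * n + 2)) (mu lam) e))) h1 (h.hε i) fun e => ?_
  have h2 : K k * g |e.2 0| ^ k ≤ ∑' k, K k * g |e.2 0| ^ k :=
    (hsum _ (hg0 _)).le_tsum k fun k _ => mul_nonneg (hK0 k) (pow_nonneg (hg0 _) k)
  have h3 : (2 ^ n * (1 + |e.2 0|)) ^ j ≤ (2 ^ n * (1 + |e.2 0|)) ^ k := by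
    refine pow_le_pow_right₀ ?_ hjk
    have := abs_nonneg (e.2 0)
    exact one_le_mul_of_one_le_of_one_le (one_le_pow₀ (by norm_num)) (by linarith)
  have h4 : (1 / 2 : ℝ) ^ k * g |e.2 0| ^ k = (2 ^ n * (1 + |e.2 0|)) ^ k * (1 + |e.2 0|) ^ (k * (2 * n + 2)) := by
    rw [← mul_pow, mul_comm k, pow_mul, ← mul_pow]
    congr 1
    simp only [hg, abs_abs]
    ring
  have hk0 := hκ0 k
  set κk := κ * ∏ j ∈ Finset.range k, (C * Jc j) with hκk
  calc 2 ^ (n + 1) * ((2 ^ n * (1 + |e.2 0|)) ^ j * (κk * wb (k * (2 * n + 2)) (mu lam) e))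
      ≤ 2 ^ (n + 1) * ((2 ^ n * (1 + |e.2 0|)) ^ k * (κk * wb (k * (2 * n + 2)) (mu lam) e)) := by
        have := wb_nonneg (k * (2 * n + 2)) (mu lam) e
        gcongr
    _ = (1 / 2 : ℝ) ^ k * ((K k * g |e.2 0| ^ k) * Real.exp (-(mu lam * gs e.2))) := by
        rw [show (1 / 2 : ℝ) ^ k * ((K k * g |e.2 0| ^ k) * Real.exp (-(mu lam * gs e.2)))
          = K k * ((1 / 2 : ℝ) ^ k * g |e.2 0| ^ k) * Real.exp (-(mu lam * gs e.2)) by ring, h4]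
        simp only [hK, wb]; ring
    _ ≤ (1 / 2 : ℝ) ^ k * ((∑' k, K k * g |e.2 0| ^ k) * Real.exp (-(mu lam * gs e.2))) := by gcongr

lemma integral_count_nat {f : ℕ → ℝ} (h : Integrable f Measure.count) : ∫ k, f k ∂Measure.count = ∑' k, f k := by
  rw [integral_countable h]
  simp [Measure.real]

lemma mu_pos (h : 0 < lam) : 0 < mu lam := by unfold mu; linarith

lemma Good.Gr (h : Good lam ε (n + 2) A A') (L : ℕ) :
    GF ε n (fun i => VarBPHZ.Gr (A i) L) (fun i => VarBPHZ.Gr (A' i) L) := by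
  obtain ⟨b, hb, hb0, hV⟩ := h.Vu
  have hgi : Integrable (fun j : ℕ => (1 / 2 : ℝ) ^ (L + 1 + j)) Measure.count := by
    rw [integrable_count_iff]
    have : Summable fun j : ℕ => (1 / 2 : ℝ) ^ j := summable_geometric_of_lt_one (by norm_num) (by norm_num)
    refine (this.mul_left ((1 / 2 : ℝ) ^ (L + 1))).congr fun j => by
      rw [← pow_add, Real.norm_of_nonneg (by positivity)]
  have hPD : ∀ i, PD (X := ℕ) n (ε i) (fun j e => (1 / 2 : ℝ) ^ (L + 1 + j) * gw b (mu lam) e)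
      (fun j e => e.2 0 ^ j * VarBPHZ.Vt (A i) (L + 1 + j) e) (fun j e => e.2 0 ^ j * VarBPHZ.Vt (A' i) (L + 1 + j) e) := by
    have key : ∀ (n : ℕ) (B F : ℕ → EE d → ℝ), (∀ j, CB n (B j) (F j)) → PB (X := ℕ) n B F := by
      intro n
      induction n with
      | zero =>
        intro B F h
        refine ⟨?_, fun j e => (h j).bound e⟩
        refine continuous_iff_continuousAt.2 fun p => ?_
        have : (fun p : ℕ × EE d => F p.1 p.2) =ᶠ[nhds p] fun q => F p.1 q.2 := by
          have : {q : ℕ × EE d | q.1 = p.1} ∈ nhds p :=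
            ((isOpen_discrete {p.1}).preimage continuous_fst).mem_nhds rfl
          filter_upwards [this] with q hq
          rw [show q.1 = p.1 from hq]
        rw [continuousAt_congr this]
        exact ((h p.1).cont.comp continuous_snd).continuousAt
      | succ n ih =>
        intro B F h
        have h0 := ih B F fun j => (h j).pred
        exact ⟨h0.cont, h0.bound, fun j => (h j).diff, fun i => ih _ _ fun j => (h j).deriv i⟩
    intro i
    exact ⟨key _ _ _ fun j => (hV i j (L + 1 + j) (by omega)).cl, key _ _ _ fun j => (hV i j (L + 1 + j) (by omega)).cr,
      key _ _ _ fun j => (hV i j (L + 1 + j) (by omega)).s⟩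
  set c : ℝ := ∫ j : ℕ, (1 / 2 : ℝ) ^ (L + 1 + j) ∂Measure.count with hc
  have hc0 : 0 ≤ c := integral_nonneg fun j => by positivity
  refine ⟨fun s => c * b s, mu lam, by fun_prop, fun s => mul_nonneg hc0 (hb0 s), mu_pos h.pos, fun i => ?_⟩
  have := (hPD i).integral hgi (gw_cont hb _)
  have e1 : (fun e => ∫ j : ℕ, e.2 0 ^ j * VarBPHZ.Vt (A i) (L + 1 + j) e ∂Measure.count) = VarBPHZ.Gr (A i) L := by
    funext e
    exact integral_count_nat ((hPD i).l.integrable hgi e)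
  have e2 : (fun e => ∫ j : ℕ, e.2 0 ^ j * VarBPHZ.Vt (A' i) (L + 1 + j) e ∂Measure.count) = VarBPHZ.Gr (A' i) L := by
    funext e
    exact integral_count_nat ((hPD i).r.integrable hgi e)
  rw [e1, e2] at this
  refine CD.mono this (h.hε i) fun e => le_of_eq ?_
  simp only [gw]; ring

end series

end

section

set_option linter.unusedSectionVars false
set_option linter.unusedVariables false

/-! ## The decomposition -/

/-- Taylor polynomial in the variable `u`. -/
noncomputable def TP (f : EE d → ℝ) (L : ℕ) (e : EE d) : ℝ :=
  ∑ m ∈ Finset.range (L + 1), e.2 0 ^ m * (Iop^[m] f) (ev e)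

/-- Partial sums of the Volterra series. -/
noncomputable def Um (A : Coeffs d) (L : ℕ) (σ : ℝ) (e : EE d) : ℝ :=
  ∑ k ∈ Finset.range (L + 1), e.2 0 ^ k * Vt A k (shear σ e)

lemma avT_zero (e : EE d) : (avT d).Φ 0 e = ev e := by
  rw [avT_Φ]; simp [ev, cl]

section dec
variable {I : Type} {lam : ℝ} {ε : I → ℝ} {n : ℕ} {A A' : I → Coeffs d} {N : ℕ} {β : ℝ} {f f' : I → EE d → ℝ}

lemma UW.ev (hε : ∀ i, 0 ≤ ε i) (h : UW ε n N β f f') :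
    UW ε n N β (fun i e => f i (VarBPHZ.ev e)) (fun i e => f' i (VarBPHZ.ev e)) := by
  obtain ⟨C, hC, h⟩ := h
  refine ⟨compC d n * C, mul_nonneg (zero_le_one.trans (one_le_compC d n)) hC, fun i => ?_⟩
  have := av_integrand (hε i) (h i) (fun θ e => mul_le_mul_of_nonneg_left (wb_av N β θ e) hC) 0
  have h2 := PD.comap this (g := fun _ : Unit => (0:ℝ)) continuous_const
  simp only [pow_zero, one_mul, avT_zero] at h2
  refine PD.mono (hε i) h2 fun _ e => le_of_eq ?_
  ring

lemma UW.tp (hε : ∀ i, 0 ≤ ε i) (L : ℕ) (h : UW ε (n + L) N β f f') :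
    UW ε n (N + L) β (fun i => TP (f i) L) (fun i => TP (f' i) L) := by
  refine UW.sum _ fun m hm => ?_
  have hm' : m ≤ L := by simpa [Nat.lt_succ_iff] using hm
  have h1 := ((h.le (show n + m ≤ n + L by omega)).iop_iter hε m).ev hε
  have := (UW.upow hε m).mul hε h1
  exact this.weaken hε (by omega) (by linarith)

lemma Good.um (h : Good lam ε (n + 2) A A') (L : ℕ) {σ : ℝ} (hσ : |σ| ≤ 1) :
    ∃ N, UW ε n N (mu lam / 2) (fun i => Um (A i) L σ) (fun i => Um (A' i) L σ) := by
  obtain ⟨C, κ, hC, hκ, hV⟩ := h.Vt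
  have hμ := mu_pos h.pos
  refine ⟨L + L * (2 * n + 2) + n, UW.sum _ fun k hk => ?_⟩
  have hk' : k ≤ L := by simpa [Nat.lt_succ_iff] using hk
  have h1 : UW ε n (k * (2 * n + 2)) (mu lam) (fun i => VarBPHZ.Vt (A i) k) (fun i => VarBPHZ.Vt (A' i) k) :=
    ⟨_, mul_nonneg hκ (Finset.prod_nonneg fun j _ => mul_nonneg hC (Jc_nonneg j)), fun i => hV i k⟩
  have h2 := h1.shear h.hε hσ (η := mu lam / 2) (by linarith)
  have := (UW.upow h.hε k).mul h.hε h2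
  refine this.weaken h.hε ?_ (by linarith)
  have : k * (2 * n + 2) ≤ L * (2 * n + 2) := Nat.mul_le_mul_right _ hk'
  omega

end dec

/-- The main part of the kernel, without cutoff. -/
noncomputable def Gm (A : Coeffs d) (L : ℕ) (σ : ℝ) : EE d → ℝ := TP (Um A L σ) L

/-- The remainder profile. -/
noncomputable def Rm (A : Coeffs d) (L : ℕ) (σ : ℝ) (e : EE d) : ℝ := Gr A L (shear σ e) + (Iop^[L + 1] (Um A L σ)) e

/-- The remainder kernel. -/
noncomputable def Rk (χ : Pt d → ℝ) (A : Coeffs d) (L : ℕ) (σ : ℝ) (e : EE d) : ℝ :=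
  (fun _ : Pt d => (1:ℝ)) e.2 * KK ((L:ℤ) + 1 - d) (Rm A L σ) e + (fun ζ => 1 - χ ζ) e.2 * KK (-(d:ℤ)) (Gm A L σ) e

/-- The main kernel. -/
noncomputable def Km (χ : Pt d → ℝ) (A : Coeffs d) (L : ℕ) (σ : ℝ) (w ζ : Pt d) : ℝ :=
  χ ζ * KK (-(d:ℤ)) (Gm A L σ) (w, ζ)

lemma CB_one (n : ℕ) : CB n (fun _ : EE d => (1:ℝ)) (fun e => (fun _ : Pt d => (1:ℝ)) e.2) := by
  have := PB.const (X := Unit) (d := d) (n := n) 1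
  simpa [CB] using this

lemma Good.rk {I : Type} {lam : ℝ} {ε : I → ℝ} {r : ℕ} {A A' : I → Coeffs d} {χ : Pt d → ℝ} {Cχ : ℝ} {L : ℕ}
    (h : Good lam ε (r + L + 1 + 2) A A') (hL : 2 * r + 3 + d ≤ L)
    (hχ : CB r (fun _ => Cχ) (fun e : EE d => 1 - χ e.2)) (hχ1 : ∀ ζ, pnorm ζ < 1 / 2 → χ ζ = 1) {σ : ℝ} (hσ : |σ| ≤ 1) :
    KF ε r (fun i => Rk χ (A i) L σ) (fun i => Rk χ (A' i) L σ) := by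
  have hε := h.hε
  obtain ⟨N, hU⟩ := h.um L hσ
  have hμ := mu_pos h.pos
  have hG := (h.Gr L).le (show r ≤ r + L + 1 by omega)
  have h1 : GF ε r (fun i => Rm (A i) L σ) (fun i => Rm (A' i) L σ) :=
    (hG.shear hε hσ).add hε ((UW.iop_iter hε (L + 1) (n := r) hU).gf hε (by linarith))
  have h2 : GF ε r (fun i => Gm (A i) L σ) (fun i => Gm (A' i) L σ) :=
    (UW.tp hε L (n := r) (hU.le (by omega))).gf hε (by linarith)
  refine KF.add (h1.ker hε _ one_pos (ψ := fun _ => 1) (CB_one r) (Or.inl ?_)) (h2.ker hε _ one_half_pos (ψ := fun ζ => 1 - χ ζ) hχ (Or.inr fun ζ hζ => ?_))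
  · push_cast [← @Nat.cast_le ℤ] at hL ⊢; linarith
  · simp [hχ1 ζ hζ]

section gamma
variable {lam : ℝ} {ρ n : ℕ} {A : Coeffs d}

lemma volterra_KK (hlam : 0 < lam) (hρ : 8 ≤ ρ) (hA : ParReg lam ρ A) (k : ℕ) (z zb : Pt d) :
    volterra A k z zb = KK (-(d:ℤ)) (fun e => e.2 0 ^ k * Vt A k e) (zb, z - zb) := by
  have hg := good_of hlam (n := 4) hρ hA
  have hμ := mu_pos hlam
  obtain ⟨C, hC, hZ⟩ := (hg.Zt (β := 0) (by linarith))
  have hsh : ∀ i j, UW (fun p : Nbd lam ρ A => p.1.2) 1 (0 + 1) (0 - 1) (fun _ e => lift (fun z => A.a z i j) (shear 1 e))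
      (fun p e => lift (fun z => p.1.1.a z i j) (shear 1 e)) := fun i j =>
    UW.shear hg.hε (by simp) one_pos ((hg.ha i j).le (by norm_num))
  choose c hc hsh using hsh
  have ha : ∀ i j, CB 1 (fun e => (∑ i, ∑ j, c i j) * wb (0 + 1) (0 - 1) e) (shf fun z => A.a z i j) := by
    intro i j
    refine PB.mono (hsh i j (nbd0 hA)).cl fun _ e => ?_
    have h1 := wb_nonneg (0 + 1) (0 - 1) e
    have h2 := Finset.single_le_sum (f := fun i => ∑ j, c i j) (fun i _ => Finset.sum_nonneg fun j _ => hc i j) (Finset.mem_univ i)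
    have h3 := Finset.single_le_sum (f := fun j => c i j) (fun j _ => hc i j) (Finset.mem_univ j)
    have : c i j ≤ ∑ i, ∑ j, c i j := h3.trans h2
    gcongr
  rw [volterra_eq ((hZ (nbd0 hA)).le (by norm_num)).cl ha]
  unfold KK
  split_ifs with h
  · have := Real.sqrt_pos.2 h
    simp only [vv_zero]
    rw [show (k:ℤ) - d = k + -d from sub_eq_add_neg _ _, zpow_add₀ this.ne', zpow_natCast]
    ring
  · rfl

lemma volterra_neg (hlam : 0 < lam) (hρ : 8 ≤ ρ) (hA : ParReg lam ρ A) (k : ℕ) (z zb : Pt d) (h : ¬ zb 0 < z 0) :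
    volterra A k z zb = 0 := by
  rw [volterra_KK hlam hρ hA, KK_neg]
  simpa using h

lemma Vsummable (hlam : 0 < lam) (hρ : 8 ≤ ρ) (hA : ParReg lam ρ A) (e : EE d) :
    Summable fun k => e.2 0 ^ k * Vt A k e := by
  obtain ⟨b, hb, hb0, h⟩ := (good_of hlam (n := 0 + 2) (by omega) hA).Vu
  refine Summable.of_norm_bounded (g := fun k => (1 / 2 : ℝ) ^ k * gw b (mu lam) e)
    ((summable_geometric_of_lt_one (by norm_num) (by norm_num)).mul_right _) fun k => ?_
  exact (h (nbd0 hA) k k le_rfl).cl.bound e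

lemma volterra_summable (hlam : 0 < lam) (hρ : 8 ≤ ρ) (hA : ParReg lam ρ A) (z zb : Pt d) :
    Summable fun k => volterra A k z zb := by
  simp only [volterra_KK hlam hρ hA]
  unfold KK
  split_ifs
  · exact (Vsummable hlam hρ hA _).mul_left _
  · exact summable_zero

lemma Gamma_KK (hlam : 0 < lam) (hρ : 8 ≤ ρ) (hA : ParReg lam ρ A) (z zb : Pt d) :
    GammaKer A z zb = KK (-(d:ℤ)) (fun e => ∑' k, e.2 0 ^ k * Vt A k e) (zb, z - zb) := by
  unfold GammaKer
  simp only [volterra_KK hlam hρ hA]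
  unfold KK
  split_ifs
  · rw [tsum_mul_left]
  · simp

lemma series_split (hlam : 0 < lam) (hρ : 8 ≤ ρ) (hA : ParReg lam ρ A) (L : ℕ) (hL : 2 * (L + 1 + 2) ≤ ρ) {σ : ℝ} (hσ : |σ| ≤ 1) (e : EE d) :
    ∑' k, e.2 0 ^ k * Vt A k (shear σ e) = Gm A L σ e + e.2 0 ^ (L + 1) * Rm A L σ e := by
  have hg := good_of hlam hL hA
  obtain ⟨N, C, hC, hU⟩ := hg.um L hσ
  have hs := Vsummable hlam hρ hA (shear σ e)
  have h1 := hs.sum_add_tsum_nat_add (L + 1)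
  change _ = ∑' k, e.2 0 ^ k * Vt A k (shear σ e) at h1
  rw [← h1]
  have h2 := taylor hC (hU (nbd0 hA)).cl e
  beta_reduce at h2
  have h3 : ∑ i ∈ Finset.range (L + 1), (shear σ e).2 0 ^ i * Vt A i (shear σ e) = Um A L σ e := rfl
  rw [h3, h2]
  have h4 : ∑' k, (shear σ e).2 0 ^ (k + (L + 1)) * Vt A (k + (L + 1)) (shear σ e) = e.2 0 ^ (L + 1) * Gr A L (shear σ e) := by
    unfold Gr
    rw [← tsum_mul_left]
    refine tsum_congr fun k => ?_
    rw [add_comm k, pow_add, mul_assoc]; rfl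
  rw [h4]
  unfold Gm TP Rm
  ring

lemma KK_add (p : ℤ) (G G' : EE d → ℝ) (e : EE d) : KK p (fun e => G e + G' e) e = KK p G e + KK p G' e := by
  unfold KK; split_ifs <;> ring

lemma KK_upow (p : ℤ) (m : ℕ) (G : EE d → ℝ) (e : EE d) : KK p (fun e => e.2 0 ^ m * G e) e = KK (m + p) G e := by
  unfold KK; split_ifs with h
  · have := Real.sqrt_pos.2 h
    simp only [vv_zero]
    rw [zpow_add₀ this.ne', zpow_natCast]; ring
  · rfl

lemma KmRk (χ : Pt d → ℝ) (hlam : 0 < lam) (hρ : 8 ≤ ρ) (hA : ParReg lam ρ A) (L : ℕ) (hL : 2 * (L + 1 + 2) ≤ ρ) {σ : ℝ} (hσ : |σ| ≤ 1) (w ζ : Pt d) :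
    KK (-(d:ℤ)) (fun e => ∑' k, e.2 0 ^ k * Vt A k (shear σ e)) (w, ζ) = Km χ A L σ w ζ + Rk χ A L σ (w, ζ) := by
  simp only [series_split hlam hρ hA L hL hσ]
  rw [KK_add, KK_upow]
  unfold Km Rk
  rw [show (((L + 1 : ℕ) : ℤ) + -(d:ℤ)) = (L:ℤ) + 1 - d by push_cast; ring]
  ring

lemma shear_zero (e : EE d) : shear 0 e = e := by simp [shear]

lemma Gamma_zero (χ : Pt d → ℝ) (hlam : 0 < lam) (hρ : 8 ≤ ρ) (hA : ParReg lam ρ A) (L : ℕ) (hL : 2 * (L + 1 + 2) ≤ ρ) (z zb : Pt d) :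
    GammaKer A z zb = Km χ A L 0 zb (z - zb) + Rk χ A L 0 (ell1 d (z, zb)) := by
  rw [ell1_apply, ← KmRk χ hlam hρ hA L hL (by simp), Gamma_KK hlam hρ hA]
  simp only [shear_zero]

lemma Gamma_neg (χ : Pt d → ℝ) (hlam : 0 < lam) (hρ : 8 ≤ ρ) (hA : ParReg lam ρ A) (L : ℕ) (hL : 2 * (L + 1 + 2) ≤ ρ) (z zb : Pt d) :
    GammaKer A z zb = Km χ A L (-1) z (z - zb) + Rk χ A L (-1) (ell2 d (z, zb)) := by
  rw [ell2_apply, ← KmRk χ hlam hρ hA L hL (by simp), Gamma_KK hlam hρ hA]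
  unfold KK
  split_ifs with h
  · have h1 : shear (-1) ((z, vv (z - zb)) : EE d) = (zb, vv (z - zb)) := by
      have := sh_vv h
      unfold shear
      congr 1
      funext i
      have h2 := congrFun this i
      simp only [sh, Pi.sub_apply] at h2 ⊢
      rw [h2]; ring
    simp only
    rw [h1]
  · rfl

end gamma

end

section

set_option linter.unusedSectionVars false
set_option linter.unusedVariables false

/-! ## Cutoff functions -/

lemma CB_smooth (n : ℕ) : ∀ {ψ : Pt d → ℝ}, ContDiff ℝ (⊤ : ℕ∞) ψ → HasCompactSupport ψ →
    ∃ C, CB n (fun _ => C) (fun e : EE d => ψ e.2) := by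
  induction n with
  | zero =>
    intro ψ h hc
    obtain ⟨C, hC⟩ := hc.exists_bound_of_continuous h.continuous
    refine ⟨C, ?_, fun _ e => hC _⟩
    exact (h.continuous.comp continuous_snd).comp continuous_snd
  | succ n ih =>
    intro ψ h hc
    have hd : Differentiable ℝ ψ := h.differentiable (by simp)
    obtain ⟨C0, hC0⟩ := hc.exists_bound_of_continuous h.continuous
    have hp : ∀ i, ContDiff ℝ (⊤ : ℕ∞) (pd i ψ) := fun i => by
      have : ContDiff ℝ (⊤ : ℕ∞) (fderiv ℝ ψ) := h.fderiv_right (by simp)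
      exact this.clm_apply contDiff_const
    have hpc : ∀ i, HasCompactSupport (pd i ψ) := fun i => by
      have := hc.fderiv (𝕜 := ℝ)
      exact this.comp_left (g := fun l : Pt d →L[ℝ] ℝ => l (Pi.single i 1)) (by simp)
    choose C hC using fun i => ih (hp i) (hpc i)
    have hd2 : Differentiable ℝ (fun e : EE d => ψ e.2) := hd.comp differentiable_snd
    have hCn : ∀ i, 0 ≤ C i := fun i => (abs_nonneg _).trans ((hC i).bound 0)
    refine ⟨|C0| + ∑ i, C i, hd2.continuous.comp continuous_snd, fun _ e => ?_, fun _ => hd2, fun i => ?_⟩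
    · have := hC0 e.2
      have h2 := Finset.sum_nonneg fun i (_ : i ∈ Finset.univ) => hCn i
      rw [Real.norm_eq_abs] at this
      linarith [le_abs_self C0]
    · rcases i with i | i
      · have : D (Sum.inl i) (fun e : EE d => ψ e.2) = fun _ => 0 := funext fun e => D_snd_inl hd i e
        show CB n _ (D (Sum.inl i) (fun e : EE d => ψ e.2))
        rw [this]
        refine PB.mono (PB.const 0) fun _ e => ?_
        have h2 := Finset.sum_nonneg fun i (_ : i ∈ Finset.univ) => hCn i
        simp; positivity
      · have : D (Sum.inr i) (fun e : EE d => ψ e.2) = fun e => pd i ψ e.2 := funext fun e => D_snd_inr hd i e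
        show CB n _ (D (Sum.inr i) (fun e : EE d => ψ e.2))
        rw [this]
        refine PB.mono (hC i) fun _ e => ?_
        have := Finset.single_le_sum (fun i _ => hCn i) (Finset.mem_univ i)
        linarith [abs_nonneg C0]

lemma pnorm_comp {ζ : Pt d} (h : pnorm ζ ≤ 1) : ‖ζ‖ ≤ 1 := by
  unfold pnorm at h
  have hS : ∀ i : Fin d, |ζ i.succ| ≤ ∑ i : Fin d, |ζ i.succ| := fun i =>
    Finset.single_le_sum (f := fun i : Fin d => |ζ i.succ|) (fun _ _ => abs_nonneg _) (Finset.mem_univ i)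
  have h0 : 0 ≤ ∑ i : Fin d, |ζ i.succ| := Finset.sum_nonneg fun _ _ => abs_nonneg _
  have hq := Real.sqrt_nonneg |ζ 0|
  rw [pi_norm_le_iff_of_nonneg zero_le_one]
  intro i
  refine Fin.cases ?_ (fun i => ?_) i
  · have h1 : Real.sqrt |ζ 0| ≤ 1 := by linarith
    rw [Real.norm_eq_abs]
    have := Real.sq_sqrt (abs_nonneg (ζ 0))
    nlinarith
  · rw [Real.norm_eq_abs]; linarith [hS i]

section cut
variable {χ : Pt d → ℝ}

lemma IsCutoff.one (h : IsCutoff χ) {ζ : Pt d} (hζ : pnorm ζ ≤ 1 / 2) : χ ζ = 1 := by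
  have h1 := (h.2 ζ).1
  have h2 := (h.2 ζ).2
  rw [if_pos hζ] at h1
  rw [if_pos (by linarith)] at h2
  linarith

lemma IsCutoff.zero (h : IsCutoff χ) {ζ : Pt d} (hζ : ¬ pnorm ζ ≤ 1) : χ ζ = 0 := by
  have h1 := (h.2 ζ).1
  have h2 := (h.2 ζ).2
  rw [if_neg (by intro h; apply hζ; linarith)] at h1
  rw [if_neg hζ] at h2
  linarith

lemma IsCutoff.compact (h : IsCutoff χ) : HasCompactSupport χ := by
  refine HasCompactSupport.intro (isCompact_closedBall (0 : Pt d) 1) fun ζ hζ => h.zero fun h => hζ ?_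
  simpa using pnorm_comp h

lemma IsCutoff.CB (h : IsCutoff χ) (n : ℕ) : ∃ C, VarBPHZ.CB n (fun _ => C) (fun e : EE d => 1 - χ e.2) := by
  obtain ⟨C, hC⟩ := CB_smooth n h.1 h.compact
  exact ⟨_, PB.sub (PB.const 1) hC⟩

end cut

/-! ## Local uniform convergence -/

lemma mderiv_congr {f g : Pt d → ℝ} {z : Pt d} (h : f =ᶠ[nhds z] g) (k : Fin (d + 1) → ℕ) :
    mderiv k f =ᶠ[nhds z] mderiv k g := by
  induction k using midx_induction with
  | h0 => simpa only [mderiv_zero] using h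
  | hs k j hj ih =>
    rw [mderiv_head k j hj, mderiv_head k j hj]
    filter_upwards [(ih k le_rfl).fderiv (𝕜 := ℝ)] with y hy
    simp only [pd, hy]

lemma mderiv2_congr {F G : Pt d → Pt d → ℝ} {O : Set (EE d)} (hO : IsOpen O) (h : ∀ e ∈ O, F e.1 e.2 = G e.1 e.2)
    (j m : Fin (d + 1) → ℕ) (z zb : Pt d) (hz : (z, zb) ∈ O) : mderiv2 j m F z zb = mderiv2 j m G z zb := by
  unfold mderiv2
  refine (mderiv_congr ?_ j).eq_of_nhds
  have : {z' | (z', zb) ∈ O} ∈ nhds z := (hO.preimage (f := fun z' => (z', zb)) (by fun_prop)).mem_nhds hz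
  filter_upwards [this] with z' hz'
  refine (mderiv_congr ?_ m).eq_of_nhds
  have : {y | (z', y) ∈ O} ∈ nhds zb := (hO.preimage (f := fun y => (z', y)) (by fun_prop)).mem_nhds hz'
  filter_upwards [this] with y hy
  exact h _ hy

lemma exists_cut {S : Set (Pt d)} (hS : IsCompact S) (h0 : (0 : Pt d) ∉ S) :
    ∃ (ψ : Pt d → ℝ) (δ : ℝ) (O : Set (Pt d)), 0 < δ ∧ ContDiff ℝ (⊤ : ℕ∞) ψ ∧ HasCompactSupport ψ ∧ IsOpen O ∧ S ⊆ O ∧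
      (∀ ζ ∈ O, ψ ζ = 1) ∧ ∀ ζ, pnorm ζ < δ → ψ ζ = 0 := by
  have hp0 : ∀ ζ : Pt d, pnorm ζ ≤ 0 → ζ = 0 := by
    intro ζ h
    unfold pnorm at h
    have hq := Real.sqrt_nonneg |ζ 0|
    have h0 : 0 ≤ ∑ i : Fin d, |ζ i.succ| := Finset.sum_nonneg fun _ _ => abs_nonneg _
    have h1 : Real.sqrt |ζ 0| = 0 := by linarith
    have h2 : ∑ i : Fin d, |ζ i.succ| = 0 := by linarith
    rw [Finset.sum_eq_zero_iff_of_nonneg fun _ _ => abs_nonneg _] at h2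
    rw [Real.sqrt_eq_zero (abs_nonneg _)] at h1
    funext i
    refine Fin.cases ?_ (fun i => ?_) i
    · simpa using h1
    · simpa using h2 i (Finset.mem_univ i)
  obtain ⟨δ, hδ, hSδ⟩ : ∃ δ > 0, ∀ ζ ∈ S, δ < pnorm ζ := by
    rcases S.eq_empty_or_nonempty with rfl | hne
    · exact ⟨1, one_pos, by simp⟩
    · obtain ⟨ζ0, hζ0, hmin⟩ := hS.exists_isMinOn hne pnorm_cont.continuousOn
      have : 0 < pnorm ζ0 := by
        by_contra h
        exact h0 ((hp0 ζ0 (not_lt.1 h)) ▸ hζ0)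
      exact ⟨pnorm ζ0 / 2, by linarith, fun ζ hζ => by have := hmin hζ; simp at this; linarith⟩
  have hU : IsOpen {ζ : Pt d | δ < pnorm ζ} := isOpen_lt continuous_const pnorm_cont
  obtain ⟨T, hT, hST, hTU⟩ := exists_compact_between hS hU hSδ
  obtain ⟨f, hf1, hf0, -⟩ := exists_contMDiffMap_one_nhds_of_subset_interior (n := (⊤ : ℕ∞)) (modelWithCornersSelf ℝ (Pt d)) hS.isClosed hST
  obtain ⟨O, hO, hSO, hO1⟩ := mem_nhdsSet_iff_exists.1 hf1
  refine ⟨f, δ, O, hδ, f.contMDiff.contDiff, HasCompactSupport.intro hT hf0, hO, hSO, hO1, fun ζ hζ => hf0 ζ fun h => ?_⟩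
  exact lt_asymm hζ (hTU h)

lemma unif_conv {lam : ℝ} {ρ r : ℕ} {A : Coeffs d} (hlam : 0 < lam) (hρ : 8 ≤ ρ) (hr : 2 * (r + 2) ≤ ρ) (hA : ParReg lam ρ A)
    (j1 j2 : Fin (d + 1) → ℕ) (hj : pdeg j1 + pdeg j2 ≤ r) (Cpt : Set (Pt d × Pt d)) (hC : IsCompact Cpt)
    (hne : ∀ p ∈ Cpt, p.1 0 ≠ p.2 0) :
    TendstoUniformlyOn (fun (n : ℕ) (p : Pt d × Pt d) => ∑ k ∈ Finset.range n, mderiv2 j1 j2 (volterra A k) p.1 p.2)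
      (fun p => ∑' k, mderiv2 j1 j2 (volterra A k) p.1 p.2) atTop Cpt := by
  obtain ⟨ψ, δ, O, hδ, hψ, hψc, hO, hSO, hO1, hψ0⟩ := exists_cut (S := (fun p : EE d => p.1 - p.2) '' Cpt)
    (hC.image (by fun_prop)) (by
      rintro ⟨p, hp, h⟩
      have := congrFun h 0
      simp only [Pi.sub_apply, Pi.zero_apply] at this
      exact hne p hp (by linarith))
  obtain ⟨Cψ, hCψ⟩ := CB_smooth r hψ hψc
  have hCψ0 : 0 ≤ Cψ := (abs_nonneg _).trans (hCψ.bound 0)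
  obtain ⟨b, hb, hb0, hV⟩ := (good_of hlam hr hA).Vu
  obtain ⟨C, N, hC0, hk⟩ := ker (d := d) r (-(d:ℤ)) (mu_pos hlam) hδ hCψ0
  obtain ⟨K, hK1, hK⟩ := exists_K (ell1 d)
  have hH : ∀ k, CB r (fun e => K ^ r * ((1 / 2 : ℝ) ^ k * kw b C N (ell1 d e)))
      (fun e => ψ (ell1 d e).2 * KK (-(d:ℤ)) (fun e => e.2 0 ^ k * Vt A k e) (ell1 d e)) := by
    intro k
    have h1 : CB r (gw (fun s => (1 / 2 : ℝ) ^ k * b s) (mu lam)) (fun e => e.2 0 ^ k * Vt A k e) := by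
      refine PB.mono (hV (nbd0 hA) k k le_rfl).cl fun _ e => le_of_eq ?_
      simp only [gw]; ring
    have h2 := hk (fun s => (1 / 2 : ℝ) ^ k * b s) _ ψ (by fun_prop) (fun s => mul_nonneg (by positivity) (hb0 s)) h1 hCψ (Or.inr hψ0)
    have := CB.comp_lin (ell1 d) hK hK1 h2
    refine PB.mono this fun _ e => le_of_eq ?_
    simp only [kw]; ring
  obtain ⟨Q, hQ⟩ := hC.bddAbove_image (f := fun e => K ^ r * kw b C N (ell1 d e))
    (continuous_const.mul ((kw_cont hb C N).comp (ell1 d).continuous)).continuousOn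
  have hO' : IsOpen {e : EE d | e.1 - e.2 ∈ O} := hO.preimage (by fun_prop)
  refine tendstoUniformlyOn_tsum_nat (u := fun k => (1 / 2 : ℝ) ^ k * Q)
    ((summable_geometric_of_lt_one (by norm_num) (by norm_num)).mul_right _) fun k p hp => ?_
  have h1 : mderiv2 j1 j2 (volterra A k) p.1 p.2 =
      mderiv2 j1 j2 (fun z zb => (fun e => ψ (ell1 d e).2 * KK (-(d:ℤ)) (fun e => e.2 0 ^ k * Vt A k e) (ell1 d e)) (z, zb)) p.1 p.2 := by
    refine mderiv2_congr hO' (fun e he => ?_) j1 j2 _ _ (hSO ⟨p, hp, rfl⟩)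
    show volterra A k e.1 e.2 = ψ (ell1 d e).2 * _
    rw [show (ell1 d e).2 = e.1 - e.2 from rfl, hO1 _ he, one_mul, volterra_KK hlam hρ hA]
    rfl
  have hs1 := sum_le_pdeg j1
  have hs2 := sum_le_pdeg j2
  have hH' : CB (∑ a, j1 a + ∑ a, j2 a) _ _ := PB.le (hH k) (by omega)
  rw [h1, mderiv2_eq j1 j2 hH']
  have h3 := CB_Dk Sum.inr j2 _ hH'
  rw [← zero_add (∑ a, j1 a)] at h3
  have h4 := (CB_Dk Sum.inl j1 _ h3).bound p
  have h5 := hQ ⟨p, hp, rfl⟩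
  rw [Real.norm_eq_abs]
  refine h4.trans ?_
  have : (0:ℝ) ≤ (1 / 2) ^ k := by positivity
  calc _ = (1 / 2 : ℝ) ^ k * (K ^ r * kw b C N (ell1 d p)) := by ring
    _ ≤ _ := by gcongr

end

section

set_option linter.unusedSectionVars false
set_option linter.unusedVariables false

/-! ## Membership in the spaces of regularising kernels -/

lemma pd_const_mul (i : Fin (d + 1)) (c : ℝ) (f : Pt d → ℝ) : pd i (fun z => c * f z) = fun z => c * pd i f z := by
  funext z
  simp only [pd]
  have := congrFun (fderiv_const_smul_field (𝕜 := ℝ) (f := f) c) z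
  change fderiv ℝ (c • f) z _ = _
  rw [this]; rfl

lemma mderiv_const_mul (c : ℝ) (f : Pt d → ℝ) (k : Fin (d + 1) → ℕ) :
    mderiv k (fun z => c * f z) = fun z => c * mderiv k f z := by
  induction k using midx_induction with
  | h0 => simp only [mderiv_zero]
  | hs k j hj ih => rw [mderiv_head k j hj, mderiv_head k j hj, ih k le_rfl, pd_const_mul]

@[simp] lemma pscale_zero (c : ℝ) (z : Pt d) : pscale c z 0 = c ^ 2 * z 0 := rfl
@[simp] lemma pscale_succ (c : ℝ) (z : Pt d) (i : Fin d) : pscale c z i.succ = c * z i.succ := rfl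

lemma pscale_pscale (a b : ℝ) (z : Pt d) : pscale a (pscale b z) = pscale (a * b) z := by
  funext i
  refine Fin.cases ?_ (fun i => ?_) i
  · simp; ring
  · simp; ring

lemma pscale_one (z : Pt d) : pscale 1 z = z := by
  funext i
  refine Fin.cases ?_ (fun i => ?_) i <;> simp

lemma pnorm_pscale {c : ℝ} (hc : 0 ≤ c) (z : Pt d) : pnorm (pscale c z) = c * pnorm z := by
  unfold pnorm
  simp only [pscale_zero, pscale_succ, abs_mul, abs_of_nonneg hc, abs_of_nonneg (sq_nonneg c)]
  rw [Real.sqrt_mul (sq_nonneg c), Real.sqrt_sq hc, mul_add, Finset.mul_sum]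

/-- Parabolic scaling as a linear equivalence. -/
noncomputable def psL (c : ℝ) (hc : c ≠ 0) : Pt d ≃L[ℝ] Pt d :=
  LinearEquiv.toContinuousLinearEquiv
    { toFun := pscale c
      invFun := pscale c⁻¹
      map_add' := fun x y => by
        funext i
        refine Fin.cases ?_ (fun i => ?_) i
        · simp; ring
        · simp; ring
      map_smul' := fun a x => by
        funext i
        refine Fin.cases ?_ (fun i => ?_) i
        · simp; ring
        · simp; ring
      left_inv := fun x => by rw [pscale_pscale, inv_mul_cancel₀ hc, pscale_one]
      right_inv := fun x => by rw [pscale_pscale, mul_inv_cancel₀ hc, pscale_one] }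

lemma psL_apply (c : ℝ) (hc : c ≠ 0) (z : Pt d) : psL c hc z = pscale c z := rfl

/-- scaling weight of a coordinate -/
def cwt (i : Fin (d + 1)) : ℕ := if i = 0 then 2 else 1

lemma pscale_single (c : ℝ) (i : Fin (d + 1)) : pscale c (Pi.single i 1 : Pt d) = c ^ cwt i • (Pi.single i 1 : Pt d) := by
  funext j
  refine Fin.cases ?_ (fun j => ?_) j
  · by_cases h : i = 0
    · subst h; simp [cwt]
    · simp [cwt, h, Pi.single_apply, Ne.symm h]
  · by_cases h : i = 0
    · subst h; simp [cwt]
    · by_cases h2 : j.succ = i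
      · subst h2; simp [cwt]
      · simp [cwt, h, Pi.single_apply, h2]

lemma pdeg_single (k : Fin (d + 1) → ℕ) (j : Fin (d + 1)) : pdeg (k + Pi.single j 1) = pdeg k + cwt j := by
  unfold pdeg cwt
  rw [sum_add_single]
  by_cases h : j = 0
  · subst h; simp; omega
  · simp [h, Pi.single_apply, Ne.symm h]; omega

lemma pd_pscale {c : ℝ} (hc : c ≠ 0) (f : Pt d → ℝ) (i : Fin (d + 1)) :
    pd i (fun z => f (pscale c z)) = fun z => c ^ cwt i * pd i f (pscale c z) := by
  funext z
  simp only [pd]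
  have := (psL (d := d) c hc).comp_right_fderiv (f := f) (x := z)
  change fderiv ℝ (f ∘ psL c hc) z _ = _
  rw [this]
  change fderiv ℝ f (pscale c z) (pscale c (Pi.single i 1)) = _
  rw [pscale_single, map_smul, smul_eq_mul]

lemma mderiv_pscale {c : ℝ} (hc : c ≠ 0) (f : Pt d → ℝ) (k : Fin (d + 1) → ℕ) :
    mderiv k (fun z => f (pscale c z)) = fun z => c ^ pdeg k * mderiv k f (pscale c z) := by
  induction k using midx_induction with
  | h0 => simp [mderiv_zero, pdeg]
  | hs k j hj ih =>
    rw [mderiv_head k j hj, mderiv_head k j hj, ih k le_rfl, pd_const_mul, pd_pscale hc, pdeg_single]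
    funext z; ring

/-- scaling only the `u` variable -/
noncomputable def uscale (c : ℝ) : EE d →L[ℝ] EE d :=
  LinearMap.toContinuousLinearMap
    { toFun := fun e => (e.1, fun i => (if i = 0 then c else 1) * e.2 i)
      map_add' := fun x y => Prod.ext rfl (funext fun i => mul_add _ _ _)
      map_smul' := fun a x => Prod.ext rfl (funext fun i => mul_left_comm _ _ _) }

lemma uscale_apply (c : ℝ) (e : EE d) : uscale c e = (e.1, fun i => (if i = 0 then c else 1) * e.2 i) := rfl

lemma crd_uscale (c : ℝ) (j i : Ix d) : |crd i (uscale c (dir j))| ≤ |crd i (dir j)| * (max 1 |c|) := by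
  have h1 : (1:ℝ) ≤ max 1 |c| := le_max_left _ _
  have h2 := le_max_right 1 |c|
  rcases i with i | i
  · simp only [uscale_apply, crd_inl]
    exact le_mul_of_one_le_right (abs_nonneg _) h1
  · simp only [uscale_apply, crd_inr, abs_mul]
    rw [mul_comm]
    refine mul_le_mul_of_nonneg_left ?_ (abs_nonneg _)
    split_ifs
    · exact h2
    · simp

lemma uscale_CB (d n : ℕ) : ∃ K : ℝ, 0 ≤ K ∧ ∀ (N : ℕ) (β C c : ℝ) (G : EE d → ℝ), 0 ≤ C → 0 ≤ c → c ≤ 1 →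
    CB n (fun e => C * wb N β e) G → CB n (gw (fun s => K * C * (1 + s) ^ N) β) (fun e => G (uscale c e)) := by
  obtain ⟨K, hK1, hK⟩ := exists_K (ContinuousLinearMap.id ℝ (EE d))
  have hK0 : 0 ≤ K := by linarith
  refine ⟨K ^ n, by positivity, fun N β C c G hC hc0 hc1 h => ?_⟩
  have h1 : ∀ j, ∑ i, |crd i (uscale c (dir j) : EE d)| ≤ K := fun j => by
    refine (Finset.sum_le_sum fun i _ => ?_).trans (hK j)
    have := crd_uscale (d := d) c j i
    rwa [max_eq_left (by rwa [abs_of_nonneg hc0]), mul_one] at this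
  refine PB.mono (CB.comp_lin (uscale c) h1 hK1 h) fun _ e => ?_
  have h2 : wb N β (uscale c e) ≤ wb N β e := by
    unfold wb
    have : gs (uscale c e).2 = gs e.2 := by simp [gs, uscale_apply]
    rw [this]
    refine mul_le_mul_of_nonneg_right (pow_le_pow_left₀ (by positivity) ?_ _) (Real.exp_nonneg _)
    simp only [uscale_apply, if_true, abs_mul, abs_of_nonneg hc0]
    nlinarith [abs_nonneg (e.2 0)]
  calc K ^ n * (C * wb N β (uscale c e)) ≤ K ^ n * (C * wb N β e) := by gcongr
    _ = _ := by unfold wb gw; ring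

lemma KK_scale (p : ℤ) (G : EE d → ℝ) {c : ℝ} (hc : 0 < c) (w ζ : Pt d) :
    KK p (fun e => G (uscale c⁻¹ e)) (w, pscale c ζ) = c ^ p * KK p G (w, ζ) := by
  by_cases h : 0 < ζ 0
  · have h' : 0 < pscale c ζ 0 := by simp; positivity
    have hs : Real.sqrt (c ^ 2 * ζ 0) = c * Real.sqrt (ζ 0) := by rw [Real.sqrt_mul (sq_nonneg c), Real.sqrt_sq hc.le]
    have hv : (uscale c⁻¹ (w, vv (pscale c ζ)) : EE d) = (w, vv ζ) := by
      rw [uscale_apply]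
      refine Prod.ext rfl (funext fun i => ?_)
      refine Fin.cases ?_ (fun i => ?_) i
      · simp [hs, hc.ne']
      · simp [hs]
        rw [mul_div_mul_left _ _ hc.ne']
    rw [KK_pos (by exact h'), KK_pos (by exact h)]
    simp only [hv, pscale_zero, hs, mul_zpow]
    ring
  · have h' : ¬ 0 < pscale c ζ 0 := by simp; exact mul_nonpos_of_nonneg_of_nonpos (sq_nonneg c) (not_lt.1 h)
    rw [KK_neg (by exact h'), KK_neg (by exact h), mul_zero]

/-- The reference annulus cutoffs. -/
noncomputable def psn (χ : Pt d → ℝ) (n : ℕ) (z : Pt d) : ℝ := if n = 0 then (χ z - χ (pscale 2 z)) * χ z else χ z - χ (pscale 2 z)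

variable {χ : Pt d → ℝ}

lemma psn_eq (hχ : IsCutoff χ) (n : ℕ) (ζ : Pt d) : dyadicCut χ n ζ * χ ζ = psn χ n (pscale (2 ^ n) ζ) := by
  have h1 : dyadicCut χ n ζ = χ (pscale (2 ^ n) ζ) - χ (pscale 2 (pscale (2 ^ n) ζ)) := by
    rw [pscale_pscale, dyadicCut, pow_succ']
  unfold psn
  by_cases hn : n = 0
  · subst hn
    simp [h1, pscale_one]
  · rw [if_neg hn, h1]
    have hp : (0:ℝ) ≤ 2 ^ n := by positivity
    by_cases hz : pnorm (pscale (2 ^ n) ζ) ≤ 1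
    · rw [hχ.one (ζ := ζ), mul_one]
      rw [pnorm_pscale hp] at hz
      have : (2:ℝ) ≤ 2 ^ n := by
        calc (2:ℝ) = 2 ^ 1 := by norm_num
          _ ≤ 2 ^ n := pow_le_pow_right₀ (by norm_num) (Nat.one_le_iff_ne_zero.2 hn)
      have hnn : 0 ≤ pnorm ζ := by unfold pnorm; positivity
      nlinarith
    · rw [hχ.zero hz, hχ.zero, sub_self, zero_mul]
      rw [pnorm_pscale two_pos.le]; push Not at hz ⊢; linarith

lemma psn_zero (hχ : IsCutoff χ) (n : ℕ) {ζ : Pt d} (hz : pnorm ζ < 1 / 4) : psn χ n ζ = 0 := by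
  have h1 : χ ζ = 1 := hχ.one (by linarith)
  have h2 : χ (pscale 2 ζ) = 1 := hχ.one (by rw [pnorm_pscale two_pos.le]; linarith)
  simp [psn, h1, h2]

lemma psn_out (hχ : IsCutoff χ) (n : ℕ) {ζ : Pt d} (hz : 1 < pnorm ζ) : psn χ n ζ = 0 := by
  have h1 : χ ζ = 0 := hχ.zero (by linarith)
  have h2 : χ (pscale 2 ζ) = 0 := hχ.zero (by rw [pnorm_pscale two_pos.le]; linarith)
  simp [psn, h1, h2]

lemma psn_CB (hχ : IsCutoff χ) (q : ℕ) : ∃ C : ℝ, 0 ≤ C ∧ ∀ n, CB q (fun _ => C) (fun e : EE d => psn χ n e.2) := by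
  have hs : ContDiff ℝ (⊤ : ℕ∞) fun z : Pt d => χ z - χ (pscale 2 z) :=
    hχ.1.sub (hχ.1.comp (psL (d := d) 2 two_ne_zero).contDiff)
  have hc : ∀ n, HasCompactSupport (psn χ n) := fun n => by
    refine HasCompactSupport.intro (isCompact_closedBall (0 : Pt d) 1) fun z hz => psn_out hχ n ?_
    by_contra h
    exact hz (by simpa using pnorm_comp (not_lt.1 h))
  obtain ⟨C0, h0⟩ := CB_smooth (d := d) q (ψ := psn χ 0) (by have := hs.mul hχ.1; exact this) (hc 0)
  obtain ⟨C1, h1⟩ := CB_smooth (d := d) q (ψ := psn χ 1) (by exact hs) (hc 1)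
  refine ⟨max C0 C1, le_max_of_le_left ((abs_nonneg _).trans (h0.bound 0)), fun n => ?_⟩
  by_cases hn : n = 0
  · subst hn; exact PB.mono h0 fun _ _ => le_max_left _ _
  · have : psn χ n = psn χ 1 := by funext z; simp [psn, hn]
    rw [this]
    exact PB.mono h1 fun _ _ => le_max_right _ _

lemma piece (hχ : IsCutoff χ) (q N : ℕ) {β : ℝ} (hβ : 0 < β) : ∃ Q : ℝ, 0 ≤ Q ∧ ∀ (C : ℝ) (G : EE d → ℝ), 0 ≤ C →
    CB q (fun e => C * wb N β e) G → ∀ (w : Pt d) (n : ℕ),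
    (∀ k : Fin (d + 1) → ℕ, pdeg k < q → Differentiable ℝ (mderiv k fun ζ => dyadicCut χ n ζ * (χ ζ * KK (-(d:ℤ)) G (w, ζ)))) ∧
    (∀ k : Fin (d + 1) → ℕ, pdeg k ≤ q → Continuous (mderiv k fun ζ => dyadicCut χ n ζ * (χ ζ * KK (-(d:ℤ)) G (w, ζ)))) ∧
    (∀ z : Pt d, ¬pnorm z ≤ (2 : ℝ) ^ (-(n : ℝ)) → dyadicCut χ n z * (χ z * KK (-(d:ℤ)) G (w, z)) = 0) ∧
    ∀ (k : Fin (d + 1) → ℕ) (z : Pt d), pdeg k ≤ q →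
      |mderiv k (fun ζ => dyadicCut χ n ζ * (χ ζ * KK (-(d:ℤ)) G (w, ζ))) z| / 2 ^ (((d : ℝ) + 2 - 2 + pdeg k) * n) ≤ C * Q := by
  obtain ⟨Cψ, hCψ, hψ⟩ := psn_CB hχ q
  obtain ⟨K, hK, hu⟩ := uscale_CB d q
  obtain ⟨C0, N0, hC0, hker⟩ := ker (d := d) q (-(d:ℤ)) hβ (show (0:ℝ) < 1 / 4 by norm_num) hCψ
  refine ⟨C0 * (K * 2 ^ N * 2 ^ N0), by positivity, fun C G hC hG w n => ?_⟩
  set c : ℝ := 2 ^ n with hc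
  have hcp : 0 < c := by positivity
  have hc1 : 1 ≤ c := one_le_pow₀ (by norm_num)
  set b : ℝ → ℝ := fun s => K * C * (1 + |s|) ^ N with hb
  have hG1 : CB q (gw b β) (fun e => G (uscale c⁻¹ e)) := by
    refine PB.mono (hu N β C c⁻¹ G hC (by positivity) (inv_le_one_of_one_le₀ hc1) hG) fun _ e => ?_
    simp [gw, hb]
  have hb0 : ∀ s, 0 ≤ b s := fun s => by positivity
  have hH := hker b _ (psn χ n) (by fun_prop) hb0 hG1 (hψ n) (Or.inr fun ζ hζ => psn_zero hχ n hζ)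
  set H : EE d → ℝ := fun e => psn χ n e.2 * KK (-(d:ℤ)) (fun e => G (uscale c⁻¹ e)) e with hHdef
  have hF : (fun ζ => dyadicCut χ n ζ * (χ ζ * KK (-(d:ℤ)) G (w, ζ))) = fun ζ => c ^ d * (fun z => (fun y => H (w, y)) (pscale c z)) ζ := by
    funext ζ
    simp only [hHdef]
    rw [KK_scale _ _ hcp, ← psn_eq hχ]
    have : c ^ d * c ^ (-(d:ℤ)) = 1 := by rw [zpow_neg, zpow_natCast]; exact mul_inv_cancel₀ (by positivity)
    linear_combination (-(dyadicCut χ n ζ * χ ζ * KK (-(d:ℤ)) G (w, ζ))) * this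
  have hmd : ∀ k : Fin (d + 1) → ℕ, pdeg k ≤ q → mderiv k (fun ζ => dyadicCut χ n ζ * (χ ζ * KK (-(d:ℤ)) G (w, ζ))) =
      fun z => c ^ d * (c ^ pdeg k * Dk Sum.inr k H (w, pscale c z)) := fun k hk => by
    rw [hF, mderiv_const_mul, mderiv_pscale hcp.ne' (fun y => H (w, y)), mderiv_slice_inr w k (PB.le hH ((sum_le_pdeg k).trans hk))]
  have hps : Continuous (pscale c : Pt d → Pt d) := (psL (d := d) c hcp.ne').continuous
  have hpd : Differentiable ℝ (pscale c : Pt d → Pt d) := (psL (d := d) c hcp.ne').differentiable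
  have hk0 : ∀ (k : Fin (d + 1) → ℕ), pdeg k ≤ q → CB (q - ∑ a, k a) (kw b C0 N0) (Dk Sum.inr k H) := fun k hk =>
    CB_Dk _ k _ (by rw [Nat.sub_add_cancel ((sum_le_pdeg k).trans hk)]; exact hH)
  refine ⟨fun k hk => ?_, fun k hk => ?_, fun z hz => ?_, fun k z hk => ?_⟩
  · rw [hmd k hk.le]
    have h1 := hk0 k hk.le
    obtain ⟨m, hm⟩ : ∃ m, q - ∑ a, k a = m + 1 := ⟨q - ∑ a, k a - 1, by have := sum_le_pdeg k; omega⟩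
    rw [hm] at h1
    exact ((h1.diff.comp ((differentiable_const w).prodMk hpd)).const_mul _).const_mul _
  · rw [hmd k hk]
    exact continuous_const.mul (continuous_const.mul ((hk0 k hk).cont.comp (continuous_const.prodMk hps)))
  · have : 1 < pnorm (pscale c z) := by
      rw [pnorm_pscale hcp.le]
      push Not at hz
      rw [Real.rpow_neg (by norm_num), Real.rpow_natCast, ← hc] at hz
      calc (1:ℝ) = c * c⁻¹ := (mul_inv_cancel₀ hcp.ne').symm
        _ < _ := by gcongr
    rw [← mul_assoc, psn_eq hχ, psn_out hχ n this, zero_mul]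
  · have h2 : (2:ℝ) ^ (((d : ℝ) + 2 - 2 + pdeg k) * n) = c ^ d * c ^ pdeg k := by
      rw [← pow_add, hc, ← pow_mul, ← Real.rpow_natCast]
      congr 1; push_cast; ring
    rw [hmd k hk, h2]
    have hcc : 0 < c ^ d * c ^ pdeg k := by positivity
    beta_reduce
    rw [← mul_assoc (c ^ d), abs_mul, abs_of_pos hcc, mul_div_cancel_left₀ _ hcc.ne']
    set y := pscale c z
    by_cases hy : 1 < pnorm y
    · have h0 : mderiv k (fun y => H (w, y)) y = 0 := by
        have : (fun y => H (w, y)) =ᶠ[nhds y] fun _ => 0 := by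
          filter_upwards [(isOpen_lt continuous_const pnorm_cont).mem_nhds hy] with y' hy'
          simp only [hHdef]
          rw [psn_out hχ n hy', zero_mul]
        rw [(mderiv_congr this k).eq_of_nhds]
        have := mderiv_const_mul (d := d) 0 (fun _ => 0) k
        simpa using congrFun this y
      rw [mderiv_slice_inr w k (PB.le hH ((sum_le_pdeg k).trans hk))] at h0
      beta_reduce at h0; rw [h0, abs_zero]; positivity
    · refine ((hk0 k hk).bound _).trans ?_
      have hu1 : Real.sqrt |y 0| ≤ 1 := by
        have : 0 ≤ ∑ i : Fin d, |y i.succ| := Finset.sum_nonneg fun _ _ => abs_nonneg _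
        push Not at hy
        unfold pnorm at hy; linarith
      have hu0 := Real.sqrt_nonneg |y 0|
      simp only [kw, hb, abs_of_nonneg hu0]
      calc C0 * (K * C * (1 + Real.sqrt |y 0|) ^ N * (1 + Real.sqrt |y 0|) ^ N0)
          ≤ C0 * (K * C * 2 ^ N * 2 ^ N0) := by
            have : 1 + Real.sqrt |y 0| ≤ 2 := by linarith
            gcongr
        _ = _ := by ring

lemma parDeriv_KK {b : EE d → ℝ} {G : EE d → ℝ} (m : Fin (d + 1) → ℕ) (h : CB (∑ a, m a) b G) (p : ℤ) (w ζ : Pt d) :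
    parDeriv m (fun w ζ => χ ζ * KK p G (w, ζ)) w ζ = χ ζ * KK p (Dk Sum.inl m G) (w, ζ) := by
  unfold parDeriv
  rw [mderiv_const_mul]
  by_cases hζ : 0 < ζ 0
  · have : (fun w' => KK p G (w', ζ)) = fun w' => Real.sqrt (ζ 0) ^ p * (fun w => G (w, vv ζ)) w' := by
      funext w'; rw [KK_pos (by exact hζ)]
    rw [this, mderiv_const_mul, mderiv_slice_inl _ m h, KK_pos (by exact hζ)]
  · have : (fun w' => KK p G (w', ζ)) = fun w' => 0 * (fun _ => 0) w' := by
      funext w'; rw [KK_neg (by exact hζ), zero_mul]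
    rw [this, mderiv_const_mul, KK_neg (by exact hζ)]
    simp

lemma cker (hχ : IsCutoff χ) (M N : ℕ) {β : ℝ} (hβ : 0 < β) : ∃ Q : ℝ, 0 ≤ Q ∧ ∀ (C : ℝ) (G : EE d → ℝ), 0 ≤ C →
    CB (3 * M) (fun e => C * wb N β e) G →
    MemCKer χ 2 M (fun w ζ => χ ζ * KK (-(d:ℤ)) G (w, ζ)) ∧
    cKerNorm χ 2 M (fun w ζ => χ ζ * KK (-(d:ℤ)) G (w, ζ)) ≤ C * Q := by
  obtain ⟨Q, hQ, hp⟩ := piece hχ (2 * M) N hβ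
  refine ⟨Q, hQ, fun C G hC hG => ?_⟩
  have hD : ∀ m : Fin (d + 1) → ℕ, pdeg m ≤ M → CB (3 * M - ∑ a, m a) (fun e => C * wb N β e) (Dk Sum.inl m G) := fun m hm =>
    CB_Dk _ m _ (by rw [Nat.sub_add_cancel (by have := sum_le_pdeg m; omega)]; exact hG)
  have hpar : ∀ m : Fin (d + 1) → ℕ, pdeg m ≤ M → ∀ w ζ, parDeriv m (fun w ζ => χ ζ * KK (-(d:ℤ)) G (w, ζ)) w ζ =
      χ ζ * KK (-(d:ℤ)) (Dk Sum.inl m G) (w, ζ) := fun m hm w ζ =>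
    parDeriv_KK m (PB.le hG (by have := sum_le_pdeg m; omega)) _ w ζ
  have hpm : ∀ m : Fin (d + 1) → ℕ, pdeg m ≤ M → _ := fun m hm =>
    hp C (Dk Sum.inl m G) hC (PB.le (hD m hm) (by have := sum_le_pdeg m; omega))
  have hle : ∀ y ∈ cKerSet χ 2 M (fun w ζ => χ ζ * KK (-(d:ℤ)) G (w, ζ)), y ≤ C * Q := by
    rintro y ⟨m, w, n, hm, k, z, hk, rfl⟩
    simp only [hpar m hm]
    exact (hpm m hm w n).2.2.2 k z hk
  refine ⟨⟨fun m hm ζ => ?_, fun m hm w n => ?_, ⟨_, hle⟩⟩, Real.sSup_le hle (by positivity)⟩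
  · simp only [hpar m hm.le]
    have h1 := hD m hm.le
    obtain ⟨j, hj⟩ : ∃ j, 3 * M - ∑ a, m a = j + 1 := ⟨3 * M - ∑ a, m a - 1, by have := sum_le_pdeg m; omega⟩
    rw [hj] at h1
    refine Differentiable.const_mul ?_ _
    by_cases hζ : 0 < ζ 0
    · simp only [KK, hζ, if_true]
      exact (h1.diff.comp (differentiable_id.prodMk (differentiable_const _))).const_mul _
    · simp only [KK, hζ, if_false]
      exact differentiable_const _
  · simp only [hpar m hm]
    obtain ⟨h1, h2, h3, h4⟩ := hpm m hm w n
    refine ⟨h1, h2, h3, ⟨C * Q, ?_⟩⟩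
    rintro y ⟨k, z, hk, rfl⟩
    exact h4 k z hk

lemma Good.cker {I : Type} {lam : ℝ} {ε : I → ℝ} {M L : ℕ} {A A' : I → Coeffs d}
    (h : Good lam ε (3 * M + L + 2) A A') (hχ : IsCutoff χ) {σ : ℝ} (hσ : |σ| ≤ 1) :
    ∃ Q : ℝ, 0 ≤ Q ∧ ∀ i, MemCKer χ 2 M (Km χ (A i) L σ) ∧
      MemCKer χ 2 M (fun w ζ => Km χ (A i) L σ w ζ - Km χ (A' i) L σ w ζ) ∧
      cKerNorm χ 2 M (fun w ζ => Km χ (A i) L σ w ζ - Km χ (A' i) L σ w ζ) ≤ ε i * Q := by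
  have hε := h.hε
  obtain ⟨N, hU⟩ := h.um L hσ
  have hμ := mu_pos h.pos
  obtain ⟨C, hC, hG⟩ := UW.tp hε L hU
  obtain ⟨Q, hQ, hq⟩ := VarBPHZ.cker hχ M (N + L) (show 0 < mu lam / 2 by linarith)
  refine ⟨C * Q, by positivity, fun i => ⟨(hq C _ hC (hG i).cl).1, ?_⟩⟩
  have hs : CB (3 * M) (fun e => (ε i * C) * wb (N + L) (mu lam / 2) e) (fun e => Gm (A i) L σ e - Gm (A' i) L σ e) := by
    refine PB.mono (PD.s (hG i)) fun _ e => le_of_eq ?_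
    ring
  have := hq (ε i * C) _ (mul_nonneg (hε i) hC) hs
  have he : (fun w ζ => χ ζ * KK (-(d:ℤ)) (fun e => Gm (A i) L σ e - Gm (A' i) L σ e) (w, ζ)) =
      fun w ζ => Km χ (A i) L σ w ζ - Km χ (A' i) L σ w ζ := by
    funext w ζ
    rw [KK_sub, Km, Km]; ring
  rw [he] at this
  exact ⟨this.1, this.2.trans (le_of_eq (by ring))⟩

end

section

set_option linter.unusedSectionVars false
set_option linter.unusedVariables false

/-! ## Jets at `u = 0` with values in polynomial classes -/

section Jets
variable {X : Type} [TopologicalSpace X]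

/-- Generators of the polynomial class. -/
def RgS (A : Coeffs d) (q : ℕ) (S : Set (X → ℝ)) : Set (X → EE d → ℝ) :=
  {f | ∃ v : (Fin (d + 1) → ℕ) × CoeffVar d, pdeg v.1 ≤ q ∧ f = fun _ e => coeffEval A e.1 v} ∪
    ({f | ∃ i, f = fun _ e => e.2 i} ∪ {f | ∃ g ∈ S, f = fun x _ => g x})

/-- The polynomial class: polynomials in the coefficients, in `y` and in the parameters `S`. -/
noncomputable def Rg (A : Coeffs d) (q : ℕ) (S : Set (X → ℝ)) : Subalgebra ℝ (X → EE d → ℝ) :=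
  Algebra.adjoin ℝ (RgS A q S)

variable {A : Coeffs d} {q : ℕ} {S : Set (X → ℝ)}

lemma Rg.coeff {v : (Fin (d + 1) → ℕ) × CoeffVar d} (hv : pdeg v.1 ≤ q) :
    (fun _ e => coeffEval A e.1 v) ∈ Rg (X := X) A q S :=
  Algebra.subset_adjoin (Or.inl ⟨v, hv, rfl⟩)

lemma Rg.y (i : Fin (d + 1)) : (fun _ e => e.2 i) ∈ Rg (X := X) A q S :=
  Algebra.subset_adjoin (Or.inr (Or.inl ⟨i, rfl⟩))

lemma Rg.par {g : X → ℝ} (hg : g ∈ S) : (fun x _ => g x) ∈ Rg (X := X) A q S :=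
  Algebra.subset_adjoin (Or.inr (Or.inr ⟨g, hg, rfl⟩))

lemma Rg.const (c : ℝ) : (fun _ _ => c) ∈ Rg (X := X) A q S :=
  (Rg A q S).algebraMap_mem c

/-- Jets at `u = 0` up to order `N` lie in the class `Rg · G`. -/
def Jt (A : Coeffs d) (q : ℕ) (S : Set (X → ℝ)) (G : X → EE d → ℝ) : ℕ → (X → EE d → ℝ) → Prop
  | 0, F => ∃ P ∈ Rg A q S, ∀ x e, F x (ev e) = P x e * G x e
  | N + 1, F => (∃ P ∈ Rg A q S, ∀ x e, F x (ev e) = P x e * G x e) ∧ (∀ x, Differentiable ℝ (F x)) ∧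
      ∀ i, Jt A q S G N (fun x => D i (F x))

variable {G G' : X → EE d → ℝ} {N : ℕ} {F F' : X → EE d → ℝ}

lemma Jt.val (h : Jt A q S G N F) : ∃ P ∈ Rg A q S, ∀ x e, F x (ev e) = P x e * G x e := by
  cases N with
  | zero => exact h
  | succ N => exact h.1

lemma Jt.pred (h : Jt A q S G (N + 1) F) : Jt A q S G N F := by
  induction N generalizing F with
  | zero => exact h.1
  | succ N ih => exact ⟨h.1, h.2.1, fun i => ih (h.2.2 i)⟩

lemma Jt.le {M : ℕ} (h : Jt A q S G N F) (hM : M ≤ N) : Jt A q S G M F := by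
  obtain ⟨k, rfl⟩ := Nat.exists_eq_add_of_le hM
  induction k with
  | zero => exact h
  | succ k ih => exact ih h.pred (by omega)

lemma Jt.congrG (h : Jt A q S G N F) (hG : ∀ x e, G x e = G' x e) : Jt A q S G' N F := by
  have : G = G' := funext fun x => funext fun e => hG x e
  rwa [← this]

lemma Jt.congr (h : Jt A q S G N F) (hG : ∀ x e, F x e = F' x e) : Jt A q S G N F' := by
  have : F = F' := funext fun x => funext fun e => hG x e
  rwa [← this]

lemma Jt.zero : Jt A q S G N (fun _ _ => 0) := by
  induction N with
  | zero => exact ⟨0, Subalgebra.zero_mem _, fun x e => by simp⟩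
  | succ N ih =>
    refine ⟨⟨0, Subalgebra.zero_mem _, fun x e => by simp⟩, fun x => differentiable_const _, fun i => ?_⟩
    simp only [D_zero]
    exact ih

lemma Jt.add (h : Jt A q S G N F) (h' : Jt A q S G N F') : Jt A q S G N (fun x e => F x e + F' x e) := by
  have base : ∃ P ∈ Rg A q S, ∀ x e, F x (ev e) + F' x (ev e) = P x e * G x e := by
    obtain ⟨P, hP, h1⟩ := h.val
    obtain ⟨P', hP', h2⟩ := h'.val
    exact ⟨P + P', Subalgebra.add_mem _ hP hP', fun x e => by rw [h1, h2]; simp only [Pi.add_apply]; ring⟩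
  induction N generalizing F F' with
  | zero => exact base
  | succ N ih =>
    refine ⟨base, fun x => (h.2.1 x).add (h'.2.1 x), fun i => ?_⟩
    have e1 : (fun x => D i (fun e => F x e + F' x e)) = fun x e => D i (F x) e + D i (F' x) e := by
      funext x; exact D_add (h.2.1 x) (h'.2.1 x) i
    rw [e1]
    refine ih (h.2.2 i) (h'.2.2 i) ?_
    obtain ⟨P, hP, h1⟩ := (h.2.2 i).val
    obtain ⟨P', hP', h2⟩ := (h'.2.2 i).val
    exact ⟨P + P', Subalgebra.add_mem _ hP hP', fun x e => by rw [h1, h2]; simp only [Pi.add_apply]; ring⟩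

lemma Jt.sum {ι : Type} (s : Finset ι) {F : ι → X → EE d → ℝ} (h : ∀ j ∈ s, Jt A q S G N (F j)) :
    Jt A q S G N (fun x e => ∑ j ∈ s, F j x e) := by
  classical
  induction s using Finset.induction_on with
  | empty => simpa using Jt.zero
  | insert a s ha ih =>
    simp only [Finset.sum_insert ha]
    exact (h a (Finset.mem_insert_self _ _)).add (ih fun j hj => h j (Finset.mem_insert_of_mem hj))

lemma Jt.mul (h : Jt A q S G N F) (h' : Jt A q S G' N F') :
    Jt A q S (fun x e => G x e * G' x e) N (fun x e => F x e * F' x e) := by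
  have base : ∀ {F F' : X → EE d → ℝ} {N}, Jt A q S G N F → Jt A q S G' N F' →
      ∃ P ∈ Rg A q S, ∀ x e, F x (ev e) * F' x (ev e) = P x e * (G x e * G' x e) := by
    intro F F' N h h'
    obtain ⟨P, hP, h1⟩ := h.val
    obtain ⟨P', hP', h2⟩ := h'.val
    exact ⟨P * P', Subalgebra.mul_mem _ hP hP', fun x e => by rw [h1, h2]; simp only [Pi.mul_apply]; ring⟩
  induction N generalizing F F' with
  | zero => exact base h h'
  | succ N ih =>
    refine ⟨base h h', fun x => (h.2.1 x).mul (h'.2.1 x), fun i => ?_⟩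
    refine Jt.congr ((ih (h.2.2 i) h'.pred).add (ih h.pred (h'.2.2 i))) fun x e => ?_
    rw [D_mul (h.2.1 x) (h'.2.1 x) i]; ring

lemma Jt.const (c : ℝ) : Jt A q S (fun _ _ => 1) N (fun _ _ => c) := by
  cases N with
  | zero => exact ⟨fun _ _ => c, Rg.const c, fun x e => by simp⟩
  | succ N =>
    refine ⟨⟨fun _ _ => c, Rg.const c, fun x e => by simp⟩, fun x => differentiable_const _, fun i => ?_⟩
    refine Jt.congr Jt.zero fun x e => ?_
    simp [D]

/-- A parameter function. -/
lemma Jt.par {g : X → ℝ} (hg : (fun x _ => g x) ∈ Rg A q S) : Jt A q S (fun _ _ => 1) N (fun x _ => g x) := by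
  cases N with
  | zero => exact ⟨_, hg, fun x e => by simp⟩
  | succ N =>
    refine ⟨⟨_, hg, fun x e => by simp⟩, fun x => differentiable_const _, fun i => ?_⟩
    refine Jt.congr Jt.zero fun x e => ?_
    simp [D]

lemma D_snd (k : Fin (d + 1)) (i : Ix d) : D i (fun e : EE d => e.2 k) = fun _ => (dir i : EE d).2 k := by
  funext e
  have : HasFDerivAt (fun e : EE d => e.2 k) ((ContinuousLinearMap.proj k).comp (ContinuousLinearMap.snd ℝ (Pt d) (Pt d))) e :=
    ((ContinuousLinearMap.proj k).comp (ContinuousLinearMap.snd ℝ (Pt d) (Pt d))).hasFDerivAt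
  simp only [D]
  rw [this.fderiv]; rfl

lemma Jt.y (k : Fin (d + 1)) : Jt A q S (fun _ _ => 1) N (fun _ e => e.2 k) := by
  have base : ∃ P ∈ Rg A q S, ∀ (x : X) (e : EE d), (ev e).2 k = P x e * 1 := by
    by_cases hk : k = 0
    · exact ⟨0, Subalgebra.zero_mem _, fun x e => by simp [ev, hk]⟩
    · exact ⟨_, Rg.y k, fun x e => by simp [ev, hk]⟩
  cases N with
  | zero => exact base
  | succ N =>
    refine ⟨base, fun x => by fun_prop, fun i => ?_⟩
    exact Jt.congr (Jt.const ((dir i : EE d).2 k)) fun x e => by rw [D_snd]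

lemma Jt.one_mul {F' : X → EE d → ℝ} (h : Jt A q S (fun _ _ => 1) N F) (h' : Jt A q S G N F') :
    Jt A q S G N (fun x e => F x e * F' x e) :=
  (h.mul h').congrG fun x e => by ring

lemma Jt.const_mul (c : ℝ) (h : Jt A q S G N F) : Jt A q S G N (fun x e => c * F x e) :=
  (Jt.const c).one_mul h

lemma Jt.neg (h : Jt A q S G N F) : Jt A q S G N (fun x e => -F x e) :=
  (h.const_mul (-1)).congr fun x e => by ring

lemma Jt.sub (h : Jt A q S G N F) (h' : Jt A q S G N F') : Jt A q S G N (fun x e => F x e - F' x e) :=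
  (h.add h'.neg).congr fun x e => by ring

lemma Jt.prod {ι : Type} (s : Finset ι) {F : ι → X → EE d → ℝ} (h : ∀ j ∈ s, Jt A q S (fun _ _ => 1) N (F j)) :
    Jt A q S (fun _ _ => 1) N (fun x e => ∏ j ∈ s, F j x e) := by
  classical
  induction s using Finset.induction_on with
  | empty => simpa using Jt.const 1
  | insert a s ha ih =>
    simp only [Finset.prod_insert ha]
    exact (h a (Finset.mem_insert_self _ _)).one_mul (ih fun j hj => h j (Finset.mem_insert_of_mem hj))

lemma Jt.pow (h : Jt A q S (fun _ _ => 1) N F) (m : ℕ) :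
    Jt A q S (fun _ _ => 1) N (fun x e => F x e ^ m) := by
  have := Jt.prod (Finset.range m) (F := fun _ => F) fun j _ => h
  simpa using this

lemma Jt.deriv (h : Jt A q S G (N + 1) F) (i : Ix d) : Jt A q S G N (fun x => D i (F x)) := h.2.2 i

lemma Jt.det {m : EE d → Matrix (Fin d) (Fin d) ℝ} (h : ∀ j k, Jt A q S (fun _ _ => 1) N (fun _ e => m e j k)) :
    Jt A q S (fun _ _ => 1) N (fun _ e => (m e).det) := by
  simp only [Matrix.det_apply']
  exact Jt.sum _ fun σ _ => (Jt.prod _ fun k _ => h _ _).const_mul _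

end Jets

section JComp
variable {X : Type} [TopologicalSpace X] {A : Coeffs d} {q : ℕ} {S : Set (X → ℝ)} {N : ℕ}

/-- Non-parametric jets. -/
abbrev J1 (A : Coeffs d) (q : ℕ) (G : EE d → ℝ) (N : ℕ) (f : EE d → ℝ) : Prop :=
  Jt (X := Unit) A q ∅ (fun _ => G) N (fun _ => f)

/-- The coordinate functions of an affine map are polynomial. -/
structure AffP (A : Coeffs d) (q : ℕ) (S : Set (X → ℝ)) (T : Aff X d) : Prop where
  mα : (fun x _ => T.α x) ∈ Rg A q S
  mP : ∀ i, (fun x _ => T.P x i) ∈ Rg A q S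
  mq : ∀ i, (fun x _ => T.q x i) ∈ Rg A q S
  mP' : ∀ i, (fun x _ => T.P' x i) ∈ Rg A q S
  mq' : ∀ i, (fun x _ => T.q' x i) ∈ Rg A q S
  q0 : ∀ x, T.q x 0 = 0
  q'0 : ∀ x, T.q' x 0 = 0

lemma AffP.ev {T : Aff X d} (hT : AffP A q S T) (x : X) (e : EE d) :
    T.Φ x (ev e) = ev (e.1, fun i => T.P' x i * e.2 i + T.q' x i) := by
  have hY : T.Y x (VarBPHZ.ev e) 0 = 0 := by simp [Aff.Y, VarBPHZ.ev, hT.q0]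
  refine Prod.ext ?_ ?_
  · funext i
    simp only [Aff.Φ, hY]
    simp [VarBPHZ.ev]
  · funext i
    by_cases hi : i = 0
    · subst hi; simp [Aff.Φ, VarBPHZ.ev, hT.q'0]
    · simp [Aff.Φ, VarBPHZ.ev, hi]

lemma AffP.pull {T : Aff X d} (hT : AffP A q S T) {P : Unit → EE d → ℝ} (hP : P ∈ Rg A q ∅) :
    (fun x e => P () (e.1, fun i => T.P' x i * e.2 i + T.q' x i)) ∈ Rg A q S := by
  induction hP using Algebra.adjoin_induction with
  | mem f hf =>
    rcases hf with ⟨v, hv, rfl⟩ | ⟨i, rfl⟩ | ⟨g, hg, rfl⟩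
    · exact Rg.coeff hv
    · exact Subalgebra.add_mem _ (Subalgebra.mul_mem _ (hT.mP' i) (Rg.y i)) (hT.mq' i)
    · exact absurd hg (Set.notMem_empty _)
  | algebraMap r => exact Rg.const r
  | add f g _ _ h1 h2 => exact Subalgebra.add_mem _ h1 h2
  | mul f g _ _ h1 h2 => exact Subalgebra.mul_mem _ h1 h2

lemma AffP.jY {T : Aff X d} (hT : AffP A q S T) (i : Fin (d + 1)) :
    Jt A q S (fun _ _ => 1) N (fun x e => T.Y x e i) :=
  ((Jt.par (hT.mP i)).one_mul (Jt.y i)).add (Jt.par (hT.mq i))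

lemma J1.comp {T : Aff X d} (hT : AffP A q S T) {G f : EE d → ℝ} (h : J1 A q G N f) :
    Jt A q S (fun x e => G (e.1, fun i => T.P' x i * e.2 i + T.q' x i)) N (fun x e => f (T.Φ x e)) := by
  have base : ∀ {f : EE d → ℝ} {N}, J1 A q G N f → ∃ P ∈ Rg A q S, ∀ (x : X) (e : EE d), f (T.Φ x (VarBPHZ.ev e)) =
      P x e * G (e.1, fun i => T.P' x i * e.2 i + T.q' x i) := by
    intro f N h
    obtain ⟨P, hP, h1⟩ := h.val
    refine ⟨_, hT.pull hP, fun x e => ?_⟩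
    rw [hT.ev]
    exact h1 () _
  induction N generalizing f with
  | zero => exact base h
  | succ N ih =>
    have hd : Differentiable ℝ f := h.2.1 ()
    refine ⟨base h, fun x => hd.comp (T.diff_Φ x), fun i => ?_⟩
    cases i with
    | inl i =>
      refine Jt.congr (ih (h.2.2 (Sum.inl i))) fun x e => ?_
      rw [T.D_comp_inl hd x i]
    | inr i =>
      have hY := fun j => hT.jY (N := N) j
      have e1 := Jt.sum (Finset.univ : Finset (Fin (d + 1))) fun j _ => (hY j).one_mul (ih (h.2.2 (Sum.inl j)))
      have c1 : Jt A q S (fun _ _ => 1) N (fun x _ => T.α x * T.P x i * (if i = 0 then 1 else 0)) :=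
        Jt.par (Subalgebra.mul_mem _ (Subalgebra.mul_mem _ hT.mα (hT.mP i)) (Rg.const (if i = 0 then 1 else 0)))
      have c2 : Jt A q S (fun _ _ => 1) N (fun x _ => T.α x * T.P x i) :=
        Jt.par (Subalgebra.mul_mem _ hT.mα (hT.mP i))
      refine Jt.congr ((c1.one_mul e1).add ((c2.one_mul ((hY 0).one_mul (ih (h.2.2 (Sum.inl i))))).add
        ((Jt.par (hT.mP' i)).one_mul (ih (h.2.2 (Sum.inr i)))))) fun x e => ?_
      rw [T.D_comp_inr hd x i]

end JComp

section JInt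
variable {A : Coeffs d} {q N : ℕ}

lemma J1.av {f b : EE d → ℝ} {G : EE d → ℝ} (h : J1 A q G N f) (hf : CB N b f) (hbc : Continuous b)
    (hb : ∀ θ e, b ((avT d).Φ θ e) ≤ b e) (j : ℕ) : J1 A q G N (Av j f) := by
  have base : ∀ {f : EE d → ℝ} {N : ℕ} (j : ℕ), J1 A q G N f → ∃ P ∈ Rg A q ∅, ∀ (x : Unit) (e : EE d), Av j f (ev e) =
      P x e * G e := by
    intro f N j h
    obtain ⟨P, hP, h1⟩ := h.val
    refine ⟨_, Subalgebra.mul_mem _ (Rg.const (1 / ((j:ℝ) + 1))) hP, fun x e => ?_⟩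
    rw [Av_ev, h1 () e]
    simp only [Pi.mul_apply]
    show _ = (1 / ((j:ℝ) + 1)) * P () e * G e
    ring
  induction N generalizing f j with
  | zero => exact base j h
  | succ N ih =>
    refine ⟨base j h, fun _ => ?_, fun i => ?_⟩
    · exact CB.diff (CD.cl (Av_CD zero_le_one (hf.toCD zero_le_one) hbc hb j))
    · show J1 A q G N (D i (Av j f))
      rw [D_Av hf hbc hb]
      exact ih (h.2.2 i) (CB.deriv hf i) _

lemma J1.integral {X : Type} [TopologicalSpace X] [SecondCountableTopology X] [MeasurableSpace X] [OpensMeasurableSpace X] {μ : Measure X} {S : Set (X → ℝ)}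
    {G : X → EE d → ℝ} {G0 : EE d → ℝ} {F : X → EE d → ℝ} {g : X → ℝ} {b : EE d → ℝ} (h : Jt A q S G N F)
    (hF : PB N (fun x e => g x * b e) F) (hg : Integrable g μ) (hb : Continuous b)
    (hI : ∀ P ∈ Rg A q S, ∃ P0 ∈ Rg A q (∅ : Set (Unit → ℝ)), ∀ e, ∫ x, P x e * G x e ∂μ = P0 () e * G0 e) :
    J1 A q G0 N (fun e => ∫ x, F x e ∂μ) := by
  have base : ∀ {F : X → EE d → ℝ} {N : ℕ}, Jt A q S G N F → ∃ P ∈ Rg A q (∅ : Set (Unit → ℝ)), ∀ (x : Unit) (e : EE d),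
      ∫ x, F x (ev e) ∂μ = P x e * G0 e := by
    intro F N h
    obtain ⟨P, hP, h1⟩ := h.val
    obtain ⟨P0, hP0, h2⟩ := hI P hP
    refine ⟨P0, hP0, fun x e => ?_⟩
    simp only [h1, h2]
  induction N generalizing F with
  | zero => exact base h
  | succ N ih =>
    refine ⟨base h, fun _ e => (hF.hasFDerivAt_integral hg hb e).differentiableAt, fun i => ?_⟩
    show J1 A q G0 N (D i fun e => ∫ x, F x e ∂μ)
    rw [hF.D_integral hg hb]
    exact ih (h.2.2 i) (hF.deriv i)

end JInt

end

section

set_option linter.unusedSectionVars false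
set_option linter.unusedVariables false

/-! ## Jets of the coefficients and of `Zt`, `Et` -/

section JBase
variable {A : Coeffs d} {q N : ℕ} {lam : ℝ}

lemma J1.lift {f : Pt d → ℝ} (hf : MemCpar q f)
    (hR : ∀ l, pdeg l ≤ q → (fun _ e => mderiv l f e.1) ∈ Rg A q (∅ : Set (Unit → ℝ))) {l : Fin (d + 1) → ℕ} (hl : pdeg l + 2 * N ≤ q) :
    J1 A q (fun _ => 1) N (VarBPHZ.lift (mderiv l f)) := by
  induction N generalizing l with
  | zero => exact ⟨_, hR l (by omega), fun x e => by simp [VarBPHZ.lift, ev]⟩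
  | succ N ih =>
    have hd : Differentiable ℝ (mderiv l f) := hf.1 l (by omega)
    refine ⟨⟨_, hR l (by omega), fun x e => by simp [VarBPHZ.lift, ev]⟩, fun _ => ?_, fun i => ?_⟩
    · exact hd.comp differentiable_fst
    · cases i with
      | inl i =>
        show J1 A q (fun _ => 1) N (D (Sum.inl i) (VarBPHZ.lift (mderiv l f)))
        rw [D_lift_inl hd, pd_mderiv hf.1 l (by omega)]
        have := pdeg_add_single l i
        exact ih (by omega)
      | inr i =>
        show J1 A q (fun _ => 1) N (D (Sum.inr i) (VarBPHZ.lift (mderiv l f)))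
        rw [D_lift_inr hd]
        exact Jt.zero

lemma J1.a (hp : ParReg lam q A) (hN : 2 * N ≤ q) (i j : Fin d) :
    J1 A q (fun _ => 1) N (VarBPHZ.lift fun z => A.a z i j) := by
  have := J1.lift (N := N) (A := A) (hp.areg i j) (fun l hl => Rg.coeff (v := (l, CoeffVar.aa i j)) hl) (l := 0) (by simpa [pdeg] using hN)
  rwa [mderiv_zero] at this

lemma J1.b (hp : ParReg lam q A) (hN : 2 * N ≤ q) (i : Fin d) :
    J1 A q (fun _ => 1) N (VarBPHZ.lift fun z => A.b z i) := by
  have := J1.lift (N := N) (A := A) (hp.breg i) (fun l hl => Rg.coeff (v := (l, CoeffVar.bb i)) hl) (l := 0) (by simpa [pdeg] using hN)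
  rwa [mderiv_zero] at this

lemma J1.c (hp : ParReg lam q A) (hN : 2 * N ≤ q) :
    J1 A q (fun _ => 1) N (VarBPHZ.lift A.c) := by
  have := J1.lift (N := N) (A := A) hp.creg (fun l hl => Rg.coeff (v := (l, CoeffVar.cc)) hl) (l := 0) (by simpa [pdeg] using hN)
  rwa [mderiv_zero] at this

/-- The shear maps are polynomial. -/
lemma shT_AffP (σ : ℝ) (hσ : |σ| ≤ 1) : AffP A q (∅ : Set (Unit → ℝ)) (shT d σ hσ) where
  mα := Rg.const σ
  mP := fun _ => Rg.const 1
  mq := fun _ => Rg.const 0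
  mP' := fun _ => Rg.const 1
  mq' := fun _ => Rg.const 0
  q0 := fun _ => rfl
  q'0 := fun _ => rfl

lemma J1.shear {G f : EE d → ℝ} (h : J1 A q G N f) {σ : ℝ} (hσ : |σ| ≤ 1) :
    J1 A q G N (fun e => f (VarBPHZ.shear σ e)) := by
  have := J1.comp (shT_AffP (A := A) (q := q) σ hσ) h
  simp only [shT_Φ] at this
  refine Jt.congrG this fun x e => ?_
  simp [shT]

variable {I : Type} {ε : I → ℝ} {A' : I → Coeffs d}

lemma J1.iop {G f : EE d → ℝ} {f' : I → EE d → ℝ} {M : ℕ} {β : ℝ} (i0 : I) (h : J1 A q G (N + 1) f)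
    (hf : UW ε (N + 1) M β (fun _ => f) f') : J1 A q G N (Iop f) := by
  obtain ⟨C, hC, hu⟩ := hf
  exact J1.av (h.deriv (Sum.inr 0)) (CB.deriv (CD.cl (hu i0)) (Sum.inr 0)) (continuous_const.mul (wb_cont M β))
    (fun θ e => mul_le_mul_of_nonneg_left (wb_av M β θ e) hC) 0

lemma D_inv (i0 : I) (hg : Good lam ε (N + 1) (fun _ => A) A') (k : Ix d) (i j : Fin d) (e : EE d) :
    D k (fun e => (A.a e.1)⁻¹ i j) e = -∑ p, ∑ r, (A.a e.1)⁻¹ i p * D k (VarBPHZ.lift fun z => A.a z p r) e * (A.a e.1)⁻¹ r j := by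
  have hdi : ∀ i j, Differentiable ℝ (fun e : EE d => (A.a e.1)⁻¹ i j) := fun i j => (hg.inv i j).dl i0
  have hda : ∀ i j, Differentiable ℝ (VarBPHZ.lift fun z => A.a z i j) := fun i j => (hg.ha i j).dl i0
  set M : Matrix (Fin d) (Fin d) ℝ := fun i j => D k (fun e => (A.a e.1)⁻¹ i j) e with hM
  set B : Matrix (Fin d) (Fin d) ℝ := fun i j => D k (VarBPHZ.lift fun z => A.a z i j) e with hB
  have hU := (hg.el i0).isUnit hg.pos
  have key : M * A.a e.1 + (A.a e.1)⁻¹ * B = 0 := by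
    ext i j
    have h1 : (fun e : EE d => ∑ p, (A.a e.1)⁻¹ i p * VarBPHZ.lift (fun z => A.a z p j) e) = fun _ => (1 : Matrix (Fin d) (Fin d) ℝ) i j := by
      funext e
      have := congrFun (congrFun (Matrix.nonsing_inv_mul _ (hU e.1)) i) j
      rw [Matrix.mul_apply] at this
      exact this
    have h2 : D k (fun e : EE d => ∑ p, (A.a e.1)⁻¹ i p * VarBPHZ.lift (fun z => A.a z p j) e) e = 0 := by
      rw [h1]; simp [D]
    have h3 : D k (fun e : EE d => ∑ p, (A.a e.1)⁻¹ i p * VarBPHZ.lift (fun z => A.a z p j) e) e =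
        ∑ p, D k (fun e => (A.a e.1)⁻¹ i p * VarBPHZ.lift (fun z => A.a z p j) e) e := by
      simp only [D]
      rw [fderiv_fun_sum fun p _ => ((hdi i p).fun_mul (hda p j)) e]
      simp
    rw [h3] at h2
    simp only [Matrix.add_apply, Matrix.mul_apply, Matrix.zero_apply]
    rw [← h2, ← Finset.sum_add_distrib]
    refine Finset.sum_congr rfl fun p _ => ?_
    rw [D_mul (hdi i p) (hda p j)]
    simp only [VarBPHZ.lift, hM, hB]; ring
  have h4 : M = -((A.a e.1)⁻¹ * B * (A.a e.1)⁻¹) := by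
    have h5 := congrArg (· * (A.a e.1)⁻¹) key
    simp only [Matrix.add_mul, Matrix.zero_mul] at h5
    rw [Matrix.mul_assoc M, Matrix.mul_nonsing_inv _ (hU e.1), Matrix.mul_one] at h5
    exact eq_neg_of_add_eq_zero_left h5
  have h6 := congrFun (congrFun h4 i) j
  show M i j = _
  rw [h6, Matrix.neg_apply, Matrix.mul_apply]
  simp only [Matrix.mul_apply, Finset.sum_mul]
  rw [Finset.sum_comm]

lemma J1.inv (i0 : I) (hp : ParReg lam q A) (hN : 2 * N ≤ q) (hg : Good lam ε N (fun _ => A) A') (i j : Fin d) :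
    J1 A q (fun _ => 1) N (fun e => (A.a e.1)⁻¹ i j) := by
  have base : ∀ i j, ∃ P ∈ Rg A q (∅ : Set (Unit → ℝ)), ∀ (x : Unit) (e : EE d), (A.a (ev e).1)⁻¹ i j = P x e * 1 := by
    intro i j
    refine ⟨_, Rg.coeff (v := (0, CoeffVar.ai i j)) (by simp [pdeg]), fun x e => ?_⟩
    simp [coeffEval, mderiv_zero, ev]
  induction N generalizing i j with
  | zero => exact base i j
  | succ N ih =>
    refine ⟨base i j, fun _ => (hg.inv i j).dl i0, fun k => ?_⟩
    have hg' : Good lam ε N (fun _ => A) A' := ⟨hg.pos, hg.hε, hg.el, hg.er, fun j k => (hg.ha j k).le (Nat.le_succ _),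
      fun j => (hg.hb j).le (Nat.le_succ _), hg.hc.le (Nat.le_succ _)⟩
    have ih' := fun i j => ih (by omega) hg' i j
    have := Jt.sum (Finset.univ : Finset (Fin d)) fun p _ => Jt.sum (Finset.univ : Finset (Fin d)) fun r _ =>
      ((ih' i p).one_mul ((J1.a hp hN p r).deriv k)).one_mul (ih' r j)
    exact Jt.congr this.neg fun x e => (D_inv i0 hg k i j e).symm

lemma J1.qf (i0 : I) (hp : ParReg lam q A) (hN : 2 * N ≤ q) (hg : Good lam ε N (fun _ => A) A') :
    J1 A q (fun _ => 1) N (VarBPHZ.qf A) :=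
  Jt.sum _ fun i _ => Jt.sum _ fun j _ => ((J1.inv i0 hp hN hg i j).one_mul (Jt.y i.succ)).one_mul (Jt.y j.succ)

lemma D_Zt (i0 : I) (hg : Good lam ε (N + 1) (fun _ => A) A') (k : Ix d) :
    D k (VarBPHZ.Zt A) = fun e => (-(1/2) * ((A.a e.1)⁻¹.det * D k (fun e => (A.a e.1).det) e) + -(1/4) * D k (VarBPHZ.qf A) e) * VarBPHZ.Zt A e := by
  have hdd : Differentiable ℝ (fun e : EE d => (A.a e.1).det) := hg.det.dl i0
  have hdq : Differentiable ℝ (VarBPHZ.qf A) := (hg.qf one_pos).dl i0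
  have hpos : ∀ e : EE d, 0 < (A.a e.1).det := fun e => (hg.el i0).det_pos hg.pos _
  obtain ⟨hr1, hr2⟩ := D_rpow hdd hpos (-(1:ℝ) / 2) k
  have he : ∀ e, HasFDerivAt (fun e => Real.exp (-(1 / 4) * VarBPHZ.qf A e)) (Real.exp (-(1 / 4) * VarBPHZ.qf A e) • (-(1/4) : ℝ) • fderiv ℝ (VarBPHZ.qf A) e) e :=
    fun e => ((hdq e).hasFDerivAt.const_mul (-(1/4))).exp
  have he1 : Differentiable ℝ (fun e => Real.exp (-(1 / 4) * VarBPHZ.qf A e)) := fun e => (he e).differentiableAt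
  have he2 : D k (fun e => Real.exp (-(1 / 4) * VarBPHZ.qf A e)) = fun e => Real.exp (-(1 / 4) * VarBPHZ.qf A e) * (-(1/4) * D k (VarBPHZ.qf A) e) := by
    funext e; simp only [D]; rw [(he e).fderiv]; rfl
  funext e
  have hZ : VarBPHZ.Zt A = fun e => (4 * Real.pi) ^ (-(d : ℝ) / 2) * ((A.a e.1).det ^ (-(1 : ℝ) / 2) * Real.exp (-(1 / 4) * VarBPHZ.qf A e)) := rfl
  have h1 : D k (VarBPHZ.Zt A) e = (4 * Real.pi) ^ (-(d : ℝ) / 2) * D k (fun e => (A.a e.1).det ^ (-(1 : ℝ) / 2) * Real.exp (-(1 / 4) * VarBPHZ.qf A e)) e := by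
    rw [hZ]; simp only [D]
    rw [fderiv_const_mul ((hr1.fun_mul he1) e)]; rfl
  rw [h1, D_mul hr1 he1, hr2, he2]
  have hinv : (A.a e.1)⁻¹.det = ((A.a e.1).det)⁻¹ := by
    rw [Matrix.det_nonsing_inv, Ring.inverse_eq_inv']
  have hrp : (A.a e.1).det ^ (-(1:ℝ) / 2 - 1) = (A.a e.1).det ^ (-(1:ℝ) / 2) * ((A.a e.1).det)⁻¹ := by
    rw [Real.rpow_sub (hpos e), Real.rpow_one]; rfl
  rw [hZ, hinv]
  beta_reduce
  rw [hrp]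
  ring

lemma J1.Zt (i0 : I) (hp : ParReg lam q A) (hN : 2 * N ≤ q) (hg : Good lam ε N (fun _ => A) A') :
    J1 A q (VarBPHZ.Zt A) N (VarBPHZ.Zt A) := by
  have hZ : ∀ e, VarBPHZ.Zt A (ev e) = VarBPHZ.Zt A e := fun e => by
    simp [VarBPHZ.Zt, VarBPHZ.qf, ev]
  have base : ∃ P ∈ Rg A q (∅ : Set (Unit → ℝ)), ∀ (x : Unit) (e : EE d), VarBPHZ.Zt A (ev e) = P x e * VarBPHZ.Zt A e :=
    ⟨_, Rg.const 1, fun x e => by rw [hZ]; simp⟩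
  induction N with
  | zero => exact base
  | succ N ih =>
    have hg' : Good lam ε N (fun _ => A) A' := ⟨hg.pos, hg.hε, hg.el, hg.er, fun j k => (hg.ha j k).le (Nat.le_succ _),
      fun j => (hg.hb j).le (Nat.le_succ _), hg.hc.le (Nat.le_succ _)⟩
    refine ⟨base, fun _ => (hg.Zt (β := lam / 8) (by linarith [hg.pos])).dl i0, fun k => ?_⟩
    have h1 : J1 A q (fun _ => 1) (N + 1) (fun e => (A.a e.1).det) := Jt.det fun i j => J1.a hp hN i j
    have h2 : J1 A q (fun _ => 1) N (fun e => (A.a e.1)⁻¹.det) := Jt.det fun i j => J1.inv i0 hp (by omega) hg' i j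
    have h3 := J1.qf i0 hp hN hg
    have h4 := (((h2.one_mul (h1.deriv k)).const_mul (-(1/2))).add ((h3.deriv k).const_mul (-(1/4)))).one_mul (ih (by omega) hg')
    refine Jt.congr h4 fun x e => ?_
    exact (congrFun (D_Zt i0 hg k) e).symm

lemma J1.Et (i0 : I) (hp : ParReg lam q A) (hN : 2 * (N + 2) ≤ q) (hg : Good lam ε (N + 2) (fun _ => A) A') :
    J1 A q (VarBPHZ.Zt A) N (VarBPHZ.Et A) := by
  have s1 : |(1:ℝ)| ≤ 1 := by simp
  have hZ := J1.Zt i0 hp hN hg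
  have ha : ∀ i j, J1 A q (fun _ => 1) (N + 1) (shf fun z => A.a z i j) := fun i j => (J1.a hp (by omega) i j).shear s1
  have hb : ∀ i, J1 A q (fun _ => 1) N (shf fun z => A.b z i) := fun i => (J1.b hp (by omega) i).shear s1
  have hc : J1 A q (fun _ => 1) N (shf A.c) := (J1.c hp (by omega)).shear s1
  refine Jt.sub (Jt.sub (Jt.neg (Jt.sum _ fun i _ => Jt.sum _ fun j _ => ?_)) (Jt.sum _ fun i _ => ?_)) ?_
  · have hu := UW.shear hg.hε s1 one_pos ((hg.ha i j).le (Nat.le_succ (N + 1)))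
    exact ((ha i j).iop i0 hu).one_mul ((hZ.deriv (Sum.inr j.succ)).deriv (Sum.inr i.succ))
  · exact (hb i).one_mul (hZ.deriv (Sum.inr i.succ)).pred
  · exact hc.one_mul ((Jt.y 0).one_mul hZ.pred.pred)

end JBase

end

section

set_option linter.unusedSectionVars false
set_option linter.unusedVariables false

/-! ## Gaussian moments -/

section Gauss

lemma poly_bound (p : MvPolynomial (Fin d) ℝ) : ∀ η : ℝ, 0 < η → ∃ C : ℝ, 0 ≤ C ∧
    ∀ ξ : Fin d → ℝ, |MvPolynomial.eval ξ p| ≤ C * Real.exp (η * ∑ i, ξ i ^ 2) := by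
  induction p using MvPolynomial.induction_on with
  | C c =>
    intro η hη
    refine ⟨|c|, abs_nonneg _, fun ξ => ?_⟩
    rw [MvPolynomial.eval_C]
    have h : 0 ≤ η * ∑ i, ξ i ^ 2 := by positivity
    exact le_mul_of_one_le_right (abs_nonneg _) (Real.one_le_exp h)
  | add p p' hp hp' =>
    intro η hη
    obtain ⟨C, hC, h⟩ := hp η hη
    obtain ⟨C', hC', h'⟩ := hp' η hη
    refine ⟨C + C', by positivity, fun ξ => ?_⟩
    rw [map_add, add_mul]
    exact (abs_add_le _ _).trans (add_le_add (h ξ) (h' ξ))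
  | mul_X p n hp =>
    intro η hη
    obtain ⟨C, hC, h⟩ := hp (η / 2) (by positivity)
    obtain ⟨C', hC', h'⟩ := absorb_poly (d := d) (η / 2) (by positivity) 1
    refine ⟨C * C', by positivity, fun ξ => ?_⟩
    have h1 := h' (Fin.cons 0 ξ)
    simp only [Fin.cons_succ, gs, pow_one] at h1
    have h2 := Finset.single_le_sum (f := fun i : Fin d => |ξ i|) (fun _ _ => abs_nonneg _) (Finset.mem_univ n)
    rw [map_mul, MvPolynomial.eval_X, abs_mul]
    calc _ ≤ (C * Real.exp (η / 2 * ∑ i, ξ i ^ 2)) * (C' * Real.exp (η / 2 * ∑ i, ξ i ^ 2)) :=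
          mul_le_mul (h ξ) (by linarith) (abs_nonneg _) (by positivity)
      _ = _ := by
          rw [show η * ∑ i, ξ i ^ 2 = η / 2 * ∑ i, ξ i ^ 2 + η / 2 * ∑ i, ξ i ^ 2 by ring, Real.exp_add]; ring

lemma poly_hasFDeriv (p : MvPolynomial (Fin d) ℝ) (ξ : Fin d → ℝ) :
    HasFDerivAt (fun ξ => MvPolynomial.eval ξ p)
      (∑ j, MvPolynomial.eval ξ (MvPolynomial.pderiv j p) • ContinuousLinearMap.proj (R := ℝ) (φ := fun _ : Fin d => ℝ) j) ξ := by
  induction p using MvPolynomial.induction_on with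
  | C c => simpa using hasFDerivAt_const c ξ
  | add p p' hp hp' =>
    simp only [map_add, add_smul, Finset.sum_add_distrib]
    exact hp.add hp'
  | mul_X p n hp =>
    have h := hp.mul (hasFDerivAt_apply (𝕜 := ℝ) n ξ)
    have hf : (fun ξ => MvPolynomial.eval ξ (p * MvPolynomial.X n)) = fun ξ => MvPolynomial.eval ξ p * ξ n := by
      funext ξ; simp
    rw [hf]
    refine h.congr_fderiv ?_
    ext v
    simp only [MvPolynomial.pderiv_mul, MvPolynomial.pderiv_X, map_add, map_mul, MvPolynomial.eval_X,
      add_apply, smul_apply, sum_apply, smul_eq_mul,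
      ContinuousLinearMap.proj_apply, add_mul, Finset.sum_add_distrib]
    rw [add_comm, Finset.mul_sum]
    congr 1
    · refine Finset.sum_congr rfl fun j _ => by ring
    · rw [Finset.sum_eq_single n]
      · simp
      · intro j _ hj
        simp [Pi.single_apply, hj.symm]
      · simp

lemma poly_fderiv (p : MvPolynomial (Fin d) ℝ) (ξ : Fin d → ℝ) (j : Fin d) :
    fderiv ℝ (fun ξ => MvPolynomial.eval ξ p) ξ (Pi.single j 1) = MvPolynomial.eval ξ (MvPolynomial.pderiv j p) := by
  rw [(poly_hasFDeriv p ξ).fderiv]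
  simp [sum_apply, Pi.single_apply]

/-- The frozen Gaussian in `ξ`. -/
noncomputable def Zx (A : Coeffs d) (w : Pt d) (ξ : Fin d → ℝ) : ℝ := Zt A (w, Fin.cons 0 ξ)

lemma Zx_eq (A : Coeffs d) (w : Pt d) (ξ : Fin d → ℝ) :
    Zx A w ξ = (4 * Real.pi) ^ (-(d : ℝ) / 2) * ((A.a w).det ^ (-(1 : ℝ) / 2) *
      Real.exp (-(1 / 4) * ∑ i, ∑ j, (A.a w)⁻¹ i j * ξ i * ξ j)) := by
  simp [Zx, Zt, qf]

variable {lam : ℝ} {A : Coeffs d}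

lemma Zx_cont (w : Pt d) : Continuous (Zx A w) := by
  have : Zx A w = fun ξ => _ := funext fun ξ => Zx_eq A w ξ
  rw [this]; fun_prop

lemma Zx_bound (hlam : 0 < lam) (hA : Ell lam A) (w : Pt d) : ∃ C : ℝ, 0 ≤ C ∧ ∀ ξ, |Zx A w ξ| ≤ C * gau (lam / 4) ξ := by
  have hd := hA.det_pos hlam w
  refine ⟨(4 * Real.pi) ^ (-(d : ℝ) / 2) * (A.a w).det ^ (-(1 : ℝ) / 2), by positivity, fun ξ => ?_⟩
  rw [Zx_eq, abs_of_nonneg (by positivity), ← mul_assoc]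
  refine mul_le_mul_of_nonneg_left ?_ (by positivity)
  rw [gau]
  refine Real.exp_le_exp.mpr ?_
  have := hA.inv_lower hlam w ξ
  linarith

lemma poly_Zx_integrable (hlam : 0 < lam) (hA : Ell lam A) (w : Pt d) (p : MvPolynomial (Fin d) ℝ) :
    Integrable fun ξ => MvPolynomial.eval ξ p * Zx A w ξ := by
  obtain ⟨C, hC, h⟩ := Zx_bound hlam hA w
  obtain ⟨C', hC', h'⟩ := poly_bound p (lam / 8) (by positivity)
  refine Integrable.mono' ((gau_integrable (d := d) (μ := lam / 8) (by positivity)).const_mul (C * C')) ?_ (ae_of_all _ fun ξ => ?_)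
  · exact ((MvPolynomial.continuous_eval p).mul (Zx_cont w)).aestronglyMeasurable
  · rw [Real.norm_eq_abs, abs_mul]
    calc _ ≤ (C' * Real.exp (lam / 8 * ∑ i, ξ i ^ 2)) * (C * gau (lam / 4) ξ) :=
          mul_le_mul (h' ξ) (h ξ) (abs_nonneg _) (by positivity)
      _ = C * C' * (Real.exp (lam / 8 * ∑ i, ξ i ^ 2) * gau (lam / 4) ξ) := by ring
      _ = _ := by rw [gau, gau, ← Real.exp_add]; ring_nf

lemma Zx_fderiv (hA : Ell lam A) (w : Pt d) (ξ : Fin d → ℝ) : DifferentiableAt ℝ (Zx A w) ξ ∧ ∀ j : Fin d,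
    fderiv ℝ (Zx A w) ξ (Pi.single j 1) = -(1 / 2) * ((∑ k, (A.a w)⁻¹ j k * ξ k) * Zx A w ξ) := by
  set m := (A.a w)⁻¹ with hm
  have hq : HasFDerivAt (fun ξ : Fin d → ℝ => ∑ i, ∑ j, m i j * ξ i * ξ j)
      (∑ i, ∑ j, ((m i j * ξ i) • ContinuousLinearMap.proj (R := ℝ) (φ := fun _ : Fin d => ℝ) j + ξ j • (m i j • ContinuousLinearMap.proj (R := ℝ) (φ := fun _ : Fin d => ℝ) i))) ξ := by
    refine HasFDerivAt.fun_sum fun i _ => HasFDerivAt.fun_sum fun j _ => ?_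
    exact ((hasFDerivAt_apply (𝕜 := ℝ) i ξ).const_mul (m i j)).mul (hasFDerivAt_apply (𝕜 := ℝ) j ξ)
  have hZ : Zx A w = fun ξ => (4 * Real.pi) ^ (-(d : ℝ) / 2) * ((A.a w).det ^ (-(1 : ℝ) / 2) *
      Real.exp (-(1 / 4) * ∑ i, ∑ j, m i j * ξ i * ξ j)) := funext fun ξ => Zx_eq A w ξ
  have h2 := (((hq.const_mul (-(1/4))).exp).const_mul ((A.a w).det ^ (-(1 : ℝ) / 2))).const_mul ((4 * Real.pi) ^ (-(d : ℝ) / 2))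
  rw [← hZ] at h2
  refine ⟨h2.differentiableAt, fun j => ?_⟩
  rw [h2.fderiv, Zx_eq]
  have hs : ∀ i k, m i k = m k i := fun i k => by
    have := hA.inv_symm w
    exact congrFun (congrFun this k) i
  have h3 : (∑ i, ∑ k, ((m i k * ξ i) • ContinuousLinearMap.proj (R := ℝ) (φ := fun _ : Fin d => ℝ) k + ξ k • (m i k • ContinuousLinearMap.proj (R := ℝ) (φ := fun _ : Fin d => ℝ) i))) (Pi.single j 1 : Fin d → ℝ)
      = 2 * ∑ k, m j k * ξ k := by
    simp only [sum_apply, add_apply, smul_apply, ContinuousLinearMap.proj_apply, smul_eq_mul, Finset.sum_add_distrib]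
    have e1 : ∑ i, ∑ k, m i k * ξ i * (Pi.single j 1 : Fin d → ℝ) k = ∑ k, m j k * ξ k := by
      refine Finset.sum_congr rfl fun i _ => ?_
      simp [Pi.single_apply, hs]
    have e2 : ∑ i, ∑ k, ξ k * (m i k * (Pi.single j 1 : Fin d → ℝ) i) = ∑ k, m j k * ξ k := by
      rw [Finset.sum_comm]
      refine Finset.sum_congr rfl fun i _ => ?_
      simp [Pi.single_apply, mul_comm]
    rw [e1, e2]; ring
  simp only [smul_apply, smul_eq_mul, h3]
  ring

lemma Zx_ibp (hlam : 0 < lam) (hA : Ell lam A) (w : Pt d) (p : MvPolynomial (Fin d) ℝ) (j : Fin d) :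
    ∫ ξ, MvPolynomial.eval ξ p * ((∑ k, (A.a w)⁻¹ j k * ξ k) * Zx A w ξ) =
      2 * ∫ ξ, MvPolynomial.eval ξ (MvPolynomial.pderiv j p) * Zx A w ξ := by
  have hl : ∀ ξ : Fin d → ℝ, MvPolynomial.eval ξ p * ((∑ k, (A.a w)⁻¹ j k * ξ k) * Zx A w ξ) =
      MvPolynomial.eval ξ (p * ∑ k, MvPolynomial.C ((A.a w)⁻¹ j k) * MvPolynomial.X k) * Zx A w ξ := fun ξ => by
    simp [map_sum, mul_assoc]
  have hi : Integrable fun ξ => MvPolynomial.eval ξ p * ((∑ k, (A.a w)⁻¹ j k * ξ k) * Zx A w ξ) := by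
    simp only [hl]; exact poly_Zx_integrable hlam hA w _
  have := integral_mul_fderiv_eq_neg_fderiv_mul_of_integrable (μ := (volume : Measure (Fin d → ℝ)))
    (f := fun ξ => MvPolynomial.eval ξ p) (g := Zx A w) (v := Pi.single j 1)
    (by simp only [poly_fderiv]; exact poly_Zx_integrable hlam hA w _)
    (by
      simp only [(Zx_fderiv hA w _).2]
      refine (hi.const_mul (-(1/2))).congr (ae_of_all _ fun ξ => ?_)
      simp only; ring)
    (poly_Zx_integrable hlam hA w _) (fun ξ _ => (poly_hasFDeriv p ξ).differentiableAt)
    (fun ξ _ => (Zx_fderiv hA w ξ).1)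
  simp only [poly_fderiv, (Zx_fderiv hA w _).2] at this
  have h4 : ∫ ξ, MvPolynomial.eval ξ p * (-(1 / 2) * ((∑ k, (A.a w)⁻¹ j k * ξ k) * Zx A w ξ)) =
      -(1/2) * ∫ ξ, MvPolynomial.eval ξ p * ((∑ k, (A.a w)⁻¹ j k * ξ k) * Zx A w ξ) := by
    rw [← integral_const_mul]
    refine integral_congr_ae (ae_of_all _ fun ξ => ?_)
    simp only; ring
  rw [h4] at this
  linarith

lemma Zx_recur (hlam : 0 < lam) (hA : Ell lam A) (w : Pt d) (p : MvPolynomial (Fin d) ℝ) (i : Fin d) :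
    ∫ ξ, MvPolynomial.eval ξ (MvPolynomial.X i * p) * Zx A w ξ =
      ∑ j, A.a w i j * (2 * ∫ ξ, MvPolynomial.eval ξ (MvPolynomial.pderiv j p) * Zx A w ξ) := by
  have hU := hA.isUnit hlam w
  have h1 : ∀ ξ : Fin d → ℝ, MvPolynomial.eval ξ (MvPolynomial.X i * p) * Zx A w ξ =
      ∑ j, A.a w i j * (MvPolynomial.eval ξ p * ((∑ k, (A.a w)⁻¹ j k * ξ k) * Zx A w ξ)) := fun ξ => by
    have h2 : ∑ j, A.a w i j * ∑ k, (A.a w)⁻¹ j k * ξ k = ξ i := by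
      have : (A.a w).mulVec ((A.a w)⁻¹.mulVec ξ) i = ξ i := by
        rw [Matrix.mulVec_mulVec, Matrix.mul_nonsing_inv _ hU, Matrix.one_mulVec]
      simpa [Matrix.mulVec, dotProduct] using this
    rw [map_mul, MvPolynomial.eval_X]
    conv_lhs => rw [← h2]
    rw [Finset.sum_mul, Finset.sum_mul]
    exact Finset.sum_congr rfl fun j _ => by ring
  have hl : ∀ (j : Fin d) (ξ : Fin d → ℝ), MvPolynomial.eval ξ p * ((∑ k, (A.a w)⁻¹ j k * ξ k) * Zx A w ξ) =
      MvPolynomial.eval ξ (p * ∑ k, MvPolynomial.C ((A.a w)⁻¹ j k) * MvPolynomial.X k) * Zx A w ξ := fun j ξ => by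
    simp [map_sum, mul_assoc]
  simp only [h1]
  rw [integral_finsetSum _ fun j _ => ?_]
  · refine Finset.sum_congr rfl fun j _ => ?_
    rw [integral_const_mul, Zx_ibp hlam hA w p j]
  · simp only [hl]; exact (poly_Zx_integrable hlam hA w _).const_mul _

open scoped MatrixOrder in
lemma psd_factor {m : Matrix (Fin d) (Fin d) ℝ} (hm : m.PosSemidef) : ∃ B : Matrix (Fin d) (Fin d) ℝ, m = B.transpose * B := by
  obtain ⟨B, hB⟩ := CStarAlgebra.nonneg_iff_eq_star_mul_self.mp hm.nonneg
  exact ⟨B, by rw [hB, Matrix.star_eq_conjTranspose, Matrix.conjTranspose_eq_transpose_of_trivial]⟩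

lemma Zx_mass (hlam : 0 < lam) (hA : Ell lam A) (w : Pt d) :
    ∫ ξ, Zx A w ξ = (4 * Real.pi) ^ (-(d : ℝ) / 2) * ∫ ξ : Fin d → ℝ, gau (1 / 4) ξ := by
  have hpsd : ((A.a w)⁻¹).PosSemidef := by
    refine Matrix.PosSemidef.of_dotProduct_mulVec_nonneg ?_ fun v => ?_
    · have := hA.inv_symm w
      rwa [Matrix.IsHermitian, Matrix.conjTranspose_eq_transpose_of_trivial]
    · have := hA.inv_lower hlam w v
      rw [quad_eq] at this
      simp only [star_trivial]
      refine le_trans ?_ this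
      positivity
  obtain ⟨B, hB⟩ := psd_factor hpsd
  have hdet : (A.a w).det = ((B.det) ^ 2)⁻¹ := by
    have h1 := congrArg Matrix.det hB
    rw [Matrix.det_nonsing_inv, Matrix.det_mul, Matrix.det_transpose, Ring.inverse_eq_inv', ← sq] at h1
    rw [← h1, inv_inv]
  have hpos := hA.det_pos hlam w
  have hB0 : B.det ≠ 0 := by
    intro h; rw [h] at hdet; simp at hdet; linarith
  have hr : (A.a w).det ^ (-(1 : ℝ) / 2) = |B.det| := by
    rw [hdet, neg_div, Real.rpow_neg (by positivity), Real.inv_rpow (by positivity), inv_inv, ← Real.sqrt_eq_rpow, Real.sqrt_sq_eq_abs]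
  have hqf : ∀ ξ : Fin d → ℝ, Real.exp (-(1 / 4) * ∑ i, ∑ j, (A.a w)⁻¹ i j * ξ i * ξ j) = gau (1/4) (Matrix.toLin' B ξ) := fun ξ => by
    rw [quad_eq, hB, ← Matrix.mulVec_mulVec, Matrix.dotProduct_mulVec, Matrix.vecMul_transpose, gau, sq_eq_dot, Matrix.toLin'_apply]
    ring_nf
  simp only [Zx_eq, hqf, hr]
  rw [integral_const_mul, integral_const_mul]
  congr 1
  have hmap := Real.map_matrix_volume_pi_eq_smul_volume_pi hB0
  have h5 : ∫ ξ, gau (1/4) (Matrix.toLin' B ξ) = ∫ η, gau (1/4) η ∂(Measure.map (Matrix.toLin' B) volume) := by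
    rw [integral_map]
    · exact (LinearMap.continuous_of_finiteDimensional _).aemeasurable
    · have : Continuous (gau (d := d) (1/4)) := by unfold gau; fun_prop
      exact this.aestronglyMeasurable
  rw [h5, hmap, integral_smul_measure, ENNReal.toReal_ofReal (abs_nonneg _), smul_eq_mul, ← mul_assoc, abs_inv, mul_inv_cancel₀ (abs_ne_zero.mpr hB0), one_mul]

/-- All Gaussian moments are polynomial in the coefficients. -/
lemma moments (hlam : 0 < lam) (hA : Ell lam A) {q : ℕ} (p : MvPolynomial (Fin d) ℝ) :
    ∃ P ∈ Rg A q (∅ : Set (Unit → ℝ)), ∀ e, ∫ ξ, MvPolynomial.eval ξ p * Zx A e.1 ξ = P () e := by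
  have hsmul : ∀ (p : MvPolynomial (Fin d) ℝ) (c : ℝ), (∃ P ∈ Rg A q (∅ : Set (Unit → ℝ)), ∀ e, ∫ ξ, MvPolynomial.eval ξ p * Zx A e.1 ξ = P () e) →
      ∃ P ∈ Rg A q (∅ : Set (Unit → ℝ)), ∀ e, ∫ ξ, MvPolynomial.eval ξ (MvPolynomial.C c * p) * Zx A e.1 ξ = P () e := by
    rintro p c ⟨P, hP, h⟩
    refine ⟨_, (Rg A q _).mul_mem (Rg.const c) hP, fun e => ?_⟩
    simp only [map_mul, MvPolynomial.eval_C, mul_assoc]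
    rw [integral_const_mul, h]; rfl
  have hmon : ∀ n : ℕ, ∀ s : Fin d →₀ ℕ, s.degree < n →
      ∃ P ∈ Rg A q (∅ : Set (Unit → ℝ)), ∀ e, ∫ ξ, MvPolynomial.eval ξ (MvPolynomial.monomial s (1:ℝ)) * Zx A e.1 ξ = P () e := by
    intro n
    induction n with
    | zero => intro s hs; omega
    | succ n ih =>
      intro s hs
      by_cases h0 : s = 0
      · refine ⟨_, Rg.const ((4 * Real.pi) ^ (-(d : ℝ) / 2) * ∫ ξ : Fin d → ℝ, gau (1 / 4) ξ), fun e => ?_⟩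
        subst h0
        simp only [MvPolynomial.monomial_zero', MvPolynomial.eval_C, one_mul]
        exact Zx_mass hlam hA e.1
      · obtain ⟨i, hi⟩ : ∃ i, s i ≠ 0 := by
          by_contra hc; push Not at hc; exact h0 (Finsupp.ext hc)
        obtain ⟨s', hs'⟩ : ∃ s', s = Finsupp.single i 1 + s' :=
          ⟨s - Finsupp.single i 1, by
            ext k
            simp only [Finsupp.add_apply, Finsupp.tsub_apply, Finsupp.single_apply]
            split_ifs with h
            · subst h; omega
            · omega⟩
        have hdeg : s'.degree < n := by
          rw [hs', map_add, Finsupp.degree_single] at hs; omega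
        have hm : MvPolynomial.monomial s (1:ℝ) = MvPolynomial.X i * MvPolynomial.monomial s' (1:ℝ) := by
          rw [hs', MvPolynomial.X, MvPolynomial.monomial_mul, one_mul]
        have hj : ∀ j : Fin d, ∃ P ∈ Rg A q (∅ : Set (Unit → ℝ)), ∀ e, ∫ ξ, MvPolynomial.eval ξ (MvPolynomial.pderiv j (MvPolynomial.monomial s' (1:ℝ))) * Zx A e.1 ξ = P () e := by
          intro j
          have hlt : (s' - Finsupp.single j 1).degree < n := by
            refine lt_of_le_of_lt ?_ hdeg
            simp only [Finsupp.degree_eq_sum]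
            exact Finset.sum_le_sum fun k _ => by simp
          have := hsmul _ (s' j : ℝ) (ih _ hlt)
          rw [MvPolynomial.C_mul_monomial] at this
          rw [MvPolynomial.pderiv_monomial]
          simpa using this
        choose P hP h using hj
        refine ⟨_, (Rg A q _).sum_mem (t := Finset.univ) (f := fun j => (fun _ e => coeffEval A e.1 (0, CoeffVar.aa i j)) * ((fun _ _ => 2) * P j)) fun j _ =>
          (Rg A q _).mul_mem (Rg.coeff (by simp [pdeg])) ((Rg A q _).mul_mem (Rg.const 2) (hP j)), fun e => ?_⟩
        rw [hm, Zx_recur hlam hA]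
        simp only [h, Finset.sum_apply, Pi.mul_apply, coeffEval, mderiv_zero]
  induction p using MvPolynomial.induction_on' with
  | monomial s c =>
    have := hsmul _ c (hmon (s.degree + 1) s (by omega))
    rw [MvPolynomial.C_mul_monomial, mul_one] at this
    exact this
  | add p p' hp hp' =>
    obtain ⟨P, hP, h⟩ := hp
    obtain ⟨P', hP', h'⟩ := hp'
    refine ⟨_, (Rg A q _).add_mem hP hP', fun e => ?_⟩
    simp only [map_add, add_mul]
    rw [integral_add (poly_Zx_integrable hlam hA _ _) (poly_Zx_integrable hlam hA _ _), h, h']; rfl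

end Gauss

end

section

set_option linter.unusedSectionVars false
set_option linter.unusedVariables false

/-! ## Jets of the Volterra profiles -/

section JV
variable {lam : ℝ} {A : Coeffs d} {q N : ℕ}

/-- Parameters of the Volterra integrals. -/
def SX (d : ℕ) : Set (XX d → ℝ) :=
  {f | (f = fun x => Real.sin x.1) ∨ (f = fun x => Real.cos x.1) ∨ ∃ i : Fin d, f = fun x => x.2 i}

lemma SX_sin : (fun x _ => Real.sin x.1) ∈ Rg A q (SX d) := Rg.par (g := fun x : XX d => Real.sin x.1) (Or.inl rfl)
lemma SX_cos : (fun x _ => Real.cos x.1) ∈ Rg A q (SX d) := Rg.par (g := fun x : XX d => Real.cos x.1) (Or.inr (Or.inl rfl))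
lemma SX_Xi (i : Fin (d + 1)) : (fun x _ => Xi x i) ∈ Rg A q (SX d) := by
  refine Fin.cases ?_ (fun i => ?_) i
  · exact Rg.const 0
  · exact Rg.par (g := fun x : XX d => x.2 i) (Or.inr (Or.inr ⟨i, rfl⟩))

lemma vT1_AffP : AffP A q (SX d) (vT1 d) where
  mα := Rg.const 1
  mP := fun _ => SX_sin
  mq := fun i => (Rg A q (SX d)).mul_mem SX_cos (SX_Xi i)
  mP' := fun _ => SX_cos
  mq' := fun i => (Rg A q (SX d)).neg_mem ((Rg A q (SX d)).mul_mem SX_sin (SX_Xi i))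
  q0 := fun x => by simp [vT1]
  q'0 := fun x => by simp [vT1]

lemma vT2_AffP : AffP A q (SX d) (vT2 d) where
  mα := Rg.const 0
  mP := fun _ => Rg.const 0
  mq := fun i => Rg.const 0
  mP' := fun _ => SX_sin
  mq' := fun i => (Rg A q (SX d)).mul_mem SX_cos (SX_Xi i)
  q0 := fun x => by simp [vT2]
  q'0 := fun x => by simp [vT2]

lemma Zt_rot (x : XX d) (e : EE d) : Zt A (e.1, ya x e.2) * Zt A (e.1, yb x e.2) = Zt A e * Zx A e.1 x.2 := by
  have h : qf A (e.1, ya x e.2) + qf A (e.1, yb x e.2) = qf A e + qf A (e.1, Xi x) := by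
    simp only [qf, ya, yb, Xi_succ, ← Finset.sum_add_distrib]
    refine Finset.sum_congr rfl fun i _ => Finset.sum_congr rfl fun j _ => ?_
    have := Real.sin_sq_add_cos_sq x.1
    linear_combination ((A.a e.1)⁻¹ i j * (e.2 i.succ * e.2 j.succ + x.2 i * x.2 j)) * this
  show _ = Zt A e * Zt A (e.1, Xi x)
  have hexp : Real.exp (-(1 / 4) * qf A (e.1, ya x e.2)) * Real.exp (-(1 / 4) * qf A (e.1, yb x e.2)) =
      Real.exp (-(1 / 4) * qf A e) * Real.exp (-(1 / 4) * qf A (e.1, Xi x)) := by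
    rw [← Real.exp_add, ← Real.exp_add, ← mul_add, ← mul_add, h]
  simp only [Zt]
  linear_combination ((4 * Real.pi) ^ (-(d : ℝ) / 2) * (A.a e.1).det ^ (-(1 : ℝ) / 2)) ^ 2 * hexp

/-- Products `P(e) s(θ) p(ξ)`. -/
def TX (A : Coeffs d) (q : ℕ) : Submonoid (XX d → EE d → ℝ) where
  carrier := {f | ∃ P ∈ Rg A q (∅ : Set (Unit → ℝ)), ∃ s : ℝ → ℝ, Continuous s ∧ ∃ p : MvPolynomial (Fin d) ℝ,
    f = fun x e => P () e * (s x.1 * MvPolynomial.eval x.2 p)}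
  one_mem' := ⟨_, Rg.const 1, fun _ => 1, continuous_const, 1, by funext x e; simp⟩
  mul_mem' := by
    rintro f g ⟨P, hP, s, hs, p, rfl⟩ ⟨P', hP', s', hs', p', rfl⟩
    refine ⟨_, (Rg A q _).mul_mem hP hP', fun t => s t * s' t, hs.mul hs', p * p', ?_⟩
    funext x e
    simp only [Pi.mul_apply, map_mul]; ring

lemma TX_gen : RgS A q (SX d) ⊆ TX A q := by
  rintro f (⟨v, hv, rfl⟩ | ⟨i, rfl⟩ | ⟨g, hg, rfl⟩)
  · exact ⟨_, Rg.coeff hv, fun _ => 1, continuous_const, 1, by funext x e; simp⟩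
  · exact ⟨_, Rg.y i, fun _ => 1, continuous_const, 1, by funext x e; simp⟩
  · rcases hg with rfl | rfl | ⟨i, rfl⟩
    · exact ⟨_, Rg.const 1, Real.sin, Real.continuous_sin, 1, by funext x e; simp⟩
    · exact ⟨_, Rg.const 1, Real.cos, Real.continuous_cos, 1, by funext x e; simp⟩
    · exact ⟨_, Rg.const 1, fun _ => 1, continuous_const, MvPolynomial.X i, by funext x e; simp⟩

lemma SX_integral (hlam : 0 < lam) (hA : Ell lam A) {P : XX d → EE d → ℝ} (hP : P ∈ Rg A q (SX d)) :
    ∃ P0 ∈ Rg A q (∅ : Set (Unit → ℝ)), ∀ e, ∫ x, P x e * (Zt A e * Zx A e.1 x.2) ∂vmu d = P0 () e * Zt A e := by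
  suffices h : (∀ e, Integrable (fun x => P x e * (Zt A e * Zx A e.1 x.2)) (vmu d)) ∧
      ∃ P0 ∈ Rg A q (∅ : Set (Unit → ℝ)), ∀ e, ∫ x, P x e * (Zt A e * Zx A e.1 x.2) ∂vmu d = P0 () e * Zt A e from h.2
  have hP' : P ∈ Submodule.span ℝ ((TX A q : Submonoid (XX d → EE d → ℝ)) : Set (XX d → EE d → ℝ)) := by
    have h1 : P ∈ Subalgebra.toSubmodule (Algebra.adjoin ℝ (RgS A q (SX d))) := hP
    rw [Algebra.adjoin_eq_span] at h1
    exact Submodule.span_mono (Submonoid.closure_le.mpr TX_gen) h1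
  clear hP
  induction hP' using Submodule.span_induction with
  | mem f hf =>
    obtain ⟨P1, hP1, s, hs, p, rfl⟩ := hf
    have hsi : Integrable s (volume.restrict (Set.Ioo (0:ℝ) (Real.pi / 2))) :=
      (hs.integrableOn_Icc (a := 0) (b := Real.pi / 2)).mono_set Set.Ioo_subset_Icc_self
    have heq : ∀ e : EE d, (fun x : XX d => P1 () e * (s x.1 * MvPolynomial.eval x.2 p) * (Zt A e * Zx A e.1 x.2)) =
        fun x => (P1 () e * Zt A e) * (s x.1 * (MvPolynomial.eval x.2 p * Zx A e.1 x.2)) := fun e => by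
      funext x; ring
    have hi : ∀ e : EE d, Integrable (fun x : XX d => s x.1 * (MvPolynomial.eval x.2 p * Zx A e.1 x.2)) (vmu d) := fun e =>
      Integrable.mul_prod hsi (poly_Zx_integrable hlam hA e.1 p)
    refine ⟨fun e => ?_, ?_⟩
    · beta_reduce
      rw [heq]; exact (hi e).const_mul _
    · obtain ⟨P2, hP2, h2⟩ := moments hlam hA (q := q) p
      refine ⟨_, (Rg A q _).mul_mem hP1 ((Rg A q _).mul_mem (Rg.const (∫ t in Set.Ioo (0:ℝ) (Real.pi / 2), s t)) hP2), fun e => ?_⟩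
      beta_reduce
      rw [heq, integral_const_mul]
      have h3 : ∫ x : XX d, s x.1 * (MvPolynomial.eval x.2 p * Zx A e.1 x.2) ∂vmu d = (∫ t in Set.Ioo (0:ℝ) (Real.pi / 2), s t) * ∫ ξ, MvPolynomial.eval ξ p * Zx A e.1 ξ :=
        integral_prod_mul s (fun ξ => MvPolynomial.eval ξ p * Zx A e.1 ξ)
      rw [h3, h2]
      simp only [Pi.mul_apply]; ring
  | zero => exact ⟨fun e => by simp, _, Rg.const 0, fun e => by simp⟩
  | add f g _ _ hf hg =>
    obtain ⟨i1, P1, hP1, h1⟩ := hf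
    obtain ⟨i2, P2, hP2, h2⟩ := hg
    have heq : ∀ e : EE d, (fun x : XX d => (f + g) x e * (Zt A e * Zx A e.1 x.2)) = fun x =>
       f x e * (Zt A e * Zx A e.1 x.2) + g x e * (Zt A e * Zx A e.1 x.2) := fun e => by
      funext x; simp only [Pi.add_apply]; ring
    refine ⟨fun e => ?_, _, (Rg A q _).add_mem hP1 hP2, fun e => ?_⟩
    · rw [heq]; exact (i1 e).add (i2 e)
    · rw [heq, integral_add (i1 e) (i2 e), h1, h2]; simp only [Pi.add_apply]; ring
  | smul c f _ hf =>
    obtain ⟨i1, P1, hP1, h1⟩ := hf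
    have heq : ∀ e : EE d, (fun x : XX d => (c • f) x e * (Zt A e * Zx A e.1 x.2)) = fun x =>
       c * (f x e * (Zt A e * Zx A e.1 x.2)) := fun e => by
      funext x; simp only [Pi.smul_apply, smul_eq_mul]; ring
    refine ⟨fun e => ?_, _, (Rg A q _).mul_mem (Rg.const c) hP1, fun e => ?_⟩
    · rw [heq]; exact (i1 e).const_mul c
    · rw [heq, integral_const_mul, h1]; simp only [Pi.mul_apply]; ring

variable {I : Type} {ε : I → ℝ} {A' : I → Coeffs d}

lemma J1.Vt (i0 : I) (hp : ParReg lam q A) (hN : 2 * (N + 2) ≤ q) (hg : Good lam ε (N + 2) (fun _ => A) A') (k : ℕ) :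
    J1 A q (VarBPHZ.Zt A) N (VarBPHZ.Vt A k) := by
  have hμ : 0 < mu lam := by have := hg.pos; unfold mu; linarith
  obtain ⟨CE, hCE, hE⟩ := hg.Et (β := 2 * mu lam) (by unfold mu; linarith [hg.pos])
  obtain ⟨C, hC, hS⟩ := step_bound (d := d) (n := N) hμ (N + 2) hCE
  obtain ⟨C0, κ, hC0, hκ, hV⟩ := hg.Vt
  have hC' : ∀ k, 0 ≤ κ * ∏ j ∈ Finset.range k, (C0 * Jc j) := fun k =>
    mul_nonneg hκ (Finset.prod_nonneg fun j _ => by have := Jc_nonneg j; positivity)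
  induction k with
  | zero => exact Jt.le (J1.Zt i0 hp hN hg) (by omega)
  | succ k ih =>
    have h1 := (hS (ε i0) (hg.hε i0) _ _ (hE i0) k _ _ (hC' k) _ _ (hV i0 k)).l
    have hcos : (fun (x : XX d) (_ : EE d) => 2 * Real.cos x.1 ^ (k + 1)) ∈ Rg A q (SX d) :=
      (Rg A q _).mul_mem (Rg.const 2) ((Rg A q _).pow_mem SX_cos _)
    have hj : Jt A q (SX d) (fun x e => VarBPHZ.Zt A e * Zx A e.1 x.2) N (stepF k (VarBPHZ.Vt A k) (VarBPHZ.Et A)) := by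
      have h2 := Jt.one_mul (Jt.par hcos) ((J1.comp vT1_AffP ih).mul (J1.comp vT2_AffP (J1.Et i0 hp hN hg)).neg)
      exact Jt.congrG h2 fun x e => Zt_rot x e
    refine J1.integral hj h1 (vg_integrable hμ k) (by have := wb_cont (d := d) (k * (2 * N + 2) + (N + 2 + N)) (mu lam); fun_prop) fun P hP => ?_
    exact SX_integral hg.pos (hg.el i0) hP

end JV

end

section

set_option linter.unusedSectionVars false
set_option linter.unusedVariables false

/-! ## Membership in the local class -/

section Lam
variable {lam : ℝ} {A : Coeffs d} {q N : ℕ} {I : Type} {ε : I → ℝ} {A' : I → Coeffs d}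

lemma J1.iop_iter {G f : EE d → ℝ} {f' : I → EE d → ℝ} {M : ℕ} {β : ℝ} (hε : ∀ i, 0 ≤ ε i) (i0 : I) (m : ℕ) (h : J1 A q G (N + m) f)
    (hf : UW ε (N + m) M β (fun _ => f) f') : J1 A q G N (Iop^[m] f) := by
  induction m generalizing f f' with
  | zero => exact h
  | succ m ih =>
    simp only [Function.iterate_succ_apply]
    exact ih (J1.iop i0 h hf) (UW.iop hε hf)

lemma J1.Um (i0 : I) (hp : ParReg lam q A) (hN : 2 * (N + 2) ≤ q) (hg : Good lam ε (N + 2) (fun _ => A) A') (L : ℕ) {σ : ℝ} (hσ : |σ| ≤ 1) :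
    J1 A q (VarBPHZ.Zt A) N (VarBPHZ.Um A L σ) :=
  Jt.sum _ fun k _ => ((Jt.y 0).pow k).one_mul ((J1.Vt i0 hp hN hg k).shear hσ)

lemma Gm_poly (i0 : I) (L : ℕ) (hp : ParReg lam q A) (hN : 2 * (L + 2) ≤ q) (hg : Good lam ε (L + 2) (fun _ => A) A') {σ : ℝ} (hσ : |σ| ≤ 1) :
    ∃ P ∈ Rg A q (∅ : Set (Unit → ℝ)), ∀ e, Gm A L σ e = P () e * Zt A e := by
  obtain ⟨Nw, hU⟩ := hg.um L hσ
  have hJ := J1.Um i0 hp hN hg L hσ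
  have h1 : ∀ m : Fin (L + 1), ∃ P ∈ Rg A q (∅ : Set (Unit → ℝ)), ∀ e, (Iop^[(m : ℕ)] (VarBPHZ.Um A L σ)) (ev e) = P () e * Zt A e := by
    intro m
    have hm : 0 + (m : ℕ) ≤ L := by have := m.2; omega
    obtain ⟨P, hP, h⟩ := (J1.iop_iter (N := 0) hg.hε i0 m (Jt.le hJ hm) (hU.le hm)).val
    exact ⟨P, hP, fun e => h () e⟩
  choose P hP h using h1
  refine ⟨_, (Rg A q _).sum_mem (t := Finset.univ) (f := fun m : Fin (L + 1) => (fun _ e => e.2 0) ^ (m : ℕ) * P m) fun m _ =>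
    (Rg A q _).mul_mem ((Rg A q _).pow_mem (Rg.y 0) _) (hP m), fun e => ?_⟩
  simp only [Gm, TP, Finset.sum_apply, Pi.mul_apply, Pi.pow_apply]
  rw [← Fin.sum_univ_eq_sum_range (fun m => e.2 0 ^ m * (Iop^[m] (VarBPHZ.Um A L σ)) (ev e)), Finset.sum_mul]
  refine Finset.sum_congr rfl fun m _ => ?_
  rw [h]; ring

lemma lambdaAtom_zero (p : MvPolynomial ((Fin (d + 1) → ℕ) × CoeffVar d) ℝ) (Q : MvPolynomial (Fin (d + 1)) ℝ) (w ζ : Pt d) :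
    lambdaAtom A p 0 (fun _ => MvPolynomial.X 0 * Q) w ζ =
      MvPolynomial.eval (coeffEval A w) p * (MvPolynomial.eval (vv ζ) Q * Wker A w ζ) := by
  unfold lambdaAtom
  congr 1
  have hc : ∀ y : Fin 0 → Pt d, chainDiff ζ y 0 = ζ := fun y => by
    have : (Fin.cons ζ (Fin.snoc y 0 : Fin 1 → Pt d) : Fin 2 → Pt d) 1 = 0 := by
      rw [show (1 : Fin 2) = Fin.succ 0 from rfl, Fin.cons_succ]
      exact Fin.snoc_last (α := fun _ => Pt d) (0 : Pt d) y
    simp only [chainDiff]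
    exact (congrArg (fun v => ζ - v) this).trans (sub_zero ζ)
  have hv : (volume : Measure (Fin 0 → Pt d)) = Measure.dirac isEmptyElim := Measure.pi_of_empty _ _
  rw [hv, integral_dirac]
  simp only [Nat.reduceAdd, Finset.univ_unique, Finset.prod_singleton, Fin.default_eq_zero, hc]
  unfold ratKer
  by_cases h : 0 < ζ 0
  · have hs := Real.sqrt_pos.2 h
    have hvv : (Fin.cons (Real.sqrt (ζ 0)) fun i : Fin d => ζ i.succ / Real.sqrt (ζ 0)) = vv ζ := rfl
    rw [if_pos h, hvv, map_mul, MvPolynomial.eval_X, vv_zero, ← mul_assoc, inv_mul_cancel₀ hs.ne', one_mul]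
  · simp [Wker, h]

/-- Products `p(coefficients) Q(y)`. -/
def TL (A : Coeffs d) (q : ℕ) : Submonoid (Unit → EE d → ℝ) where
  carrier := {f | ∃ p ∈ MvPolynomial.supported ℝ {v : (Fin (d + 1) → ℕ) × CoeffVar d | pdeg v.1 ≤ q}, ∃ Q : MvPolynomial (Fin (d + 1)) ℝ,
    f = fun _ e => MvPolynomial.eval (coeffEval A e.1) p * MvPolynomial.eval e.2 Q}
  one_mem' := ⟨1, Subalgebra.one_mem _, 1, by funext x e; simp⟩
  mul_mem' := by
    rintro f g ⟨p, hp, Q, rfl⟩ ⟨p', hp', Q', rfl⟩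
    refine ⟨p * p', Subalgebra.mul_mem _ hp hp', Q * Q', ?_⟩
    funext x e
    simp only [Pi.mul_apply, map_mul]; ring

lemma TL_gen : RgS A q (∅ : Set (Unit → ℝ)) ⊆ TL A q := by
  rintro f (⟨v, hv, rfl⟩ | ⟨i, rfl⟩ | ⟨g, hg, rfl⟩)
  · exact ⟨MvPolynomial.X v, MvPolynomial.X_mem_supported.mpr hv, 1, by funext x e; simp⟩
  · exact ⟨1, Subalgebra.one_mem _, MvPolynomial.X i, by funext x e; simp⟩
  · exact absurd hg (Set.notMem_empty _)

lemma memLambda_of {P : Unit → EE d → ℝ} (hP : P ∈ Rg A q (∅ : Set (Unit → ℝ))) :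
    MemLambda A q (fun w ζ => P () (w, vv ζ) * Wker A w ζ) := by
  have hP' : P ∈ Submodule.span ℝ ((TL A q : Submonoid (Unit → EE d → ℝ)) : Set (Unit → EE d → ℝ)) := by
    have h1 : P ∈ Subalgebra.toSubmodule (Algebra.adjoin ℝ (RgS A q (∅ : Set (Unit → ℝ)))) := hP
    rw [Algebra.adjoin_eq_span] at h1
    exact Submodule.span_mono (Submonoid.closure_le.mpr TL_gen) h1
  rw [Submodule.mem_span_set'] at hP'
  obtain ⟨n, c, g, rfl⟩ := hP'
  choose p hp Q hQ using fun m => (g m).2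
  refine ⟨n, fun m => MvPolynomial.C (c m) * p m, fun _ => 0, fun m _ => MvPolynomial.X 0 * Q m, fun m mo hmo v hv => ?_, fun w ζ => ?_⟩
  · have h1 : MvPolynomial.C (c m) * p m ∈ MvPolynomial.supported ℝ {v : (Fin (d + 1) → ℕ) × CoeffVar d | pdeg v.1 ≤ q} :=
      Subalgebra.mul_mem _ (Subalgebra.algebraMap_mem _ _) (hp m)
    rw [MvPolynomial.mem_supported] at h1
    exact h1 ((MvPolynomial.mem_vars_iff_mem_support v).mpr ⟨mo, hmo, hv⟩)
  · simp only [lambdaAtom_zero, Finset.sum_apply, Pi.smul_apply, smul_eq_mul, Finset.sum_mul]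
    refine Finset.sum_congr rfl fun m _ => ?_
    rw [congrFun (congrFun (hQ m) ()) (w, vv ζ)]
    simp only [map_mul, MvPolynomial.eval_C]; ring

lemma Km_chiLambda (χ : Pt d → ℝ) (i0 : I) (L : ℕ) (hp : ParReg lam q A) (hN : 2 * (L + 2) ≤ q) (hg : Good lam ε (L + 2) (fun _ => A) A') {σ : ℝ} (hσ : |σ| ≤ 1) :
    MemChiLambda χ A q (Km χ A L σ) := by
  obtain ⟨P, hP, h⟩ := Gm_poly i0 L hp hN hg hσ
  refine ⟨_, memLambda_of hP, fun w ζ => ?_⟩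
  rw [Km, Wker_eq]
  congr 1
  by_cases hz : 0 < ζ 0
  · rw [KK_pos (e := (w, ζ)) hz, KK_pos (e := (w, ζ)) hz, h]; ring
  · rw [KK_neg (e := (w, ζ)) hz, KK_neg (e := (w, ζ)) hz, mul_zero]

end Lam

end

/-- Proposition on decompositions of the heat kernel.
For every `r, M ∈ ℕ` there is `ρ = ρ(r, M, d)` such that for coefficient fields
satisfying the parabolicity–regularity assumption with respect to `ρ`, the kernel
`Γ = Σ_k Z * (−E)^{*k}` (each summand vanishing unless `t > t̄`, the series converging
pointwise and, in fact, in `C^r` locally away from `{t = t̄}`) admits the two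
decompositions `Γ(z,z̄) = K^z(z−z̄) + R(z,z̄) = K̄^{z̄}(z−z̄) + R̄(z,z̄)`, where
`K, K̄, R, R̄` depend only on `r` and `(a,b,c)` (not on `M`), with
`K, K̄ ∈ C^M(𝒦_M^2) ∩ χΛ_ρ` and `R, R̄ ∈ C_{loc,t}^r`, and the decompositions can be
chosen so that the maps `𝐀_ρ ∋ (a,b,c) ↦ (K,R)` and `𝐀_ρ ∋ (a,b,c) ↦ (K̄,R̄)` are
continuous into `C^M(𝒦_M^2) ⊕ C_{loc,t}^r`. -/
theorem gamma_kernel_decomposition (d : ℕ) (hd : 1 ≤ d) (lam : ℝ) (hlam : 0 < lam)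
    (χ : Pt d → ℝ) (hχ : IsCutoff χ) (r : ℕ) :
    ∃ Kmap Rmap Kbar Rbar : Coeffs d → Pt d → Pt d → ℝ,
      ∀ M : ℕ, ∃ ρ : ℕ, ∀ A : Coeffs d, ParReg lam ρ A →
        ((∀ (k : ℕ) (z zb : Pt d), ¬zb 0 < z 0 → volterra A k z zb = 0) ∧
          (∀ z zb : Pt d, Summable fun k => volterra A k z zb) ∧
          (∀ j1 j2 : Fin (d + 1) → ℕ, pdeg j1 + pdeg j2 ≤ r →
            ∀ Cpt : Set (Pt d × Pt d), IsCompact Cpt → (∀ p ∈ Cpt, p.1 0 ≠ p.2 0) →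
              TendstoUniformlyOn
                (fun (n : ℕ) (p : Pt d × Pt d) =>
                  ∑ k ∈ Finset.range n, mderiv2 j1 j2 (volterra A k) p.1 p.2)
                (fun p => ∑' k, mderiv2 j1 j2 (volterra A k) p.1 p.2) atTop Cpt)) ∧
        ((∀ z zb : Pt d, GammaKer A z zb = Kmap A z (z - zb) + Rmap A z zb) ∧
          (∀ z zb : Pt d, GammaKer A z zb = Kbar A zb (z - zb) + Rbar A z zb) ∧
          MemCKer χ 2 M (Kmap A) ∧ MemChiLambda χ A ρ (Kmap A) ∧
          MemCKer χ 2 M (Kbar A) ∧ MemChiLambda χ A ρ (Kbar A) ∧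
          MemCloc r (Rmap A) ∧ MemCloc r (Rbar A)) ∧
        ∀ T : ℝ, 0 < T → ∀ ε : ℝ, 0 < ε → ∃ δ : ℝ, 0 < δ ∧
          ∀ A' : Coeffs d, ParReg lam ρ A' → coeffDist ρ A A' ≤ δ →
            (MemCKer χ 2 M (fun w ζ => Kmap A w ζ - Kmap A' w ζ) ∧
              cKerNorm χ 2 M (fun w ζ => Kmap A w ζ - Kmap A' w ζ) ≤ ε) ∧
            (MemCloc r (fun z zb => Rmap A z zb - Rmap A' z zb) ∧
              clocNorm r T (fun z zb => Rmap A z zb - Rmap A' z zb) ≤ ε) ∧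
            (MemCKer χ 2 M (fun w ζ => Kbar A w ζ - Kbar A' w ζ) ∧
              cKerNorm χ 2 M (fun w ζ => Kbar A w ζ - Kbar A' w ζ) ≤ ε) ∧
            (MemCloc r (fun z zb => Rbar A z zb - Rbar A' z zb) ∧
              clocNorm r T (fun z zb => Rbar A z zb - Rbar A' z zb) ≤ ε) := by
  obtain ⟨Cχ, hCχ⟩ := hχ.CB r
  have hχ1 : ∀ ζ, pnorm ζ < 1 / 2 → χ ζ = 1 := fun ζ h => hχ.one h.le
  have s0 : |(0 : ℝ)| ≤ 1 := by simp
  have s1 : |(-1 : ℝ)| ≤ 1 := by simp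
  obtain ⟨L, hL⟩ : ∃ L, L = 2 * r + 3 + d := ⟨_, rfl⟩
  refine ⟨fun A => Km χ A L (-1), fun A z zb => Rk χ A L (-1) (ell2 d (z, zb)),
    fun A => Km χ A L 0, fun A z zb => Rk χ A L 0 (ell1 d (z, zb)), fun M =>
    ⟨8 + 2 * (3 * M + L + 2) + 2 * (r + L + 1 + 2), fun A hA => ?_⟩⟩
  obtain ⟨ρ, hρ⟩ : ∃ ρ, ρ = 8 + 2 * (3 * M + L + 2) + 2 * (r + L + 1 + 2) := ⟨_, rfl⟩
  rw [← hρ] at hA ⊢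
  have h8 : 8 ≤ ρ := by omega
  have gR := good_of hlam (n := r + L + 1 + 2) (by omega) hA
  have gK := good_of hlam (n := 3 * M + L + 2) (by omega) hA
  have gL := good_of hlam (n := L + 2) (by omega) hA
  have hε : ∀ p : Nbd lam ρ A, 0 ≤ p.1.2 := fun p => p.2.2.1
  obtain ⟨a1, a2, a3⟩ := (gR.rk hL.ge hCχ hχ1 s1).cloc hε (ell2 d) (fun e => rfl)
  obtain ⟨b1, b2, b3⟩ := (gR.rk hL.ge hCχ hχ1 s0).cloc hε (ell1 d) (fun e => rfl)
  obtain ⟨Q1, hQ1, k1⟩ := gK.cker hχ s1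
  obtain ⟨Q2, hQ2, k2⟩ := gK.cker hχ s0
  refine ⟨⟨volterra_neg hlam h8 hA, volterra_summable hlam h8 hA,
    fun j1 j2 hj Cpt hC hne => unif_conv hlam h8 (by omega) hA j1 j2 hj Cpt hC hne⟩,
    ⟨Gamma_neg χ hlam h8 hA L (by omega), Gamma_zero χ hlam h8 hA L (by omega),
      (k1 (nbd0 hA)).1, Km_chiLambda χ (nbd0 hA) L hA (by omega) gL s1,
      (k2 (nbd0 hA)).1, Km_chiLambda χ (nbd0 hA) L hA (by omega) gL s0,
      a1 (nbd0 hA), b1 (nbd0 hA)⟩, ?_⟩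
  intro T hT ε hε0
  obtain ⟨Q3, hQ3, c3⟩ := a3 T
  obtain ⟨Q4, hQ4, c4⟩ := b3 T
  have hS : 0 < Q1 + Q2 + Q3 + Q4 + 1 := by positivity
  have hδ0 : 0 < min 1 (ε / (Q1 + Q2 + Q3 + Q4 + 1)) := lt_min one_pos (by positivity)
  refine ⟨min 1 (ε / (Q1 + Q2 + Q3 + Q4 + 1)), hδ0, fun A' hA' hd' => ?_⟩
  have key : ∀ Q, Q ≤ Q1 + Q2 + Q3 + Q4 + 1 → min 1 (ε / (Q1 + Q2 + Q3 + Q4 + 1)) * Q ≤ ε := by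
    intro Q hQ
    calc min 1 (ε / (Q1 + Q2 + Q3 + Q4 + 1)) * Q
        ≤ min 1 (ε / (Q1 + Q2 + Q3 + Q4 + 1)) * (Q1 + Q2 + Q3 + Q4 + 1) :=
          mul_le_mul_of_nonneg_left hQ hδ0.le
      _ ≤ ε / (Q1 + Q2 + Q3 + Q4 + 1) * (Q1 + Q2 + Q3 + Q4 + 1) :=
          mul_le_mul_of_nonneg_right (min_le_right _ _) hS.le
      _ = ε := div_mul_cancel₀ _ hS.ne'
  let p : Nbd lam ρ A := ⟨(A', min 1 (ε / (Q1 + Q2 + Q3 + Q4 + 1))), hA', hδ0.le, min_le_left _ _, hd'⟩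
  exact ⟨⟨(k1 p).2.1, (k1 p).2.2.trans (key Q1 (by linarith))⟩,
    ⟨a2 p, (c3 p).trans (key Q3 (by linarith))⟩,
    ⟨(k2 p).2.1, (k2 p).2.2.trans (key Q2 (by linarith))⟩,
    ⟨b2 p, (c4 p).trans (key Q4 (by linarith))⟩⟩

end VarBPHZ
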